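/- For admissible T → ∞, ∑_{0<γ≤T} ζ'(ρ) = (T/4π) log²(T/2π) + (−1 + C_0)(T/2π) log(T/2π) + (1 − C_0 − C_0² + 3C_1)(T/2π) + E(T), where unconditionally E(T) = O(T e^{−C√(log T)}) for some constant C > 0, and under the Riemann Hypothesis E(T) = O(T^{1/2} log^{7/2} T). -/

import Mathlib

open Complex Filter Finset

/-- The order of vanishing of the Riemann zeta function at a point `ρ`:
the least `k` such that the `k`-th derivative of `ζ` is nonzero at `ρ`. -/
noncomputable def zetaZeroOrder (ρ : ℂ) : ℕ :=
  sInf {k : ℕ | iteratedDeriv k riemannZeta ρ ≠ 0}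

/-- A non-trivial zero of the Riemann zeta function. -/
def IsNontrivialZero (ρ : ℂ) : Prop :=
  riemannZeta ρ = 0 ∧ 0 < ρ.re ∧ ρ.re < 1

/-- `∑_{0<γ≤T} ζ^{(n)}(ρ)`, the sum of the `n`-th derivative of `ζ` over the
non-trivial zeros `ρ = β + iγ` with `0 < γ ≤ T`, counted with multiplicity. -/
noncomputable def zetaZeroSum (n : ℕ) (T : ℝ) : ℂ :=
  ∑ᶠ ρ ∈ {ρ : ℂ | IsNontrivialZero ρ ∧ 0 < ρ.im ∧ ρ.im ≤ T},
    (zetaZeroOrder ρ : ℂ) * iteratedDeriv n riemannZeta ρ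

/-- `T` is admissible: `|T - γ| ≥ δ / log T` for every ordinate `γ` of a
non-trivial zero of `ζ`. -/
def AdmissibleHeight (δ T : ℝ) : Prop :=
  ∀ ρ : ℂ, IsNontrivialZero ρ → δ / Real.log T ≤ |T - ρ.im|

/-- The main term in Fujii's theorem on Shanks' conjecture, in terms of the
Laurent coefficients `C j` of `ζ` about `s = 1`. -/
noncomputable def fujiiMainTerm (C : ℕ → ℂ) (T : ℝ) : ℂ :=
  (((T / (4 * Real.pi)) * Real.log (T / (2 * Real.pi)) ^ 2 : ℝ) : ℂ)
  + (-1 + C 0) * (((T / (2 * Real.pi)) * Real.log (T / (2 * Real.pi)) : ℝ) : ℂ)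
  + (1 - C 0 - (C 0) ^ 2 + 3 * C 1) * ((T / (2 * Real.pi) : ℝ) : ℂ)

open scoped Topology Interval Real

local notation "ζ" => riemannZeta

/-- Boundary integral of a rectangle, counterclockwise. -/
noncomputable def rectInt (f : ℂ → ℂ) (a b c d : ℝ) : ℂ :=
  (∫ x in a..b, f (x + c * I)) - (∫ x in a..b, f (x + d * I))
    + I * (∫ y in c..d, f (b + y * I)) - I * ∫ y in c..d, f (a + y * I)

/-- Boundary of a rectangle. -/
def rectBd (a b c d : ℝ) : Set ℂ :=
  {z | (z.re ∈ Set.Icc a b ∧ (z.im = c ∨ z.im = d)) ∨ (z.im ∈ Set.Icc c d ∧ (z.re = a ∨ z.re = b))}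

section rect
variable {a b c d : ℝ}

lemma rectBd_cont (hab : a ≤ b) (hcd : c ≤ d) {f : ℂ → ℂ} (hf : ContinuousOn f (rectBd a b c d)) :
    ContinuousOn (fun x : ℝ => f (x + c * I)) (Set.uIcc a b) ∧
    ContinuousOn (fun x : ℝ => f (x + d * I)) (Set.uIcc a b) ∧
    ContinuousOn (fun y : ℝ => f (b + y * I)) (Set.uIcc c d) ∧
    ContinuousOn (fun y : ℝ => f (a + y * I)) (Set.uIcc c d) := by
  rw [Set.uIcc_of_le hab, Set.uIcc_of_le hcd]
  refine ⟨hf.comp (by fun_prop) ?_, hf.comp (by fun_prop) ?_, hf.comp (by fun_prop) ?_,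
    hf.comp (by fun_prop) ?_⟩ <;> intro x hx <;> simp [rectBd] <;> simp_all

lemma rectInt_congr (hab : a ≤ b) (hcd : c ≤ d) {f g : ℂ → ℂ}
    (h : Set.EqOn f g (rectBd a b c d)) : rectInt f a b c d = rectInt g a b c d := by
  unfold rectInt
  have h1 : ∀ x ∈ Set.uIcc a b, f (x + c * I) = g (x + c * I) := by
    intro x hx; rw [Set.uIcc_of_le hab] at hx; apply h; simp [rectBd]; simp_all
  have h2 : ∀ x ∈ Set.uIcc a b, f (x + d * I) = g (x + d * I) := by
    intro x hx; rw [Set.uIcc_of_le hab] at hx; apply h; simp [rectBd]; simp_all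
  have h3 : ∀ x ∈ Set.uIcc c d, f (b + x * I) = g (b + x * I) := by
    intro x hx; rw [Set.uIcc_of_le hcd] at hx; apply h; simp [rectBd]; simp_all
  have h4 : ∀ x ∈ Set.uIcc c d, f (a + x * I) = g (a + x * I) := by
    intro x hx; rw [Set.uIcc_of_le hcd] at hx; apply h; simp [rectBd]; simp_all
  rw [intervalIntegral.integral_congr h1, intervalIntegral.integral_congr h2,
    intervalIntegral.integral_congr h3, intervalIntegral.integral_congr h4]

lemma rectInt_add (hab : a ≤ b) (hcd : c ≤ d) {f g : ℂ → ℂ}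
    (hf : ContinuousOn f (rectBd a b c d)) (hg : ContinuousOn g (rectBd a b c d)) :
    rectInt (fun z => f z + g z) a b c d = rectInt f a b c d + rectInt g a b c d := by
  obtain ⟨f1, f2, f3, f4⟩ := rectBd_cont hab hcd hf
  obtain ⟨g1, g2, g3, g4⟩ := rectBd_cont hab hcd hg
  unfold rectInt
  rw [intervalIntegral.integral_add f1.intervalIntegrable g1.intervalIntegrable,
    intervalIntegral.integral_add f2.intervalIntegrable g2.intervalIntegrable,
    intervalIntegral.integral_add f3.intervalIntegrable g3.intervalIntegrable,
    intervalIntegral.integral_add f4.intervalIntegrable g4.intervalIntegrable]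
  ring

lemma rectInt_smul (k : ℂ) (f : ℂ → ℂ) :
    rectInt (fun z => k * f z) a b c d = k * rectInt f a b c d := by
  unfold rectInt
  simp only [intervalIntegral.integral_const_mul]
  ring

lemma rectInt_eq_zero (hab : a ≤ b) (hcd : c ≤ d) {f : ℂ → ℂ}
    (hf : ∀ z : ℂ, z.re ∈ Set.Icc a b → z.im ∈ Set.Icc c d → AnalyticAt ℂ f z) :
    rectInt f a b c d = 0 := by
  have := Complex.integral_boundary_rect_eq_zero_of_differentiableOn f (a + c * I) (b + d * I) (by
    intro z hz
    rw [Complex.mem_reProdIm] at hz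
    simp [Set.uIcc_of_le hab, Set.uIcc_of_le hcd] at hz
    exact (hf z hz.1 hz.2).differentiableAt.differentiableWithinAt)
  simpa [rectInt] using this

/-- primitive on the whole boundary -/
lemma rectInt_of_primitive (hab : a ≤ b) (hcd : c ≤ d) {f F : ℂ → ℂ}
    (hf : ContinuousOn f (rectBd a b c d))
    (hF : ∀ z ∈ rectBd a b c d, HasDerivAt F (f z) z) : rectInt f a b c d = 0 := by
  obtain ⟨f1, f2, f3, f4⟩ := rectBd_cont hab hcd hf
  have e (k : ℝ) (hk : k = c ∨ k = d)
      (hi : ContinuousOn (fun x : ℝ => f (x + k * I)) (Set.uIcc a b)) :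
      ∫ x in a..b, f (x + k * I) = F (b + k * I) - F (a + k * I) := by
    apply intervalIntegral.integral_eq_sub_of_hasDerivAt (f := fun x : ℝ => F (x + k * I))
    · intro x hx
      rw [Set.uIcc_of_le hab] at hx
      have h := hF (x + k * I) (by simp [rectBd]; simp_all)
      have h2 : HasDerivAt (fun x : ℝ => (x : ℂ) + k * I) 1 x :=
        (Complex.ofRealCLM.hasDerivAt (x := x)).add_const _
      have h3 := HasDerivAt.comp x h h2
      rw [mul_one] at h3; exact h3
    · exact hi.intervalIntegrable
  have e' (k : ℝ) (hk : k = a ∨ k = b)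
      (hi : ContinuousOn (fun x : ℝ => f (k + x * I)) (Set.uIcc c d)) :
      I * ∫ x in c..d, f (k + x * I) = F (k + d * I) - F (k + c * I) := by
    rw [← intervalIntegral.integral_const_mul]
    apply intervalIntegral.integral_eq_sub_of_hasDerivAt (f := fun x : ℝ => F (k + x * I))
    · intro x hx
      rw [Set.uIcc_of_le hcd] at hx
      have h := hF (k + x * I) (by simp [rectBd]; simp_all)
      have h2 : HasDerivAt (fun x : ℝ => (k : ℂ) + x * I) I x := by
        simpa using ((Complex.ofRealCLM.hasDerivAt (x := x)).mul_const I).const_add (k : ℂ)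
      have h3 := HasDerivAt.comp x h h2
      rw [mul_comm] at h3; exact h3
    · exact (hi.const_smul I).intervalIntegrable
  unfold rectInt
  rw [e c (by simp) f1, e d (by simp) f2, e' b (by simp) f3, e' a (by simp) f4]
  ring

/-- The integral of `1/z` over a vertical/horizontal segment -/
lemma int_inv_seg (p q k m : ℂ) (hk : k ≠ 0) (hm : m ≠ 0) {u v : ℝ}
    (h : ∀ x ∈ Set.uIcc u v, k * (p + x * m - q) ∈ Complex.slitPlane) :
    m * ∫ x in u..v, (1 / (p + x * m - q)) =
      Complex.log (k * (p + v * m - q)) - Complex.log (k * (p + u * m - q)) := by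
  rw [← intervalIntegral.integral_const_mul]
  have hne : ∀ x ∈ Set.uIcc u v, (p + x * m - q) ≠ 0 := by
    intro x hx h0
    have := h x hx
    rw [h0] at this; simp at this
  apply intervalIntegral.integral_eq_sub_of_hasDerivAt
    (f := fun x : ℝ => Complex.log (k * (p + x * m - q)))
  · intro x hx
    have h2 : HasDerivAt (fun x : ℝ => k * ((p : ℂ) + x * m - q)) (k * m) x := by
      simpa using ((((Complex.ofRealCLM.hasDerivAt (x := x)).mul_const m).const_add p).sub_const q).const_mul k
    have := h2.clog_real (h x hx)
    have h0 := hne x hx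
    have e : k * m / (k * (p + x * m - q)) = m * (1 / (p + x * m - q)) := by field_simp
    rw [← e]; exact this
  · apply ContinuousOn.intervalIntegrable
    apply ContinuousOn.mul continuousOn_const
    apply ContinuousOn.div continuousOn_const (by fun_prop)
    exact hne

lemma log_negI_mul {z : ℂ} (hr : 0 < z.re) :
    Complex.log (-I * z) = Complex.log z - π / 2 * I := by
  have hz : z ≠ 0 := by intro h; simp [h] at hr
  rw [Complex.log_mul (by simp) hz]
  · rw [Complex.log_neg_I]; ring
  · rw [Complex.arg_neg_I]
    have := (Complex.abs_arg_lt_pi_div_two_iff (z := z)).2 (Or.inl hr)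
    rw [abs_lt] at this
    constructor <;> linarith [Real.pi_pos]

lemma rectInt_inv {p : ℂ} (h1 : a < p.re) (h2 : p.re < b) (h3 : c < p.im) (h4 : p.im < d) :
    rectInt (fun z => 1 / (z - p)) a b c d = 2 * π * I := by
  have hab := (h1.trans h2).le
  have hcd := (h3.trans h4).le
  have eb := int_inv_seg (c * I) p I 1 (by simp) (by simp) (u := a) (v := b) (by
    intro x hx; left; simp; linarith)
  have et := int_inv_seg (d * I) p (-I) 1 (by simp) (by simp) (u := a) (v := b) (by
    intro x hx; left; simp; linarith)
  have er := int_inv_seg b p 1 I (by simp) (by simp) (u := c) (v := d) (by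
    intro x hx; left; simp; linarith)
  have el := int_inv_seg a p (-1) I (by simp) (by simp) (u := c) (v := d) (by
    intro x hx; left; simp; linarith)
  simp only [mul_one, one_mul] at eb et er el
  unfold rectInt
  have eb' : ∫ x in a..b, (1 / ((x : ℂ) + c * I - p)) = ∫ x in a..b, (1 / ((c : ℂ) * I + x - p)) := by
    simp only [add_comm]
  have et' : ∫ x in a..b, (1 / ((x : ℂ) + d * I - p)) = ∫ x in a..b, (1 / ((d : ℂ) * I + x - p)) := by
    simp only [add_comm]
  rw [eb', et', eb, et, er, el]
  -- corners
  have k1 := log_negI_mul (z := I * (c * I + b - p)) (by simp; linarith)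
  have k2 := log_negI_mul (z := (b + d * I - p)) (by simp; linarith)
  have k3 := log_negI_mul (z := -I * (d * I + a - p)) (by simp; linarith)
  have k4 := log_negI_mul (z := -1 * (a + c * I - p)) (by simp; linarith)
  have l1 : -I * (I * (c * I + b - p)) = b + c * I - p := by
    linear_combination (-(c * I + b - p)) * I_mul_I
  have l3 : -I * (-I * (d * I + a - p)) = -1 * (a + d * I - p) := by
    linear_combination ((d * I + a - p)) * I_mul_I
  have l4 : -I * (-1 * (a + c * I - p)) = I * (c * I + a - p) := by ring
  have l2 : -I * (b + d * I - p) = -I * (d * I + b - p) := by ring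
  rw [l1] at k1; rw [l2] at k2; rw [l3] at k3; rw [l4] at k4
  rw [k1, k2, k3, k4]
  ring

lemma rectInt_inv_pow {p : ℂ} (h1 : a < p.re) (h2 : p.re < b) (h3 : c < p.im) (h4 : p.im < d)
    (n : ℕ) : rectInt (fun z => 1 / (z - p) ^ (n + 2)) a b c d = 0 := by
  have hne : ∀ z ∈ rectBd a b c d, z - p ≠ 0 := by
    intro z hz h0
    rw [sub_eq_zero] at h0
    subst h0
    rcases hz with ⟨_, h | h⟩ | ⟨_, h | h⟩ <;> linarith
  apply rectInt_of_primitive (h1.trans h2).le (h3.trans h4).le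
    (F := fun z => -(1 / ((n : ℂ) + 1)) * (1 / (z - p) ^ (n + 1)))
  · apply ContinuousOn.div continuousOn_const (by fun_prop)
    intro z hz; exact pow_ne_zero _ (hne z hz)
  · intro z hz
    have h0 := hne z hz
    have hd : HasDerivAt (fun z => (z - p) ^ (n + 1)) (((n + 1 : ℕ) : ℂ) * (z - p) ^ n * 1) z := by
      exact ((hasDerivAt_id z).sub_const p).pow (n + 1)
    have := ((hd.inv (pow_ne_zero _ h0)).const_mul (-(1 / ((n : ℂ) + 1))))
    have hn : (n : ℂ) + 1 ≠ 0 := by exact_mod_cast Nat.succ_ne_zero n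
    have e : -(1 / ((n : ℂ) + 1)) * (-(((n + 1 : ℕ) : ℂ) * (z - p) ^ n * 1) / ((z - p) ^ (n + 1)) ^ 2)
        = 1 / (z - p) ^ (n + 2) := by
      push_cast
      field_simp
      ring
    rw [← e]
    simp only [one_div] at this ⊢
    exact this

/-- Residue theorem for rectangles, poles of order at most three. -/
theorem rect_residue (hab : a < b) (hcd : c < d) (S : Finset ℂ) (res : ℂ → ℂ) :
    ∀ (f : ℂ → ℂ),
    (∀ p ∈ S, (a < p.re ∧ p.re < b) ∧ c < p.im ∧ p.im < d) →
    (∀ z : ℂ, z.re ∈ Set.Icc a b → z.im ∈ Set.Icc c d → z ∉ S → AnalyticAt ℂ f z) →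
    (∀ p ∈ S, ∃ c2 c3 : ℂ, ∃ h : ℂ → ℂ, AnalyticAt ℂ h p ∧ ∀ᶠ z in 𝓝[≠] p,
      f z = h z + res p * (1 / (z - p)) + c2 * (1 / (z - p) ^ 2) + c3 * (1 / (z - p) ^ 3)) →
    rectInt f a b c d = 2 * π * I * ∑ p ∈ S, res p := by
  classical
  induction S using Finset.induction_on with
  | empty =>
    intro f _ hf _
    simp only [Finset.sum_empty, mul_zero]
    exact rectInt_eq_zero hab.le hcd.le (fun z h1 h2 => hf z h1 h2 (by simp))
  | insert p S hpS ih =>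
    intro f hS hf hres
    obtain ⟨c2, c3, h, hh, hev⟩ := hres p (Finset.mem_insert_self _ _)
    obtain ⟨⟨h1, h2⟩, h3, h4⟩ := hS p (Finset.mem_insert_self _ _)
    set g : ℂ → ℂ := fun z => res p * (1 / (z - p)) + c2 * (1 / (z - p) ^ 2)
      + c3 * (1 / (z - p) ^ 3) with hg
    have hgan : ∀ z, z ≠ p → AnalyticAt ℂ g z := by
      intro z hz
      have h0 : z - p ≠ 0 := sub_ne_zero.2 hz
      have hs : AnalyticAt ℂ (fun z => z - p) z := analyticAt_id.sub analyticAt_const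
      refine ((analyticAt_const.mul (analyticAt_const.div hs h0)).add
        (analyticAt_const.mul (analyticAt_const.div (hs.pow 2) (pow_ne_zero _ h0)))).add
        (analyticAt_const.mul (analyticAt_const.div (hs.pow 3) (pow_ne_zero _ h0)))
    set f1 : ℂ → ℂ := Function.update (fun z => f z - g z) p (h p) with hf1
    have hf1ne : ∀ z, z ≠ p → f1 =ᶠ[𝓝 z] fun z => f z - g z := by
      intro z hz
      filter_upwards [isOpen_ne.mem_nhds hz] with w hw
      simp [hf1, Function.update_of_ne hw]
    have hf1p : f1 =ᶠ[𝓝 p] h := by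
      rw [eventually_nhdsWithin_iff] at hev
      filter_upwards [hev] with w hw
      by_cases hwp : w = p
      · subst hwp; simp [hf1]
      · simp only [hf1, Function.update_of_ne hwp, hw hwp, hg]; ring
    have hbd : ∀ z ∈ rectBd a b c d, z ≠ p ∧ z.re ∈ Set.Icc a b ∧ z.im ∈ Set.Icc c d ∧
        z ∉ insert p S := by
      intro z hz
      have key : z ∉ insert p S := by
        intro hzS
        obtain ⟨⟨h1, h2⟩, h3, h4⟩ := hS z hzS
        rcases hz with ⟨_, h | h⟩ | ⟨_, h | h⟩ <;> linarith
      refine ⟨fun h => key (by simp [h]), ?_, ?_, key⟩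
      · rcases hz with ⟨hz, _⟩ | ⟨_, h | h⟩
        · exact hz
        · rw [h]; exact ⟨le_rfl, hab.le⟩
        · rw [h]; exact ⟨hab.le, le_rfl⟩
      · rcases hz with ⟨_, h | h⟩ | ⟨hz, _⟩
        · rw [h]; exact ⟨le_rfl, hcd.le⟩
        · rw [h]; exact ⟨hcd.le, le_rfl⟩
        · exact hz
    have ih1 := ih f1 (fun q hq => hS q (Finset.mem_insert_of_mem hq)) (by
      intro z hz1 hz2 hzS
      by_cases hzp : z = p
      · subst hzp; exact hh.congr hf1p.symm
      · exact ((hf z hz1 hz2 (by simp [hzp, hzS])).sub (hgan z hzp)).congr (hf1ne z hzp).symm) (by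
      intro q hq
      have hqp : q ≠ p := fun h => hpS (h ▸ hq)
      obtain ⟨e2, e3, k, hk, hke⟩ := hres q (Finset.mem_insert_of_mem hq)
      refine ⟨e2, e3, fun z => k z - g z, hk.sub (hgan q hqp), ?_⟩
      filter_upwards [hke, (hf1ne q hqp).filter_mono nhdsWithin_le_nhds] with z hz1 hz2
      rw [hz2, hz1]; ring)
    have hf1c : ContinuousOn f1 (rectBd a b c d) := by
      intro z hz
      obtain ⟨k1, k2, k3, k4⟩ := hbd z hz
      exact (((hf z k2 k3 k4).sub (hgan z k1)).congr (hf1ne z k1).symm).continuousAt.continuousWithinAt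
    have hc (n : ℕ) : ContinuousOn (fun z : ℂ => 1 / (z - p) ^ n) (rectBd a b c d) := by
      apply ContinuousOn.div continuousOn_const (by fun_prop)
      intro z hz; exact pow_ne_zero _ (sub_ne_zero.2 (hbd z hz).1)
    have hc1 : ContinuousOn (fun z : ℂ => 1 / (z - p)) (rectBd a b c d) := by simpa using hc 1
    have e1 : rectInt f a b c d = rectInt (fun z => f1 z + g z) a b c d := by
      apply rectInt_congr hab.le hcd.le
      intro z hz
      simp [hf1, Function.update_of_ne (hbd z hz).1]
    rw [e1, rectInt_add hab.le hcd.le hf1c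
      (fun z hz => (hgan z (hbd z hz).1).continuousAt.continuousWithinAt), ih1]
    have e2 : rectInt g a b c d = res p * (2 * π * I) := by
      have q1 : ContinuousOn (fun z => res p * (1 / (z - p))) (rectBd a b c d) :=
        continuousOn_const.mul hc1
      have q2 : ContinuousOn (fun z => c2 * (1 / (z - p) ^ 2)) (rectBd a b c d) :=
        continuousOn_const.mul (hc 2)
      have q3 : ContinuousOn (fun z => c3 * (1 / (z - p) ^ 3)) (rectBd a b c d) :=
        continuousOn_const.mul (hc 3)
      have q4 : ContinuousOn (fun z => res p * (1 / (z - p)) + c2 * (1 / (z - p) ^ 2))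
        (rectBd a b c d) := q1.add q2
      rw [hg, rectInt_add hab.le hcd.le q4 q3, rectInt_add hab.le hcd.le q1 q2, rectInt_smul, rectInt_smul, rectInt_smul, rectInt_inv h1 h2 h3 h4,
        rectInt_inv_pow h1 h2 h3 h4 0, rectInt_inv_pow h1 h2 h3 h4 1]
      ring
    rw [e2, Finset.sum_insert hpS]
    ring

end rect

/-- The integral of the fractional part against `u ^ (-(s+1))` over `u > N`. -/
noncomputable def fracInt (N : ℝ) (s : ℂ) : ℂ :=
  ∫ u in Set.Ioi N, ((Int.fract u : ℝ) : ℂ) * (u : ℂ) ^ (-(s + 1))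

lemma fract_loc (A : Set ℝ) (hA : MeasurableSet A) :
    MeasureTheory.LocallyIntegrableOn (A.indicator fun u : ℝ => ((Int.fract u : ℝ) : ℂ))
      (Set.Ioi 0) MeasureTheory.volume := by
  apply MeasureTheory.LocallyIntegrable.locallyIntegrableOn
  refine MeasureTheory.LocallyIntegrable.mono (f := fun _ : ℝ => (1 : ℂ))
    (MeasureTheory.locallyIntegrable_const _) ?_ ?_
  · exact ((Complex.measurable_ofReal.comp measurable_fract).indicator hA).aestronglyMeasurable
  · refine Filter.Eventually.of_forall fun u => ?_
    by_cases h : u ∈ A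
    · simp [h, abs_of_nonneg (Int.fract_nonneg u), (Int.fract_lt_one u).le]
    · simp [h]

lemma fract_ind_top (A : Set ℝ) :
    (A.indicator fun u : ℝ => ((Int.fract u : ℝ) : ℂ)) =O[atTop] fun x : ℝ => x ^ (-(0:ℝ)) := by
  apply Asymptotics.IsBigO.of_bound 1
  filter_upwards with u
  by_cases h : u ∈ A
  · simp [h, abs_of_nonneg (Int.fract_nonneg u), (Int.fract_lt_one u).le]
  · simp [h]

lemma fract_ind_zero (b : ℝ) :
    ((Set.Ioi (1:ℝ)).indicator fun u : ℝ => ((Int.fract u : ℝ) : ℂ)) =O[𝓝[>] 0] fun x : ℝ => x ^ (-b) := by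
  apply Asymptotics.IsBigO.of_bound 1
  have : ∀ᶠ u : ℝ in 𝓝[>] 0, u < 1 :=
    (Filter.Eventually.filter_mono nhdsWithin_le_nhds (eventually_lt_nhds zero_lt_one))
  filter_upwards [this] with u hu
  have : u ∉ Set.Ioi (1:ℝ) := by simp; exact hu.le
  simp only [this, not_false_eq_true, Set.indicator_of_notMem, norm_zero, one_mul]; positivity

lemma fracInt_eq_mellin (s : ℂ) :
    fracInt 1 s = mellin ((Set.Ioi (1:ℝ)).indicator fun u : ℝ => ((Int.fract u : ℝ) : ℂ)) (-s) := by
  unfold fracInt mellin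
  have h1 : (fun t : ℝ => (t : ℂ) ^ (-s - 1) •
      ((Set.Ioi (1:ℝ)).indicator fun u : ℝ => ((Int.fract u : ℝ) : ℂ)) t) =
      (Set.Ioi (1:ℝ)).indicator fun u : ℝ => ((Int.fract u : ℝ) : ℂ) * (u : ℂ) ^ (-(s + 1)) := by
    funext t
    by_cases h : t ∈ Set.Ioi (1:ℝ)
    · simp only [h, Set.indicator_of_mem, smul_eq_mul]
      rw [show -s - 1 = -(s + 1) by ring]; ring
    · simp only [h, not_false_eq_true, Set.indicator_of_notMem, smul_zero]
  rw [h1, MeasureTheory.setIntegral_indicator measurableSet_Ioi]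
  congr 2
  ext x; simp; try (intro h; linarith)

lemma fracInt_diff {s : ℂ} (hs : 0 < s.re) : DifferentiableAt ℂ (fracInt 1) s := by
  have h : fracInt 1 = fun s => mellin ((Set.Ioi (1:ℝ)).indicator fun u : ℝ => ((Int.fract u : ℝ) : ℂ)) (-s) := by
    funext s; exact fracInt_eq_mellin s
  rw [h]
  have := mellin_differentiableAt_of_isBigO_rpow (s := -s) (a := 0) (b := (-s).re - 1)
    (fract_loc (Set.Ioi 1) measurableSet_Ioi) (fract_ind_top _) (by simpa using hs)
    (fract_ind_zero _) (by simp)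
  exact this.comp s (differentiableAt_id.neg)

lemma cpow_neg_intOn {s : ℂ} (hs : 0 < s.re) {N : ℝ} (hN : 0 < N) :
    MeasureTheory.IntegrableOn (fun u : ℝ => (u : ℂ) ^ (-(s + 1))) (Set.Ioi N) := by
  rw [integrableOn_Ioi_cpow_iff hN]
  simp; linarith

lemma fracInt_integrable {s : ℂ} (hs : 0 < s.re) {N : ℝ} (hN : 0 < N) :
    MeasureTheory.IntegrableOn (fun u : ℝ => ((Int.fract u : ℝ) : ℂ) * (u : ℂ) ^ (-(s + 1)))
      (Set.Ioi N) := by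
  refine MeasureTheory.Integrable.bdd_mul (c := 1) (cpow_neg_intOn hs hN)
    (Complex.measurable_ofReal.comp measurable_fract).aestronglyMeasurable ?_
  refine Filter.Eventually.of_forall fun u => ?_
  simp [abs_of_nonneg (Int.fract_nonneg u), (Int.fract_lt_one u).le]

lemma zeta_fracInt_aux {s : ℂ} (hs : 1 < s.re) :
    ζ s = s / (s - 1) - s * fracInt 1 s := by
  have h0 : 0 < s.re := by linarith
  have hs1 : s - 1 ≠ 0 := by
    intro h
    have := congrArg Complex.re h
    simp at this; linarith
  have hs0 : s ≠ 0 := by rintro rfl; simp at h0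
  have hsum : LSeriesSummable (1 : ℕ → ℂ) s := LSeriesSummable_one_iff.2 hs
  have key := LSeries_eq_mul_integral (1 : ℕ → ℂ) (r := 1) zero_le_one hs hsum (by
    apply Asymptotics.IsBigO.of_bound 1
    filter_upwards with n
    simp)
  rw [LSeries_one_eq_riemannZeta hs] at key
  have e : fracInt 1 s = (∫ u in Set.Ioi (1:ℝ), (u : ℂ) ^ (-s)) -
      ∫ t in Set.Ioi (1:ℝ), (∑ k ∈ Finset.Icc 1 ⌊t⌋₊, (1 : ℕ → ℂ) k) * (t : ℂ) ^ (-(s + 1)) := by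
    have i1 : MeasureTheory.IntegrableOn (fun u : ℝ => (u : ℂ) ^ (-s)) (Set.Ioi 1) := by
      rw [integrableOn_Ioi_cpow_iff zero_lt_one]; simpa using hs
    have hc : Set.EqOn (fun t : ℝ => (∑ k ∈ Finset.Icc 1 ⌊t⌋₊, (1 : ℕ → ℂ) k) * (t : ℂ) ^ (-(s + 1)))
        (fun t : ℝ => (t : ℂ) ^ (-s) - ((Int.fract t : ℝ) : ℂ) * (t : ℂ) ^ (-(s + 1))) (Set.Ioi 1) := by
      intro t ht
      have ht0 : (0:ℝ) < t := lt_trans zero_lt_one ht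
      have e1 : (t : ℂ) ^ (-s) = t * (t : ℂ) ^ (-(s + 1)) := by
        rw [show -s = 1 + (-(s + 1)) by ring, cpow_add _ _ (by exact_mod_cast ht0.ne'), cpow_one]
      have e2 : ((⌊t⌋₊ : ℕ) : ℂ) = t - ((Int.fract t : ℝ) : ℂ) := by
        rw [Int.fract, ← natCast_floor_eq_intCast_floor ht0.le]; push_cast; ring
      simp only [Pi.one_apply, Finset.sum_const, Nat.card_Icc, add_tsub_cancel_right, nsmul_eq_mul,
        mul_one]
      rw [e1, e2]; ring
    rw [MeasureTheory.setIntegral_congr_fun measurableSet_Ioi hc,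
      MeasureTheory.integral_sub i1 (fracInt_integrable h0 zero_lt_one)]
    unfold fracInt
    ring
  have e3 : ∫ u in Set.Ioi (1:ℝ), (u : ℂ) ^ (-s) = 1 / (s - 1) := by
    rw [integral_Ioi_cpow_of_lt (by simpa using hs) zero_lt_one]
    rw [ofReal_one, one_cpow, show -s + 1 = -(s - 1) by ring, neg_div_neg_eq]
  rw [e, e3, mul_sub, ← key]
  field_simp
  ring

lemma riemannZeta₁_eq_mul {s : ℂ} (hs : s ≠ 1) : riemannZeta₁ s = (s - 1) * ζ s := by
  rw [riemannZeta_eq_inv_sub_mul hs]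
  have : s - 1 ≠ 0 := sub_ne_zero.2 hs
  field_simp

lemma zeta_fracInt {s : ℂ} (hs : 0 < s.re) (hs1 : s ≠ 1) :
    ζ s = s / (s - 1) - s * fracInt 1 s := by
  have hU : IsOpen {s : ℂ | 0 < s.re} := isOpen_lt continuous_const continuous_re
  have key : Set.EqOn riemannZeta₁ (fun s => s - s * (s - 1) * fracInt 1 s) {s : ℂ | 0 < s.re} := by
    refine AnalyticOnNhd.eqOn_of_preconnected_of_eventuallyEq (𝕜 := ℂ) (z₀ := 2) ?_ ?_ ?_ ?_ ?_
    · exact DifferentiableOn.analyticOnNhd (differentiable_riemannZeta₁.differentiableOn) hU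
    · apply DifferentiableOn.analyticOnNhd _ hU
      intro z hz
      have h1 : DifferentiableAt ℂ (fun s : ℂ => s) z := differentiableAt_id
      exact (h1.sub ((h1.mul (h1.sub_const 1)).mul (fracInt_diff hz))).differentiableWithinAt
    · exact (convex_halfSpace_re_gt 0).isPreconnected
    · simp
    · have : {s : ℂ | 1 < s.re} ∈ 𝓝 (2 : ℂ) :=
        (isOpen_lt continuous_const continuous_re).mem_nhds (by simp)
      filter_upwards [this] with z hz
      have hz1 : z ≠ 1 := by rintro rfl; simp at hz
      have : z - 1 ≠ 0 := sub_ne_zero.2 hz1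
      rw [riemannZeta₁_eq_mul hz1, zeta_fracInt_aux hz]
      field_simp
  have h := key hs
  have : s - 1 ≠ 0 := sub_ne_zero.2 hs1
  simp only at h
  rw [riemannZeta₁_eq_mul hs1] at h
  apply mul_left_cancel₀ this
  rw [h]; field_simp

lemma fracInt_step {s : ℂ} (hs : 0 < s.re) (hs1 : s ≠ 1) (n : ℕ) (hn : 1 ≤ n) :
    s * fracInt n s = s * fracInt (n + 1 : ℕ) s - 1 / ((n + 1 : ℕ) : ℂ) ^ s
      + (((n + 1 : ℕ) : ℂ) ^ (1 - s) - (n : ℂ) ^ (1 - s)) / (1 - s) := by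
  have hn0 : (0:ℝ) < n := by exact_mod_cast hn
  have hle : (n:ℝ) ≤ ((n + 1 : ℕ) : ℝ) := by push_cast; linarith
  have hs0 : s ≠ 0 := by rintro rfl; simp at hs
  have hs1' : 1 - s ≠ 0 := sub_ne_zero.2 hs1.symm
  have hi := fracInt_integrable hs hn0
  have split : fracInt n s = (∫ u in (n:ℝ)..((n + 1 : ℕ) : ℝ), ((Int.fract u : ℝ) : ℂ) * (u : ℂ) ^ (-(s + 1)))
      + fracInt (n + 1 : ℕ) s := by
    unfold fracInt
    rw [intervalIntegral.integral_of_le hle, ← MeasureTheory.setIntegral_union _ measurableSet_Ioi]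
    · rw [Set.Ioc_union_Ioi_eq_Ioi hle]
    · exact hi.mono_set Set.Ioc_subset_Ioi_self
    · exact hi.mono_set (Set.Ioi_subset_Ioi hle)
    · rw [Set.disjoint_left]; intro x hx hx2; exact absurd hx.2 (not_le.2 hx2)
  have hcongr : (∫ u in (n:ℝ)..((n + 1 : ℕ) : ℝ), ((Int.fract u : ℝ) : ℂ) * (u : ℂ) ^ (-(s + 1)))
      = ∫ u in (n:ℝ)..((n + 1 : ℕ) : ℝ), ((u : ℂ) - n) * (u : ℂ) ^ (-(s + 1)) := by
    apply intervalIntegral.integral_congr_ae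
    have : ∀ᵐ u : ℝ, u ≠ ((n + 1 : ℕ) : ℝ) := by
      simp [MeasureTheory.ae_iff]
    filter_upwards [this] with u hu hmem
    rw [Set.uIoc_of_le hle] at hmem
    have hlt : u < ((n + 1 : ℕ) : ℝ) := lt_of_le_of_ne hmem.2 hu
    have : ⌊u⌋ = (n : ℤ) := by
      rw [Int.floor_eq_iff]; push_cast at hlt ⊢; exact ⟨hmem.1.le, hlt⟩
    simp [Int.fract, this]
  have ftc : s * (∫ u in (n:ℝ)..((n + 1 : ℕ) : ℝ), ((u : ℂ) - n) * (u : ℂ) ^ (-(s + 1)))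
      = (-((((n + 1 : ℕ) : ℝ) : ℂ) - n) * (((n + 1 : ℕ) : ℝ) : ℂ) ^ (-s) + (((n + 1 : ℕ) : ℝ) : ℂ) ^ (1 - s) / (1 - s))
      - (-(((n : ℝ) : ℂ) - n) * ((n : ℝ) : ℂ) ^ (-s) + ((n : ℝ) : ℂ) ^ (1 - s) / (1 - s)) := by
    rw [← intervalIntegral.integral_const_mul]
    apply intervalIntegral.integral_eq_sub_of_hasDerivAt
      (f := fun u : ℝ => -((u : ℂ) - n) * (u : ℂ) ^ (-s) + (u : ℂ) ^ (1 - s) / (1 - s))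
    · intro u hu
      rw [Set.uIcc_of_le hle] at hu
      have hu0 : u ≠ 0 := (lt_of_lt_of_le hn0 hu.1).ne'
      have d1 : HasDerivAt (fun u : ℝ => (u : ℂ) ^ (-s)) (-s * (u : ℂ) ^ (-s - 1)) u := by
        exact hasDerivAt_ofReal_cpow_const hu0 (by simpa using hs0)
      have d2 : HasDerivAt (fun u : ℝ => (u : ℂ) ^ (1 - s) / (1 - s)) ((u : ℂ) ^ (-s)) u := by
        have := (hasDerivAt_ofReal_cpow_const hu0 hs1').div_const (1 - s)
        rw [mul_div_cancel_left₀ _ hs1', show 1 - s - 1 = -s by ring] at this; exact this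
      have d0 : HasDerivAt (fun u : ℝ => -((u : ℂ) - n)) (-1) u :=
        ((Complex.ofRealCLM.hasDerivAt (x := u)).sub_const _).neg
      have := (d0.mul d1).add d2
      refine this.congr_deriv ?_
      rw [show -(s + 1) = -s - 1 by ring]; ring
    · apply ContinuousOn.intervalIntegrable
      rw [Set.uIcc_of_le hle]
      refine continuousOn_const.mul (ContinuousOn.mul (by fun_prop) ?_)
      intro u hu
      have hu0 : u ≠ 0 := (lt_of_lt_of_le hn0 hu.1).ne'
      exact (Complex.continuousAt_ofReal_cpow_const u _ (Or.inr hu0)).continuousWithinAt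
  rw [split, hcongr, mul_add, ftc, one_div, ← cpow_neg]
  push_cast
  ring

lemma zeta_sum_fracInt {s : ℂ} (hs : 0 < s.re) (hs1 : s ≠ 1) (N : ℕ) :
    ζ s = ∑ n ∈ Finset.range (N + 1), 1 / ((n + 1 : ℕ) : ℂ) ^ s
      + ((N + 1 : ℕ) : ℂ) ^ (1 - s) / (s - 1) - s * fracInt (N + 1 : ℕ) s := by
  have h1 : s - 1 ≠ 0 := sub_ne_zero.2 hs1
  have h1' : 1 - s ≠ 0 := sub_ne_zero.2 hs1.symm
  induction N with
  | zero =>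
    rw [zeta_fracInt hs hs1]; simp; field_simp; ring
  | succ N ih =>
    rw [ih, fracInt_step hs hs1 (N + 1) (by omega), Finset.sum_range_succ _ (N + 1)]
    rw [show (1 - s) = -(s - 1) by ring, div_neg]
    ring

lemma fracInt_bound {s : ℂ} (hs : 0 < s.re) {N : ℝ} (hN : 0 < N) :
    ‖fracInt N s‖ ≤ N ^ (-s.re) / s.re := by
  have h := MeasureTheory.norm_integral_le_of_norm_le (μ := MeasureTheory.volume.restrict (Set.Ioi N))
    (f := fun u : ℝ => ((Int.fract u : ℝ) : ℂ) * (u : ℂ) ^ (-(s + 1)))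
    (g := fun u : ℝ => u ^ (-(s.re + 1)))
    (by exact (integrableOn_Ioi_rpow_iff hN).2 (by linarith)) (by
      rw [MeasureTheory.ae_restrict_iff' measurableSet_Ioi]
      refine Filter.Eventually.of_forall fun u hu => ?_
      have hu0 : 0 < u := hN.trans hu
      rw [norm_mul, norm_cpow_eq_rpow_re_of_pos hu0]
      simp only [norm_real, Real.norm_eq_abs, abs_of_nonneg (Int.fract_nonneg u), neg_re, add_re, one_re]
      exact mul_le_of_le_one_left (by positivity) (Int.fract_lt_one u).le)
  rw [integral_Ioi_rpow_of_lt (by linarith) hN] at h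
  refine h.trans (le_of_eq ?_)
  rw [show -(s.re + 1) + 1 = -s.re by ring, neg_div_neg_eq]

/-- Basic bound for zeta to the right of the critical line. -/
lemma zeta_bound : ∃ K > (0:ℝ), ∀ s : ℂ, 1/2 ≤ s.re → 2 ≤ |s.im| →
    ‖ζ s‖ ≤ K * |s.im| ^ (max (1 - s.re) 0) * Real.log |s.im| := by
  refine ⟨20, by norm_num, fun s hs ht => ?_⟩
  set t := |s.im| with htdef
  set σ := s.re with hσdef
  have ht0 : 0 < t := by linarith
  have hs0 : 0 < s.re := by rw [← hσdef]; linarith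
  have hs1 : s ≠ 1 := by rintro rfl; simp [htdef] at ht; linarith
  set N := ⌊t⌋₊ with hN
  have hNt : (N : ℝ) ≤ t := Nat.floor_le ht0.le
  have htN : t < N + 1 := Nat.lt_floor_add_one t
  rw [zeta_sum_fracInt hs0 hs1 N]
  set m := max (1 - σ) 0 with hm
  have hm0 : 0 ≤ m := le_max_right _ _
  have hmh : m ≤ 1/2 := max_le (by linarith) (by norm_num)
  have hlog2 : 1/2 ≤ Real.log t := by
    have := Real.log_two_gt_d9
    have h3 := Real.log_le_log (by norm_num) ht
    linarith
  have htm : 1 ≤ t ^ m := Real.one_le_rpow (by linarith) hm0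
  have h2m : (N + 1 : ℝ) ^ m ≤ 2 * t ^ m := by
    calc (N + 1 : ℝ) ^ m ≤ (2 * t) ^ m := by
          apply Real.rpow_le_rpow (by positivity) _ hm0; linarith
      _ = 2 ^ m * t ^ m := Real.mul_rpow (by norm_num) ht0.le
      _ ≤ 2 ^ (1:ℝ) * t ^ m := by
          gcongr
          · norm_num
          · linarith
      _ = _ := by simp
  have hlogN : Real.log (N + 1) ≤ 2 * Real.log t := by
    have : Real.log (N + 1) ≤ Real.log (t ^ 2) := by
      apply Real.log_le_log (by positivity); nlinarith
    rw [Real.log_pow] at this; exact_mod_cast this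
  have b1 : ‖∑ n ∈ Finset.range (N + 1), 1 / ((n + 1 : ℕ) : ℂ) ^ s‖ ≤ 8 * t ^ m * Real.log t := by
    calc ‖∑ n ∈ Finset.range (N + 1), 1 / ((n + 1 : ℕ) : ℂ) ^ s‖
        ≤ ∑ n ∈ Finset.range (N + 1), (N + 1 : ℝ) ^ m * ((n : ℝ) + 1)⁻¹ := by
          apply norm_sum_le_of_le
          intro n hn
          have hn1 : (0:ℝ) < (n : ℝ) + 1 := by positivity
          have : ((n + 1 : ℕ) : ℂ) = (((n : ℝ) + 1 : ℝ) : ℂ) := by push_cast; ring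
          rw [this, one_div, norm_inv, norm_cpow_eq_rpow_re_of_pos hn1, ← Real.rpow_neg hn1.le,
            ← Real.rpow_neg_one ((n : ℝ) + 1)]
          have hnN : (n : ℝ) + 1 ≤ N + 1 := by
            have := Finset.mem_range.1 hn
            have : n ≤ N := by omega
            have : (n : ℝ) ≤ N := by exact_mod_cast this
            linarith
          calc ((n : ℝ) + 1) ^ (-σ) ≤ ((n : ℝ) + 1) ^ (m + -1) := by
                apply Real.rpow_le_rpow_of_exponent_le (by linarith [Nat.cast_nonneg (α := ℝ) n])
                have := le_max_left (1 - σ) 0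
                linarith
            _ = ((n : ℝ) + 1) ^ m * ((n : ℝ) + 1) ^ (-1 : ℝ) := Real.rpow_add hn1 _ _
            _ ≤ _ := by gcongr
      _ = (N + 1 : ℝ) ^ m * ((harmonic (N + 1) : ℚ) : ℝ) := by
          rw [← Finset.mul_sum, harmonic]; push_cast; rfl
      _ ≤ (2 * t ^ m) * (1 + Real.log (N + 1)) := by
          have := harmonic_le_one_add_log (N + 1)
          push_cast at this
          have h0 : (0:ℝ) ≤ ((harmonic (N + 1) : ℚ) : ℝ) := by
            exact_mod_cast (harmonic_pos (by omega)).le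
          gcongr
      _ ≤ 8 * t ^ m * Real.log t := by nlinarith
  have hN1 : (0:ℝ) < (N : ℝ) + 1 := by positivity
  have hNc : ((N + 1 : ℕ) : ℂ) = (((N : ℝ) + 1 : ℝ) : ℂ) := by push_cast; ring
  have b2 : ‖((N + 1 : ℕ) : ℂ) ^ (1 - s) / (s - 1)‖ ≤ 2 * t ^ m := by
    rw [norm_div, hNc, norm_cpow_eq_rpow_re_of_pos hN1]
    have h1 : 1 ≤ ‖s - 1‖ := by
      have := Complex.abs_im_le_norm (s - 1)
      simp at this; linarith
    have h2 : ((N : ℝ) + 1) ^ (1 - s).re ≤ 2 * t ^ m := by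
      refine le_trans ?_ h2m
      apply Real.rpow_le_rpow_of_exponent_le (by linarith [Nat.cast_nonneg (α := ℝ) N])
      simp [hm, hσdef]
    calc _ ≤ ((N : ℝ) + 1) ^ (1 - s).re / 1 := by gcongr
      _ ≤ _ := by simpa using h2
  have b3 : ‖s * fracInt (N + 1 : ℕ) s‖ ≤ 3 * t ^ m := by
    rw [norm_mul]
    have h1 := fracInt_bound hs0 (N := ((N + 1 : ℕ) : ℝ)) (by push_cast; positivity)
    have h2 : ‖s‖ ≤ σ + t := by
      have := Complex.norm_le_abs_re_add_abs_im s
      rwa [abs_of_pos hs0] at this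
    have h3 : (((N + 1 : ℕ) : ℝ)) ^ (-s.re) ≤ t ^ (-σ) := by
      apply Real.rpow_le_rpow_of_nonpos ht0 (by push_cast; linarith) (by linarith)
    have h4 : t ^ (-σ) ≤ t ^ (m + -1) := by
      apply Real.rpow_le_rpow_of_exponent_le (by linarith)
      have := le_max_left (1 - σ) 0
      linarith
    rw [Real.rpow_add ht0, Real.rpow_neg_one] at h4
    calc ‖s‖ * ‖fracInt (N + 1 : ℕ) s‖ ≤ (σ + t) * (t ^ (-σ) / σ) := by
          refine mul_le_mul h2 (h1.trans ?_) (norm_nonneg _) (by linarith)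
          gcongr
      _ ≤ (σ + t) * ((t ^ m * t⁻¹) / σ) := by
          have : 0 < σ := hs0
          gcongr
      _ = t ^ m * ((σ + t) / (σ * t)) := by field_simp
      _ ≤ t ^ m * 3 := by
          have hσ0 : 0 < σ := hs0
          gcongr
          rw [div_le_iff₀ (by positivity)]
          nlinarith
      _ = _ := by ring
  calc _ ≤ ‖∑ n ∈ Finset.range (N + 1), 1 / ((n + 1 : ℕ) : ℂ) ^ s‖ +
        ‖((N + 1 : ℕ) : ℂ) ^ (1 - s) / (s - 1)‖ + ‖s * fracInt (N + 1 : ℕ) s‖ :=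
        (norm_sub_le _ _).trans (add_le_add_left (norm_add_le _ _) _)
    _ ≤ 8 * t ^ m * Real.log t + 2 * t ^ m + 3 * t ^ m := by gcongr
    _ ≤ 20 * t ^ m * Real.log t := by nlinarith

/-! ### The function `Hf` and its Dirichlet series -/

/-- `ζ'' - ζ'^2/ζ`. -/
noncomputable def Hf (s : ℂ) : ℂ :=
  deriv (deriv ζ) s - deriv ζ s ^ 2 / ζ s

/-- The Dirichlet coefficients of `Hf`. -/
noncomputable def bco (n : ℕ) : ℝ :=
  ∑ d ∈ n.divisors, ArithmeticFunction.vonMangoldt d * Real.log d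

lemma bco_nonneg (n : ℕ) : 0 ≤ bco n :=
  Finset.sum_nonneg fun d _ => mul_nonneg ArithmeticFunction.vonMangoldt_nonneg (Real.log_natCast_nonneg d)

lemma bco_le (n : ℕ) : bco n ≤ Real.log n ^ 2 := by
  rcases Nat.eq_zero_or_pos n with rfl | hn
  · simp [bco]
  calc bco n ≤ ∑ d ∈ n.divisors, ArithmeticFunction.vonMangoldt d * Real.log n := by
        apply Finset.sum_le_sum
        intro d hd
        have h1 := Nat.divisor_le hd
        have h2 := Nat.pos_of_mem_divisors hd
        apply mul_le_mul_of_nonneg_left _ ArithmeticFunction.vonMangoldt_nonneg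
        exact Real.log_le_log (by exact_mod_cast h2) (by exact_mod_cast h1)
    _ = Real.log n ^ 2 := by
        rw [← Finset.sum_mul, ArithmeticFunction.vonMangoldt_sum]; ring

lemma zeta_analyticAt {s : ℂ} (hs : s ≠ 1) : AnalyticAt ℂ ζ s := by
  rw [analyticAt_iff_eventually_differentiableAt]
  filter_upwards [isOpen_ne.mem_nhds hs] with z hz
  exact differentiableAt_riemannZeta hz

lemma ne_one_of_re {s : ℂ} (hs : 1 < s.re) : s ≠ 1 := by rintro rfl; simp at hs

lemma Hf_eq_mul {s : ℂ} (hs : s ≠ 1) (h0 : ζ s ≠ 0) :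
    Hf s = ζ s * deriv (fun z => deriv ζ z / ζ z) s := by
  have h1 := zeta_analyticAt hs
  rw [show (fun z => deriv ζ z / ζ z) = deriv ζ / ζ from rfl,
    deriv_div h1.deriv.differentiableAt h1.differentiableAt h0, Hf]
  field_simp

lemma Hf_analyticAt {s : ℂ} (hs : s ≠ 1) (h0 : ζ s ≠ 0) : AnalyticAt ℂ Hf s := by
  have h1 := zeta_analyticAt hs
  exact h1.deriv.deriv.sub ((h1.deriv.pow 2).div h1 h0)

lemma bco_conv : (fun n => (bco n : ℂ)) = LSeries.convolution
    (LSeries.logMul fun n => (ArithmeticFunction.vonMangoldt n : ℂ)) 1 := by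
  funext n
  rw [LSeries.convolution_def, bco]
  beta_reduce
  rw [Nat.sum_divisorsAntidiagonal
    (f := fun d e => (LSeries.logMul fun n => (ArithmeticFunction.vonMangoldt n : ℂ)) d * (1 : ℕ → ℂ) e)]
  push_cast
  apply Finset.sum_congr rfl
  intro d _
  simp [LSeries.logMul]; ring

lemma logMul_vm_summable {s : ℂ} (hs : 1 < s.re) :
    LSeriesSummable (LSeries.logMul fun n => (ArithmeticFunction.vonMangoldt n : ℂ)) s := by
  apply LSeriesSummable_of_abscissaOfAbsConv_lt_re
  rw [LSeries.abscissaOfAbsConv_logMul]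
  refine lt_of_le_of_lt ?_ (EReal.coe_lt_coe_iff.2 hs)
  apply LSeries.abscissaOfAbsConv_le_of_forall_lt_LSeriesSummable
  intro y hy
  exact ArithmeticFunction.LSeriesSummable_vonMangoldt (by simpa using hy)

lemma bco_summable {s : ℂ} (hs : 1 < s.re) : LSeriesSummable (fun n => (bco n : ℂ)) s := by
  rw [bco_conv]
  exact (logMul_vm_summable hs).convolution (LSeriesSummable_one_iff.2 hs)

lemma bco_LSeries {s : ℂ} (hs : 1 < s.re) : LSeries (fun n => (bco n : ℂ)) s = Hf s := by
  have h0 := riemannZeta_ne_zero_of_one_le_re hs.le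
  rw [bco_conv, LSeries_convolution' (logMul_vm_summable hs) (LSeriesSummable_one_iff.2 hs),
    LSeries_one_eq_riemannZeta hs, Hf_eq_mul (ne_one_of_re hs) h0, mul_comm]
  congr 1
  have hab : LSeries.abscissaOfAbsConv (fun n => (ArithmeticFunction.vonMangoldt n : ℂ)) < s.re := by
    refine lt_of_le_of_lt ?_ (EReal.coe_lt_coe_iff.2 hs)
    apply LSeries.abscissaOfAbsConv_le_of_forall_lt_LSeriesSummable
    intro y hy
    exact ArithmeticFunction.LSeriesSummable_vonMangoldt (by simpa using hy)
  have h1 := LSeries_deriv hab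
  have h2 : (LSeries fun n => (ArithmeticFunction.vonMangoldt n : ℂ)) =ᶠ[𝓝 s]
      fun z => -(deriv ζ z / ζ z) := by
    filter_upwards [(isOpen_lt continuous_const continuous_re).mem_nhds hs] with z hz
    rw [ArithmeticFunction.LSeries_vonMangoldt_eq_deriv_riemannZeta_div hz]; ring
  rw [h2.deriv_eq, deriv.fun_neg] at h1
  linear_combination h1

lemma Hf_hasSum {s : ℂ} (hs : 1 < s.re) :
    HasSum (fun n : ℕ => (bco n : ℂ) * (n : ℂ) ^ (-s)) (Hf s) := by
  have h := (bco_summable hs).hasSum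
  rw [show (∑' b, LSeries.term (fun n => (bco n : ℂ)) s b) = Hf s from bco_LSeries hs] at h
  convert h using 2 with n
  rcases Nat.eq_zero_or_pos n with rfl | hn
  · simp [bco]
  · rw [LSeries.term_of_ne_zero hn.ne', cpow_neg]; rfl

lemma bco_real_summable {σ : ℝ} (hs : 1 < σ) : Summable fun n : ℕ => bco n * (n : ℝ) ^ (-σ) := by
  have h := (Hf_hasSum (s := (σ : ℂ)) (by simpa using hs)).summable.norm
  refine h.congr fun n => ?_
  rcases Nat.eq_zero_or_pos n with rfl | hn
  · simp [bco]
  · rw [norm_mul, norm_natCast_cpow_of_pos hn]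
    simp [abs_of_nonneg (bco_nonneg n)]

lemma Hf_norm_le {s : ℂ} (hs : 1 < s.re) :
    ‖Hf s‖ ≤ ∑' n : ℕ, bco n * (n : ℝ) ^ (-s.re) := by
  rw [← (Hf_hasSum hs).tsum_eq]
  refine tsum_of_norm_bounded (bco_real_summable hs).hasSum fun n => ?_
  rcases Nat.eq_zero_or_pos n with rfl | hn
  · simp [bco]
  · rw [norm_mul, norm_natCast_cpow_of_pos hn]
    simp [abs_of_nonneg (bco_nonneg n)]

lemma riemannZeta₁_analyticAt (s : ℂ) : AnalyticAt ℂ riemannZeta₁ s :=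
  differentiable_riemannZeta₁.analyticAt s

/-- `Hf` near `1` in terms of `Z = (s-1) ζ`. -/
lemma Hf_eq_Z {s : ℂ} (hs : s ≠ 1) (h0 : ζ s ≠ 0) :
    Hf s = riemannZeta₁ s / (s - 1) ^ 3
      + (deriv (deriv riemannZeta₁) s - deriv riemannZeta₁ s ^ 2 / riemannZeta₁ s) / (s - 1) := by
  have hu : s - 1 ≠ 0 := sub_ne_zero.2 hs
  have hd : ∀ z : ℂ, z ≠ 1 → deriv riemannZeta₁ z = ζ z + (z - 1) * deriv ζ z := by
    intro z hz
    have h1 : riemannZeta₁ =ᶠ[𝓝 z] fun w => (w - 1) * ζ w := by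
      filter_upwards [isOpen_ne.mem_nhds hz] with w hw using riemannZeta₁_eq_mul hw
    rw [h1.deriv_eq]
    have h2 := ((hasDerivAt_id z).sub_const 1).mul (differentiableAt_riemannZeta hz).hasDerivAt
    have h3 := h2.deriv
    simp only [id, one_mul] at h3
    exact h3
  have hdd : deriv (deriv riemannZeta₁) s = 2 * deriv ζ s + (s - 1) * deriv (deriv ζ) s := by
    have h1 : deriv riemannZeta₁ =ᶠ[𝓝 s] fun w => ζ w + (w - 1) * deriv ζ w := by
      filter_upwards [isOpen_ne.mem_nhds hs] with w hw using hd w hw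
    rw [h1.deriv_eq]
    have h2 := (differentiableAt_riemannZeta hs).hasDerivAt.add (((hasDerivAt_id s).sub_const 1).mul
      (zeta_analyticAt hs).deriv.differentiableAt.hasDerivAt)
    have h3 := h2.deriv
    simp only [id, one_mul] at h3
    refine Eq.trans ?_ (h3.trans ?_)
    · rfl
    · ring
  rw [hdd, hd s hs, riemannZeta₁_eq_mul hs, Hf]
  field_simp
  ring

lemma riemannZeta₁_ne_zero {s : ℂ} (hs : 1 ≤ s.re) : riemannZeta₁ s ≠ 0 := by
  by_cases h : s = 1
  · subst h; simp [riemannZeta₁_one]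
  · rw [riemannZeta₁_eq_mul h]
    exact mul_ne_zero (sub_ne_zero.2 h) (riemannZeta_ne_zero_of_one_le_re hs)

/-- `∑ b(n) n^{-a} ≪ (a-1)^{-3}`. -/
lemma bco_tsum_le : ∃ K > (0:ℝ), ∀ a : ℝ, 1 < a → a ≤ 2 →
    ∑' n : ℕ, bco n * (n : ℝ) ^ (-a) ≤ K / (a - 1) ^ 3 := by
  have hc : ContinuousOn (fun a : ℝ => riemannZeta₁ a + (a - 1 : ℂ) ^ 2 *
      (deriv (deriv riemannZeta₁) a - deriv riemannZeta₁ a ^ 2 / riemannZeta₁ a)) (Set.Icc 1 2) := by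
    intro a ha
    have hA := riemannZeta₁_analyticAt a
    have hs : AnalyticAt ℂ (fun s : ℂ => s) (a : ℂ) := analyticAt_id
    have : AnalyticAt ℂ (fun s => riemannZeta₁ s + (s - 1 : ℂ) ^ 2 *
      (deriv (deriv riemannZeta₁) s - deriv riemannZeta₁ s ^ 2 / riemannZeta₁ s)) (a : ℂ) :=
      hA.add (((hs.sub analyticAt_const).pow 2).mul (hA.deriv.deriv.sub
        ((hA.deriv.pow 2).div hA (riemannZeta₁_ne_zero (by simpa using ha.1)))))
    exact (ContinuousAt.comp (f := fun a : ℝ => (a : ℂ)) this.continuousAt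
      Complex.continuous_ofReal.continuousAt).continuousWithinAt
  obtain ⟨K, hK⟩ := isCompact_Icc.exists_bound_of_continuousOn hc
  refine ⟨max K 1, by positivity, fun a ha ha2 => ?_⟩
  have h1 : (a : ℂ) ≠ 1 := by exact_mod_cast ha.ne'
  have hu : (a : ℂ) - 1 ≠ 0 := sub_ne_zero.2 h1
  have hsum := Hf_hasSum (s := (a : ℂ)) (by simpa using ha)
  have h2 : ((∑' n : ℕ, bco n * (n : ℝ) ^ (-a) : ℝ) : ℂ) = Hf a := by
    rw [← hsum.tsum_eq, Complex.ofReal_tsum]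
    congr 1; funext n
    push_cast [Complex.ofReal_cpow (Nat.cast_nonneg n)]
    rfl
  have h3 := hK a ⟨ha.le, ha2⟩
  have h4 : Hf a = (riemannZeta₁ a + (a - 1 : ℂ) ^ 2 *
      (deriv (deriv riemannZeta₁) a - deriv riemannZeta₁ a ^ 2 / riemannZeta₁ a)) / ((a - 1 : ℝ) : ℂ) ^ 3 := by
    rw [Hf_eq_Z h1 (riemannZeta_ne_zero_of_one_le_re (by simpa using ha.le))]
    push_cast
    field_simp
  have h5 : ‖Hf a‖ ≤ max K 1 / (a - 1) ^ 3 := by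
    rw [h4, norm_div, norm_pow, norm_real, Real.norm_of_nonneg (by linarith)]
    have : 0 < (a - 1) ^ 3 := by have : 0 < a - 1 := by linarith
                                 positivity
    gcongr
    exact h3.trans (le_max_left _ _)
  rw [← h2, norm_real] at h5
  exact (le_abs_self _).trans h5

lemma gammaSeq_norm_le {s : ℂ} (hs : 0 < s.re) {n : ℕ} (hn : n ≠ 0) :
    ‖GammaSeq s n‖ ≤ Real.Gamma s.re := by
  have hn0 : (0:ℝ) < n := by positivity
  have h1 := Real.BohrMollerup.ge_logGammaSeq (n := n) Real.convexOn_log_Gamma (fun {y} hy => by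
    simp only [Function.comp]
    rw [Real.Gamma_add_one hy.ne', Real.log_mul hy.ne' (Real.Gamma_pos_of_pos hy).ne', add_comm]) hs hn
  simp only [Function.comp, Real.Gamma_one, Real.log_one, zero_add] at h1
  have h2 := Real.exp_le_exp.2 h1
  rw [Real.exp_log (Real.Gamma_pos_of_pos hs)] at h2
  refine le_trans ?_ h2
  unfold Real.BohrMollerup.logGammaSeq GammaSeq
  rw [norm_div, norm_mul, norm_prod, Real.exp_sub, Real.exp_add, Real.exp_sum,
    Real.exp_log (by positivity), norm_natCast_cpow_of_pos (by omega), mul_comm s.re, Real.exp_mul,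
    Real.exp_log hn0, norm_natCast]
  gcongr with i hi
  rw [Real.exp_log (by positivity)]
  have := Complex.re_le_norm (s + i)
  simpa using this

lemma gamma_norm_le {s : ℂ} (hs : 0 < s.re) : ‖Gamma s‖ ≤ Real.Gamma s.re := by
  refine le_of_tendsto (GammaSeq_tendsto_Gamma s).norm ?_
  filter_upwards [eventually_ne_atTop 0] with n hn using gammaSeq_norm_le hs hn

lemma gammaSeq_diff {s : ℂ} (hs : 0 < s.re) {n : ℕ} (hn : n ≠ 0) :
    DifferentiableAt ℂ (fun s => GammaSeq s n) s := by
  unfold GammaSeq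
  refine DifferentiableAt.div ?_ ?_ ?_
  · refine DifferentiableAt.mul_const ?_ _
    exact differentiableAt_id.const_cpow (Or.inl (by exact_mod_cast hn))
  · fun_prop
  · rw [Finset.prod_ne_zero_iff]
    intro i _ h
    have := congrArg Complex.re h
    simp at this
    linarith [Nat.cast_nonneg (α := ℝ) i]

lemma gammaSeq_logDeriv {s : ℂ} (hs : 0 < s.re) {n : ℕ} (hn : n ≠ 0) :
    logDeriv (fun s => GammaSeq s n) s
      = Complex.log n - ∑ k ∈ Finset.range (n + 1), 1 / (s + k) := by
  have hne : ∀ i ∈ Finset.range (n + 1), s + (i : ℂ) ≠ 0 := by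
    intro i _ h
    have := congrArg Complex.re h
    simp at this
    linarith [Nat.cast_nonneg (α := ℝ) i]
  have hn' : (n : ℂ) ≠ 0 := by exact_mod_cast hn
  have hd : DifferentiableAt ℂ (fun s : ℂ => (n : ℂ) ^ s) s :=
    differentiableAt_id.const_cpow (Or.inl hn')
  unfold GammaSeq
  rw [logDeriv_div (f := fun s : ℂ => (n : ℂ) ^ s * (n.factorial : ℂ))
    (g := fun s : ℂ => ∏ j ∈ Finset.range (n + 1), (s + (j : ℂ))) _ ?_
    (Finset.prod_ne_zero_iff.2 hne) (hd.mul_const _) (by fun_prop),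
    logDeriv_prod hne (fun i _ => by fun_prop)]
  · congr 1
    · rw [logDeriv_mul_const _ _ _, logDeriv_apply]
      · have : HasDerivAt (fun s : ℂ => (n : ℂ) ^ s) ((n : ℂ) ^ s * Complex.log n * 1) s :=
          (hasDerivAt_id s).const_cpow (Or.inl hn')
        rw [this.deriv]
        have : (n : ℂ) ^ s ≠ 0 := by rw [cpow_ne_zero_iff]; left; exact hn'
        field_simp
      · exact_mod_cast n.factorial_ne_zero
    · apply Finset.sum_congr rfl
      intro i _
      rw [logDeriv_apply]
      simp
  · refine mul_ne_zero ?_ (by exact_mod_cast n.factorial_ne_zero)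
    rw [cpow_ne_zero_iff]; left; exact hn'

lemma gammaSeq_deriv_tendsto {s : ℂ} (hs : 0 < s.re) :
    Tendsto (fun n : ℕ => deriv (fun s => GammaSeq s n) s) atTop (𝓝 (deriv Gamma s)) := by
  have hU : IsOpen {s : ℂ | 0 < s.re} := isOpen_lt continuous_const continuous_re
  set R := s.re / 2 with hR
  have hR0 : 0 < R := by positivity
  have hsub : Metric.closedBall s R ⊆ {s : ℂ | 0 < s.re} := by
    intro z hz
    rw [Metric.mem_closedBall, dist_eq_norm] at hz
    have := Complex.abs_re_le_norm (z - s)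
    simp only [sub_re] at this
    have h2 := (abs_le.1 (this.trans hz)).1
    simp only [Set.mem_setOf_eq]; linarith
  have e : ∀ f : ℂ → ℂ, DifferentiableOn ℂ f {s : ℂ | 0 < s.re} →
      deriv f s = (2 * π * I)⁻¹ • ∮ z in C(s, R), ((z - s) ^ 2)⁻¹ • f z := fun f hf =>
    (Complex.two_pi_I_inv_smul_circleIntegral_sub_sq_inv_smul_of_differentiable hU hsub hf
      (Metric.mem_ball_self hR0)).symm
  rw [e Gamma (fun z hz => (differentiableAt_Gamma z (fun m h => by
    rw [h] at hz; simp at hz; linarith [Nat.cast_nonneg (α := ℝ) m])).differentiableWithinAt)]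
  have e2 : ∀ᶠ n : ℕ in atTop, (2 * π * I)⁻¹ • (∮ z in C(s, R), ((z - s) ^ 2)⁻¹ • GammaSeq z n)
      = deriv (fun s => GammaSeq s n) s := by
    filter_upwards [eventually_ne_atTop 0] with n hn
    rw [e _ (fun z hz => (gammaSeq_diff hz hn).differentiableWithinAt)]
  refine Tendsto.congr' e2 (Tendsto.const_smul ?_ _)
  have hcirc : ∀ θ : ℝ, 0 < (circleMap s R θ).re := fun θ =>
    hsub (Metric.sphere_subset_closedBall (circleMap_mem_sphere s hR0.le θ))
  have hcne : ∀ θ : ℝ, (circleMap s R θ - s) ^ 2 ≠ 0 := by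
    intro θ
    apply pow_ne_zero
    simp [circleMap, hR0.ne']
  unfold circleIntegral
  apply intervalIntegral.tendsto_integral_filter_of_dominated_convergence
    (fun θ => ‖deriv (circleMap s R) θ‖ * (‖((circleMap s R θ - s) ^ 2)⁻¹‖ * Real.Gamma (circleMap s R θ).re))
  · filter_upwards [eventually_ne_atTop 0] with n hn
    apply Continuous.aestronglyMeasurable
    simp only [smul_eq_mul]
    refine Continuous.mul ?_ (Continuous.mul ?_ ?_)
    · rw [show deriv (circleMap s R) = fun θ => circleMap 0 R θ * I from funext (deriv_circleMap s R)]; fun_prop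
    · exact Continuous.inv₀ (by fun_prop) hcne
    · rw [continuous_iff_continuousAt]
      intro θ
      exact ContinuousAt.comp (f := circleMap s R) (g := fun z => GammaSeq z n)
        (gammaSeq_diff (hcirc θ) hn).continuousAt (continuous_circleMap s R).continuousAt
  · filter_upwards [eventually_ne_atTop 0] with n hn
    refine Filter.Eventually.of_forall fun θ _ => ?_
    rw [norm_smul, norm_smul]
    gcongr
    exact gammaSeq_norm_le (hcirc θ) hn
  · apply Continuous.intervalIntegrable
    refine Continuous.mul ?_ (Continuous.mul ?_ ?_)
    · simp only [deriv_circleMap]; fun_prop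
    · exact (Continuous.inv₀ (by fun_prop) hcne).norm
    · rw [continuous_iff_continuousAt]
      intro θ
      exact ContinuousAt.comp (f := fun θ => (circleMap s R θ).re) (g := Real.Gamma)
        (Real.differentiableAt_Gamma (fun m h => by
          have := hcirc θ; rw [h] at this; linarith [Nat.cast_nonneg (α := ℝ) m])).continuousAt
        (by fun_prop)
  · refine Filter.Eventually.of_forall fun θ _ => ?_
    exact ((GammaSeq_tendsto_Gamma _).const_smul _).const_smul _

lemma digamma_tendsto {s : ℂ} (hs : 0 < s.re) :
    Tendsto (fun n : ℕ => Complex.log n - ∑ k ∈ Finset.range (n + 1), 1 / (s + k)) atTop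
      (𝓝 (digamma s)) := by
  have h := (gammaSeq_deriv_tendsto hs).div (GammaSeq_tendsto_Gamma s) (Gamma_ne_zero_of_re_pos hs)
  rw [digamma_def, logDeriv_apply]
  refine h.congr' ?_
  filter_upwards [eventually_ne_atTop 0] with n hn
  rw [← gammaSeq_logDeriv hs hn, logDeriv_apply]; rfl

lemma log_sub_le {S : Set ℂ} (hS : Convex ℝ S) {m : ℝ} (hm : 0 < m)
    (hslit : ∀ z ∈ S, z ∈ slitPlane) (hnorm : ∀ z ∈ S, m ≤ ‖z‖) {z w : ℂ} (hz : z ∈ S)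
    (hw : w ∈ S) : ‖Complex.log z - Complex.log w‖ ≤ ‖z - w‖ / m := by
  have := hS.norm_image_sub_le_of_norm_hasDerivWithin_le (f := Complex.log) (f' := fun z => z⁻¹)
    (C := 1 / m) (fun x hx => (hasDerivAt_log (hslit x hx)).hasDerivWithinAt) (fun x hx => by
      rw [norm_inv, one_div]
      exact inv_anti₀ hm (hnorm x hx)) hw hz
  rw [div_eq_mul_one_div, mul_comm]; exact this

lemma sum_inv_sq_le {t : ℝ} (ht : 1 ≤ t) (n : ℕ) :
    ∑ k ∈ Finset.range n, 1 / (t ^ 2 + (k : ℝ) ^ 2) ≤ 4 / t - 2 / (t + n - 1 / 2) := by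
  induction n with
  | zero =>
    simp only [Finset.range_zero, Finset.sum_empty, Nat.cast_zero, add_zero]
    rw [sub_nonneg, div_le_div_iff₀ (by linarith) (by linarith)]
    linarith
  | succ n ih =>
    rw [Finset.sum_range_succ]
    have hn : (0:ℝ) ≤ n := Nat.cast_nonneg n
    have h1 : 1 / (t ^ 2 + (n : ℝ) ^ 2) ≤ 2 / (t + n - 1 / 2) - 2 / (t + (n + 1 : ℕ) - 1 / 2) := by
      push_cast
      rw [div_sub_div _ _ (by linarith) (by linarith), div_le_div_iff₀ (by positivity)
        (mul_pos (by linarith) (by linarith))]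
      nlinarith [sq_nonneg (t - n)]
    linarith

lemma log_step {w : ℂ} (hw : 0 < w.re) :
    ‖Complex.log (w + 1) - Complex.log w - 1 / w‖ ≤ 1 / ‖w‖ ^ 2 := by
  have hw0 : w ≠ 0 := fun h => by simp [h] at hw
  have hre : ∀ u ∈ Set.Icc (0:ℝ) 1, 0 < (w + u).re := by
    intro u hu; simp; linarith [hu.1]
  have hder : ∀ u ∈ Set.Icc (0:ℝ) 1, HasDerivWithinAt
      (fun u : ℝ => Complex.log (w + u) - u / w) ((w + u)⁻¹ - 1 / w) (Set.Icc 0 1) u := by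
    intro u hu
    have h1 : HasDerivAt (fun u : ℝ => w + (u:ℂ)) 1 u := (ofRealCLM.hasDerivAt).const_add w
    have h2 := (hasDerivAt_log (Or.inl (hre u hu) : w + (u:ℂ) ∈ slitPlane)).comp (𝕜 := ℝ) u h1
    rw [mul_one] at h2
    have h3 : HasDerivAt (fun u : ℝ => (u:ℂ) / w) (1 / w) u := (ofRealCLM.hasDerivAt).div_const w
    exact (h2.sub h3).hasDerivWithinAt
  have hb : ∀ u ∈ Set.Ico (0:ℝ) 1, ‖(w + (u:ℂ))⁻¹ - 1 / w‖ ≤ 1 / ‖w‖ ^ 2 := by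
    intro u hu
    have hr := hre u ⟨hu.1, hu.2.le⟩
    have hne : w + (u:ℂ) ≠ 0 := fun h => by rw [h] at hr; simp at hr
    have e : (w + (u:ℂ))⁻¹ - 1 / w = -u / ((w + u) * w) := by field_simp; ring
    have hle : ‖w‖ ≤ ‖w + u‖ := by
      rw [Complex.norm_def, Complex.norm_def]
      apply Real.sqrt_le_sqrt
      simp only [normSq_apply, add_re, ofReal_re, add_im, ofReal_im, add_zero]
      nlinarith [hu.1]
    have hw1 : 0 < ‖w‖ := norm_pos_iff.2 hw0
    rw [e, norm_div, norm_mul, norm_neg, norm_real, Real.norm_of_nonneg hu.1, sq]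
    gcongr
    exact hu.2.le
  have := norm_image_sub_le_of_norm_deriv_le_segment_01' hder hb
  simpa [sub_right_comm] using this

lemma digamma_log {s : ℂ} (hs : 0 < s.re) (ht : 1 ≤ |s.im|) :
    ‖digamma s - Complex.log s‖ ≤ 4 / |s.im| := by
  have hlim : Tendsto (fun n : ℕ => (Complex.log n - Complex.log (s + n + 1))
      + ∑ k ∈ Finset.range (n + 1), (Complex.log (s + k + 1) - Complex.log (s + k) - 1 / (s + k)))
      atTop (𝓝 (digamma s - Complex.log s)) := by
    refine ((digamma_tendsto hs).sub_const (Complex.log s)).congr fun n => ?_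
    have h2 : ∑ k ∈ Finset.range (n + 1), (Complex.log (s + k + 1) - Complex.log (s + k))
        = Complex.log (s + n + 1) - Complex.log s := by
      have := Finset.sum_range_sub (fun k : ℕ => Complex.log (s + k)) (n + 1)
      simp only [Nat.cast_add, Nat.cast_one, ← add_assoc, Nat.cast_zero, add_zero] at this
      exact this
    rw [Finset.sum_sub_distrib, h2]; ring
  have h0 : Tendsto (fun n : ℕ => Complex.log n - Complex.log (s + n + 1)) atTop (𝓝 0) := by
    have h1 : Tendsto (fun n : ℕ => ‖s + 1‖ / (n:ℝ)) atTop (𝓝 0) :=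
      tendsto_const_div_atTop_nhds_zero_nat _
    refine squeeze_zero_norm' ?_ h1
    filter_upwards [eventually_gt_atTop 0] with n hn
    have hn' : (0:ℝ) < n := by exact_mod_cast hn
    have := log_sub_le (S := {z : ℂ | (n:ℝ) ≤ z.re}) (convex_halfSpace_re_ge _) hn'
      (fun z hz => Or.inl (lt_of_lt_of_le hn' hz)) (fun z hz => le_trans hz (re_le_norm z))
      (z := n) (w := s + n + 1) (by simp) (by simp; linarith)
    refine this.trans (le_of_eq ?_)
    rw [norm_sub_rev]; congr 2; ring
  have hlim2 := hlim.sub h0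
  simp only [add_sub_cancel_left, sub_zero] at hlim2
  refine le_of_tendsto hlim2.norm (Filter.Eventually.of_forall fun n => ?_)
  refine (norm_sum_le _ _).trans ?_
  have h3 := sum_inv_sq_le ht (n + 1)
  have h4 : 0 ≤ 2 / (|s.im| + ((n+1 : ℕ):ℝ) - 1 / 2) := by
    have : (0:ℝ) ≤ ((n+1:ℕ):ℝ) := Nat.cast_nonneg _
    apply div_nonneg (by norm_num); linarith
  refine le_trans (Finset.sum_le_sum fun k _ => ?_) (h3.trans (by linarith))
  have hk : (0:ℝ) ≤ k := Nat.cast_nonneg _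
  refine (log_step (by simp; linarith)).trans ?_
  rw [Complex.sq_norm, normSq_apply]
  simp only [add_re, natCast_re, add_im, natCast_im, add_zero, sq_abs]
  apply one_div_le_one_div_of_le
  · have : 0 < |s.im| ^ 2 := by positivity
    rw [sq_abs] at this; positivity
  · nlinarith

lemma digamma_im {s : ℂ} (hs : 0 < s.re) (ht : 1 ≤ s.im) :
    ‖digamma s - Real.log s.im - I * (π / 2)‖ ≤ (4 + s.re) / s.im := by
  have ht0 : 0 < s.im := by linarith
  have h1 := digamma_log hs (by rwa [abs_of_pos ht0])
  rw [abs_of_pos ht0] at h1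
  have h2 := log_sub_le (S := {z : ℂ | s.im ≤ z.im}) (convex_halfSpace_im_ge _) ht0
      (fun z hz => Or.inr (ne_of_gt (lt_of_lt_of_le ht0 hz)))
      (fun z hz => le_trans hz (im_le_norm z))
      (z := s) (w := s.im * I) (by simp) (by simp)
  have e : Complex.log (s.im * I) = Real.log s.im + I * (π / 2) := by
    rw [log_ofReal_mul ht0 I_ne_zero, log_I]; ring
  have e2 : s - s.im * I = s.re := by
    apply Complex.ext <;> simp
  rw [e, e2, norm_real, Real.norm_of_nonneg hs.le] at h2
  calc _ = ‖(digamma s - Complex.log s) + (Complex.log s - (Real.log s.im + I * (π / 2)))‖ := by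
        congr 1; ring
    _ ≤ _ := (norm_add_le _ _).trans (by rw [add_div]; exact add_le_add h1 h2)

lemma gamma_analyticAt {s : ℂ} (hs : 0 < s.re) : AnalyticAt ℂ Gamma s := by
  rw [Complex.analyticAt_iff_eventually_differentiableAt]
  filter_upwards [(isOpen_lt continuous_const continuous_re).mem_nhds hs] with z hz
  exact differentiableAt_Gamma z (fun m h => by
    rw [h] at hz; simp at hz; linarith [Nat.cast_nonneg (α := ℝ) m])

lemma digamma_analyticAt {s : ℂ} (hs : 0 < s.re) : AnalyticAt ℂ digamma s := by
  have h := (gamma_analyticAt hs).deriv.div (gamma_analyticAt hs) (Gamma_ne_zero_of_re_pos hs)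
  exact h

lemma digamma_deriv_le {s : ℂ} (hs : 1 / 8 ≤ s.re) (ht : 2 ≤ |s.im|) :
    ‖deriv digamma s‖ ≤ 100 / |s.im| := by
  have h0 : 0 < s.re := by linarith
  have hsl : ∀ z : ℂ, 0 < z.re → z ∈ slitPlane := fun z hz => Or.inl hz
  have hd : ∀ z : ℂ, 0 < z.re → DifferentiableAt ℂ (fun z => digamma z - Complex.log z) z :=
    fun z hz => (digamma_analyticAt hz).differentiableAt.sub (differentiableAt_id.clog (hsl z hz))
  have hball : ∀ z ∈ Metric.closedBall s (1/16), 0 < z.re ∧ |s.im| - 1/16 ≤ |z.im| := by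
    intro z hz
    rw [Metric.mem_closedBall, dist_eq_norm] at hz
    have h1 := (abs_re_le_norm (z - s)).trans hz
    have h2 := (abs_im_le_norm (z - s)).trans hz
    rw [sub_re, abs_le] at h1
    rw [sub_im] at h2
    have := abs_sub_abs_le_abs_sub s.im z.im
    rw [abs_sub_comm] at this
    exact ⟨by linarith [h1.1], by linarith⟩
  have key := Complex.norm_deriv_le_of_forall_mem_sphere_norm_le (c := s) (R := 1/16)
    (f := fun z => digamma z - Complex.log z) (C := 5 / |s.im|) (by norm_num)
    ⟨fun z hz => (hd z (hball z (Metric.ball_subset_closedBall hz)).1).differentiableWithinAt, by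
      rw [closure_ball _ (by norm_num)]
      exact fun z hz => (hd z (hball z hz).1).continuousAt.continuousWithinAt⟩ (fun z hz => by
      have hz := hball z (Metric.sphere_subset_closedBall hz)
      refine (digamma_log hz.1 (by linarith)).trans ?_
      rw [div_le_div_iff₀ (by linarith) (by linarith)]
      linarith)
  have e : deriv digamma s = deriv (fun z => digamma z - Complex.log z) s + s⁻¹ := by
    have h := (digamma_analyticAt h0).differentiableAt.hasDerivAt.sub (hasDerivAt_log (hsl s h0))
    rw [show (fun z => digamma z - Complex.log z) = digamma - Complex.log from rfl, h.deriv]; ring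
  rw [e]
  refine (norm_add_le _ _).trans ?_
  have h5 : ‖s⁻¹‖ ≤ 1 / |s.im| := by
    rw [norm_inv, one_div]; exact inv_anti₀ (by linarith) (abs_im_le_norm s)
  calc _ ≤ 5 / |s.im| / (1/16) + 1 / |s.im| := add_le_add key h5
    _ ≤ _ := by
      rw [show 5 / |s.im| / (1/16) + 1 / |s.im| = 81 / |s.im| by ring]
      gcongr; norm_num

lemma gron {f f' : ℝ → ℂ} {K a b : ℝ} (hf : ∀ x ∈ Set.uIcc a b, HasDerivAt f (f' x) x)
    (hb : ∀ x ∈ Set.uIcc a b, ‖f' x‖ ≤ K * ‖f x‖) :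
    ‖f b‖ ≤ ‖f a‖ * Real.exp (K * |b - a|) := by
  have hmem : ∀ u ∈ Set.Icc (0:ℝ) 1, a + u * (b - a) ∈ Set.uIcc a b := by
    intro u hu
    rw [← segment_eq_uIcc, segment_eq_image']
    exact ⟨u, hu, by simp⟩
  have hd : ∀ u ∈ Set.Icc (0:ℝ) 1, HasDerivAt (fun u : ℝ => f (a + u * (b - a)))
      (((b - a : ℝ) : ℂ) * f' (a + u * (b - a))) u := by
    intro u hu
    have h1 : HasDerivAt (fun u : ℝ => a + u * (b - a)) (b - a) u := by
      simpa using ((hasDerivAt_id u).mul_const (b - a)).const_add a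
    have := (hf _ (hmem u hu)).scomp u h1
    simpa [Function.comp_def] using this
  have h := norm_le_gronwallBound_of_norm_deriv_right_le (f := fun u : ℝ => f (a + u * (b - a)))
    (f' := fun u => ((b - a : ℝ) : ℂ) * f' (a + u * (b - a))) (δ := ‖f a‖) (K := K * |b - a|)
    (ε := 0) (a := 0) (b := 1)
    (fun u hu => (hd u hu).continuousAt.continuousWithinAt)
    (fun u hu => (hd u ⟨hu.1, hu.2.le⟩).hasDerivWithinAt) (by simp) (fun u hu => by
      rw [norm_mul, norm_real, Real.norm_eq_abs, add_zero]
      calc _ ≤ |b - a| * (K * ‖f (a + u * (b - a))‖) := by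
            gcongr; exact hb _ (hmem u ⟨hu.1, hu.2.le⟩)
        _ = _ := by ring) 1 (by simp)
  simpa [gronwallBound_ε0] using h

/-- The gamma factor `(2 * π)^{-s} e^{-iπs/2} Γ(s)`. -/
noncomputable def XF (s : ℂ) : ℂ :=
  cexp (-(s * (Real.log (2 * π) + I * (π / 2)))) * Gamma s

/-- The full factor: `ζ(1-s) = YF(s) ζ(s)`. -/
noncomputable def YF (s : ℂ) : ℂ := XF s * (1 + cexp (I * π * s))

lemma YF_eq (s : ℂ) : YF s = 2 * (2 * π) ^ (-s) * Gamma s * cos (π * s / 2) := by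
  have h2 : (2 * (π:ℂ)) ≠ 0 := by simp [Real.pi_ne_zero]
  have h3 : Complex.log (2 * (π:ℂ)) = (Real.log (2 * π) : ℝ) := by
    rw [ofReal_log (by positivity)]; push_cast; rfl
  unfold YF XF
  rw [cpow_def_of_ne_zero h2, h3, Complex.cos,
    show -(s * (((Real.log (2 * π) : ℝ):ℂ) + I * (π / 2)))
      = ((Real.log (2 * π) : ℝ):ℂ) * -s + -(π * s / 2) * I by ring,
    exp_add, show I * π * s = (π * s / 2) * I + (π * s / 2) * I by ring, exp_add]
  have h4 : cexp (-(π * s / 2) * I) * cexp ((π * s / 2) * I) = 1 := by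
    rw [← exp_add]; simp
  linear_combination (cexp (((Real.log (2 * π) : ℝ):ℂ) * -s) * Gamma s
    * cexp ((π * s / 2) * I)) * h4

lemma zeta_fe {s : ℂ} (hs : 0 < s.re) (hs1 : s ≠ 1) :
    ζ (1 - s) = YF s * ζ s := by
  rw [YF_eq, riemannZeta_one_sub (fun m h => by
    rw [h] at hs; simp at hs; linarith [Nat.cast_nonneg (α := ℝ) m]) hs1]

lemma XF_hasDerivAt {s : ℂ} (hs : 0 < s.re) :
    HasDerivAt XF ((digamma s - (Real.log (2 * π) + I * (π / 2))) * XF s) s := by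
  have h1 : HasDerivAt (fun s : ℂ => -(s * (Real.log (2 * π) + I * (π / 2))))
      (-(1 * (Real.log (2 * π) + I * (π / 2)))) s :=
    ((hasDerivAt_id s).mul_const _).neg
  have h2 := h1.cexp.mul (gamma_analyticAt hs).differentiableAt.hasDerivAt
  refine h2.congr_deriv ?_
  have h3 : deriv Gamma s = digamma s * Gamma s := by
    rw [digamma_def, logDeriv_apply, div_mul_cancel₀ _ (Gamma_ne_zero_of_re_pos hs)]
  rw [h3]; unfold XF; ring

lemma XF_norm (s : ℂ) :
    ‖XF s‖ = (2 * π) ^ (-s.re) * Real.exp (π / 2 * s.im) * ‖Gamma s‖ := by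
  unfold XF
  rw [norm_mul, Complex.norm_exp, Real.rpow_def_of_pos (by positivity), ← Real.exp_add]
  congr 2
  simp
  ring

lemma XF_ne_zero {s : ℂ} (hs : 0 < s.re) : XF s ≠ 0 :=
  mul_ne_zero (exp_ne_zero _) (Gamma_ne_zero_of_re_pos hs)

lemma XF_analyticAt {s : ℂ} (hs : 0 < s.re) : AnalyticAt ℂ XF s := by
  rw [Complex.analyticAt_iff_eventually_differentiableAt]
  filter_upwards [(isOpen_lt continuous_const continuous_re).mem_nhds hs] with z hz
  exact (XF_hasDerivAt hz).differentiableAt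

lemma XF_half {t : ℝ} : ‖XF (1/2 + t * I)‖ ≤ 1 := by
  have h1 := Complex.Gamma_mul_Gamma_one_sub (1/2 + t * I)
  have e1 : (1:ℂ) - (1/2 + t * I) = (starRingEnd ℂ) (1/2 + t * I) := by
    apply Complex.ext <;> norm_num
  rw [e1, Complex.Gamma_conj, Complex.mul_conj, normSq_eq_norm_sq] at h1
  have e2 : Complex.sin (π * (1/2 + t * I)) = ((Real.cosh (π * t) : ℝ) : ℂ) := by
    rw [show (π : ℂ) * (1/2 + t * I) = π * t * I + π / 2 by ring,
      Complex.sin_add_pi_div_two, Complex.cos_mul_I]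
    push_cast; rfl
  rw [e2] at h1
  have h2 : ‖Gamma (1/2 + t * I)‖ ^ 2 = π / Real.cosh (π * t) := by exact_mod_cast h1
  have h3 : ‖XF (1/2 + t * I)‖ ^ 2 ≤ 1 := by
    rw [XF_norm, mul_pow, mul_pow, h2]
    have e3 : ((2 * π) ^ (-(1/2 + t * I : ℂ).re)) ^ 2 = (2 * π)⁻¹ := by
      rw [← Real.rpow_natCast, ← Real.rpow_mul (by positivity), ← Real.rpow_neg_one]
      congr 1; norm_num
    have e4 : (Real.exp (π / 2 * (1/2 + t * I : ℂ).im)) ^ 2 = Real.exp (π * t) := by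
      rw [← Real.exp_nat_mul]; congr 1; norm_num; ring
    rw [e3, e4, Real.cosh_eq]
    have hp := Real.exp_pos (π * t)
    have hp2 := Real.exp_pos (-(π * t))
    have : (2 * π)⁻¹ * Real.exp (π * t) * (π / ((Real.exp (π * t) + Real.exp (-(π * t))) / 2))
      = Real.exp (π * t) / (Real.exp (π * t) + Real.exp (-(π * t))) := by
      field_simp
    rw [this, div_le_one (by positivity)]; linarith
  have := norm_nonneg (XF (1/2 + t * I))
  nlinarith

lemma log_two_pi : 0 ≤ Real.log (2 * π) ∧ Real.log (2 * π) ≤ 2 := by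
  have h3 := Real.pi_gt_three
  constructor
  · apply Real.log_nonneg; linarith
  · rw [Real.log_le_iff_le_exp (by positivity)]
    have h1 := Real.exp_one_gt_d9
    have : Real.exp 2 = Real.exp 1 * Real.exp 1 := by rw [← Real.exp_add]; norm_num
    have h4 := Real.pi_lt_d2
    rw [this]; nlinarith

lemma XF_bound : ∃ C > (0:ℝ), ∀ s : ℂ, 1/8 ≤ s.re → s.re ≤ 8 → 1 ≤ s.im →
    ‖XF s‖ ≤ C * s.im ^ (s.re - 1/2) := by
  refine ⟨Real.exp (14 * 8), Real.exp_pos _, fun s h1 h2 ht => ?_⟩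
  obtain ⟨σ, t⟩ := s
  simp only at h1 h2 ht ⊢
  have ht0 : 0 < t := by linarith
  have hre : ∀ x ∈ Set.uIcc (1/2) σ, 1/8 ≤ x ∧ x ≤ 8 := by
    intro x hx
    rw [Set.mem_uIcc] at hx
    rcases hx with hx | hx <;> constructor <;> linarith [hx.1, hx.2]
  have key := gron (f := fun x : ℝ => cexp (-(x * Real.log t)) * XF (x + t * I))
    (f' := fun x : ℝ => (digamma (x + t * I) - (Real.log (2 * π) + I * (π / 2))
      - Real.log t) * (cexp (-(x * Real.log t)) * XF (x + t * I))) (K := 14) (a := 1/2) (b := σ)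
    (fun x hx => by
      have h5 : HasDerivAt (fun x : ℝ => (x:ℂ) + t * I) 1 x := (ofRealCLM.hasDerivAt).add_const _
      have h6 : HasDerivAt (fun x : ℝ => -((x:ℂ) * Real.log t)) (-(1 * Real.log t)) x :=
        ((ofRealCLM.hasDerivAt).mul_const _).neg
      have h7 := (XF_hasDerivAt (s := x + t * I) (by simp; linarith [(hre x hx).1])).comp (𝕜 := ℝ) x h5
      have h8 := h6.cexp.mul h7
      refine h8.congr_deriv ?_
      simp only [Function.comp]
      ring) (fun x hx => by
      rw [norm_mul]
      gcongr
      have h5 := digamma_im (s := x + t * I) (by simp; linarith [(hre x hx).1]) (by simpa using ht)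
      simp only [add_re, ofReal_re, mul_re, I_re, mul_zero, ofReal_im, I_im, mul_one, sub_self,
        add_zero, add_im, mul_im, zero_add, zero_mul] at h5
      have h6 : (4 + x) / t ≤ 12 := by
        rw [div_le_iff₀ ht0]; nlinarith [(hre x hx).2]
      calc _ = ‖(digamma (x + t * I) - Real.log t - I * (π / 2)) - (Real.log (2 * π) : ℝ)‖ := by
            congr 1; ring
        _ ≤ 12 + 2 := by
            refine (norm_sub_le _ _).trans (add_le_add (h5.trans h6) ?_)
            rw [norm_real, Real.norm_of_nonneg log_two_pi.1]; exact log_two_pi.2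
        _ = 14 := by norm_num)
  have e : ∀ x : ℝ, ‖cexp (-((x:ℂ) * Real.log t)) * XF (x + t * I)‖ = t ^ (-x) * ‖XF (x + t * I)‖ := by
    intro x
    rw [norm_mul, Complex.norm_exp, Real.rpow_def_of_pos ht0]
    congr 2; simp; ring
  rw [e, e] at key
  have hX := XF_half (t := t)
  rw [show (⟨σ, t⟩ : ℂ) = σ + t * I from Complex.mk_eq_add_mul_I σ t]
  have hσ : |σ - 1/2| ≤ 8 := by rw [abs_le]; constructor <;> linarith
  have hpos : 0 < t ^ (-σ) := Real.rpow_pos_of_pos ht0 _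
  have h9 : t ^ (-σ) * ‖XF (σ + t * I)‖ ≤ t ^ (-(1/2:ℝ)) * 1 * Real.exp (14 * 8) := by
    refine key.trans ?_
    gcongr
    push_cast; exact hX
  have h10 : ‖XF (σ + t * I)‖ = t ^ σ * (t ^ (-σ) * ‖XF (σ + t * I)‖) := by
    rw [← mul_assoc, ← Real.rpow_add ht0]; simp
  rw [h10]
  calc _ ≤ t ^ σ * (t ^ (-(1/2:ℝ)) * 1 * Real.exp (14 * 8)) := by gcongr
    _ = Real.exp (14*8) * (t ^ σ * t ^ (-(1/2:ℝ))) := by ring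
    _ = _ := by rw [← Real.rpow_add ht0]; rfl

lemma YF_conj (s : ℂ) : YF (starRingEnd ℂ s) = starRingEnd ℂ (YF s) := by
  have h : (2 * (π:ℂ)) ^ (-(starRingEnd ℂ) s) = (starRingEnd ℂ) ((2 * (π:ℂ)) ^ (-s)) := by
    have e : (2 * (π:ℂ)) = ((2 * π : ℝ) : ℂ) := by push_cast; rfl
    rw [e, ← map_neg, cpow_conj _ _ (by
      rw [arg_ofReal_of_nonneg (by positivity)]; exact Real.pi_pos.ne), conj_ofReal]
  have h2 : cos (π * (starRingEnd ℂ) s / 2) = starRingEnd ℂ (cos (π * s / 2)) := by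
    rw [← Complex.cos_conj]; congr 1
    simp only [map_mul, map_div₀, conj_ofReal, map_ofNat]
  rw [YF_eq, YF_eq, h, h2, Complex.Gamma_conj]
  simp only [map_mul, map_ofNat]

lemma exp_pi_le {s : ℂ} (ht : 1 ≤ s.im) : ‖cexp (I * π * s)‖ ≤ 1/2 := by
  rw [Complex.norm_exp]
  have : (I * π * s).re = -(π * s.im) := by simp
  rw [this, Real.exp_neg]
  have h1 := Real.add_one_le_exp (π * s.im)
  have h3 := Real.pi_gt_three
  rw [one_div]
  apply inv_anti₀ (by norm_num)
  nlinarith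

lemma YF_bound : ∃ C > (0:ℝ), ∀ s : ℂ, 1/8 ≤ s.re → s.re ≤ 8 → 1 ≤ |s.im| →
    ‖YF s‖ ≤ C * |s.im| ^ (s.re - 1/2) := by
  obtain ⟨C, hC, h⟩ := XF_bound
  have hp : ∀ s : ℂ, 1/8 ≤ s.re → s.re ≤ 8 → 1 ≤ s.im → ‖YF s‖ ≤ (2 * C) * |s.im| ^ (s.re - 1/2) := by
    intro s h1 h2 h3
    have h4 : ‖1 + cexp (I * π * s)‖ ≤ 2 := by
      refine (norm_add_le _ _).trans ?_
      have := exp_pi_le h3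
      rw [norm_one]; linarith
    unfold YF
    rw [norm_mul, abs_of_pos (by linarith)]
    calc _ ≤ (C * s.im ^ (s.re - 1/2)) * 2 := by
          gcongr; exact h s h1 h2 h3
      _ = _ := by ring
  refine ⟨2 * C, by positivity, fun s h1 h2 h3 => ?_⟩
  rcases le_abs.1 h3 with h4 | h4
  · exact hp s h1 h2 h4
  · have := hp (starRingEnd ℂ s) (by simpa using h1) (by simpa using h2) (by simpa using h4)
    rw [YF_conj] at this
    simpa using this

lemma ne_one_of_im {s : ℂ} (h : 0 < |s.im|) : s ≠ 1 := by
  rintro rfl; simp at h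

lemma zeta_bound2 : ∃ C > (0:ℝ), ∀ s : ℂ, -7 ≤ s.re → 2 ≤ |s.im| →
    ‖ζ s‖ ≤ C * |s.im| ^ (1/2 + max (-s.re) 0) * Real.log |s.im| := by
  obtain ⟨K, hK, h1⟩ := zeta_bound
  obtain ⟨C, hC, h2⟩ := YF_bound
  refine ⟨K + C * K, by positivity, fun s hs ht => ?_⟩
  have hlog : 0 ≤ Real.log |s.im| := Real.log_nonneg (by linarith)
  have ht1 : 1 ≤ |s.im| := by linarith
  have ht0 : 0 < |s.im| := by linarith
  rcases le_total (1/2) s.re with h | h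
  · refine (h1 s h ht).trans ?_
    gcongr
    · nlinarith
    · apply max_le <;> linarith [le_max_right (-s.re) 0]
  · have e : ζ s = YF (1 - s) * ζ (1 - s) := by
      rw [← zeta_fe (by simp; linarith) (ne_one_of_im (by simpa using ht0)), sub_sub_cancel]
    have h3 := h2 (1 - s) (by simp; linarith) (by simp; linarith) (by simpa using ht1)
    have h4 := h1 (1 - s) (by simp; linarith) (by simpa using ht)
    simp only [sub_re, one_re, sub_im, one_im, zero_sub, abs_neg, sub_sub_cancel] at h3 h4
    rw [e, norm_mul]
    calc _ ≤ (C * |s.im| ^ (1 - s.re - 1/2)) * (K * |s.im| ^ (max s.re 0) * Real.log |s.im|) := by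
          gcongr
      _ = C * K * (|s.im| ^ (1 - s.re - 1/2) * |s.im| ^ (max s.re 0)) * Real.log |s.im| := by ring
      _ = C * K * |s.im| ^ (1/2 + max (-s.re) 0) * Real.log |s.im| := by
          rw [← Real.rpow_add ht0]
          congr 3
          rcases le_total s.re 0 with h5 | h5
          · rw [max_eq_right h5, max_eq_left (by linarith)]; ring
          · rw [max_eq_left h5, max_eq_right (by linarith)]; ring
      _ ≤ _ := by gcongr; linarith

lemma cauchy_deriv {f : ℂ → ℂ} {s : ℂ} {r M : ℝ} (hr : 0 < r)
    (hf : ∀ z, ‖z - s‖ ≤ r → AnalyticAt ℂ f z) (hM : ∀ z, ‖z - s‖ ≤ r → ‖f z‖ ≤ M) :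
    ‖deriv f s‖ ≤ M / r := by
  refine Complex.norm_deriv_le_of_forall_mem_sphere_norm_le hr ⟨fun z hz => ?_, ?_⟩ (fun z hz => ?_)
  · exact (hf z (by rw [← dist_eq_norm]; exact (Metric.mem_ball.1 hz).le)).differentiableAt.differentiableWithinAt
  · rw [closure_ball _ hr.ne']
    exact fun z hz => (hf z (by rw [← dist_eq_norm]; exact hz)).continuousAt.continuousWithinAt
  · exact hM z (by rw [← dist_eq_norm]; exact (Metric.mem_sphere.1 hz).le)

lemma near_im {z s : ℂ} {r : ℝ} (h : ‖z - s‖ ≤ r) :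
    |s.im| - r ≤ |z.im| ∧ |z.im| ≤ |s.im| + r ∧ s.re - r ≤ z.re ∧ z.re ≤ s.re + r := by
  have h1 := (abs_re_le_norm (z - s)).trans h
  have h2 := (abs_im_le_norm (z - s)).trans h
  rw [sub_re, abs_le] at h1
  rw [sub_im] at h2
  have h3 := abs_sub_abs_le_abs_sub s.im z.im
  have h4 := abs_sub_abs_le_abs_sub z.im s.im
  rw [abs_sub_comm] at h3
  exact ⟨by linarith, by linarith, by linarith [h1.1], by linarith [h1.2]⟩

lemma log_le_two {t u : ℝ} (ht : 2 ≤ t) (hu0 : 0 < u) (hu : u ≤ 2 * t) : Real.log u ≤ 2 * Real.log t := by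
  calc Real.log u ≤ Real.log (t * t) := Real.log_le_log hu0 (by nlinarith)
    _ = _ := by rw [Real.log_mul (by linarith) (by linarith)]; ring

lemma log_ge_one {t : ℝ} (ht : 3 ≤ t) : 1 ≤ Real.log t := by
  rw [Real.le_log_iff_exp_le (by linarith)]
  linarith [Real.exp_one_lt_d9]

/-- `ζ'` just left of the critical strip. -/
lemma zeta_deriv_strip : ∃ C > (0:ℝ), ∀ s : ℂ, 3 ≤ |s.im| → -(1 / Real.log |s.im|) ≤ s.re →
    ‖deriv ζ s‖ ≤ C * |s.im| ^ (1/2:ℝ) * Real.log |s.im| ^ 2 := by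
  obtain ⟨C, hC, h⟩ := zeta_bound2
  refine ⟨C * (2 * Real.exp 4) * 2, by positivity, fun s ht hs => ?_⟩
  set t := |s.im| with htd
  have hl := log_ge_one ht
  have hl0 : 0 < Real.log t := by linarith
  have hr1 : 1 / Real.log t ≤ 1 := by rw [div_le_one hl0]; exact hl
  have key := cauchy_deriv (f := ζ) (s := s) (r := 1 / Real.log t)
    (M := C * ((2 * Real.exp 4) * t ^ (1/2:ℝ)) * (2 * Real.log t)) (by positivity)
    (fun z hz => zeta_analyticAt (ne_one_of_im (by linarith [(near_im hz).1])))
    (fun z hz => by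
      obtain ⟨h1, h2, h3, h4⟩ := near_im hz
      rw [← htd] at h1 h2
      have hz0 : 0 < |z.im| := by linarith
      have hz1 : 1 ≤ |z.im| := by linarith
      have hlog2 : Real.log |z.im| ≤ 2 * Real.log t := log_le_two (by linarith) hz0 (by linarith)
      refine (h z (by linarith) (by linarith)).trans ?_
      have hlz : 0 ≤ Real.log |z.im| := Real.log_nonneg hz1
      gcongr
      calc |z.im| ^ (1/2 + max (-z.re) 0) ≤ |z.im| ^ (1/2 + 2 / Real.log t) := by
            apply Real.rpow_le_rpow_of_exponent_le hz1
            have : max (-z.re) 0 ≤ 2 / Real.log t := by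
              apply max_le
              · have : 2 / Real.log t = 1 / Real.log t + 1 / Real.log t := by ring
                linarith
              · positivity
            linarith
        _ = |z.im| ^ (2 / Real.log t) * |z.im| ^ (1/2:ℝ) := by
            rw [Real.rpow_add hz0]; ring
        _ ≤ Real.exp 4 * (2 * t ^ (1/2:ℝ)) := by
            gcongr
            · rw [Real.rpow_def_of_pos hz0]
              apply Real.exp_le_exp.2
              rw [mul_div_assoc', div_le_iff₀ hl0]; linarith
            · calc |z.im| ^ (1/2:ℝ) ≤ (4 * t) ^ (1/2:ℝ) := by
                    apply Real.rpow_le_rpow hz0.le (by linarith) (by norm_num)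
                _ = 2 * t ^ (1/2:ℝ) := by
                    rw [Real.mul_rpow (by norm_num) (by linarith)]
                    congr 1
                    rw [← Real.sqrt_eq_rpow, show (4:ℝ) = 2 ^ 2 by norm_num]
                    exact Real.sqrt_sq (by norm_num)
        _ = _ := by ring)
  refine key.trans (le_of_eq ?_)
  field_simp

/-- Crude polynomial bound for `ζ'` with `Re s ≥ -3/4`. -/
lemma zeta_d1 : ∃ C > (0:ℝ), ∀ s : ℂ, -(3/4) ≤ s.re → 3 ≤ |s.im| →
    ‖deriv ζ s‖ ≤ C * |s.im| ^ (3/2:ℝ) := by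
  obtain ⟨C, hC, h⟩ := zeta_bound2
  refine ⟨C * (8 * 8) * 8 * 2 ^ (3/2 : ℝ), by positivity, fun s hs ht => ?_⟩
  set t := |s.im| with htd
  have key := cauchy_deriv (f := ζ) (s := s) (r := 1 / 8)
    (M := C * (8 * 8) * (2 * t) ^ (3/2:ℝ)) (by positivity)
    (fun z hz => zeta_analyticAt (ne_one_of_im (by linarith [(near_im hz).1])))
    (fun z hz => by
      obtain ⟨h1, h2, h3, h4⟩ := near_im hz
      rw [← htd] at h1 h2
      have hz0 : 0 < |z.im| := by linarith
      have hz1 : 1 ≤ |z.im| := by linarith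
      refine (h z (by linarith) (by linarith)).trans ?_
      have hlz : 0 ≤ Real.log |z.im| := Real.log_nonneg hz1
      have h5 : Real.log |z.im| ≤ 8 * 8 * |z.im| ^ (1/8:ℝ) := by
        have := Real.log_le_rpow_div hz0.le (show (0:ℝ) < 1/8 by norm_num)
        have h6 : 0 ≤ |z.im| ^ (1/8:ℝ) := by positivity
        linarith
      calc C * |z.im| ^ (1/2 + max (-z.re) 0) * Real.log |z.im|
          ≤ C * |z.im| ^ (1/2 + 7/8 : ℝ) * (8 * 8 * |z.im| ^ (1/8:ℝ)) := by
            gcongr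
            · apply max_le <;> linarith
        _ = C * (8 * 8) * (|z.im| ^ (1/2 + 7/8 : ℝ) * |z.im| ^ (1/8:ℝ)) := by ring
        _ = C * (8 * 8) * |z.im| ^ (3/2:ℝ) := by rw [← Real.rpow_add hz0]; norm_num
        _ ≤ _ := by gcongr; linarith)
  refine key.trans (le_of_eq ?_)
  rw [Real.mul_rpow (by norm_num) (by linarith)]; ring

lemma zeta_d2 : ∃ C > (0:ℝ), ∀ s : ℂ, -(1/2) ≤ s.re → 4 ≤ |s.im| →
    ‖deriv (deriv ζ) s‖ ≤ C * |s.im| ^ (3/2:ℝ) := by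
  obtain ⟨C, hC, h⟩ := zeta_d1
  refine ⟨C * 4 * 2 ^ (3/2 : ℝ), by positivity, fun s hs ht => ?_⟩
  set t := |s.im| with htd
  have key := cauchy_deriv (f := deriv ζ) (s := s) (r := 1 / 4)
    (M := C * (2 * t) ^ (3/2:ℝ)) (by positivity)
    (fun z hz => (zeta_analyticAt (ne_one_of_im (by linarith [(near_im hz).1]))).deriv)
    (fun z hz => by
      obtain ⟨h1, h2, h3, h4⟩ := near_im hz
      rw [← htd] at h1 h2
      refine (h z (by linarith) (by linarith)).trans ?_
      gcongr; linarith)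
  refine key.trans (le_of_eq ?_)
  rw [Real.mul_rpow (by norm_num) (by linarith)]; ring

lemma deriv_zeta_conj (s : ℂ) :
    deriv ζ (starRingEnd ℂ s) = starRingEnd ℂ (deriv ζ s) := by
  have e : (starRingEnd ℂ) ∘ ζ ∘ (starRingEnd ℂ) = ζ := by
    funext z; simp [riemannZeta_conj]
  have := congrFun (deriv_conj_conj (f := ζ)) (starRingEnd ℂ s)
  rw [e] at this
  simpa using this

lemma deriv2_zeta_conj (s : ℂ) :
    deriv (deriv ζ) (starRingEnd ℂ s) = starRingEnd ℂ (deriv (deriv ζ) s) := by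
  have e : (starRingEnd ℂ) ∘ (deriv ζ) ∘ (starRingEnd ℂ) = deriv ζ := by
    funext z; simp [deriv_zeta_conj]
  have := congrFun (deriv_conj_conj (f := deriv ζ)) (starRingEnd ℂ s)
  rw [e] at this
  simpa using this

lemma Hf_conj (s : ℂ) : Hf (starRingEnd ℂ s) = starRingEnd ℂ (Hf s) := by
  unfold Hf
  rw [deriv2_zeta_conj, deriv_zeta_conj, riemannZeta_conj]
  simp

lemma one_add_exp_ne {s : ℂ} (hs : 0 < s.im) : 1 + cexp (I * π * s) ≠ 0 := by
  intro h
  have h1 : ‖cexp (I * π * s)‖ = 1 := by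
    rw [show cexp (I * π * s) = -1 by linear_combination h]; simp
  rw [Complex.norm_exp, Real.exp_eq_one_iff] at h1
  have h2 : (I * π * s).re = -(π * s.im) := by simp
  rw [h2] at h1
  have := mul_pos Real.pi_pos hs
  linarith

lemma YF_ne_zero {s : ℂ} (hs : 0 < s.re) (ht : s.im ≠ 0) : YF s ≠ 0 := by
  have hp : ∀ s : ℂ, 0 < s.re → 0 < s.im → YF s ≠ 0 := fun s h1 h2 =>
    mul_ne_zero (XF_ne_zero h1) (one_add_exp_ne h2)
  rcases lt_or_gt_of_ne ht with h | h
  · have := hp (starRingEnd ℂ s) (by simpa using hs) (by simpa using h)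
    rw [YF_conj] at this
    simpa using this
  · exact hp s hs h

lemma zero_in_strip {s : ℂ} (h : ζ s = 0) (ht : s.im ≠ 0) : 0 < s.re ∧ s.re < 1 := by
  constructor
  · by_contra hc
    push Not at hc
    have hs1 : 1 - s ≠ 1 := ne_one_of_im (by simpa using ht)
    have e : ζ s = YF (1 - s) * ζ (1 - s) := by
      rw [← zeta_fe (by simp; linarith) hs1, sub_sub_cancel]
    rw [h] at e
    exact mul_ne_zero (YF_ne_zero (by simp; linarith) (by simpa using ht))
      (riemannZeta_ne_zero_of_one_le_re (by simp; linarith)) e.symm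
  · by_contra hc
    push Not at hc
    exact riemannZeta_ne_zero_of_one_le_re hc h

/-- logarithmic derivative of `YF` -/
noncomputable def LY (s : ℂ) : ℂ :=
  digamma s - (Real.log (2 * π) + I * (π / 2))
    + I * π * (1 - 1 / (1 + cexp (I * π * s)))

lemma YF_hasDerivAt {s : ℂ} (hs : 0 < s.re) (ht : 0 < s.im) :
    HasDerivAt YF (LY s * YF s) s := by
  have h1 : HasDerivAt (fun s : ℂ => I * π * s) (I * π * 1) s :=
    (hasDerivAt_id s).const_mul _
  have h2 := (XF_hasDerivAt hs).mul (h1.cexp.const_add 1)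
  refine h2.congr_deriv ?_
  have := one_add_exp_ne ht
  unfold LY YF
  field_simp
  ring

lemma LY_hasDerivAt {s : ℂ} (hs : 0 < s.re) (ht : 0 < s.im) :
    HasDerivAt LY (deriv digamma s - π ^ 2 * cexp (I * π * s)
      / (1 + cexp (I * π * s)) ^ 2) s := by
  have h1 : HasDerivAt (fun s : ℂ => I * π * s) (I * π * 1) s :=
    (hasDerivAt_id s).const_mul _
  have hne := one_add_exp_ne ht
  have h2 := (((hasDerivAt_const s (1:ℂ)).div (h1.cexp.const_add 1) hne).const_sub 1).const_mul (I * π)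
  have h3 := ((digamma_analyticAt hs).differentiableAt.hasDerivAt.sub_const
    (Real.log (2 * π) + I * (π / 2))).add h2
  refine h3.congr_deriv ?_
  have hI : I ^ 2 = -1 := I_sq
  field_simp
  linear_combination (π ^ 2 * cexp (I * π * s)) * hI

lemma LY_deriv_le {s : ℂ} (hs : 1/8 ≤ s.re) (ht : 2 ≤ s.im) : ‖deriv LY s‖ ≤ 200 / s.im := by
  have h0 : 0 < s.im := by linarith
  rw [(LY_hasDerivAt (by linarith) h0).deriv]
  have h1 := digamma_deriv_le hs (by rwa [abs_of_pos h0])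
  rw [abs_of_pos h0] at h1
  have h2 : ‖cexp (I * π * s)‖ ≤ 1/2 := exp_pi_le (by linarith)
  have h3 : 1/2 ≤ ‖1 + cexp (I * π * s)‖ := by
    have := norm_sub_norm_le (1:ℂ) (-cexp (I * π * s))
    rw [norm_one, norm_neg, sub_neg_eq_add] at this
    linarith
  have h4 : ‖cexp (I * π * s)‖ ≤ 1 / s.im := by
    rw [Complex.norm_exp]
    have : (I * π * s).re = -(π * s.im) := by simp
    rw [this, Real.exp_neg, one_div]
    apply inv_anti₀ h0
    have h1 := Real.add_one_le_exp (π * s.im)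
    have h3 := Real.pi_gt_three
    nlinarith
  have h5 : ‖(π:ℂ) ^ 2 * cexp (I * π * s) / (1 + cexp (I * π * s)) ^ 2‖ ≤ 64 / s.im := by
    rw [norm_div, norm_mul, norm_pow, norm_pow, norm_real, Real.norm_of_nonneg Real.pi_pos.le]
    calc _ ≤ 4 ^ 2 * (1 / s.im) / (1/2) ^ 2 := by
          gcongr
          exact Real.pi_le_four
      _ = _ := by ring
  calc _ ≤ 100 / s.im + 64 / s.im := (norm_sub_le _ _).trans (add_le_add h1 h5)
    _ = 164 / s.im := by ring
    _ ≤ _ := by gcongr; norm_num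

lemma Hf_reflect {w : ℂ} (hw : 1 < w.re) (ht : 0 < w.im) :
    Hf (1 - w) = YF w * Hf w + YF w * ζ w * deriv LY w := by
  have hU : IsOpen {z : ℂ | 1 < z.re ∧ 0 < z.im} :=
    (isOpen_lt continuous_const continuous_re).inter (isOpen_lt continuous_const continuous_im)
  have hz : ∀ z : ℂ, 1 < z.re ∧ 0 < z.im → z ≠ 1 ∧ 1 - z ≠ 1 ∧ ζ z ≠ 0
      ∧ ζ (1 - z) ≠ 0 := by
    intro z hz
    have h1 : z ≠ 1 := by rintro rfl; simp at hz
    have h2 : ζ z ≠ 0 := riemannZeta_ne_zero_of_one_le_re hz.1.le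
    refine ⟨h1, fun h => ?_, h2, ?_⟩
    · have := congrArg Complex.im h; simp at this; linarith [hz.2]
    · rw [zeta_fe (by linarith [hz.1]) h1]
      exact mul_ne_zero (YF_ne_zero (by linarith [hz.1]) hz.2.ne') h2
  have hd : ∀ z : ℂ, z ≠ 1 → HasDerivAt ζ (deriv ζ z) z := fun z h =>
    (differentiableAt_riemannZeta h).hasDerivAt
  have hsub : ∀ z : ℂ, HasDerivAt (fun z : ℂ => 1 - z) (-1) z := fun z =>
    (hasDerivAt_id z).const_sub 1
  -- first log derivative
  have hL : ∀ z : ℂ, 1 < z.re ∧ 0 < z.im →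
      -(deriv ζ (1 - z) / ζ (1 - z)) = LY z + deriv ζ z / ζ z := by
    intro z hz'
    obtain ⟨h1, h2, h3, h4⟩ := hz z hz'
    have hA : HasDerivAt (fun z => ζ (1 - z)) (deriv ζ (1 - z) * -1) z :=
      (hd _ h2).comp z (hsub z)
    have hB := (YF_hasDerivAt (by linarith [hz'.1]) hz'.2).mul (hd z h1)
    have e : (fun z => ζ (1 - z)) =ᶠ[𝓝 z] (YF * ζ) := by
      filter_upwards [hU.mem_nhds hz'] with u hu
      exact zeta_fe (by linarith [hu.1]) (hz u hu).1
    have h5 := (hA.congr_of_eventuallyEq e.symm).unique hB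
    have hY := YF_ne_zero (s := z) (by linarith [hz'.1]) hz'.2.ne'
    rw [zeta_fe (by linarith [hz'.1]) h1]
    field_simp
    linear_combination h5
  have hw' : 1 < w.re ∧ 0 < w.im := ⟨hw, ht⟩
  obtain ⟨h1, h2, h3, h4⟩ := hz w hw'
  set ℓ := fun z => deriv ζ z / ζ z with hℓ
  have hdℓ : ∀ z : ℂ, z ≠ 1 → ζ z ≠ 0 → HasDerivAt ℓ (deriv ℓ z) z := fun z ha hb =>
    (((zeta_analyticAt ha).deriv.div (zeta_analyticAt ha) hb).differentiableAt).hasDerivAt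
  have hA : HasDerivAt (fun z => -ℓ (1 - z)) (-(deriv ℓ (1 - w) * -1)) w :=
    ((hdℓ _ h2 h4).comp w (hsub w)).neg
  have hB := (LY_hasDerivAt (s := w) (by linarith) ht).differentiableAt.hasDerivAt.add (hdℓ w h1 h3)
  have e : (fun z => -ℓ (1 - z)) =ᶠ[𝓝 w] (LY + ℓ) := by
    filter_upwards [hU.mem_nhds hw'] with u hu
    exact hL u hu
  have h5 := (hA.congr_of_eventuallyEq e.symm).unique hB
  rw [Hf_eq_mul h2 h4, Hf_eq_mul h1 h3, zeta_fe (by linarith) h1]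
  linear_combination (YF w * ζ w) * h5

lemma logDeriv_local {g : ℂ → ℂ} {z0 : ℂ} {A : ℝ} (hA : 0 < A)
    (hd : DifferentiableOn ℂ g (Metric.ball z0 3)) (hne : ∀ z ∈ Metric.ball z0 3, g z ≠ 0)
    (hb : ∀ z ∈ Metric.ball z0 3, ‖g z‖ ≤ Real.exp A * ‖g z0‖) {s : ℂ} (hs : ‖s - z0‖ ≤ 5/2) :
    ‖logDeriv g s‖ ≤ 100 * A := by
  have hz0 : z0 ∈ Metric.ball z0 3 := Metric.mem_ball_self (by norm_num)
  have hld : DifferentiableOn ℂ (logDeriv g) (Metric.ball z0 3) :=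
    (hd.deriv Metric.isOpen_ball).div hd hne
  obtain ⟨h, h0, hh⟩ := hld.isExactOn_ball.with_val_at z0 0
  have hda : ∀ z ∈ Metric.ball z0 3, HasDerivAt g (deriv g z) z := fun z hz =>
    (hd.differentiableAt (Metric.isOpen_ball.mem_nhds hz)).hasDerivAt
  have hexp : ∀ z ∈ Metric.ball z0 3, g z = g z0 * cexp (h z) := by
    have hc : ∀ z ∈ Metric.ball z0 3, HasDerivAt (fun z => g z * cexp (-(h z))) 0 z := by
      intro z hz
      have := (hda z hz).mul (hh z hz).neg.cexp
      refine this.congr_deriv ?_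
      rw [logDeriv_apply]
      have := hne z hz
      field_simp
      ring
    intro z hz
    have := (convex_ball z0 3).norm_image_sub_le_of_norm_hasDerivWithin_le (C := 0)
      (f := fun z => g z * cexp (-(h z))) (f' := fun _ => 0)
      (fun x hx => (hc x hx).hasDerivWithinAt) (by simp) hz0 hz
    rw [zero_mul, norm_le_zero_iff, sub_eq_zero] at this
    simp only [h0, neg_zero, Complex.exp_zero, mul_one] at this
    rw [← this, mul_assoc, ← Complex.exp_add]; simp
  have hre : ∀ z ∈ Metric.ball z0 3, (h z).re ≤ A := by
    intro z hz
    have h1 := hb z hz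
    rw [hexp z hz, norm_mul, Complex.norm_exp, mul_comm] at h1
    exact Real.exp_le_exp.1 (le_of_mul_le_mul_right h1 (norm_pos_iff.2 (hne z0 hz0)))
  have hsh : ∀ w ∈ Metric.ball (0:ℂ) 3, z0 + w ∈ Metric.ball z0 3 := by
    intro w hw; simpa using hw
  have hbc : ∀ z, ‖z - z0‖ ≤ 11/4 → ‖h z‖ ≤ 22 * A := by
    intro z hz
    have := Complex.borelCaratheodory_zero (f := fun w => h (z0 + w)) (M := A) (R := 3)
      (z := z - z0) hA (fun w hw => by
        have h1 : HasDerivAt (fun w => z0 + w) 1 w := (hasDerivAt_id w).const_add z0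
        exact ((hh _ (hsh w hw)).comp w h1).differentiableAt.differentiableWithinAt)
      (fun w hw => hre _ (hsh w hw)) (by norm_num)
      (by rw [mem_ball_zero_iff]; linarith) (by simpa using h0)
    simp only [add_sub_cancel] at this
    refine this.trans ?_
    rw [div_le_iff₀ (by linarith)]
    nlinarith [norm_nonneg (z - z0)]
  have hin : ∀ z, ‖z - s‖ ≤ 1/4 → ‖z - z0‖ ≤ 11/4 := by
    intro z hz
    have := norm_add_le (z - s) (s - z0)
    rw [sub_add_sub_cancel] at this
    linarith
  have hmem : ∀ z, ‖z - z0‖ ≤ 11/4 → z ∈ Metric.ball z0 3 := by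
    intro z hz; rw [mem_ball_iff_norm]; linarith
  have hfin := cauchy_deriv (f := h) (s := s) (r := 1/4) (M := 22 * A) (by norm_num)
    (fun z hz => by
      have hz' := hmem z (hin z hz)
      rw [Complex.analyticAt_iff_eventually_differentiableAt]
      filter_upwards [Metric.isOpen_ball.mem_nhds hz'] with w hw using (hh w hw).differentiableAt)
    (fun z hz => hbc z (hin z hz))
  rw [(hh s (hmem s (by linarith))).deriv] at hfin
  linarith

lemma landau_local {f : ℂ → ℂ} {z0 : ℂ} {A : ℝ} (hA : 0 < A)
    (hd : DifferentiableOn ℂ f (Metric.ball z0 9)) (h0 : f z0 ≠ 0)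
    (hb : ∀ z ∈ Metric.ball z0 9, ‖f z‖ ≤ Real.exp A * ‖f z0‖) :
    ∃ L : Multiset ℂ, (L.card : ℝ) ≤ 3 * A ∧ (∀ ρ ∈ L, ‖ρ - z0‖ ≤ 3 ∧ f ρ = 0) ∧
      (∀ ρ, ‖ρ - z0‖ ≤ 3 → f ρ = 0 → ρ ∈ L) ∧
      ∀ s, ‖s - z0‖ ≤ 5/2 → f s ≠ 0 →
        ‖logDeriv f s - (L.map (fun ρ => 1 / (s - ρ))).sum‖ ≤ 100 * A := by
  set P : ℕ → Prop := fun n => ∃ L : Multiset ℂ, ∃ g : ℂ → ℂ, L.card = n ∧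
    (∀ ρ ∈ L, ‖ρ - z0‖ ≤ 3 ∧ f ρ = 0) ∧ DifferentiableOn ℂ g (Metric.ball z0 9) ∧
    (∀ z ∈ Metric.ball z0 9, f z = (L.map (fun ρ => z - ρ)).prod * g z) ∧
    (∀ s ∈ Metric.ball z0 9, f s ≠ 0 →
      logDeriv f s = (L.map (fun ρ => 1 / (s - ρ))).sum + logDeriv g s) with hP
  have hz0 : z0 ∈ Metric.ball z0 9 := Metric.mem_ball_self (by norm_num)
  -- bounds for the cofactor
  have hcof : ∀ (L : Multiset ℂ) (g : ℂ → ℂ),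
    (∀ ρ ∈ L, ‖ρ - z0‖ ≤ 3 ∧ f ρ = 0) → DifferentiableOn ℂ g (Metric.ball z0 9) →
    (∀ z ∈ Metric.ball z0 9, f z = (L.map (fun ρ => z - ρ)).prod * g z) →
    ∀ z, ‖z - z0‖ ≤ 8 → ‖g z‖ ≤ Real.exp A * (3/5) ^ L.card * ‖g z0‖ := by
    intro L g hL hg hfg z hz
    have h1 : ‖f z0‖ ≤ 3 ^ L.card * ‖g z0‖ := by
      rw [hfg z0 hz0, norm_mul]
      gcongr
      have : ∀ L : Multiset ℂ, (∀ ρ ∈ L, ‖ρ - z0‖ ≤ 3) →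
          ‖(L.map (fun ρ => z0 - ρ)).prod‖ ≤ 3 ^ L.card := by
        intro L
        induction L using Multiset.induction_on with
        | empty => simp
        | cons a L ih =>
          intro h
          simp only [Multiset.map_cons, Multiset.prod_cons, Multiset.card_cons, norm_mul, pow_succ']
          gcongr
          · rw [norm_sub_rev]; exact h a (by simp)
          · exact ih (fun ρ hρ => h ρ (by simp [hρ]))
      exact this L (fun ρ hρ => (hL ρ hρ).1)
    have h2 : ∀ w, ‖w - z0‖ = 8 → ‖g w‖ ≤ Real.exp A * (3/5) ^ L.card * ‖g z0‖ := by
      intro w hw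
      have hwb : w ∈ Metric.ball z0 9 := by rw [mem_ball_iff_norm]; linarith
      have h3 : 5 ^ L.card ≤ ‖(L.map (fun ρ => w - ρ)).prod‖ := by
        have : ∀ L : Multiset ℂ, (∀ ρ ∈ L, ‖ρ - z0‖ ≤ 3) →
            5 ^ L.card ≤ ‖(L.map (fun ρ => w - ρ)).prod‖ := by
          intro L
          induction L using Multiset.induction_on with
          | empty => simp
          | cons a L ih =>
            intro h
            simp only [Multiset.map_cons, Multiset.prod_cons, Multiset.card_cons, norm_mul, pow_succ']
            gcongr
            · have h4 := h a (by simp)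
              have h5 := norm_sub_le_norm_sub_add_norm_sub w a z0
              linarith
            · exact ih (fun ρ hρ => h ρ (by simp [hρ]))
        exact this L (fun ρ hρ => (hL ρ hρ).1)
      have h4 := hb w hwb
      rw [hfg w hwb, norm_mul] at h4
      have h5 : 5 ^ L.card * ‖g w‖ ≤ Real.exp A * (3 ^ L.card * ‖g z0‖) :=
        (mul_le_mul_of_nonneg_right h3 (norm_nonneg _)).trans (h4.trans (by gcongr))
      rw [div_pow]
      have h6 : (0:ℝ) < 5 ^ L.card := by positivity
      rw [show Real.exp A * (3 ^ L.card / 5 ^ L.card) * ‖g z0‖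
        = (Real.exp A * (3 ^ L.card * ‖g z0‖)) / 5 ^ L.card by ring, le_div_iff₀ h6]
      linarith
    have hsub : Metric.closedBall z0 8 ⊆ Metric.ball z0 9 := Metric.closedBall_subset_ball (by norm_num)
    refine Complex.norm_le_of_forall_mem_frontier_norm_le (U := Metric.ball z0 8)
      Metric.isBounded_ball ⟨hg.mono (Metric.ball_subset_ball (by norm_num)), ?_⟩ ?_ ?_
    · rw [closure_ball _ (by norm_num)]
      exact hg.continuousOn.mono hsub
    · intro w hw
      rw [frontier_ball _ (by norm_num)] at hw
      exact h2 w (by simpa [dist_eq_norm] using hw)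
    · rw [closure_ball _ (by norm_num)]
      rw [Metric.mem_closedBall, dist_eq_norm]; exact hz
  have hgz0 : ∀ (L : Multiset ℂ) (g : ℂ → ℂ),
      (∀ z ∈ Metric.ball z0 9, f z = (L.map (fun ρ => z - ρ)).prod * g z) → g z0 ≠ 0 := by
    intro L g h hc
    have := h z0 hz0
    rw [hc, mul_zero] at this
    exact h0 this
  have hcard : ∀ n, P n → (n:ℝ) ≤ 3 * A := by
    rintro n ⟨L, g, hn, hL, hg, hfg, -⟩
    have h1 := hcof L g hL hg hfg z0 (by simp)
    rw [hn] at h1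
    have h2 := norm_pos_iff.2 (hgz0 L g hfg)
    have h3 : 1 ≤ Real.exp A * (3/5) ^ n := by
      by_contra hc
      push Not at hc
      nlinarith
    have h4 := Real.log_le_log (by norm_num) h3
    rw [Real.log_one, Real.log_mul (Real.exp_ne_zero _) (by positivity), Real.log_exp, Real.log_pow] at h4
    have h5 : Real.log (3/5) ≤ -(2/5) := by
      have := Real.log_le_sub_one_of_pos (show (0:ℝ) < 3/5 by norm_num)
      linarith
    have h6 : (n:ℝ) * Real.log (3/5) ≤ n * (-(2/5)) := by gcongr
    linarith
  have hP0 : P 0 := ⟨0, f, by simp, by simp, hd, by simp, by simp⟩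
  classical
  set N := Nat.findGreatest P ⌊3 * A⌋₊ with hN
  have hPN : P N := Nat.findGreatest_spec (P := P) (Nat.zero_le _) hP0
  have hmax : ¬ P (N + 1) := by
    intro h
    have h1 : N + 1 ≤ ⌊3 * A⌋₊ := Nat.le_floor (hcard _ h)
    have := Nat.le_findGreatest h1 h
    omega
  have hNc := hcard N hPN
  obtain ⟨L, g, hn, hL, hg, hfg, hlog⟩ := hPN
  have hgne : ∀ z, ‖z - z0‖ ≤ 3 → g z ≠ 0 := by
    intro ρ hρ hgρ
    apply hmax
    have hρb : ρ ∈ Metric.ball z0 9 := by rw [mem_ball_iff_norm]; linarith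
    have hnb : Metric.ball z0 9 ∈ 𝓝 ρ := Metric.isOpen_ball.mem_nhds hρb
    have hfρ : f ρ = 0 := by rw [hfg ρ hρb, hgρ, mul_zero]
    have hgd : DifferentiableOn ℂ (dslope g ρ) (Metric.ball z0 9) :=
      (differentiableOn_dslope hnb).2 hg
    have hgm : ∀ z, g z = (z - ρ) * dslope g ρ z := by
      intro z
      have := sub_smul_dslope g ρ z
      rw [hgρ, sub_zero, smul_eq_mul] at this
      exact this.symm
    refine ⟨ρ ::ₘ L, dslope g ρ, by simp [hn], ?_, hgd, ?_, ?_⟩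
    · intro τ hτ
      rw [Multiset.mem_cons] at hτ
      rcases hτ with rfl | hτ
      · exact ⟨hρ, hfρ⟩
      · exact hL τ hτ
    · intro z hz
      rw [hfg z hz, hgm z]
      simp only [Multiset.map_cons, Multiset.prod_cons]; ring
    · intro s hs hfs
      have hgs : g s ≠ 0 := by
        intro h; apply hfs; rw [hfg s hs, h, mul_zero]
      have hg1 : s - ρ ≠ 0 ∧ dslope g ρ s ≠ 0 := by
        rw [hgm s] at hgs; exact mul_ne_zero_iff.1 hgs
      rw [hlog s hs hfs]
      have e : logDeriv g s = 1 / (s - ρ) + logDeriv (dslope g ρ) s := by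
        have e1 : g = fun z => (z - ρ) * dslope g ρ z := funext hgm
        conv_lhs => rw [e1]
        rw [logDeriv_mul s hg1.1 hg1.2 (by fun_prop)
          (hgd.differentiableAt (Metric.isOpen_ball.mem_nhds hs))]
        congr 1
        rw [logDeriv_apply]; simp
      rw [e, Multiset.map_cons, Multiset.sum_cons]; ring
  refine ⟨L, by rw [hn]; exact hNc, hL, ?_, ?_⟩
  · intro ρ hρ hf
    have hρb : ρ ∈ Metric.ball z0 9 := by rw [mem_ball_iff_norm]; linarith
    rw [hfg ρ hρb] at hf
    have := (mul_eq_zero.1 hf).resolve_right (hgne ρ hρ)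
    rw [Multiset.prod_eq_zero_iff, Multiset.mem_map] at this
    obtain ⟨τ, hτ, e⟩ := this
    rw [sub_eq_zero.1 e]; exact hτ
  · intro s hs hfs
    have hsb : s ∈ Metric.ball z0 9 := by rw [mem_ball_iff_norm]; linarith
    rw [hlog s hsb hfs, add_sub_cancel_left]
    refine logDeriv_local hA (hg.mono (Metric.ball_subset_ball (by norm_num)))
      (fun z hz => hgne z (by rw [mem_ball_iff_norm] at hz; exact hz.le)) (fun z hz => ?_) hs
    rw [mem_ball_iff_norm] at hz
    refine (hcof L g hL hg hfg z (by linarith)).trans ?_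
    have : ((3:ℝ)/5) ^ L.card ≤ 1 := pow_le_one₀ (by norm_num) (by norm_num)
    have h7 := Real.exp_pos A
    gcongr
    nlinarith

lemma zeta_two_lower {s : ℂ} (hs : s.re = 2) : 1/4 ≤ ‖ζ s‖ := by
  have h1 : (1:ℝ) < s.re := by rw [hs]; norm_num
  have hn : ∀ n : ℕ, ‖1 / ((n:ℂ) + 1) ^ s‖ = 1 / ((n:ℝ) + 1) ^ 2 := by
    intro n
    have := Complex.norm_natCast_cpow_of_pos (Nat.succ_pos n) s
    rw [hs] at this
    push_cast at this
    rw [norm_div, this, norm_one]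
    norm_cast
  have hz2 := hasSum_zeta_two
  have hz3 := (hasSum_nat_add_iff' (f := fun n : ℕ => (1:ℝ) / (n:ℝ) ^ 2) 2).2 hz2
  simp only [Finset.sum_range_succ, Finset.range_zero, Finset.sum_empty] at hz3
  have hsum : Summable fun n : ℕ => 1 / ((n:ℂ) + 1) ^ s := by
    apply Summable.of_norm
    simp_rw [hn]
    have := (summable_nat_add_iff (f := fun n : ℕ => (1:ℝ) / (n:ℝ) ^ 2) 1).2 hz2.summable
    simpa using this
  rw [zeta_eq_tsum_one_div_nat_add_one_cpow h1, hsum.tsum_eq_zero_add]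
  have hb : ‖∑' n : ℕ, 1 / (((n + 1 : ℕ):ℂ) + 1) ^ s‖ ≤ 3/4 := by
    refine (tsum_of_norm_bounded hz3 fun n => ?_).trans ?_
    · rw [hn]; push_cast; apply le_of_eq; ring
    · have := Real.pi_lt_d2
      have := Real.pi_pos
      norm_num
      nlinarith
  have := norm_sub_norm_le (1:ℂ) (-∑' n : ℕ, 1 / (((n + 1 : ℕ):ℂ) + 1) ^ s)
  rw [norm_one, norm_neg, sub_neg_eq_add] at this
  simp only [Nat.cast_zero, zero_add, one_cpow, div_one]
  linarith

/-- Local description of `ζ'/ζ` near height `T`. -/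
lemma zeta_local : ∃ C ≥ (1:ℝ), ∀ T : ℝ, 20 ≤ T → ∃ L : Multiset ℂ,
      (L.card : ℝ) ≤ C * Real.log T ∧
      (∀ ρ ∈ L, ‖ρ - (2 + T * I)‖ ≤ 3 ∧ ζ ρ = 0) ∧
      (∀ ρ, ‖ρ - (2 + T * I)‖ ≤ 3 → ζ ρ = 0 → ρ ∈ L) ∧
      ∀ s, ‖s - (2 + T * I)‖ ≤ 5/2 → ζ s ≠ 0 →
        ‖logDeriv ζ s - (L.map (fun ρ => 1 / (s - ρ))).sum‖ ≤ C * Real.log T := by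
  obtain ⟨C, hC, h⟩ := zeta_bound2
  set D := 17 + max 0 (Real.log (4 * C)) with hD
  have hD0 : 17 ≤ D := by rw [hD]; linarith [le_max_left 0 (Real.log (4 * C))]
  refine ⟨100 * D, by linarith, fun T hT => ?_⟩
  have hl := log_ge_one (show 3 ≤ T by linarith)
  have hA : 0 < D * Real.log T := by positivity
  have hlow := zeta_two_lower (s := 2 + T * I) (by simp)
  have him : ∀ z ∈ Metric.ball (2 + T * I : ℂ) 9, T - 9 ≤ |z.im| ∧ |z.im| ≤ T + 9 ∧ -7 ≤ z.re := by
    intro z hz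
    rw [mem_ball_iff_norm] at hz
    have := near_im hz.le
    simp only [add_im, im_ofNat, mul_im, ofReal_re, I_im, mul_one, ofReal_im, I_re, mul_zero,
      add_zero, zero_add, add_re, re_ofNat, mul_re, sub_self] at this
    rw [abs_of_pos (by linarith : 0 < T)] at this
    exact ⟨this.1, this.2.1, by linarith [this.2.2.1]⟩
  obtain ⟨L, h1, h2, h3, h4⟩ := landau_local (f := ζ) (z0 := 2 + T * I) hA
    (fun z hz => (differentiableAt_riemannZeta (ne_one_of_im (by linarith [(him z hz).1]))).differentiableWithinAt)
    (norm_pos_iff.1 (by linarith)) (fun z hz => by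
      obtain ⟨ha, hb, hc⟩ := him z hz
      have hz0 : 0 < |z.im| := by linarith
      have hz1 : 1 ≤ |z.im| := by linarith
      have hlz : Real.log |z.im| ≤ |z.im| := (Real.log_le_sub_one_of_pos hz0).trans (by linarith)
      have hlz0 : 0 ≤ Real.log |z.im| := Real.log_nonneg hz1
      have hlog2 : Real.log |z.im| ≤ 2 * Real.log T := log_le_two (by linarith) hz0 (by linarith)
      calc ‖ζ z‖ ≤ C * |z.im| ^ (1/2 + max (-z.re) 0) * Real.log |z.im| := h z hc (by linarith)
        _ ≤ C * |z.im| ^ (7.5:ℝ) * |z.im| ^ (1:ℝ) := by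
            rw [Real.rpow_one]
            gcongr
            · rcases le_total (-z.re) 0 with h5 | h5
              · rw [max_eq_right h5]; norm_num
              · rw [max_eq_left h5]; linarith
        _ = C * |z.im| ^ (8.5:ℝ) := by rw [mul_assoc, ← Real.rpow_add hz0]; norm_num
        _ ≤ (Real.exp (D * Real.log T) / 4) := by
            rw [Real.rpow_def_of_pos hz0, le_div_iff₀ (by norm_num)]
            rw [mul_right_comm, show C * 4 = Real.exp (Real.log (4 * C)) by
              rw [Real.exp_log (by positivity)]; ring, ← Real.exp_add]
            apply Real.exp_le_exp.2
            have h6 := le_max_right 0 (Real.log (4 * C))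
            have h7 := le_max_left 0 (Real.log (4 * C))
            rw [hD]
            nlinarith
        _ ≤ _ := by
            have := Real.exp_pos (D * Real.log T)
            nlinarith)
  refine ⟨L, h1.trans (by nlinarith), h2, h3, fun s hs hs0 => (h4 s hs hs0).trans (by linarith)⟩

lemma zero_im_of_near {ρ : ℂ} {T : ℝ} (h : ‖ρ - (2 + T * I)‖ ≤ 3) : T - 3 ≤ ρ.im ∧ ρ.im ≤ T + 3 := by
  have := (abs_im_le_norm (ρ - (2 + T * I))).trans h
  simp [abs_le] at this
  constructor <;> linarith [this.1, this.2]

lemma near_of_strip {ρ : ℂ} {T : ℝ} (h0 : 0 < ρ.re) (h1 : ρ.re < 1) (h : |ρ.im - T| ≤ 3/2) :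
    ‖ρ - (2 + T * I)‖ ≤ 3 := by
  rw [Complex.norm_def]
  apply Real.sqrt_le_iff.2 ⟨by norm_num, ?_⟩
  rw [normSq_apply]
  simp only [sub_re, add_re, re_ofNat, mul_re, ofReal_re, I_re, mul_zero, ofReal_im, I_im, mul_one,
    sub_self, add_zero, sub_im, add_im, im_ofNat, mul_im, zero_add]
  rw [abs_le] at h
  nlinarith [h.1, h.2]

/-- number of zeros in unit windows -/
lemma zero_count : ∃ C ≥ (1:ℝ), ∀ T : ℝ, 20 ≤ T → ∀ S : Finset ℂ,
    (∀ ρ ∈ S, ζ ρ = 0 ∧ |ρ.im - T| ≤ 3/2) → (S.card : ℝ) ≤ C * Real.log T := by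
  obtain ⟨C, hC, h⟩ := zeta_local
  refine ⟨C, hC, fun T hT S hS => ?_⟩
  obtain ⟨L, h1, h2, h3, h4⟩ := h T hT
  classical
  have hsub : S ⊆ L.toFinset := by
    intro ρ hρ
    obtain ⟨ha, hb⟩ := hS ρ hρ
    have him : ρ.im ≠ 0 := by
      rw [abs_le] at hb
      intro h; rw [h] at hb; linarith [hb.1]
    obtain ⟨hc, hd⟩ := zero_in_strip ha him
    rw [Multiset.mem_toFinset]
    exact h3 ρ (near_of_strip hc hd hb) ha
  have h5 : S.card ≤ L.card := (Finset.card_le_card hsub).trans (Multiset.toFinset_card_le L)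
  exact (by exact_mod_cast h5 : (S.card:ℝ) ≤ L.card).trans h1

lemma inv_dist_le {d u : ℝ} (hd : 0 < d) :
    (Real.sqrt (u ^ 2 + d ^ 2))⁻¹ ≤ Real.sqrt d⁻¹ + Real.sqrt d * (1 / (u ^ 2 + d ^ 2)) := by
  set q := Real.sqrt (u ^ 2 + d ^ 2) with hq
  have hq0 : 0 < q := Real.sqrt_pos.2 (by positivity)
  have hqq : u ^ 2 + d ^ 2 = q ^ 2 := (Real.sq_sqrt (by positivity)).symm
  set e := Real.sqrt d with he
  have he0 : 0 < e := Real.sqrt_pos.2 hd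
  rw [Real.sqrt_inv, ← he, hqq]
  have : e⁻¹ + e * (1 / q ^ 2) - q⁻¹ = (q ^ 2 - e * q + e ^ 2) / (e * q ^ 2) := by
    field_simp; ring
  have h2 : 0 ≤ (q ^ 2 - e * q + e ^ 2) / (e * q ^ 2) := by
    apply div_nonneg _ (by positivity)
    nlinarith [sq_nonneg (q - e)]
  linarith

lemma int_cauchy_le {d β p q : ℝ} (hd : 0 < d) :
    IntervalIntegrable (fun σ : ℝ => 1 / ((σ - β) ^ 2 + d ^ 2)) MeasureTheory.volume p q ∧
    ∫ σ in p..q, 1 / ((σ - β) ^ 2 + d ^ 2) ≤ π / d := by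
  have hc : Continuous (fun σ : ℝ => 1 / ((σ - β) ^ 2 + d ^ 2)) := by
    apply Continuous.div continuous_const (by fun_prop)
    intro σ; positivity
  refine ⟨hc.intervalIntegrable _ _, ?_⟩
  have hder : ∀ σ : ℝ, HasDerivAt (fun σ => Real.arctan ((σ - β) / d) / d) (1 / ((σ - β) ^ 2 + d ^ 2)) σ := by
    intro σ
    have h1 : HasDerivAt (fun σ : ℝ => (σ - β) / d) (1 / d) σ :=
      ((hasDerivAt_id σ).sub_const β).div_const d
    refine (h1.arctan.div_const d).congr_deriv ?_
    field_simp
    ring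
  rw [intervalIntegral.integral_eq_sub_of_hasDerivAt (fun x _ => hder x) (hc.intervalIntegrable _ _),
    ← sub_div]
  gcongr
  linarith [Real.arctan_lt_pi_div_two ((q - β) / d), Real.neg_pi_div_two_lt_arctan ((p - β) / d)]

lemma pole_sum_int {d T p q : ℝ} (hd : 0 < d) (hpq : p ≤ q) (hlen : q - p ≤ 3) (L : Multiset ℂ)
    (hL : ∀ ρ ∈ L, d ≤ |T - ρ.im|) :
    Continuous (fun σ : ℝ => (L.map (fun ρ => 1 / ((σ + T * I : ℂ) - ρ))).sum) ∧
    ∫ σ in p..q, ‖(L.map (fun ρ => 1 / ((σ + T * I : ℂ) - ρ))).sum‖ ≤ L.card * (7 * Real.sqrt d⁻¹) := by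
  induction L using Multiset.induction_on with
  | empty => exact ⟨by simpa using continuous_const, by simp⟩
  | cons ρ L ih =>
    obtain ⟨h1, h2⟩ := ih (fun τ hτ => hL τ (by simp [hτ]))
    have hρ := hL ρ (by simp)
    have hne : ∀ σ : ℝ, (σ + T * I : ℂ) - ρ ≠ 0 := by
      intro σ h
      have := congrArg Complex.im h
      simp at this
      rw [this] at hρ; simp at hρ; linarith
    have hc : Continuous (fun σ : ℝ => 1 / ((σ + T * I : ℂ) - ρ)) :=
      Continuous.div continuous_const (by fun_prop) hne
    simp only [Multiset.map_cons, Multiset.sum_cons, Multiset.card_cons]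
    refine ⟨hc.add h1, ?_⟩
    have hb : ∀ σ : ℝ, ‖1 / ((σ + T * I : ℂ) - ρ)‖ ≤
        Real.sqrt d⁻¹ + Real.sqrt d * (1 / ((σ - ρ.re) ^ 2 + d ^ 2)) := by
      intro σ
      refine le_trans ?_ (inv_dist_le hd)
      rw [one_div, norm_inv]
      apply inv_anti₀ (Real.sqrt_pos.2 (by positivity))
      rw [Complex.norm_def]
      apply Real.sqrt_le_sqrt
      rw [normSq_apply]
      simp only [sub_re, add_re, ofReal_re, mul_re, I_re, mul_zero, ofReal_im, I_im, mul_one,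
        sub_self, add_zero, sub_im, add_im, mul_im, zero_add]
      have := mul_self_le_mul_self hd.le hρ
      rw [abs_mul_abs_self] at this
      nlinarith
    obtain ⟨hi, hI⟩ := int_cauchy_le (β := ρ.re) (p := p) (q := q) hd
    have hint : ∫ σ in p..q, ‖1 / ((σ + T * I : ℂ) - ρ)‖ ≤ 7 * Real.sqrt d⁻¹ := by
      calc _ ≤ ∫ σ in p..q, (Real.sqrt d⁻¹ + Real.sqrt d * (1 / ((σ - ρ.re) ^ 2 + d ^ 2))) := by
            apply intervalIntegral.integral_mono_on hpq (hc.norm.intervalIntegrable _ _)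
              (intervalIntegrable_const.add (hi.const_mul _)) (fun σ _ => hb σ)
        _ = (q - p) * Real.sqrt d⁻¹ + Real.sqrt d * ∫ σ in p..q, 1 / ((σ - ρ.re) ^ 2 + d ^ 2) := by
            rw [intervalIntegral.integral_add intervalIntegrable_const (hi.const_mul _)]
            simp [intervalIntegral.integral_const_mul]
        _ ≤ 3 * Real.sqrt d⁻¹ + Real.sqrt d * (4 / d) := by
            gcongr
            exact hI.trans (by gcongr; exact Real.pi_le_four)
        _ = 7 * Real.sqrt d⁻¹ := by
            have : Real.sqrt d * (4 / d) = 4 * Real.sqrt d⁻¹ := by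
              rw [Real.sqrt_inv]
              have h5 : 0 < Real.sqrt d := Real.sqrt_pos.2 hd
              have h6 : d = Real.sqrt d * Real.sqrt d := (Real.mul_self_sqrt hd.le).symm
              field_simp
              rw [sq]; exact h6.symm
            rw [this]; ring
    calc _ ≤ ∫ σ in p..q, (‖1 / ((σ + T * I : ℂ) - ρ)‖ +
          ‖(L.map (fun ρ => 1 / ((σ + T * I : ℂ) - ρ))).sum‖) := by
          apply intervalIntegral.integral_mono_on hpq ((hc.add h1).norm.intervalIntegrable _ _)
            ((hc.norm.add h1.norm).intervalIntegrable _ _) (fun σ _ => norm_add_le _ _)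
      _ = _ := intervalIntegral.integral_add (hc.norm.intervalIntegrable _ _) (h1.norm.intervalIntegrable _ _)
      _ ≤ _ := by push_cast; linarith

/-- at a height away from zeros -/
lemma logDeriv_int : ∃ C > (0:ℝ), ∀ T d p q : ℝ, 20 ≤ T → 0 < d → p ≤ q → -(1/2) ≤ p → q ≤ 2 →
    (∀ ρ, ζ ρ = 0 → 0 < ρ.im → d ≤ |T - ρ.im|) →
    ∫ σ in p..q, ‖logDeriv ζ (σ + T * I)‖ ≤ C * Real.log T * (1 + Real.sqrt d⁻¹) := by
  obtain ⟨C, hC, h⟩ := zeta_local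
  refine ⟨7 * C, by linarith, fun T d p q hT hd hpq hp hq hz => ?_⟩
  obtain ⟨L, h1, h2, h3, h4⟩ := h T hT
  have hl := log_ge_one (show 3 ≤ T by linarith)
  obtain ⟨h5, h6⟩ := pole_sum_int hd hpq (by linarith) L (T := T) (fun ρ hρ => by
    obtain ⟨ha, hb⟩ := h2 ρ hρ
    exact hz ρ hb (by linarith [(zero_im_of_near ha).1]))
  have hne : ∀ σ : ℝ, ζ (σ + T * I) ≠ 0 := by
    intro σ h
    have := hz _ h (by simp; linarith)
    simp at this; linarith
  have hcont : Continuous (fun σ : ℝ => logDeriv ζ (σ + T * I)) := by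
    rw [continuous_iff_continuousAt]
    intro σ
    have ha := zeta_analyticAt (s := σ + T * I) (ne_one_of_im (by simp; linarith))
    have hb : ContinuousAt (logDeriv ζ) (σ + T * I) :=
      (ha.deriv.div ha (hne σ)).continuousAt
    exact ContinuousAt.comp (f := fun σ : ℝ => (σ + T * I : ℂ)) hb (by fun_prop)
  calc _ ≤ ∫ σ in p..q, (C * Real.log T + ‖(L.map (fun ρ => 1 / ((σ + T * I : ℂ) - ρ))).sum‖) := by
        apply intervalIntegral.integral_mono_on hpq (hcont.norm.intervalIntegrable _ _)
          ((continuous_const.add h5.norm).intervalIntegrable _ _)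
        intro σ hσ
        have h7 := h4 (σ + T * I) (by
          rw [show (σ + T * I : ℂ) - (2 + T * I) = ((σ - 2 : ℝ) : ℂ) by push_cast; ring, norm_real,
            Real.norm_eq_abs, abs_le]
          constructor <;> linarith [hσ.1, hσ.2]) (hne σ)
        have := norm_le_norm_add_norm_sub' (logDeriv ζ (σ + T * I))
          ((L.map (fun ρ => 1 / ((σ + T * I : ℂ) - ρ))).sum)
        refine this.trans ?_
        rw [add_comm]
        exact add_le_add h7 le_rfl
    _ = (q - p) * (C * Real.log T) + ∫ σ in p..q, ‖(L.map (fun ρ => 1 / ((σ + T * I : ℂ) - ρ))).sum‖ := by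
        rw [intervalIntegral.integral_add intervalIntegrable_const (h5.norm.intervalIntegrable _ _)]
        simp
        ring
    _ ≤ 3 * (C * Real.log T) + (C * Real.log T) * (7 * Real.sqrt d⁻¹) := by
        have : 0 ≤ C * Real.log T := by positivity
        refine add_le_add (by nlinarith) (h6.trans ?_)
        gcongr
    _ ≤ _ := by
        have : 0 ≤ C * Real.log T := by positivity
        nlinarith

/-- Good heights. -/
lemma good_height : ∃ C > (0:ℝ), ∀ j : ℕ, 30 ≤ j → ∃ T : ℝ, (j:ℝ) ≤ T ∧ T ≤ j + 1 ∧
    ∀ σ : ℝ, -(1/2) ≤ σ → σ ≤ 2 → ζ (σ + T * I) ≠ 0 ∧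
      ‖logDeriv ζ (σ + T * I)‖ ≤ C * Real.log T ^ 2 := by
  obtain ⟨C, hC, h⟩ := zeta_local
  refine ⟨C + C * (8 * C), by positivity, fun j hj => ?_⟩
  have hj' : (30:ℝ) ≤ j := by exact_mod_cast hj
  obtain ⟨L, h1, h2, h3, -⟩ := h (j + 1/2) (by linarith)
  set n := L.card with hn
  set r : ℝ := 1 / (2 * (n + 1)) with hr
  have hr0 : 0 < r := by positivity
  classical
  set G := L.toFinset with hG
  have hGn : G.card ≤ n := Multiset.toFinset_card_le L
  have hnot : ¬ (Set.Icc (j:ℝ) (j+1) ⊆ ⋃ ρ ∈ G, Set.Ioo (ρ.im - r) (ρ.im + r)) := by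
    intro hsub
    have h5 := MeasureTheory.measure_mono (μ := MeasureTheory.volume) hsub
    have h6 := MeasureTheory.measure_biUnion_finset_le (μ := MeasureTheory.volume) G
      (fun ρ : ℂ => Set.Ioo (ρ.im - r) (ρ.im + r))
    have h7 := h5.trans h6
    simp only [Real.volume_Icc, Real.volume_Ioo, add_sub_cancel_left] at h7
    have e : ∀ ρ : ℂ, ρ.im + r - (ρ.im - r) = 2 * r := fun ρ => by ring
    simp only [e, Finset.sum_const, nsmul_eq_mul] at h7
    rw [← ENNReal.ofReal_natCast, ← ENNReal.ofReal_mul (by positivity),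
      ENNReal.ofReal_le_ofReal_iff (by positivity)] at h7
    have h8 : (G.card:ℝ) ≤ n := by exact_mod_cast hGn
    have h9 : (G.card:ℝ) * (2 * r) ≤ n * (2 * r) := by gcongr
    have h10 : (n:ℝ) * (2 * r) < 1 := by
      rw [hr]
      rw [show (n:ℝ) * (2 * (1 / (2 * (n + 1)))) = n / (n + 1) by field_simp, div_lt_one (by positivity)]
      linarith
    linarith
  rw [Set.not_subset] at hnot
  obtain ⟨T, hT, hTn⟩ := hnot
  have hdist : ∀ ρ, ζ ρ = 0 → 0 < ρ.im → r ≤ |T - ρ.im| := by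
    intro ρ hρ him
    by_contra hc
    push Not at hc
    have hr2 : r ≤ 1/2 := by
      rw [hr, div_le_div_iff₀ (by positivity) (by norm_num)]
      have : (0:ℝ) ≤ n := Nat.cast_nonneg _
      linarith
    obtain ⟨ha, hb⟩ := zero_in_strip hρ him.ne'
    have hρL : ρ ∈ G := by
      rw [hG, Multiset.mem_toFinset]
      apply h3 ρ _ hρ
      have := near_of_strip (T := j + 1/2) ha hb (by
        rw [abs_lt] at hc; rw [abs_le]
        constructor <;> linarith [hc.1, hc.2, hT.1, hT.2])
      exact_mod_cast this
    apply hTn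
    rw [abs_lt] at hc
    simp only [Set.mem_iUnion]
    exact ⟨ρ, hρL, by constructor <;> linarith [hc.1, hc.2]⟩
  obtain ⟨L', g1, g2, g3, g4⟩ := h T (by linarith [hT.1])
  have hl := log_ge_one (show 3 ≤ T by linarith [hT.1])
  refine ⟨T, hT.1, hT.2, fun σ hσ1 hσ2 => ?_⟩
  have hne : ζ (σ + T * I) ≠ 0 := by
    intro h
    have := hdist _ h (by simp; linarith [hT.1])
    simp at this; linarith
  refine ⟨hne, ?_⟩
  have h7 := g4 (σ + T * I) (by
          rw [show (σ + T * I : ℂ) - (2 + T * I) = ((σ - 2 : ℝ) : ℂ) by push_cast; ring, norm_real,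
            Real.norm_eq_abs, abs_le]
          constructor <;> linarith) hne
  have hrinv : r⁻¹ ≤ 8 * C * Real.log T := by
    rw [hr, one_div, inv_inv]
    have hlj : Real.log (j + 1/2) ≤ 2 * Real.log T := log_le_two (by linarith [hT.1]) (by linarith) (by linarith [hT.1])
    have : (n:ℝ) ≤ C * (2 * Real.log T) := h1.trans (by gcongr)
    nlinarith
  have hsum : ∀ L : Multiset ℂ, (∀ ρ ∈ L, r ≤ |T - ρ.im|) →
      ‖(L.map (fun ρ => 1 / ((σ + T * I : ℂ) - ρ))).sum‖ ≤ L.card * r⁻¹ := by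
    intro L
    induction L using Multiset.induction_on with
    | empty => simp
    | cons a L ih =>
      intro hL
      simp only [Multiset.map_cons, Multiset.sum_cons, Multiset.card_cons]
      refine (norm_add_le _ _).trans ?_
      have i1 := ih (fun ρ hρ => hL ρ (by simp [hρ]))
      have i2 : ‖1 / ((σ + T * I : ℂ) - a)‖ ≤ r⁻¹ := by
        rw [one_div, norm_inv]
        apply inv_anti₀ hr0
        refine (hL a (by simp)).trans ?_
        have := abs_im_le_norm ((σ + T * I : ℂ) - a)
        simpa using this
      push_cast; linarith
  have h8 := hsum L' (fun ρ hρ => hdist ρ (g2 ρ hρ).2 (by linarith [(zero_im_of_near (g2 ρ hρ).1).1, hT.1]))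
  have h9 := norm_le_norm_add_norm_sub' (logDeriv ζ (σ + T * I))
          ((L'.map (fun ρ => 1 / ((σ + T * I : ℂ) - ρ))).sum)
  have h10 : (L'.card:ℝ) * r⁻¹ ≤ (C * Real.log T) * (8 * C * Real.log T) := by
    gcongr
  nlinarith

/-- The `3-4-1` inequality. -/
lemma three_four_one {σ t : ℝ} (hσ : 1 < σ) :
    0 ≤ -(3 * (logDeriv ζ (σ:ℂ)).re + 4 * (logDeriv ζ (σ + t * I)).re
      + (logDeriv ζ (σ + (2 * t : ℝ) * I)).re) := by
  have key : ∀ u : ℝ, HasSum (fun n : ℕ => (LSeries.term (fun n => (ArithmeticFunction.vonMangoldt n : ℂ))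
      (σ + u * I) n).re) (-(logDeriv ζ (σ + u * I)).re) := by
    intro u
    have h1 : 1 < (σ + u * I : ℂ).re := by simpa using hσ
    have h2 := ArithmeticFunction.LSeriesSummable_vonMangoldt h1
    have h3 := h2.hasSum
    have h4 := ArithmeticFunction.LSeries_vonMangoldt_eq_deriv_riemannZeta_div h1
    rw [LSeries] at h4
    rw [h4] at h3
    have h5 := Complex.hasSum_re h3
    convert h5 using 1
    rw [logDeriv_apply, neg_div]; simp
  have hterm : ∀ (u : ℝ) (n : ℕ), n ≠ 0 → (LSeries.term (fun n => (ArithmeticFunction.vonMangoldt n : ℂ))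
      (σ + u * I) n).re = ArithmeticFunction.vonMangoldt n * (n:ℝ) ^ (-σ) * Real.cos (u * Real.log n) := by
    intro u n hn
    have hn' : (n:ℂ) ≠ 0 := by exact_mod_cast hn
    have hnp : (0:ℝ) < n := by positivity
    rw [LSeries.term_of_ne_zero hn, div_eq_mul_inv, ← cpow_neg, re_ofReal_mul,
      cpow_def_of_ne_zero hn', ← natCast_log, mul_assoc, Complex.exp_re, Real.rpow_def_of_pos hnp]
    have e1 : (((Real.log n : ℝ):ℂ) * -(σ + u * I)).re = Real.log n * (-σ) := by rw [re_ofReal_mul]; simp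
    have e2 : (((Real.log n : ℝ):ℂ) * -(σ + u * I)).im = -(u * Real.log n) := by rw [im_ofReal_mul]; simp; ring
    rw [e1, e2, Real.cos_neg]
  have h0 := ((key 0).mul_left 3).add ((key t).mul_left 4) |>.add (key (2 * t))
  have := h0.nonneg (fun n => by
    by_cases hn : n = 0
    · subst hn; simp
    · rw [hterm _ n hn, hterm _ n hn, hterm _ n hn]
      have hL : 0 ≤ ArithmeticFunction.vonMangoldt n * (n:ℝ) ^ (-σ) :=
        mul_nonneg ArithmeticFunction.vonMangoldt_nonneg (by positivity)
      have e : Real.cos (2 * t * Real.log n) = 2 * Real.cos (t * Real.log n) ^ 2 - 1 := by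
        rw [mul_assoc, Real.cos_two_mul]
      rw [e, zero_mul, Real.cos_zero]
      have : 0 ≤ (ArithmeticFunction.vonMangoldt n * (n:ℝ) ^ (-σ)) * (2 * (1 + Real.cos (t * Real.log n)) ^ 2) := by
        positivity
      nlinarith)
  have e0 : (σ + (0:ℝ) * I : ℂ) = σ := by simp
  rw [e0] at this
  linarith

lemma logDeriv_near_one : ∃ K > (0:ℝ), ∀ σ : ℝ, 1 < σ → σ ≤ 2 →
    -(logDeriv ζ (σ:ℂ)).re ≤ 1 / (σ - 1) + K := by
  have hcont : ContinuousOn (fun σ : ℝ => logDeriv riemannZeta₁ (σ:ℂ)) (Set.Icc 1 2) := by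
    intro σ hσ
    have ha := riemannZeta₁_analyticAt (σ:ℂ)
    have hb : ContinuousAt (logDeriv riemannZeta₁) (σ:ℂ) :=
      (ha.deriv.div ha (riemannZeta₁_ne_zero (by simpa using hσ.1))).continuousAt
    exact (ContinuousAt.comp (f := fun σ : ℝ => (σ : ℂ)) hb (by fun_prop)).continuousWithinAt
  obtain ⟨K, hK⟩ := isCompact_Icc.exists_bound_of_continuousOn hcont
  refine ⟨|K| + 1, by positivity, fun σ h1 h2 => ?_⟩
  have h3 := hK σ ⟨h1.le, h2⟩
  have hne : (σ:ℂ) ≠ 1 := by exact_mod_cast h1.ne'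
  have hne' : (σ:ℂ) - 1 ≠ 0 := sub_ne_zero.mpr hne
  have e : logDeriv riemannZeta₁ (σ:ℂ) = 1 / ((σ:ℂ) - 1) + logDeriv ζ σ := by
    have : riemannZeta₁ =ᶠ[𝓝 (σ:ℂ)] fun s => (s - 1) * ζ s := by
      filter_upwards [isOpen_ne.mem_nhds hne] with s hs
      exact riemannZeta₁_eq_mul hs
    rw [show logDeriv riemannZeta₁ (σ:ℂ) = logDeriv (fun s => (s - 1) * ζ s) σ by
      rw [logDeriv_apply, logDeriv_apply, this.deriv_eq, this.eq_of_nhds], logDeriv_mul (f := fun s : ℂ => s - 1) (g := ζ) (σ:ℂ) hne'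
      (riemannZeta_ne_zero_of_one_le_re (by simpa using h1.le)) (by fun_prop)
      (zeta_analyticAt hne).differentiableAt]
    congr 1
    simp [logDeriv_apply]
  have e2 : (logDeriv riemannZeta₁ (σ:ℂ)).re = 1 / (σ - 1) + (logDeriv ζ (σ:ℂ)).re := by
    rw [e, add_re]
    congr 1
    rw [show (1:ℂ) / ((σ:ℂ) - 1) = ((1 / (σ - 1) : ℝ) : ℂ) by push_cast; rfl, ofReal_re]
  have h4 := (abs_le.mp ((abs_re_le_norm _).trans h3)).1
  linarith [le_abs_self K]

lemma pole_sum_re_ge {s : ℂ} (L : Multiset ℂ) (hL : ∀ ρ ∈ L, ρ.re < s.re) :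
    0 ≤ ((L.map (fun ρ => 1 / (s - ρ))).sum).re := by
  induction L using Multiset.induction_on with
  | empty => simp
  | cons a L ih =>
    have h1 := ih (fun ρ hρ => hL ρ (by simp [hρ]))
    have h2 := hL a (by simp)
    simp only [Multiset.map_cons, Multiset.sum_cons, add_re]
    have : 0 ≤ (1 / (s - a)).re := by
      rw [one_div, inv_re]
      apply div_nonneg _ (normSq_nonneg _)
      simp; linarith
    linarith

/-- Classical zero-free region. -/
lemma zero_free : ∃ c > (0:ℝ), ∀ ρ : ℂ, ζ ρ = 0 → 20 ≤ ρ.im →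
    ρ.re ≤ 1 - c / Real.log ρ.im := by
  obtain ⟨C, hC, h⟩ := zeta_local
  obtain ⟨K, hK, hk⟩ := logDeriv_near_one
  set C' := 3 * K + 6 * C with hC'
  have hC'1 : 1 ≤ C' := by rw [hC']; linarith
  refine ⟨1 / (14 * C'), by positivity, fun ρ hρ him => ?_⟩
  set γ := ρ.im with hγ
  have hl := log_ge_one (show 3 ≤ γ by linarith)
  obtain ⟨hb0, hb1⟩ := zero_in_strip hρ (show ρ.im ≠ 0 by rw [← hγ]; linarith)
  set η := 1 / (2 * C' * Real.log γ) with hη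
  have hη0 : 0 < η := by positivity
  have hη1 : η ≤ 1 := by
    rw [hη, div_le_one (by positivity)]; nlinarith
  set σ := 1 + η with hσ
  have hσ1 : 1 < σ := by linarith
  have hnorm : ∀ T : ℝ, ‖(σ + T * I : ℂ) - (2 + T * I)‖ ≤ 5 / 2 := by
    intro T
    rw [show (σ + T * I : ℂ) - (2 + T * I) = ((σ - 2 : ℝ) : ℂ) by push_cast; ring, norm_real,
            Real.norm_eq_abs, abs_le]
    constructor <;> linarith
  have hne : ∀ T : ℝ, ζ (σ + T * I) ≠ 0 := fun T =>
    riemannZeta_ne_zero_of_one_le_re (by simp; linarith)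
  have hre : ∀ T : ℝ, 20 ≤ T → ∀ τ, ‖τ - (2 + T * I)‖ ≤ 3 → ζ τ = 0 → τ.re < σ := by
    intro T hT τ h1 h2
    have := (zero_in_strip h2 (show τ.im ≠ 0 from ne_of_gt (by linarith [(zero_im_of_near h1).1]))).2
    linarith
  obtain ⟨L1, a1, a2, a3, a4⟩ := h γ him
  obtain ⟨L2, b1, b2, b3, b4⟩ := h (2 * γ) (by linarith)
  have A := (abs_le.mp ((abs_re_le_norm _).trans (a4 _ (hnorm γ) (hne γ)))).1
  have B := (abs_le.mp ((abs_re_le_norm _).trans (b4 _ (hnorm (2 * γ)) (hne (2 * γ))))).1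
  have B2 := pole_sum_re_ge (s := σ + (2 * γ : ℝ) * I) L2 (fun τ hτ => by
    simpa using hre (2 * γ) (by linarith) τ (b2 τ hτ).1 (b2 τ hτ).2)
  have hρL : ρ ∈ L1 := a3 ρ (by
    have := near_of_strip (T := γ) hb0 hb1 (by simp [← hγ]; norm_num)
    exact_mod_cast this) hρ
  obtain ⟨L1', rfl⟩ := Multiset.exists_cons_of_mem hρL
  have A2 := pole_sum_re_ge (s := σ + γ * I) L1' (fun τ hτ => by
    simpa using hre γ him τ (a2 τ (by simp [hτ])).1 (a2 τ (by simp [hτ])).2)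
  have A3 : (1 / ((σ + γ * I : ℂ) - ρ)).re = 1 / (σ - ρ.re) := by
    rw [show (σ + γ * I : ℂ) - ρ = ((σ - ρ.re : ℝ) : ℂ) by
      apply Complex.ext <;> simp [hγ] ]
    rw [show (1:ℂ) / ((σ - ρ.re : ℝ) : ℂ) = ((1 / (σ - ρ.re) : ℝ) : ℂ) by push_cast; rfl, ofReal_re]
  simp only [Multiset.map_cons, Multiset.sum_cons, sub_re, add_re, A3] at A
  simp only [sub_re] at B
  have h341 := three_four_one (t := γ) hσ1
  have hk1 := hk σ hσ1 (by linarith)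
  have hl2 : Real.log (2 * γ) ≤ 2 * Real.log γ := log_le_two (by linarith) (by linarith) le_rfl
  have hCl : C * Real.log (2 * γ) ≤ C * (2 * Real.log γ) := by gcongr
  have e1 : 1 / (σ - 1) = 1 / η := by rw [hσ]; congr 1; ring
  have e2 : C' * Real.log γ = 1 / (2 * η) := by rw [hη]; field_simp
  have hKl : 3 * K ≤ 3 * K * Real.log γ := by nlinarith
  have main : 4 * (1 / (σ - ρ.re)) ≤ 3 * (1 / η) + C' * Real.log γ := by
    rw [hC']
    rw [e1] at hk1
    linarith
  rw [e2] at main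
  have hpos : 0 < σ - ρ.re := by linarith
  have m2 : 4 * (1 / (σ - ρ.re)) ≤ 7 / (2 * η) := by
    refine main.trans (le_of_eq ?_); field_simp; norm_num
  rw [mul_one_div, div_le_div_iff₀ hpos (by positivity)] at m2
  have e3 : 1 / (14 * C') / Real.log γ = η / 7 := by rw [hη]; field_simp; norm_num
  rw [e3]
  linarith

/-- Gamma integral with complex parameter. -/
lemma gamma_cexp_integrable {s z : ℂ} (hs : 0 < s.re) (hz : 0 < z.re) :
    MeasureTheory.IntegrableOn (fun t : ℝ => (t:ℂ) ^ (s - 1) * cexp (-(z * t))) (Set.Ioi 0) := by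
  have h := integrableOn_rpow_mul_exp_neg_mul_rpow (p := 1) (s := s.re - 1) (b := z.re) (by linarith) (by norm_num) hz
  refine MeasureTheory.Integrable.mono' h ?_ ?_
  · apply ContinuousOn.aestronglyMeasurable _ measurableSet_Ioi
    apply ContinuousOn.mul
    · intro t ht
      exact ((continuousAt_ofReal_cpow_const t (s - 1) (Or.inr (ne_of_gt ht)))).continuousWithinAt
    · fun_prop
  · rw [MeasureTheory.ae_restrict_iff' measurableSet_Ioi]
    refine Eventually.of_forall (fun t ht => ?_)
    rw [norm_mul, norm_cpow_eq_rpow_re_of_pos ht, Complex.norm_exp]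
    simp

lemma gamma_cexp_hasDeriv {s z₀ : ℂ} (hs : 0 < s.re) (hz : 0 < z₀.re) :
    DifferentiableAt ℂ (fun z : ℂ => ∫ t in Set.Ioi (0:ℝ), (t:ℂ) ^ (s - 1) * cexp (-(z * t))) z₀ := by
  have hb := integrableOn_rpow_mul_exp_neg_mul_rpow (p := 1) (s := s.re) (b := z₀.re / 2) (by linarith) (by norm_num) (by linarith)
  have := hasDerivAt_integral_of_dominated_loc_of_deriv_le (𝕜 := ℂ)
    (μ := MeasureTheory.volume.restrict (Set.Ioi (0:ℝ)))
    (F := fun z t => (t:ℂ) ^ (s - 1) * cexp (-(z * t)))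
    (F' := fun z t => (t:ℂ) ^ (s - 1) * (cexp (-(z * t)) * (-(1 * t))))
    (x₀ := z₀) (s := Metric.ball z₀ (z₀.re / 2)) (bound := fun t => t ^ s.re * Real.exp (-(z₀.re / 2) * t ^ (1:ℝ)))
    (Metric.ball_mem_nhds _ (by linarith)) ?_ (gamma_cexp_integrable hs hz) ?_ ?_ hb ?_
  · exact this.2.differentiableAt
  · filter_upwards [(isOpen_lt continuous_const continuous_re).mem_nhds hz] with z hz'
    exact (gamma_cexp_integrable hs hz').aestronglyMeasurable
  · apply ContinuousOn.aestronglyMeasurable _ measurableSet_Ioi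
    apply ContinuousOn.mul
    · intro t ht
      exact ((continuousAt_ofReal_cpow_const t (s - 1) (Or.inr (ne_of_gt ht)))).continuousWithinAt
    · fun_prop
  · rw [MeasureTheory.ae_restrict_iff' measurableSet_Ioi]
    refine Eventually.of_forall (fun t ht z hz' => ?_)
    have ht0 : (0:ℝ) < t := ht
    rw [norm_mul, norm_mul, norm_cpow_eq_rpow_re_of_pos ht, Complex.norm_exp]
    have e1 : ‖-(1 * (t:ℂ))‖ = t := by simp [abs_of_pos ht0]
    rw [e1, sub_re, one_re, Real.rpow_one]
    have e2 : t ^ s.re = t ^ (s.re - 1) * t := by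
      rw [Real.rpow_sub_one ht0.ne']; field_simp
    rw [e2]
    have e3 : (-(z * t)).re ≤ -(z₀.re / 2) * t := by
      have h1 := (abs_le.mp ((abs_re_le_norm (z - z₀)).trans (mem_ball_iff_norm.mp hz').le)).1
      rw [sub_re] at h1
      have : (-(z * t)).re = - z.re * t := by simp
      rw [this]
      nlinarith
    calc _ = t ^ (s.re - 1) * t * Real.exp (-(z * t)).re := by ring
      _ ≤ _ := by gcongr
  · refine Eventually.of_forall (fun t z _ => ?_)
    exact (((hasDerivAt_id z).mul_const (t:ℂ)).neg.cexp).const_mul _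

lemma gamma_cexp {s z : ℂ} (hs : 0 < s.re) (hz : 0 < z.re) :
    ∫ t in Set.Ioi (0:ℝ), (t:ℂ) ^ (s - 1) * cexp (-(z * t)) = cexp (-(s * Complex.log z)) * Gamma s := by
  have hopen : IsOpen {z : ℂ | 0 < z.re} := isOpen_lt continuous_const continuous_re
  have hf : AnalyticOnNhd ℂ (fun z : ℂ => ∫ t in Set.Ioi (0:ℝ), (t:ℂ) ^ (s - 1) * cexp (-(z * t))) {z : ℂ | 0 < z.re} :=
    DifferentiableOn.analyticOnNhd (fun z hz => (gamma_cexp_hasDeriv hs hz).differentiableWithinAt) hopen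
  have hg : AnalyticOnNhd ℂ (fun z : ℂ => cexp (-(s * Complex.log z)) * Gamma s) {z : ℂ | 0 < z.re} :=
    DifferentiableOn.analyticOnNhd (fun z hz => by
      have : DifferentiableAt ℂ Complex.log z := differentiableAt_log (Or.inl hz)
      exact (by fun_prop : DifferentiableAt ℂ (fun z : ℂ => cexp (-(s * Complex.log z)) * Gamma s) z).differentiableWithinAt) hopen
  have hreal : ∀ r : ℝ, 0 < r → ∫ t in Set.Ioi (0:ℝ), (t:ℂ) ^ (s - 1) * cexp (-((r:ℂ) * t)) = cexp (-(s * Complex.log r)) * Gamma s := by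
    intro r hr
    rw [integral_cpow_mul_exp_neg_mul_Ioi hs hr, cpow_def_of_ne_zero (by simp [hr.ne'])]
    congr 2
    rw [show (1:ℂ) / r = ((r⁻¹ : ℝ) : ℂ) by push_cast; simp, ← ofReal_log (by positivity), ← ofReal_log hr.le, Real.log_inv]
    push_cast; ring
  have hpre : IsPreconnected {z : ℂ | 0 < z.re} := (convex_halfSpace_re_gt 0).isPreconnected
  refine hf.eqOn_of_preconnected_of_frequently_eq hg hpre (z₀ := 1) (by simp) ?_ hz
  have hseq : Tendsto (fun n : ℕ => ((1 + 1 / ((n:ℝ) + 1) : ℝ) : ℂ)) atTop (𝓝[≠] 1) := by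
    rw [tendsto_nhdsWithin_iff]
    constructor
    · have : Tendsto (fun n : ℕ => (1 + 1 / ((n:ℝ) + 1) : ℝ)) atTop (𝓝 (1 + 0)) :=
        tendsto_const_nhds.add tendsto_one_div_add_atTop_nhds_zero_nat
      have h2 := (continuous_ofReal.tendsto (1 + 0)).comp this
      simpa [Function.comp_def] using h2
    · refine Eventually.of_forall (fun n h => ?_)
      have h' : ((1 + 1 / ((n:ℝ) + 1) : ℝ) : ℂ) = ((1:ℝ):ℂ) := by simpa using h
      have h'' : (1 + 1 / ((n:ℝ) + 1) : ℝ) = 1 := by exact_mod_cast h'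
      have : (0:ℝ) < 1 / ((n:ℝ) + 1) := by positivity
      linarith
  refine hseq.frequently (Eventually.of_forall (fun n => hreal _ (by positivity))).frequently

/-- Regularised oscillating factor. -/
noncomputable def RF (A ε : ℝ) (s : ℂ) : ℂ := XF s * cexp (-(s * (A - I * ε)))

lemma RF_hasDerivAt {A ε : ℝ} {s : ℂ} (hs : 0 < s.re) : HasDerivAt (RF A ε)
    ((digamma s - (Real.log (2 * π) + I * (π / 2)) - (A - I * ε)) * RF A ε s) s := by
  have h0 : HasDerivAt (fun s : ℂ => -(s * (A - I * ε))) (-(1 * (A - I * ε))) s :=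
    ((hasDerivAt_id s).mul_const ((A:ℂ) - I * ε)).neg
  have h := (XF_hasDerivAt hs).mul h0.cexp
  refine h.congr_deriv ?_
  simp only [RF]; ring

lemma RF_norm {A ε : ℝ} {s : ℂ} : ‖RF A ε s‖ = ‖XF s‖ * (Real.exp (-(s.re * A)) * Real.exp (-(ε * s.im))) := by
  rw [RF, norm_mul, Complex.norm_exp, ← Real.exp_add]
  congr 2
  simp; ring

lemma osc_int {u v M q : ℝ} (hu : 0 < u) (huv : u ≤ v) (hq : 0 < q) {f g g' : ℝ → ℂ}
    (hf : ∀ t ∈ Set.Icc u v, HasDerivAt f (I * g t * f t) t)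
    (hg : ∀ t ∈ Set.Icc u v, HasDerivAt g (g' t) t)
    (hg' : ContinuousOn g' (Set.Icc u v))
    (hM : ∀ t ∈ Set.Icc u v, ‖f t‖ ≤ M) (hg1 : ∀ t ∈ Set.Icc u v, ‖g' t‖ ≤ 100 / t)
    (hl : ∀ t ∈ Set.Icc u v, Real.log (t / q) ≠ 0)
    (hg2 : ∀ t ∈ Set.Icc u v, |Real.log (t / q)| / 2 ≤ ‖g t‖) :
    ‖∫ t in u..v, f t‖ ≤ 402 * M * (1 / |Real.log (u / q)| + 1 / |Real.log (v / q)|) := by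
  have hM0 : 0 ≤ M := (norm_nonneg _).trans (hM u ⟨le_rfl, huv⟩)
  have hgne : ∀ t ∈ Set.Icc u v, g t ≠ 0 := by
    intro t ht h
    have h1 := hg2 t ht
    rw [h, norm_zero] at h1
    have := abs_pos.mpr (hl t ht)
    linarith
  have hfc : ContinuousOn f (Set.Icc u v) := fun t ht => (hf t ht).continuousAt.continuousWithinAt
  have hgc : ContinuousOn g (Set.Icc u v) := fun t ht => (hg t ht).continuousAt.continuousWithinAt
  have hprim : ∀ t ∈ Set.uIcc u v, HasDerivAt (fun t => f t / (I * g t)) (f t - f t * g' t / (I * g t ^ 2)) t := by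
    intro t ht
    rw [Set.uIcc_of_le huv] at ht
    have hne := hgne t ht
    refine ((hf t ht).div ((hg t ht).const_mul I) (mul_ne_zero I_ne_zero hne)).congr_deriv ?_
    field_simp
    try ring
  have hrc : ContinuousOn (fun t => f t * g' t / (I * g t ^ 2)) (Set.Icc u v) := by
    apply (hfc.mul hg').div (continuousOn_const.mul (hgc.pow 2))
    intro t ht; exact mul_ne_zero I_ne_zero (pow_ne_zero _ (hgne t ht))
  have hi1 : IntervalIntegrable f MeasureTheory.volume u v := (hfc.mono (by rw [Set.uIcc_of_le huv])).intervalIntegrable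
  have hi2 : IntervalIntegrable (fun t => f t * g' t / (I * g t ^ 2)) MeasureTheory.volume u v :=
    (hrc.mono (by rw [Set.uIcc_of_le huv])).intervalIntegrable
  have hftc := intervalIntegral.integral_eq_sub_of_hasDerivAt hprim (hi1.sub hi2)
  rw [intervalIntegral.integral_sub hi1 hi2] at hftc
  have hlogd : ∀ t ∈ Set.uIcc u v, HasDerivAt (fun t => -(Real.log (t / q))⁻¹) (1 / (t * Real.log (t / q) ^ 2)) t := by
    intro t ht
    rw [Set.uIcc_of_le huv] at ht
    have ht0 : 0 < t := lt_of_lt_of_le hu ht.1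
    have h1 : HasDerivAt (fun t => Real.log (t / q)) (1 / q / (t / q)) t :=
      ((hasDerivAt_id t).div_const q).log (by positivity)
    refine (h1.inv (hl t ht)).neg.congr_deriv ?_
    have := hl t ht
    field_simp
  have hlc : ContinuousOn (fun t => 1 / (t * Real.log (t / q) ^ 2)) (Set.uIcc u v) := by
    rw [Set.uIcc_of_le huv]
    intro t ht
    have ht0 : 0 < t := lt_of_lt_of_le hu ht.1
    apply ContinuousAt.continuousWithinAt
    have := hl t ht
    have h3 : t / q ≠ 0 := by positivity
    have h4 : ContinuousAt (fun t => Real.log (t / q)) t := ContinuousAt.log (f := fun t => t / q) (by fun_prop) h3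
    exact continuousAt_const.div (continuousAt_id.mul (h4.pow 2)) (mul_ne_zero ht0.ne' (pow_ne_zero 2 this))
  have hii := hlc.intervalIntegrable (μ := MeasureTheory.volume)
  have hftc2 := intervalIntegral.integral_eq_sub_of_hasDerivAt hlogd hii
  have hbd : ‖∫ t in u..v, f t * g' t / (I * g t ^ 2)‖ ≤ ∫ t in u..v, 400 * M * (1 / (t * Real.log (t / q) ^ 2)) := by
    apply intervalIntegral.norm_integral_le_of_norm_le huv _ (hii.const_mul _)
    refine Eventually.of_forall (fun t ht => ?_)
    have ht' : t ∈ Set.Icc u v := ⟨ht.1.le, ht.2⟩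
    have ht0 : 0 < t := lt_of_lt_of_le hu ht'.1
    have hl' := abs_pos.mpr (hl t ht')
    rw [norm_div, norm_mul, norm_mul, norm_I, one_mul, norm_pow]
    calc _ ≤ M * (100 / t) / (|Real.log (t / q)| / 2) ^ 2 := by
          gcongr
          · exact hM t ht'
          · exact hg1 t ht'
          · exact hg2 t ht'
      _ = _ := by
          rw [div_pow, sq_abs]; field_simp; ring
  rw [intervalIntegral.integral_const_mul, hftc2] at hbd
  have hend : ∀ t ∈ Set.Icc u v, ‖f t / (I * g t)‖ ≤ 2 * M * (1 / |Real.log (t / q)|) := by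
    intro t ht
    have hl' := abs_pos.mpr (hl t ht)
    rw [norm_div, norm_mul, norm_I, one_mul]
    calc _ ≤ M / (|Real.log (t / q)| / 2) := by
          gcongr
          · exact hM t ht
          · exact hg2 t ht
      _ = _ := by field_simp
  have e1 := hend u ⟨le_rfl, huv⟩
  have e2 := hend v ⟨huv, le_rfl⟩
  have e3 : -(Real.log (v / q))⁻¹ - -(Real.log (u / q))⁻¹ ≤ 1 / |Real.log (u / q)| + 1 / |Real.log (v / q)| := by
    rw [one_div, one_div, ← abs_inv, ← abs_inv]
    linarith [neg_abs_le (Real.log (v / q))⁻¹, le_abs_self (Real.log (u / q))⁻¹]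
  have e4 : 400 * M * (-(Real.log (v / q))⁻¹ - -(Real.log (u / q))⁻¹) ≤ 400 * M * (1 / |Real.log (u / q)| + 1 / |Real.log (v / q)|) := by
    gcongr
  have e5 : (∫ t in u..v, f t) = (f v / (I * g v) - f u / (I * g u)) + ∫ t in u..v, f t * g' t / (I * g t ^ 2) := by
    rw [← hftc]; ring
  rw [e5]
  have e6 := norm_add_le (f v / (I * g v) - f u / (I * g u)) (∫ t in u..v, f t * g' t / (I * g t ^ 2))
  have e7 := norm_sub_le (f v / (I * g v)) (f u / (I * g u))
  linarith

lemma line_hasDerivAt (σ t : ℝ) : HasDerivAt (fun t : ℝ => (σ + t * I : ℂ)) I t := by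
  have := ((hasDerivAt_id (t:ℝ)).ofReal_comp.mul_const I).const_add (σ:ℂ)
  simpa using this

lemma comp_line {f : ℂ → ℂ} {f' : ℂ} {σ t : ℝ} (h : HasDerivAt f f' (σ + t * I)) :
    HasDerivAt (fun t : ℝ => f (σ + t * I)) (f' * I) t :=
  HasDerivAt.comp (𝕜 := ℝ) t (h := fun t : ℝ => (σ + t * I : ℂ)) h (line_hasDerivAt σ t)

lemma RF_cont {A ε σ : ℝ} (hσ : 0 < σ) : Continuous (fun t : ℝ => RF A ε (σ + t * I)) := by
  rw [continuous_iff_continuousAt]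
  intro t
  exact (comp_line (RF_hasDerivAt (by simpa using hσ))).continuousAt

lemma RF_osc : ∃ C > (0:ℝ), ∀ σ A ε u v M : ℝ, 1/8 ≤ σ → σ ≤ 2 → 0 ≤ ε → 2 ≤ u → u ≤ v →
    (∀ t ∈ Set.Icc u v, 12 / t ≤ |Real.log (t / (2 * π * Real.exp A))|) →
    (∀ t ∈ Set.Icc u v, t ^ (σ - 1/2) ≤ M) →
    ‖∫ t in u..v, RF A ε (σ + t * I)‖ ≤ C * (Real.exp (-(σ * A)) * M) *
      (1 / |Real.log (u / (2 * π * Real.exp A))| + 1 / |Real.log (v / (2 * π * Real.exp A))|) := by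
  obtain ⟨C, hC, hX⟩ := XF_bound
  refine ⟨402 * C, by positivity, fun σ A ε u v M h1 h2 hε hu huv hl hM => ?_⟩
  have hM0 : 0 ≤ M := (Real.rpow_nonneg (by linarith) _).trans (hM u ⟨le_rfl, huv⟩)
  have hre : ∀ t : ℝ, (σ + t * I : ℂ).re = σ := by intro t; simp
  have him : ∀ t : ℝ, (σ + t * I : ℂ).im = t := by intro t; simp
  refine (osc_int (M := C * (Real.exp (-(σ * A)) * M)) (q := 2 * π * Real.exp A) (by linarith) huv (by positivity)
    (g := fun t => digamma (σ + t * I) - (Real.log (2 * π) + I * (π / 2)) - (A - I * ε))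
    (g' := fun t => deriv digamma (σ + t * I) * I) ?_ ?_ ?_ ?_ ?_ ?_ ?_).trans (le_of_eq (by ring))
  · intro t ht
    refine (comp_line (RF_hasDerivAt (by rw [hre]; linarith))).congr_deriv ?_
    ring
  · intro t ht
    have := comp_line (σ := σ) (t := t) (digamma_analyticAt (by rw [hre]; linarith)).differentiableAt.hasDerivAt
    exact (this.sub_const _).sub_const _
  · intro t ht
    have := comp_line (σ := σ) (t := t) (digamma_analyticAt (by rw [hre]; linarith)).deriv.differentiableAt.hasDerivAt
    exact (this.continuousAt.mul continuousAt_const).continuousWithinAt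
  · intro t ht
    have ht1 : 2 ≤ t := hu.trans ht.1
    rw [RF_norm]
    have := hX (σ + t * I) (by rw [hre]; exact h1) (by rw [hre]; linarith) (by rw [him]; linarith)
    rw [hre, him] at this ⊢
    have e : Real.exp (-(ε * t)) ≤ 1 := by
      rw [Real.exp_le_one_iff]; have : 0 ≤ ε * t := by positivity
      linarith
    calc _ ≤ (C * M) * (Real.exp (-(σ * A)) * 1) := by
          gcongr
          exact this.trans (by gcongr; exact hM t ht)
      _ = _ := by ring
  · intro t ht
    have ht1 : 2 ≤ t := hu.trans ht.1
    rw [norm_mul, norm_I, mul_one]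
    have := digamma_deriv_le (s := σ + t * I) (by rw [hre]; exact h1) (by rw [him, abs_of_nonneg] <;> linarith)
    rwa [him, abs_of_nonneg (by linarith)] at this
  · intro t ht h
    have ht1 : 2 ≤ t := hu.trans ht.1
    have := hl t ht
    rw [h, abs_zero] at this
    have : 0 < 12 / t := by positivity
    linarith
  · intro t ht
    have ht1 : 2 ≤ t := hu.trans ht.1
    have hlt := hl t ht
    have e : Real.log (t / (2 * π * Real.exp A)) = Real.log t - Real.log (2 * π) - A := by
      rw [Real.log_div (by positivity) (by positivity), Real.log_mul (by positivity) (by positivity), Real.log_exp]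
      ring
    have hd := digamma_im (s := σ + t * I) (by rw [hre]; linarith) (by rw [him]; linarith)
    rw [hre, him] at hd
    have hd2 : (4 + σ) / t ≤ 6 / t := by gcongr; linarith
    have hd3 := (abs_re_le_norm _).trans (hd.trans hd2)
    refine le_trans ?_ (abs_re_le_norm _)
    have e2 : (digamma (σ + t * I) - (Real.log (2 * π) + I * (π / 2)) - (A - I * ε)).re
      = (digamma (σ + t * I) - Real.log t - I * (π / 2)).re + Real.log (t / (2 * π * Real.exp A)) := by
      rw [e]
      simp only [sub_re, add_re, ofReal_re, mul_re, I_re, I_im, zero_mul]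
      simp
      ring
    rw [e2]
    have h12 : 12 / t = 6 / t + 6 / t := by ring
    set a := (digamma (σ + t * I) - Real.log t - I * (π / 2)).re
    set b := Real.log (t / (2 * π * Real.exp A))
    have := abs_sub_abs_le_abs_sub b (-a)
    rw [abs_neg, sub_neg_eq_add, add_comm b a] at this
    linarith

lemma XF_line_cont {σ : ℝ} (hσ : 0 < σ) : Continuous (fun t : ℝ => XF (σ + t * I)) := by
  rw [continuous_iff_continuousAt]
  intro t
  exact (comp_line (XF_hasDerivAt (by simpa using hσ))).continuousAt

lemma gamma_12 : ∃ K > (0:ℝ), ∀ a : ℝ, 1 ≤ a → a ≤ 2 → Real.Gamma a ≤ K := by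
  have hc : ContinuousOn Real.Gamma (Set.Icc 1 2) := by
    intro a ha
    refine (Real.differentiableAt_Gamma (fun m h => ?_)).continuousAt.continuousWithinAt
    have := ha.1
    have hm : (0:ℝ) ≤ m := Nat.cast_nonneg m
    linarith
  obtain ⟨K, hK⟩ := isCompact_Icc.exists_bound_of_continuousOn hc
  exact ⟨|K| + 1, by positivity, fun a h1 h2 =>
    (le_abs_self _).trans ((hK a ⟨h1, h2⟩).trans (by linarith [le_abs_self K]))⟩

lemma RF_left_bound : ∃ K > (0:ℝ), ∀ a A ε t₀ t : ℝ, 1 ≤ a → a ≤ 2 → 0 ≤ ε → ε ≤ 1/2 → 0 ≤ t₀ → t ≤ t₀ →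
    ‖RF A ε (a + t * I)‖ ≤ K * Real.exp (-(a * A)) * Real.exp (2 * t₀) * Real.exp t := by
  obtain ⟨K, hK, hg⟩ := gamma_12
  refine ⟨K, hK, fun a A ε t₀ t h1 h2 hε hε2 ht0 ht => ?_⟩
  have hre : (a + t * I : ℂ).re = a := by simp
  have him : (a + t * I : ℂ).im = t := by simp
  rw [RF_norm, XF_norm, hre, him]
  have g1 : ‖Gamma (a + t * I)‖ ≤ K := (gamma_norm_le (by rw [hre]; linarith)).trans (by rw [hre]; exact hg a h1 h2)
  have g2 : (2 * π) ^ (-a) ≤ 1 := Real.rpow_le_one_of_one_le_of_nonpos (by linarith [Real.pi_gt_three]) (by linarith)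
  have g3 : Real.exp (π / 2 * t) * Real.exp (-(ε * t)) ≤ Real.exp (2 * t₀) * Real.exp t := by
    rw [← Real.exp_add, ← Real.exp_add, Real.exp_le_exp]
    have := Real.pi_gt_three
    have := Real.pi_lt_four
    rcases le_total t 0 with h | h <;> nlinarith
  calc (2 * π) ^ (-a) * Real.exp (π / 2 * t) * ‖Gamma (a + t * I)‖ * (Real.exp (-(a * A)) * Real.exp (-(ε * t)))
      = ((2 * π) ^ (-a) * ‖Gamma (a + t * I)‖) * Real.exp (-(a * A)) * (Real.exp (π / 2 * t) * Real.exp (-(ε * t))) := by ring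
    _ ≤ (1 * K) * Real.exp (-(a * A)) * (Real.exp (2 * t₀) * Real.exp t) := by gcongr
    _ = _ := by ring

lemma RF_integrable {a A ε : ℝ} (h1 : 1 ≤ a) (h2 : a ≤ 2) (hε : 0 < ε) (hε2 : ε ≤ 1/2) :
    MeasureTheory.Integrable (fun t : ℝ => RF A ε (a + t * I)) := by
  obtain ⟨K, hK, hl⟩ := RF_left_bound
  obtain ⟨C, hC, hX⟩ := XF_bound
  have hc := RF_cont (A := A) (ε := ε) (σ := a) (by linarith)
  rw [← MeasureTheory.integrableOn_univ, ← Set.Iic_union_Ioi (a := (1:ℝ)), MeasureTheory.integrableOn_union]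
  constructor
  · refine MeasureTheory.Integrable.mono' ((integrableOn_exp_Iic 1).const_mul (K * Real.exp (-(a * A)) * Real.exp (2 * 1)))
      hc.aestronglyMeasurable ?_
    rw [MeasureTheory.ae_restrict_iff' measurableSet_Iic]
    exact Eventually.of_forall (fun t ht => hl a A ε 1 t h1 h2 hε.le hε2 (by norm_num) ht)
  · have hb := integrableOn_rpow_mul_exp_neg_mul_rpow (p := 1) (s := 2) (b := ε) (by norm_num) (by norm_num) hε
    refine MeasureTheory.Integrable.mono' ((hb.mono_set (Set.Ioi_subset_Ioi (by norm_num : (0:ℝ) ≤ 1))).const_mul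
      (C * Real.exp (-(a * A)))) hc.aestronglyMeasurable ?_
    rw [MeasureTheory.ae_restrict_iff' measurableSet_Ioi]
    refine Eventually.of_forall (fun t ht => ?_)
    have ht1 : (1:ℝ) ≤ t := le_of_lt ht
    have := hX (a + t * I) (by simp; linarith) (by simp; linarith) (by simpa using ht1)
    rw [RF_norm]
    have hre : (a + t * I : ℂ).re = a := by simp
    have him : (a + t * I : ℂ).im = t := by simp
    rw [hre, him] at this ⊢
    rw [Real.rpow_one]
    have e : t ^ (a - 1/2) ≤ t ^ (2:ℝ) := Real.rpow_le_rpow_of_exponent_le ht1 (by linarith)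
    calc _ ≤ (C * t ^ (2:ℝ)) * (Real.exp (-(a * A)) * Real.exp (-(ε * t))) := by
          gcongr; exact this.trans (by gcongr)
      _ = _ := by rw [neg_mul]; ring

lemma RF_mellin {a A ε : ℝ} (h1 : 1 ≤ a) (h2 : a ≤ 2) (hε : 0 < ε) (hε2 : ε ≤ 1/2) :
    ∫ t : ℝ, RF A ε (a + t * I) = 2 * π *
      cexp (-cexp (Real.log (2 * π) + A + I * (π / 2) - I * ε)) := by
  set w : ℂ := Real.log (2 * π) + A + I * (π / 2) - I * ε with hw
  set z := cexp w with hz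
  have hwim : w.im = π / 2 - ε := by
    rw [hw]; simp
  have hlog : Complex.log z = w := by
    rw [hz, Complex.log_exp] <;> rw [hwim] <;> linarith [Real.pi_gt_three]
  have hzre : 0 < z.re := by
    rw [hz, exp_re, hwim]
    apply mul_pos (Real.exp_pos _)
    rw [Real.cos_pi_div_two_sub]
    exact Real.sin_pos_of_pos_of_lt_pi hε (by linarith [Real.pi_gt_three])
  have hmel : ∀ s : ℂ, 0 < s.re → mellin (fun x : ℝ => cexp (-(z * x))) s = RF A ε s := by
    intro s hs
    rw [mellin]
    simp only [smul_eq_mul]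
    rw [gamma_cexp hs hzre, hlog, RF, XF, mul_right_comm, ← Complex.exp_add]
    congr 2
    rw [hw]; ring
  have hline : ∀ t : ℝ, mellin (fun x : ℝ => cexp (-(z * x))) (a + t * I) = RF A ε (a + t * I) :=
    fun t => hmel _ (by simp; linarith)
  have hinv := mellinInv_mellin_eq a (fun x : ℝ => cexp (-(z * x))) (x := 1) one_pos ?_ ?_ ?_
  · rw [mellinInv] at hinv
    simp only [hline, ofReal_one, one_cpow, one_smul, mul_one, Complex.real_smul] at hinv
    rw [← hinv]
    push_cast
    have := Real.pi_ne_zero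
    have : (π:ℂ) ≠ 0 := by exact_mod_cast this
    generalize (∫ t : ℝ, RF A ε (a + t * I)) = J
    field_simp
  · have := gamma_cexp_integrable (s := a) (z := z) (by simp; linarith) hzre
    exact this
  · rw [VerticalIntegrable]
    simp only [hline]
    exact RF_integrable h1 h2 hε hε2
  · fun_prop

lemma RF_analyticAt {A ε : ℝ} {s : ℂ} (hs : 0 < s.re) : AnalyticAt ℂ (RF A ε) s := by
  rw [Complex.analyticAt_iff_eventually_differentiableAt]
  filter_upwards [(isOpen_lt continuous_const continuous_re).mem_nhds hs] with z hz
  exact (RF_hasDerivAt hz).differentiableAt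

lemma RF_horiz : ∃ C > (0:ℝ), ∀ a A ε T : ℝ, 1 ≤ a → a ≤ 2 → 0 ≤ ε → 1 ≤ T → Real.exp A ≤ T →
    ‖∫ x in (1/4:ℝ)..a, RF A ε (x + T * I)‖ ≤
      C * (Real.exp (-(a * A)) * T ^ (a - 1/2)) * Real.exp (-(ε * T)) := by
  obtain ⟨C, hC, hX⟩ := XF_bound
  refine ⟨C * 2, by positivity, fun a A ε T h1 h2 hε hT hA => ?_⟩
  have hT0 : 0 < T := by linarith
  have key : ∀ x ∈ Set.uIoc (1/4) a, ‖RF A ε (x + T * I)‖ ≤ C * (Real.exp (-(a * A)) * T ^ (a - 1/2)) * Real.exp (-(ε * T)) := by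
    intro x hx
    rw [Set.uIoc_of_le (by linarith)] at hx
    have hre : (x + T * I : ℂ).re = x := by simp
    have him : (x + T * I : ℂ).im = T := by simp
    rw [RF_norm]
    have := hX (x + T * I) (by rw [hre]; linarith [hx.1]) (by rw [hre]; linarith [hx.2]) (by rwa [him])
    rw [hre, him] at this ⊢
    have e : T ^ (x - 1/2) * Real.exp (-(x * A)) ≤ T ^ (a - 1/2) * Real.exp (-(a * A)) := by
      rw [Real.rpow_def_of_pos hT0, Real.rpow_def_of_pos hT0, ← Real.exp_add, ← Real.exp_add, Real.exp_le_exp]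
      have : A ≤ Real.log T := by rw [Real.le_log_iff_exp_le hT0]; exact hA
      nlinarith [hx.2]
    calc _ ≤ (C * T ^ (x - 1/2)) * (Real.exp (-(x * A)) * Real.exp (-(ε * T))) := by gcongr
      _ = C * (T ^ (x - 1/2) * Real.exp (-(x * A))) * Real.exp (-(ε * T)) := by ring
      _ ≤ C * (T ^ (a - 1/2) * Real.exp (-(a * A))) * Real.exp (-(ε * T)) := by gcongr
      _ = _ := by ring
  refine (intervalIntegral.norm_integral_le_of_norm_le_const key).trans ?_
  rw [abs_of_nonneg (by linarith)]
  have : 0 ≤ C * (Real.exp (-(a * A)) * T ^ (a - 1/2)) * Real.exp (-(ε * T)) := by positivity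
  nlinarith

/-- Tail of the regularised integral. -/
lemma RF_tail : ∃ C > (0:ℝ), ∀ a A ε T : ℝ, 1 ≤ a → a ≤ 2 → 0 < ε → ε ≤ 1/2 → 144 ≤ T →
    2 * π * Real.exp A ≤ T - Real.sqrt T →
    ‖∫ t in Set.Ioi T, RF A ε (a + t * I)‖ ≤
      C * (Real.exp (-(a * A)) * T ^ (a - 1/2)) * (1 + T / (T - 2 * π * Real.exp A)) := by
  obtain ⟨C1, hC1, hosc⟩ := RF_osc
  obtain ⟨C2, hC2, hhor⟩ := RF_horiz
  refine ⟨2 * C1 + C2, by positivity, fun a A ε T h1 h2 hε hε2 hT hq => ?_⟩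
  have hT0 : 0 < T := by linarith
  set q := 2 * π * Real.exp A with hqd
  have hq0 : 0 < q := by positivity
  have hsT : 12 ≤ Real.sqrt T := by
    rw [show (12:ℝ) = Real.sqrt 144 by rw [show (144:ℝ) = 12 ^ 2 by norm_num]; simp]
    exact Real.sqrt_le_sqrt hT
  have hsT2 : Real.sqrt T * Real.sqrt T = T := Real.mul_self_sqrt hT0.le
  have hAT : Real.exp A ≤ T := by
    have : Real.exp A ≤ q := by rw [hqd]; nlinarith [Real.exp_pos A, Real.pi_gt_three]
    linarith
  have hTq : 0 < T - q := by linarith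
  have hlogge : ∀ t, T ≤ t → (T - q) / T ≤ Real.log (t / q) := by
    intro t ht
    have ht0 : 0 < t := by linarith
    have := Real.one_sub_inv_le_log_of_pos (show 0 < t / q by positivity)
    have e : 1 - (t / q)⁻¹ = 1 - q / t := by rw [inv_div]
    rw [e] at this
    have : q / t ≤ q / T := by gcongr
    have e2 : (T - q) / T = 1 - q / T := by field_simp
    linarith
  have hfrac : 1 / Real.sqrt T ≤ (T - q) / T := by
    rw [div_le_div_iff₀ (by positivity) hT0]; nlinarith
  have hB0 : 0 ≤ Real.exp (-(a * A)) * T ^ (a - 1/2) := by positivity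
  have hfin : ∀ M : ℝ, T ≤ M → ‖∫ t in T..M, RF A ε (a + t * I)‖ ≤
      2 * C1 * (Real.exp (-(a * A)) * T ^ (a - 1/2)) * (T / (T - q)) + C2 * (Real.exp (-(a * A)) * T ^ (a - 1/2))
        + C2 * (Real.exp (-(a * A)) * M ^ (a - 1/2)) * Real.exp (-(ε * M)) := by
    intro M hM
    have hrect := rectInt_eq_zero (a := 1/4) (b := a) (c := T) (d := M) (by linarith) hM (f := RF A ε)
      (fun z hz _ => RF_analyticAt (by linarith [hz.1]))
    rw [rectInt] at hrect
    have e1 : ‖∫ t in T..M, RF A ε ((1/4:ℝ) + t * I)‖ ≤ 2 * C1 * (Real.exp (-(a * A)) * T ^ (a - 1/2)) * (T / (T - q)) := by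
      refine (hosc (1/4) A ε T M (T ^ ((1/4:ℝ) - 1/2)) (by norm_num) (by norm_num) hε.le (by linarith) hM ?_ ?_).trans ?_
      · intro t ht
        have := hlogge t ht.1
        rw [abs_of_nonneg (le_trans (by positivity) this)]
        refine le_trans ?_ (hfrac.trans this)
        have ht0 : 0 < t := by linarith [ht.1]
        rw [div_le_div_iff₀ ht0 (by positivity)]
        nlinarith [ht.1]
      · intro t ht
        exact Real.rpow_le_rpow_of_nonpos hT0 ht.1 (by norm_num)
      · have f1 : Real.exp (-(1/4 * A)) * T ^ ((1/4:ℝ) - 1/2) ≤ Real.exp (-(a * A)) * T ^ (a - 1/2) := by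
          rw [Real.rpow_def_of_pos hT0, Real.rpow_def_of_pos hT0, ← Real.exp_add, ← Real.exp_add, Real.exp_le_exp]
          have : A ≤ Real.log T := by rw [Real.le_log_iff_exp_le hT0]; exact hAT
          nlinarith
        have f2 : ∀ t, T ≤ t → 1 / |Real.log (t / q)| ≤ T / (T - q) := by
          intro t ht
          have := hlogge t ht
          rw [abs_of_nonneg (le_trans (by positivity) this)]
          have e := one_div_le_one_div_of_le (by positivity) this
          rwa [one_div_div] at e
        have f3 := f2 T le_rfl
        have f4 := f2 M hM
        calc _ ≤ C1 * (Real.exp (-(a * A)) * T ^ (a - 1/2)) * (T / (T - q) + T / (T - q)) := by gcongr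
          _ = _ := by ring
    have e2 := hhor a A ε T h1 h2 hε.le (by linarith) hAT
    have e3 := hhor a A ε M h1 h2 hε.le (by linarith) (hAT.trans hM)
    have e2' : C2 * (Real.exp (-(a * A)) * T ^ (a - 1/2)) * Real.exp (-(ε * T)) ≤ C2 * (Real.exp (-(a * A)) * T ^ (a - 1/2)) := by
      apply mul_le_of_le_one_right (by positivity)
      rw [Real.exp_le_one_iff]; have : 0 ≤ ε * T := by positivity
      linarith
    set P := ∫ x in (1/4:ℝ)..a, RF A ε (x + T * I)
    set Q := ∫ x in (1/4:ℝ)..a, RF A ε (x + M * I)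
    set R := ∫ t in T..M, RF A ε ((1/4:ℝ) + t * I)
    have e4 : (∫ t in T..M, RF A ε (a + t * I)) = R + I * P - I * Q := by
      have hI : I * I = -1 := I_mul_I
      linear_combination (-I) * hrect + ((∫ t in T..M, RF A ε (a + t * I)) - R) * hI
    rw [e4]
    have e5 := norm_sub_le (R + I * P) (I * Q)
    have e6 := norm_add_le R (I * P)
    rw [norm_mul, norm_I, one_mul] at e5 e6
    linarith
  have hlim := MeasureTheory.intervalIntegral_tendsto_integral_Ioi T
    ((RF_integrable (A := A) h1 h2 hε hε2).integrableOn (s := Set.Ioi T)) tendsto_id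
  have hdec : Tendsto (fun M : ℝ => 2 * C1 * (Real.exp (-(a * A)) * T ^ (a - 1/2)) * (T / (T - q)) + C2 * (Real.exp (-(a * A)) * T ^ (a - 1/2))
        + C2 * (Real.exp (-(a * A)) * M ^ (a - 1/2)) * Real.exp (-(ε * M))) atTop
      (𝓝 (2 * C1 * (Real.exp (-(a * A)) * T ^ (a - 1/2)) * (T / (T - q)) + C2 * (Real.exp (-(a * A)) * T ^ (a - 1/2)) + C2 * Real.exp (-(a * A)) * 0)) := by
    refine tendsto_const_nhds.add ?_
    have := (tendsto_rpow_mul_exp_neg_mul_atTop_nhds_zero (a - 1/2) ε hε).const_mul (C2 * Real.exp (-(a * A)))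
    refine this.congr (fun M => ?_)
    rw [neg_mul]; ring
  have hle := le_of_tendsto_of_tendsto hlim.norm hdec (by
    filter_upwards [eventually_ge_atTop T] with M hM
    exact hfin M hM)
  refine hle.trans ?_
  have : 0 ≤ T / (T - q) := by positivity
  have e7 : 0 ≤ (Real.exp (-(a * A)) * T ^ (a - 1/2)) * (T / (T - q)) := by positivity
  nlinarith

/-- Low frequencies: the integral equals the main term up to a small error. -/
lemma gonek_low : ∃ C > (0:ℝ), ∀ a A t₀ T : ℝ, 1 ≤ a → a ≤ 2 → 1 ≤ t₀ → t₀ ≤ 31 → 144 ≤ T →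
    2 * π * Real.exp A ≤ T - Real.sqrt T →
    ‖(∫ t in t₀..T, RF A 0 (a + t * I)) - 2 * π * cexp (-(2 * π * Real.exp A * I))‖ ≤
      C * (Real.exp (-(a * A)) * T ^ (a - 1/2)) * (1 + T / (T - 2 * π * Real.exp A)) := by
  obtain ⟨K, hK, hl⟩ := RF_left_bound
  obtain ⟨C, hC, htail⟩ := RF_tail
  refine ⟨K * Real.exp 93 + C, by positivity, fun a A t₀ T h1 h2 ht0 ht1 hT hq => ?_⟩
  set q := 2 * π * Real.exp A with hqd
  have hsT : 0 < Real.sqrt T := Real.sqrt_pos.mpr (by linarith)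
  have hTq : 0 < T - q := by linarith
  have hT0 : 0 < T := by linarith
  have hreg : ∀ ε : ℝ, 0 < ε → ε ≤ 1/2 →
      ‖(∫ t in t₀..T, RF A ε (a + t * I)) - 2 * π *
        cexp (-cexp (Real.log (2 * π) + A + I * (π / 2) - I * ε))‖ ≤
      (K * Real.exp 93 + C) * (Real.exp (-(a * A)) * T ^ (a - 1/2)) * (1 + T / (T - q)) := by
    intro ε hε hε2
    have hint := RF_integrable (A := A) h1 h2 hε hε2
    rw [← RF_mellin h1 h2 hε hε2]
    have s1 := intervalIntegral.integral_Iic_add_Ioi (b := t₀) hint.integrableOn hint.integrableOn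
    have s2 := intervalIntegral.integral_Ioi_sub_Ioi (a := t₀) (b := T) hint.integrableOn (by linarith)
    rw [← s1, ← s2]
    have b1 := htail a A ε T h1 h2 hε hε2 hT hq
    have b2 : ‖∫ t in Set.Iic t₀, RF A ε (a + t * I)‖ ≤ K * Real.exp 93 * Real.exp (-(a * A)) := by
      have := MeasureTheory.norm_integral_le_of_norm_le
        ((integrableOn_exp_Iic t₀).const_mul (K * Real.exp (-(a * A)) * Real.exp (2 * t₀)))
        (f := fun t : ℝ => RF A ε (a + t * I)) (by
          rw [MeasureTheory.ae_restrict_iff' measurableSet_Iic]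
          exact Eventually.of_forall (fun t ht => hl a A ε t₀ t h1 h2 hε.le hε2 (by linarith) ht))
      refine this.trans ?_
      rw [MeasureTheory.integral_const_mul, integral_exp_Iic]
      calc _ = K * Real.exp (-(a * A)) * (Real.exp (2 * t₀) * Real.exp t₀) := by ring
        _ ≤ K * Real.exp (-(a * A)) * Real.exp 93 := by
            rw [← Real.exp_add]; gcongr; linarith
        _ = _ := by ring
    have e : ∀ x y z : ℂ, x - y - (z + x) = -(z + y) := fun x y z => by ring
    rw [e, norm_neg]
    refine (norm_add_le _ _).trans ((add_le_add b2 b1).trans ?_)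
    have hone : 1 ≤ T ^ (a - 1/2) := Real.one_le_rpow (by linarith) (by linarith)
    have hp : 0 ≤ T / (T - q) := by positivity
    have : K * Real.exp 93 * Real.exp (-(a * A)) ≤ K * Real.exp 93 * (Real.exp (-(a * A)) * T ^ (a - 1/2)) * (1 + T / (T - q)) := by
      have h3 : Real.exp (-(a * A)) * 1 * 1 ≤ (Real.exp (-(a * A)) * T ^ (a - 1/2)) * (1 + T / (T - q)) := by
        gcongr; linarith
      have : 0 < K * Real.exp 93 := by positivity
      nlinarith
    linarith
  have hcont : Continuous (fun ε : ℝ => (∫ t in t₀..T, RF A ε (a + t * I)) - 2 * π *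
        cexp (-cexp (Real.log (2 * π) + A + I * (π / 2) - I * ε))) := by
    apply Continuous.sub
    · apply intervalIntegral.continuous_parametric_intervalIntegral_of_continuous'
      have hX := XF_line_cont (σ := a) (by linarith)
      simp only [RF, Function.uncurry_def]
      exact (hX.comp continuous_snd).mul (by fun_prop)
    · fun_prop
  have hlim : Tendsto _ (𝓝[>] (0:ℝ)) _ := (hcont.norm.tendsto 0).mono_left nhdsWithin_le_nhds
  have hle := le_of_tendsto hlim (by
    filter_upwards [Ioc_mem_nhdsGT (show (0:ℝ) < 1/2 by norm_num)] with ε hε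
    exact hreg ε hε.1 hε.2)
  have e0 : cexp (Real.log (2 * π) + A + I * (π / 2) - I * (0:ℝ)) = 2 * π * Real.exp A * I := by
    rw [show (Real.log (2 * π) + A + I * (π / 2) - I * (0:ℝ) : ℂ) = (Real.log (2 * π) : ℝ) + A + π / 2 * I by push_cast; ring]
    rw [Complex.exp_add, Complex.exp_add, exp_pi_div_two_mul_I, ← ofReal_exp, Real.exp_log (by positivity)]
    push_cast; ring
  rw [e0] at hle
  exact hle

/-- High frequencies. -/
lemma gonek_high : ∃ C > (0:ℝ), ∀ a A t₀ T : ℝ, 1 ≤ a → a ≤ 2 → 30 ≤ t₀ → t₀ ≤ 31 → 2304 ≤ T →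
    T + Real.sqrt T ≤ 2 * π * Real.exp A →
    ‖∫ t in t₀..T, RF A 0 (a + t * I)‖ ≤
      C * (Real.exp (-(a * A)) * T ^ (a - 1/2)) * (1 + T / (2 * π * Real.exp A - T)) := by
  obtain ⟨C1, hC1, hosc⟩ := RF_osc
  refine ⟨2 * C1, by positivity, fun a A t₀ T h1 h2 ht0 ht1 hT hq => ?_⟩
  have hT0 : 0 < T := by linarith
  set q := 2 * π * Real.exp A with hqd
  have hq0 : 0 < q := by positivity
  have hsT : 48 ≤ Real.sqrt T := by
    rw [show (48:ℝ) = Real.sqrt 2304 by rw [show (2304:ℝ) = 48 ^ 2 by norm_num]; simp]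
    exact Real.sqrt_le_sqrt hT
  have hsT2 : Real.sqrt T * Real.sqrt T = T := Real.mul_self_sqrt hT0.le
  have hTq : 0 < q - T := by linarith
  have hlog : ∀ t, 0 < t → t ≤ T → (q - t) / q ≤ |Real.log (t / q)| := by
    intro t ht htT
    have := Real.one_sub_inv_le_log_of_pos (show 0 < q / t by positivity)
    have e : 1 - (q / t)⁻¹ = (q - t) / q := by rw [inv_div]; field_simp
    rw [e] at this
    have e2 : Real.log (t / q) = - Real.log (q / t) := by rw [← Real.log_inv, inv_div]
    rw [e2, abs_neg]
    exact this.trans (le_abs_self _)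
  have f2 : ∀ t, 0 < t → t ≤ T → 1 / |Real.log (t / q)| ≤ 1 + T / (q - T) := by
    intro t ht htT
    have := hlog t ht htT
    have h3 : (q - T) / q ≤ (q - t) / q := by gcongr
    have e := one_div_le_one_div_of_le (by positivity) (h3.trans this)
    rw [one_div_div] at e
    refine e.trans (le_of_eq ?_)
    field_simp; ring
  refine (hosc a A 0 t₀ T (T ^ (a - 1/2)) (by linarith) h2 le_rfl (by linarith) (by linarith) ?_ ?_).trans ?_
  · intro t ht
    have ht' : 30 ≤ t := ht0.trans ht.1
    have htp : 0 < t := by linarith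
    refine le_trans ?_ (hlog t htp ht.2)
    rcases le_total t (T / 2) with h | h
    · have : 12 / t ≤ 1/2 := by rw [div_le_div_iff₀ htp (by norm_num)]; linarith
      refine this.trans ?_
      rw [div_le_div_iff₀ (by norm_num) hq0]; nlinarith
    · have e1 : 12 / t ≤ 24 / T := by rw [div_le_div_iff₀ htp hT0]; linarith
      refine e1.trans ?_
      rw [div_le_div_iff₀ hT0 hq0]
      have : (24:ℝ) * q ≤ (q - T) * T := by nlinarith
      nlinarith [ht.2]
  · intro t ht
    exact Real.rpow_le_rpow (by linarith [ht.1]) ht.2 (by linarith)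
  · have f3 := f2 t₀ (by linarith) (by linarith)
    have f4 := f2 T hT0 le_rfl
    calc _ ≤ C1 * (Real.exp (-(a * A)) * T ^ (a - 1/2)) * ((1 + T / (q - T)) + (1 + T / (q - T))) := by gcongr
      _ = _ := by ring

set_option maxHeartbeats 1000000 in
/-- Gonek's lemma for a general frequency. -/
lemma gonek : ∃ C > (0:ℝ), ∀ a A t₀ T : ℝ, 1 ≤ a → a ≤ 2 → 30 ≤ t₀ → t₀ ≤ 31 → 10000 ≤ T →
    ‖(∫ t in t₀..T, RF A 0 (a + t * I)) -
      (if 2 * π * Real.exp A ≤ T then 2 * π * cexp (-(2 * π * Real.exp A * I)) else 0)‖ ≤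
      C * (Real.exp (-(a * A)) * T ^ (a - 1/2)) *
        (1 + T / (|T - 2 * π * Real.exp A| + Real.sqrt T)) := by
  obtain ⟨C1, hC1, hlow⟩ := gonek_low
  obtain ⟨C2, hC2, hhigh⟩ := gonek_high
  obtain ⟨C3, hC3, hX⟩ := XF_bound
  refine ⟨2 * C1 + 2 * C2 + (C2 * 2 + 4 * C3 + 14), by positivity, fun a A t₀ T h1 h2 ht0 ht1 hT => ?_⟩
  have hT0 : 0 < T := by linarith
  set q := 2 * π * Real.exp A with hqd
  have hq0 : 0 < q := by positivity
  set r := Real.sqrt T with hr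
  have hsT : 100 ≤ r := by
    rw [hr, show (100:ℝ) = Real.sqrt 10000 by rw [show (10000:ℝ) = 100 ^ 2 by norm_num]; simp]
    exact Real.sqrt_le_sqrt hT
  have hsT2 : r * r = T := Real.mul_self_sqrt hT0.le
  have hr0 : 0 < r := by linarith
  set E := Real.exp (-(a * A)) * T ^ (a - 1/2) with hE
  have hE0 : 0 < E := by positivity
  set D := |T - q| + r with hD
  have hD0 : 0 < D := by positivity
  have hTD : 0 < T / D := by positivity
  rcases le_or_gt q (T - r) with h | h
  · rw [if_pos (by linarith)]
    refine (hlow a A t₀ T h1 h2 (by linarith) ht1 (by linarith) h).trans ?_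
    have hd : T / (T - q) ≤ 2 * (T / D) := by
      rw [← mul_div_assoc, div_le_div_iff₀ (by linarith) hD0, hD, abs_of_nonneg (by linarith)]
      nlinarith
    calc C1 * E * (1 + T / (T - q)) ≤ C1 * E * (2 * (1 + T / D)) := by gcongr; linarith
      _ = (2 * C1) * (E * (1 + T / D)) := by ring
      _ ≤ (2 * C1 + 2 * C2 + (C2 * 2 + 4 * C3 + 14)) * (E * (1 + T / D)) := by
          gcongr; nlinarith
      _ = _ := by ring
  rcases le_or_gt (T + r) q with h' | h'
  · rw [if_neg (by linarith), sub_zero]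
    refine (hhigh a A t₀ T h1 h2 ht0 ht1 (by linarith) h').trans ?_
    have hd : T / (q - T) ≤ 2 * (T / D) := by
      rw [← mul_div_assoc, div_le_div_iff₀ (by linarith) hD0, hD, abs_of_nonpos (by linarith)]
      nlinarith
    calc C2 * E * (1 + T / (q - T)) ≤ C2 * E * (2 * (1 + T / D)) := by gcongr; linarith
      _ = (2 * C2) * (E * (1 + T / D)) := by ring
      _ ≤ (2 * C1 + 2 * C2 + (C2 * 2 + 4 * C3 + 14)) * (E * (1 + T / D)) := by
          gcongr; nlinarith
      _ = _ := by ring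
  · have hDle : D ≤ 2 * r := by
      have : |T - q| ≤ r := by rw [abs_le]; constructor <;> linarith
      linarith
    have hrle : r ≤ 2 * (T / D) := by
      rw [← mul_div_assoc, le_div_iff₀ hD0]; nlinarith
    set T' := T - 2 * r with hT'
    have hT'T : T' ≤ T := by linarith
    have hT'b : 2304 ≤ T' := by nlinarith
    have hr' : Real.sqrt T' ≤ r := Real.sqrt_le_sqrt hT'T
    have i1 := hhigh a A t₀ T' h1 h2 ht0 ht1 hT'b (by linarith)
    have hpow : T' ^ (a - 1/2) ≤ T ^ (a - 1/2) := Real.rpow_le_rpow (by linarith) hT'T (by linarith)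
    have i2 : T' / (q - T') ≤ r := by
      rw [div_le_iff₀ (by linarith)]; nlinarith
    have i3 : ‖∫ t in t₀..T', RF A 0 (a + t * I)‖ ≤ C2 * E * (1 + r) := by
      refine i1.trans ?_
      have : 0 ≤ T' / (q - T') := div_nonneg (by linarith) (by linarith)
      rw [hE]
      gcongr
    have i4 : ‖∫ t in T'..T, RF A 0 (a + t * I)‖ ≤ (C3 * E) * |T - T'| := by
      apply intervalIntegral.norm_integral_le_of_norm_le_const
      intro t ht
      rw [Set.uIoc_of_le hT'T] at ht
      have := hX (a + t * I) (by simp; linarith) (by simp; linarith) (by simp; linarith [ht.1])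
      rw [RF_norm]
      have hre : (a + t * I : ℂ).re = a := by simp
      have him : (a + t * I : ℂ).im = t := by simp
      rw [hre, him] at this ⊢
      have hp : t ^ (a - 1/2) ≤ T ^ (a - 1/2) := Real.rpow_le_rpow (by linarith [ht.1]) ht.2 (by linarith)
      rw [zero_mul, neg_zero, Real.exp_zero, mul_one]
      calc _ ≤ (C3 * T ^ (a - 1/2)) * Real.exp (-(a * A)) := by gcongr; exact this.trans (by gcongr)
        _ = _ := by rw [hE]; ring
    have hadj : (∫ t in t₀..T, RF A 0 (a + t * I)) = (∫ t in t₀..T', RF A 0 (a + t * I)) + ∫ t in T'..T, RF A 0 (a + t * I) := by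
      have hc := RF_cont (A := A) (ε := 0) (σ := a) (by linarith)
      rw [intervalIntegral.integral_add_adjacent_intervals (hc.intervalIntegrable _ _) (hc.intervalIntegrable _ _)]
    have habs : |T - T'| = 2 * r := by rw [hT', abs_of_nonneg (by linarith)]; ring
    rw [habs] at i4
    have i5 : ‖(if q ≤ T then 2 * π * cexp (-(2 * π * Real.exp A * I)) else 0 : ℂ)‖ ≤ 7 * (E * r) := by
      have hEr : 1 ≤ E * r := by
        rw [hE, hr, Real.sqrt_eq_rpow, mul_assoc, ← Real.rpow_add hT0, sub_add_cancel,
          Real.rpow_def_of_pos hT0, ← Real.exp_add, Real.one_le_exp_iff]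
        have : A ≤ Real.log T := by
          rw [Real.le_log_iff_exp_le hT0]
          have : 6 * Real.exp A ≤ q := by rw [hqd]; nlinarith [Real.exp_pos A, Real.pi_gt_three]
          have hrT : r ≤ T := by rw [← hsT2]; exact le_mul_of_one_le_left hr0.le (by linarith)
          linarith [Real.exp_pos A]
        have := mul_le_mul_of_nonneg_left this (show 0 ≤ a by linarith)
        linarith
      split_ifs
      · rw [norm_mul, Complex.norm_exp]
        have e1 : (-(2 * π * Real.exp A * I : ℂ)).re = 0 := by
          rw [show (-(2 * π * Real.exp A * I : ℂ)) = ((-(2 * π * Real.exp A) : ℝ):ℂ) * I by push_cast; ring]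
          simp only [mul_re, ofReal_re, ofReal_im, I_re, I_im]; ring
        rw [e1, Real.exp_zero, mul_one, norm_mul, norm_real, Real.norm_eq_abs, abs_of_pos Real.pi_pos]
        simp only [Complex.norm_ofNat]
        linarith [Real.pi_lt_d2]
      · rw [norm_zero]; linarith
    rw [hadj]
    refine (norm_sub_le _ _).trans ?_
    have i6 := norm_add_le (∫ t in t₀..T', RF A 0 (a + t * I)) (∫ t in T'..T, RF A 0 (a + t * I))
    have hEr : E * r ≤ 2 * (E * (T / D)) := by nlinarith
    calc _ ≤ (C2 * E * (1 + r) + C3 * E * (2 * r)) + 7 * (E * r) := by linarith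
      _ = C2 * E + (C2 + 2 * C3 + 7) * (E * r) := by ring
      _ ≤ C2 * E + (C2 + 2 * C3 + 7) * (2 * (E * (T / D))) := by gcongr
      _ ≤ _ := by
        have : 0 < E * (T / D) := by positivity
        have k1 := mul_pos hC1 hE0
        have k2 := mul_pos hC2 hE0
        have k3 := mul_pos hC3 hE0
        have k4 := mul_pos hC1 this
        have k5 := mul_pos hC2 this
        have e : (2 * C1 + 2 * C2 + (C2 * 2 + 4 * C3 + 14)) * E * (1 + T / D) =
          2 * (C1 * E) + 4 * (C2 * E) + 4 * (C3 * E) + 14 * E + 2 * (C1 * (E * (T / D)))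
            + 4 * (C2 * (E * (T / D))) + 4 * (C3 * (E * (T / D))) + 14 * (E * (T / D)) := by ring
        rw [e]
        linarith

lemma RF_log (n : ℕ) (hn : 1 ≤ n) (s : ℂ) : RF (Real.log n) 0 s = XF s * (n:ℂ) ^ (-s) := by
  have hn0 : (n:ℂ) ≠ 0 := by exact_mod_cast (by omega : n ≠ 0)
  rw [RF, Complex.cpow_def_of_ne_zero hn0, ← Complex.natCast_log]
  congr 2
  simp; ring

lemma gonek_YF : ∃ C > (0:ℝ), ∀ (a t₀ T : ℝ) (n : ℕ), 1 ≤ a → a ≤ 2 → 30 ≤ t₀ → t₀ ≤ 31 → 10000 ≤ T → 1 ≤ n →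
    ‖(∫ t in t₀..T, YF (a + t * I) * (n:ℂ) ^ (-((a:ℂ) + t * I))) -
      (if 2 * π * n ≤ T then 2 * (π:ℂ) else 0)‖ ≤
      C * ((n:ℝ) ^ (-a) * T ^ (a - 1/2)) * (1 + T / (|T - 2 * π * n| + Real.sqrt T)) := by
  obtain ⟨C1, hC1, hg⟩ := gonek
  obtain ⟨C2, hC2, hX⟩ := XF_bound
  refine ⟨C1 + C2, by positivity, fun a t₀ T n h1 h2 ht0 ht1 hT hn => ?_⟩
  have hn0 : (0:ℝ) < n := by exact_mod_cast hn
  have hT0 : 0 < T := by linarith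
  have h := hg a (Real.log n) t₀ T h1 h2 ht0 ht1 hT
  have he : Real.exp (Real.log n) = n := Real.exp_log hn0
  have hna : Real.exp (-(a * Real.log n)) = (n:ℝ) ^ (-a) := by
    rw [Real.rpow_def_of_pos hn0]; ring_nf
  have hc1 : cexp (-(2 * π * ((n:ℝ):ℂ) * I)) = 1 := by
    rw [Complex.exp_eq_one_iff]; exact ⟨-(n:ℤ), by push_cast; ring⟩
  rw [he, hna, hc1, mul_one] at h
  have hcn : Continuous (fun t : ℝ => (n:ℂ) ^ (-((a:ℂ) + t * I))) := by
    refine Continuous.const_cpow (by fun_prop) (Or.inl ?_)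
    exact_mod_cast hn0.ne'
  have hcX := XF_line_cont (σ := a) (by linarith)
  have hi1 : IntervalIntegrable (fun t : ℝ => RF (Real.log n) 0 (a + t * I)) MeasureTheory.volume t₀ T :=
    (RF_cont (by linarith)).intervalIntegrable _ _
  have hi2 : IntervalIntegrable (fun t : ℝ => XF (a + t * I) * cexp (I * π * ((a:ℂ) + t * I)) *
      (n:ℂ) ^ (-((a:ℂ) + t * I))) MeasureTheory.volume t₀ T :=
    ((hcX.mul (by fun_prop)).mul hcn).intervalIntegrable _ _
  have hsplit : (∫ t in t₀..T, YF (a + t * I) * (n:ℂ) ^ (-((a:ℂ) + t * I))) =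
      (∫ t in t₀..T, RF (Real.log n) 0 (a + t * I)) + ∫ t in t₀..T, XF (a + t * I) * cexp (I * π * ((a:ℂ) + t * I)) *
      (n:ℂ) ^ (-((a:ℂ) + t * I)) := by
    rw [← intervalIntegral.integral_add hi1 hi2]
    refine intervalIntegral.integral_congr fun t _ => ?_
    rw [RF_log n hn, YF]; ring
  have hb2 : ‖∫ t in t₀..T, XF (a + t * I) * cexp (I * π * ((a:ℂ) + t * I)) *
      (n:ℂ) ^ (-((a:ℂ) + t * I))‖ ≤ C2 * ((n:ℝ) ^ (-a) * T ^ (a - 1/2)) := by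
    have : ‖∫ t in t₀..T, XF (a + t * I) * cexp (I * π * ((a:ℂ) + t * I)) *
      (n:ℂ) ^ (-((a:ℂ) + t * I))‖ ≤ ∫ t in t₀..T, C2 * ((n:ℝ) ^ (-a) * T ^ (a - 1/2)) * Real.exp (-t) := by
      refine intervalIntegral.norm_integral_le_of_norm_le (by linarith) ?_ ?_
      · refine Eventually.of_forall fun t ht => ?_
        rw [norm_mul, norm_mul, Complex.norm_natCast_cpow_of_pos (by omega), Complex.norm_exp]
        have hx := hX (a + t * I) (by simp; linarith) (by simp; linarith) (by simp; linarith [ht.1])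
        simp only [add_re, ofReal_re, mul_re, I_re, mul_zero, ofReal_im, I_im, mul_one, sub_self, add_zero, add_im, mul_im, zero_add, neg_re] at hx ⊢
        have hte : t ^ (a - 1/2) ≤ T ^ (a - 1/2) :=
          Real.rpow_le_rpow (by linarith [ht.1]) ht.2 (by linarith)
        calc _ ≤ (C2 * T ^ (a - 1/2)) * Real.exp (-t) * (n:ℝ) ^ (-a) := by
              gcongr
              · exact hx.trans (by gcongr)
              · simp
                nlinarith [Real.pi_gt_three, ht.1]
          _ = _ := by ring
      · exact (by fun_prop : Continuous _).intervalIntegrable _ _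
    refine this.trans ?_
    rw [intervalIntegral.integral_const_mul]
    have h3 : ∫ t in t₀..T, Real.exp (-t) ≤ 1 := by
      rw [intervalIntegral.integral_comp_neg (fun x => Real.exp x), integral_exp]
      have := Real.exp_le_one_iff.mpr (by linarith : -t₀ ≤ 0)
      linarith [Real.exp_pos (-T)]
    have h4 : 0 ≤ C2 * ((n:ℝ) ^ (-a) * T ^ (a - 1/2)) := by positivity
    nlinarith
  rw [hsplit]
  have e : ∀ x y z : ℂ, x + y - z = (x - z) + y := fun x y z => by ring
  rw [e]
  refine (norm_add_le _ _).trans ?_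
  have h5 : 0 ≤ T / (|T - 2 * π * n| + Real.sqrt T) := by positivity
  have h6 : 0 ≤ C2 * ((n:ℝ) ^ (-a) * T ^ (a - 1/2)) := by positivity
  have h7 := mul_nonneg h6 h5
  calc _ ≤ _ := add_le_add h hb2
    _ ≤ _ := by linarith

lemma dist_sum_le (m : ℕ) : ∑ n ∈ range (2 * (m+1)), 1 / (|(n:ℝ) - m| + 1) ≤ 2 * (1 + Real.log (m+1)) := by
  have hH : ∑ k ∈ range (m+1), 1 / ((k:ℝ) + 1) ≤ 1 + Real.log (m+1) := by
    have := harmonic_le_one_add_log (m+1)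
    rw [harmonic] at this
    push_cast at this
    simpa [one_div] using this
  rw [two_mul, Finset.sum_range_add, two_mul]
  refine add_le_add ?_ ?_
  · rw [← Finset.sum_range_reflect]
    refine le_trans (le_of_eq ?_) hH
    refine Finset.sum_congr rfl fun k hk => ?_
    have hk' : k ≤ m := by simp at hk; omega
    have : m + 1 - 1 - k = m - k := by omega
    rw [this, Nat.cast_sub hk', show (m:ℝ) - k - m = -k by ring, abs_neg, Nat.abs_cast]
  · refine le_trans (Finset.sum_le_sum fun k hk => ?_) hH
    push_cast
    rw [show (m:ℝ) + 1 + k - m = k + 1 by ring, abs_of_nonneg (by positivity)]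
    gcongr; linarith

lemma weight_sum : ∃ C > (0:ℝ), ∀ T : ℝ, 10000 ≤ T →
    Summable (fun n : ℕ => bco n * ((n:ℝ) ^ (-(1 + 1 / Real.log T)) * (1 + T / (|T - 2 * π * n| + Real.sqrt T)))) ∧
    ∑' n : ℕ, bco n * ((n:ℝ) ^ (-(1 + 1 / Real.log T)) * (1 + T / (|T - 2 * π * n| + Real.sqrt T)))
      ≤ C * Real.log T ^ 3 := by
  obtain ⟨K, hK, hb⟩ := bco_tsum_le
  refine ⟨3 * K + 13 * 4, by positivity, fun T hT => ?_⟩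
  have hT0 : 0 < T := by linarith
  have hlog : 1 ≤ Real.log T := log_ge_one (by linarith)
  set a := 1 + 1 / Real.log T with ha
  have ha1 : 1 < a := by rw [ha]; have : 0 < 1 / Real.log T := by positivity
                         linarith
  have ha2 : a ≤ 2 := by rw [ha]; have : 1 / Real.log T ≤ 1 := by rw [div_le_one (by linarith)]; exact hlog
                         linarith
  have hpi := Real.pi_gt_three
  have hpi4 := Real.pi_lt_d2
  set m := ⌊T / (2 * π)⌋₊ with hm
  have hm1 : (m:ℝ) ≤ T / (2 * π) := Nat.floor_le (by positivity)
  have hm2 : T / (2 * π) < m + 1 := Nat.lt_floor_add_one _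
  have hsq : 100 ≤ Real.sqrt T := Real.le_sqrt_of_sq_le (by linarith)
  set g : ℕ → ℝ := fun n => if n ∈ range (2 * (m+1)) then 13 * Real.log T ^ 2 * (1 / (|(n:ℝ) - m| + 1)) else 0 with hg
  have hgs : Summable g := summable_of_ne_finset_zero (s := range (2 * (m+1))) (fun n hn => by simp only [hg]; rw [if_neg hn])
  have hgsum : ∑' n, g n ≤ 13 * 4 * Real.log T ^ 3 := by
    rw [tsum_eq_sum (s := range (2 * (m+1))) (fun n hn => by simp only [hg]; rw [if_neg hn])]
    have : ∑ n ∈ range (2 * (m+1)), g n = 13 * Real.log T ^ 2 * ∑ n ∈ range (2 * (m+1)), 1 / (|(n:ℝ) - m| + 1) := by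
      rw [Finset.mul_sum]
      exact Finset.sum_congr rfl fun n hn => by simp only [hg]; rw [if_pos hn]
    rw [this]
    have h1 := dist_sum_le m
    have h2 : Real.log (m+1) ≤ Real.log T := by
      apply Real.log_le_log (by positivity)
      have : T / (2 * π) ≤ T / 6 := by gcongr; linarith
      linarith
    have h3 : ∑ n ∈ range (2 * (m+1)), 1 / (|(n:ℝ) - m| + 1) ≤ 4 * Real.log T := by linarith
    calc _ ≤ 13 * Real.log T ^ 2 * (4 * Real.log T) := by gcongr
      _ = _ := by ring
  have hgnn : ∀ n, 0 ≤ g n := fun n => by simp only [hg]; split_ifs <;> positivity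
  have hpt : ∀ n : ℕ, bco n * ((n:ℝ) ^ (-a) * (1 + T / (|T - 2 * π * n| + Real.sqrt T))) ≤
      3 * (bco n * (n:ℝ) ^ (-a)) + g n := by
    intro n
    have hbn := bco_nonneg n
    have hp : 0 ≤ (n:ℝ) ^ (-a) := by positivity
    by_cases hfar : T / 2 ≤ |T - 2 * π * n|
    · have : T / (|T - 2 * π * n| + Real.sqrt T) ≤ 2 := by
        rw [div_le_iff₀ (by positivity)]; linarith
      have h2 : bco n * ((n:ℝ) ^ (-a) * (1 + T / (|T - 2 * π * n| + Real.sqrt T))) ≤ bco n * ((n:ℝ) ^ (-a) * 3) := by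
        gcongr; linarith
      linarith [hgnn n]
    · push Not at hfar
      obtain ⟨hf1, hf2⟩ := abs_lt.mp hfar
      have hnlo : T / (4 * π) < n := by rw [div_lt_iff₀ (by positivity)]; linarith
      have hn0 : (0:ℝ) < n := lt_trans (by positivity) hnlo
      have hn1 : (1:ℝ) ≤ n := by
        have : 0 < n := by exact_mod_cast hn0
        exact_mod_cast this
      have hnT : (n:ℝ) ≤ T := by nlinarith
      have hmem : n ∈ range (2 * (m+1)) := by
        simp only [Finset.mem_range]
        have : (n:ℝ) < 2 * (m + 1) := by
          rw [div_lt_iff₀ (by positivity)] at hm2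
          have h3 : 2 * π * n < 2 * π * (2 * (m+1)) := by linarith
          exact lt_of_mul_lt_mul_left h3 (by positivity)
        exact_mod_cast this
      have hgv : g n = 13 * Real.log T ^ 2 * (1 / (|(n:ℝ) - m| + 1)) := by simp only [hg]; rw [if_pos hmem]
      have hbl : bco n ≤ Real.log T ^ 2 := by
        refine (bco_le n).trans ?_
        have h0 : 0 ≤ Real.log n := Real.log_nonneg hn1
        have : Real.log n ≤ Real.log T := Real.log_le_log hn0 hnT
        gcongr
      have hpa : (n:ℝ) ^ (-a) ≤ 13 / T := by
        calc (n:ℝ) ^ (-a) ≤ (n:ℝ) ^ (-1:ℝ) := Real.rpow_le_rpow_of_exponent_le hn1 (by linarith)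
          _ = 1 / n := by rw [Real.rpow_neg_one, one_div]
          _ ≤ 13 / T := by
            rw [div_le_div_iff₀ hn0 hT0]
            rw [div_lt_iff₀ (by positivity)] at hnlo
            nlinarith
      have hd : |(n:ℝ) - m| + 1 ≤ |T - 2 * π * n| + Real.sqrt T := by
        have h1 : |(n:ℝ) - m| ≤ |T / (2 * π) - n| + 1 := by
          rw [abs_sub_comm]
          have : |(m:ℝ) - n| ≤ |m - T / (2 * π)| + |T / (2 * π) - n| := abs_sub_le _ _ _
          have h2 : |m - T / (2 * π)| ≤ 1 := by rw [abs_le]; constructor <;> linarith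
          linarith
        have h2 : |T / (2 * π) - n| ≤ |T - 2 * π * n| := by
          have : T - 2 * π * n = (2 * π) * (T / (2 * π) - n) := by field_simp
          rw [this, abs_mul, abs_of_pos (by positivity : 0 < 2 * π)]
          nlinarith [abs_nonneg (T / (2 * π) - n)]
        linarith
      have hq : T / (|T - 2 * π * n| + Real.sqrt T) ≤ T / (|(n:ℝ) - m| + 1) := by gcongr
      have h8 : bco n * ((n:ℝ) ^ (-a) * (T / (|T - 2 * π * n| + Real.sqrt T))) ≤ g n := by
        rw [hgv]
        calc _ ≤ Real.log T ^ 2 * (13 / T * (T / (|(n:ℝ) - m| + 1))) := by gcongr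
          _ = _ := by field_simp
      have h9 : 0 ≤ bco n * (n:ℝ) ^ (-a) := by positivity
      linarith
  have hs1 := bco_real_summable ha1
  have hmaj := (hs1.mul_left 3).add hgs
  have hsum : Summable (fun n : ℕ => bco n * ((n:ℝ) ^ (-a) * (1 + T / (|T - 2 * π * n| + Real.sqrt T)))) := by
    refine Summable.of_nonneg_of_le (fun n => ?_) hpt hmaj
    have := bco_nonneg n
    positivity
  refine ⟨hsum, (hsum.tsum_le_tsum hpt hmaj).trans ?_⟩
  rw [(hs1.mul_left 3).tsum_add hgs, tsum_mul_left]
  have h1 := hb a ha1 ha2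
  have h2 : K / (a - 1) ^ 3 = K * Real.log T ^ 3 := by rw [ha]; field_simp; ring
  rw [h2] at h1
  linarith

/-- The summatory function of the Dirichlet coefficients. -/
noncomputable def BF (x : ℝ) : ℝ := ∑ n ∈ range (⌊x⌋₊ + 1), bco n

lemma bco_zero : bco 0 = 0 := by simp [bco]

lemma left_main : ∃ C > (0:ℝ), ∀ t₀ T : ℝ, 30 ≤ t₀ → t₀ ≤ 31 → 10000 ≤ T →
    ‖(∫ t in t₀..T, YF (((1 + 1 / Real.log T : ℝ):ℂ) + t * I) * Hf (((1 + 1 / Real.log T : ℝ):ℂ) + t * I)) -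
      2 * π * BF (T / (2 * π))‖ ≤ C * T ^ ((1:ℝ)/2) * Real.log T ^ 3 := by
  obtain ⟨C1, hC1, hg⟩ := gonek_YF
  obtain ⟨C2, hC2, hw⟩ := weight_sum
  refine ⟨C1 * Real.exp 1 * C2, by positivity, fun t₀ T ht0 ht1 hT => ?_⟩
  obtain ⟨hws, hwt⟩ := hw T hT
  have hT0 : 0 < T := by linarith
  have hlog : 1 ≤ Real.log T := log_ge_one (by linarith)
  set a := 1 + 1 / Real.log T with ha
  have ha1 : 1 < a := by rw [ha]; have : 0 < 1 / Real.log T := by positivity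
                         linarith
  have ha2 : a ≤ 2 := by rw [ha]; have : 1 / Real.log T ≤ 1 := by rw [div_le_one (by linarith)]; exact hlog
                         linarith
  have hTa : T ^ (a - 1/2) = Real.exp 1 * T ^ ((1:ℝ)/2) := by
    have : a - 1/2 = 1 / Real.log T + 1/2 := by rw [ha]; ring
    rw [this, Real.rpow_add hT0]
    congr 1
    rw [Real.rpow_def_of_pos hT0]; congr 1; field_simp
  have hYc : Continuous (fun t : ℝ => YF (a + t * I)) := by
    simp only [YF]
    exact (XF_line_cont (σ := a) (by linarith)).mul (by fun_prop)
  have hsumI : HasSum (fun n : ℕ => ∫ t in t₀..T, YF (a + t * I) * ((bco n : ℂ) * (n:ℂ) ^ (-((a:ℂ) + t * I))))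
      (∫ t in t₀..T, YF (a + t * I) * Hf (a + t * I)) := by
    refine intervalIntegral.hasSum_integral_of_dominated_convergence
      (fun n t => ‖YF (a + t * I)‖ * (bco n * (n:ℝ) ^ (-a))) ?_ ?_ ?_ ?_ ?_
    · intro n
      rcases Nat.eq_zero_or_pos n with rfl | hn
      · simp only [bco_zero, ofReal_zero, zero_mul, mul_zero]
        exact MeasureTheory.aestronglyMeasurable_const
      · refine Continuous.aestronglyMeasurable (hYc.mul (continuous_const.mul ?_))
        refine Continuous.const_cpow (by fun_prop) (Or.inl ?_)
        exact_mod_cast hn.ne'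
    · intro n
      refine Eventually.of_forall fun t _ => ?_
      rcases Nat.eq_zero_or_pos n with rfl | hn
      · simp [bco_zero]
      · rw [norm_mul, norm_mul, Complex.norm_natCast_cpow_of_pos hn, Complex.norm_real, Real.norm_of_nonneg (bco_nonneg n)]
        simp
    · exact Eventually.of_forall fun t _ => (bco_real_summable ha1).mul_left _
    · simp only [tsum_mul_left]
      exact (hYc.norm.mul continuous_const).intervalIntegrable _ _
    · exact Eventually.of_forall fun t _ => (Hf_hasSum (by simpa using ha1)).mul_left _
  have hB : HasSum (fun n : ℕ => (bco n : ℂ) * (if 2 * π * n ≤ T then 2 * (π:ℂ) else 0))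
      (2 * π * BF (T / (2 * π))) := by
    have : (2 * π * BF (T / (2 * π)) : ℂ) = ∑ n ∈ range (⌊T / (2 * π)⌋₊ + 1),
        (bco n : ℂ) * (if 2 * π * n ≤ T then 2 * (π:ℂ) else 0) := by
      rw [BF]; push_cast; rw [Finset.mul_sum]
      refine Finset.sum_congr rfl fun n hn => ?_
      rw [if_pos]
      · ring
      · simp only [Finset.mem_range] at hn
        have h1 : (n:ℝ) ≤ T / (2 * π) := (Nat.le_floor_iff (by positivity)).mp (by omega)
        rw [le_div_iff₀ (by positivity)] at h1; linarith
    rw [this]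
    refine hasSum_sum_of_ne_finset_zero fun n hn => ?_
    rw [if_neg, mul_zero]
    intro h
    apply hn
    simp only [Finset.mem_range]
    have : n ≤ ⌊T / (2 * π)⌋₊ := by
      apply Nat.le_floor
      rw [le_div_iff₀ (by positivity)]; linarith
    omega
  have hd := hsumI.sub hB
  have hbd : ∀ n : ℕ, ‖(∫ t in t₀..T, YF (a + t * I) * ((bco n : ℂ) * (n:ℂ) ^ (-((a:ℂ) + t * I)))) -
      (bco n : ℂ) * (if 2 * π * n ≤ T then 2 * (π:ℂ) else 0)‖ ≤
      C1 * T ^ (a - 1/2) * (bco n * ((n:ℝ) ^ (-a) * (1 + T / (|T - 2 * π * n| + Real.sqrt T)))) := by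
    intro n
    rcases Nat.eq_zero_or_pos n with rfl | hn
    · simp [bco_zero]
    have e : (∫ t in t₀..T, YF (a + t * I) * ((bco n : ℂ) * (n:ℂ) ^ (-((a:ℂ) + t * I)))) =
        (bco n : ℂ) * ∫ t in t₀..T, YF (a + t * I) * (n:ℂ) ^ (-((a:ℂ) + t * I)) := by
      rw [← intervalIntegral.integral_const_mul]
      exact intervalIntegral.integral_congr fun t _ => by ring
    rw [e, ← mul_sub, norm_mul, Complex.norm_real, Real.norm_of_nonneg (bco_nonneg n)]
    have := mul_le_mul_of_nonneg_left (hg a t₀ T n ha1.le ha2 ht0 ht1 hT hn) (bco_nonneg n)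
    refine this.trans (le_of_eq (by ring))
  rw [← hd.tsum_eq]
  refine (tsum_of_norm_bounded ((hws.mul_left (C1 * T ^ (a - 1/2))).hasSum) hbd).trans ?_
  rw [tsum_mul_left, hTa]
  calc _ ≤ C1 * (Real.exp 1 * T ^ ((1:ℝ)/2)) * (C2 * Real.log T ^ 3) := by gcongr
    _ = _ := by ring

lemma zeta_not_ev_zero (ρ : ℂ) : ¬ ∀ᶠ z in 𝓝 ρ, ζ z = 0 := by
  intro h
  obtain ⟨r, hr, hb⟩ := Metric.eventually_nhds_iff_ball.mp h
  have hf := (isCompact_closedBall ρ (r/2)).inter_riemannZetaZeros_finite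
  have hinf : (Metric.ball ρ (r/2)).Infinite := by
    apply infinite_of_mem_nhds ρ
    exact Metric.ball_mem_nhds _ (by linarith)
  apply hinf
  refine hf.subset fun z hz => ⟨Metric.ball_subset_closedBall hz, ?_⟩
  exact hb z (Metric.ball_subset_ball (by linarith) hz)

lemma Hf_pole {ρ : ℂ} (h1 : ρ ≠ 1) (h0 : ζ ρ = 0) : ∃ h : ℂ → ℂ, AnalyticAt ℂ h ρ ∧
    ∀ᶠ z in 𝓝[≠] ρ, Hf z = h z + (-deriv ζ ρ) * (1 / (z - ρ)) := by
  have hz := zeta_analyticAt h1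
  obtain ⟨m, g, hg, hg0, hev⟩ := hz.exists_eventuallyEq_pow_smul_nonzero_iff.mpr (zeta_not_ev_zero ρ)
  have hm : m ≠ 0 := by
    rintro rfl
    have := hev.self_of_nhds
    simp [h0] at this
    exact hg0 this.symm
  have hev' : ∀ᶠ z in 𝓝 ρ, ζ =ᶠ[𝓝 z] fun z => (z - ρ) ^ m * g z := by
    have := hev.eventually_nhds
    simp only [smul_eq_mul] at this
    exact this
  have hgd : ∀ᶠ z in 𝓝 ρ, AnalyticAt ℂ g z := hg.eventually_analyticAt
  have hgne : ∀ᶠ z in 𝓝 ρ, g z ≠ 0 := hg.continuousAt.eventually_ne hg0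
  -- derivative formula
  have hder : ∀ᶠ z in 𝓝 ρ, deriv ζ z = m * (z - ρ) ^ (m-1) * g z + (z - ρ) ^ m * deriv g z := by
    filter_upwards [hev', hgd] with z e1 e2
    rw [e1.deriv_eq]
    have h2 : HasDerivAt (fun z => (z - ρ) ^ m) (m * (z - ρ) ^ (m-1)) z := by
      exact (((hasDerivAt_id z).sub_const ρ).pow m).congr_deriv (by simp)
    exact (h2.mul e2.differentiableAt.hasDerivAt).deriv
  have hmd : (m:ℂ) * deriv ζ ρ = deriv ζ ρ := by
    by_cases hm1 : m = 1
    · subst hm1; simp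
    · have : deriv ζ ρ = 0 := by
        rw [hder.self_of_nhds]
        simp [hm, show m - 1 ≠ 0 by omega]
      rw [this, mul_zero]
  have hZd : AnalyticAt ℂ (deriv ζ) ρ := hz.deriv
  have hD : AnalyticAt ℂ (dslope (deriv ζ) ρ) ρ := by
    obtain ⟨p, hp⟩ := hZd
    exact ⟨_, hp.has_fpower_series_dslope_fslope⟩
  refine ⟨fun z => deriv (deriv ζ) z - deriv ζ z * (deriv g z / g z) - m * dslope (deriv ζ) ρ z,
    ((hZd.deriv.sub (hZd.mul (hg.deriv.div hg hg0))).sub (analyticAt_const.mul hD)), ?_⟩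
  filter_upwards [nhdsWithin_le_nhds hder, nhdsWithin_le_nhds hgne, nhdsWithin_le_nhds hev, self_mem_nhdsWithin] with z e1 e2 e3 e4
  have hzr : z - ρ ≠ 0 := sub_ne_zero.mpr e4
  have hds : dslope (deriv ζ) ρ z = (deriv ζ z - deriv ζ ρ) / (z - ρ) := by
    rw [dslope_of_ne _ e4, slope_def_field]
  rw [hds, Hf]
  have hld : deriv ζ z / ζ z = m / (z - ρ) + deriv g z / g z := by
    rw [e1, e3, smul_eq_mul]
    obtain ⟨k, rfl⟩ := Nat.exists_eq_succ_of_ne_zero hm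
    simp only [Nat.succ_eq_add_one, Nat.add_sub_cancel]
    field_simp
    ring
  have : deriv ζ z ^ 2 / ζ z = deriv ζ z * (deriv ζ z / ζ z) := by ring
  rw [this, hld]
  linear_combination (-(1 / (z - ρ))) * hmd

lemma order_mul {ρ : ℂ} (h0 : ζ ρ = 0) :
    (zetaZeroOrder ρ : ℂ) * iteratedDeriv 1 ζ ρ = deriv ζ ρ := by
  rw [iteratedDeriv_one]
  by_cases hd : deriv ζ ρ = 0
  · rw [hd, mul_zero]
  · have : zetaZeroOrder ρ = 1 := by
      rw [zetaZeroOrder]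
      apply le_antisymm
      · exact Nat.sInf_le (by simpa using hd)
      · apply le_csInf ⟨1, by simpa using hd⟩
        intro k hk
        rcases Nat.eq_zero_or_pos k with rfl | h
        · simp [h0] at hk
        · exact h
    rw [this]; simp

lemma zset_finite (T : ℝ) : {ρ : ℂ | IsNontrivialZero ρ ∧ 0 < ρ.im ∧ ρ.im ≤ T}.Finite := by
  have hf := ((isCompact_Icc (a := (0:ℝ)) (b := 1)).reProdIm (isCompact_Icc (a := (0:ℝ)) (b := T))).inter_riemannZetaZeros_finite
  refine hf.subset ?_
  rintro ρ ⟨⟨h0, h1, h2⟩, h3, h4⟩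
  refine ⟨?_, h0⟩
  rw [mem_reProdIm]
  exact ⟨⟨h1.le, h2.le⟩, h3.le, h4⟩

/-- The finite set of nontrivial zeros with ordinates in `(0, T]`. -/
noncomputable def zfin (T : ℝ) : Finset ℂ := (zset_finite T).toFinset

lemma mem_zfin {T : ℝ} {ρ : ℂ} : ρ ∈ zfin T ↔ ζ ρ = 0 ∧ 0 < ρ.im ∧ ρ.im ≤ T := by
  simp only [zfin, Set.Finite.mem_toFinset, Set.mem_setOf_eq, IsNontrivialZero]
  constructor
  · rintro ⟨⟨h0, _⟩, h⟩; exact ⟨h0, h⟩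
  · rintro ⟨h0, h1, h2⟩
    exact ⟨⟨h0, zero_in_strip h0 h1.ne'⟩, h1, h2⟩

lemma zetaZeroSum_eq (T : ℝ) : zetaZeroSum 1 T = ∑ ρ ∈ zfin T, deriv ζ ρ := by
  rw [zetaZeroSum, finsum_mem_eq_finite_toFinset_sum _ (zset_finite T)]
  refine Finset.sum_congr rfl fun ρ hρ => order_mul ?_
  exact (mem_zfin.mp hρ).1

lemma Hf_rect {p q c d : ℝ} (hp : p ≤ 0) (hq : 1 ≤ q) (hc : 0 < c) (hcd : c < d)
    (hcz : ∀ ρ, ζ ρ = 0 → ρ.im ≠ c) (hdz : ∀ ρ, ζ ρ = 0 → ρ.im ≠ d) :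
    rectInt Hf p q c d = -(2 * π * I * ∑ ρ ∈ (zfin d).filter (fun ρ => c < ρ.im), deriv ζ ρ) := by
  have key := rect_residue (a := p) (b := q) (c := c) (d := d) (by linarith) hcd
    ((zfin d).filter (fun ρ => c < ρ.im)) (fun ρ => -deriv ζ ρ) Hf ?_ ?_ ?_
  · rw [key, Finset.sum_neg_distrib]; ring
  · intro ρ hρ
    rw [Finset.mem_filter, mem_zfin] at hρ
    obtain ⟨⟨h0, h1, h2⟩, h3⟩ := hρ
    have := zero_in_strip h0 h1.ne'
    exact ⟨⟨by linarith [this.1], by linarith [this.2]⟩, h3, lt_of_le_of_ne h2 (hdz ρ h0)⟩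
  · intro z hz1 hz2 hzS
    have hzi : 0 < z.im := by linarith [hz2.1]
    refine Hf_analyticAt ?_ ?_
    · rintro rfl; simp at hzi
    · intro h0
      apply hzS
      rw [Finset.mem_filter, mem_zfin]
      exact ⟨⟨h0, hzi, hz2.2⟩, lt_of_le_of_ne hz2.1 (Ne.symm (hcz z h0))⟩
  · intro ρ hρ
    rw [Finset.mem_filter, mem_zfin] at hρ
    obtain ⟨⟨h0, h1, h2⟩, h3⟩ := hρ
    obtain ⟨h, ha, he⟩ := Hf_pole (ρ := ρ) (by rintro rfl; simp at h1) h0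
    refine ⟨0, 0, h, ha, ?_⟩
    filter_upwards [he] with z hz
    rw [hz]; ring

lemma bco_one : bco 1 = 0 := by simp [bco]

lemma Hf_line_cont {a : ℝ} (ha : 1 < a) : Continuous (fun t : ℝ => Hf (a + t * I)) := by
  rw [continuous_iff_continuousAt]
  intro t
  have h := Hf_analyticAt (s := a + t * I) (ne_one_of_re (by simpa using ha))
    (riemannZeta_ne_zero_of_one_le_re (by simpa using ha.le))
  exact ContinuousAt.comp (f := fun t : ℝ => (a:ℂ) + t * I) h.continuousAt (by fun_prop)

lemma right_edge : ∃ K > (0:ℝ), ∀ a c d : ℝ, 1 < a → a ≤ 2 → c ≤ d →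
    ‖∫ y in c..d, Hf (a + y * I)‖ ≤ K / (a - 1) ^ 3 := by
  obtain ⟨K, hK, hb⟩ := bco_tsum_le
  refine ⟨4 * K, by positivity, fun a c d ha1 ha2 hcd => ?_⟩
  have hsumI : HasSum (fun n : ℕ => ∫ t in c..d, ((bco n : ℂ) * (n:ℂ) ^ (-((a:ℂ) + t * I))))
      (∫ t in c..d, Hf (a + t * I)) := by
    refine intervalIntegral.hasSum_integral_of_dominated_convergence
      (fun n t => (bco n * (n:ℝ) ^ (-a))) ?_ ?_ ?_ ?_ ?_
    · intro n
      rcases Nat.eq_zero_or_pos n with rfl | hn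
      · simp only [bco_zero, ofReal_zero, zero_mul]
        exact MeasureTheory.aestronglyMeasurable_const
      · refine Continuous.aestronglyMeasurable ((continuous_const.mul ?_))
        refine Continuous.const_cpow (by fun_prop) (Or.inl ?_)
        exact_mod_cast hn.ne'
    · intro n
      refine Eventually.of_forall fun t _ => ?_
      rcases Nat.eq_zero_or_pos n with rfl | hn
      · simp [bco_zero]
      · rw [norm_mul, Complex.norm_natCast_cpow_of_pos hn, Complex.norm_real, Real.norm_of_nonneg (bco_nonneg n)]
        simp
    · exact Eventually.of_forall fun t _ => (bco_real_summable ha1)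
    · exact (continuous_const).intervalIntegrable _ _
    · exact Eventually.of_forall fun t _ => (Hf_hasSum (by simpa using ha1))
  have hbd : ∀ n : ℕ, ‖∫ t in c..d, ((bco n : ℂ) * (n:ℂ) ^ (-((a:ℂ) + t * I)))‖ ≤ 4 * (bco n * (n:ℝ) ^ (-a)) := by
    intro n
    rcases Nat.eq_zero_or_pos n with rfl | hn
    · simp [bco_zero]
    by_cases hn1 : n = 1
    · simp [hn1, bco_one]
    have hn2 : 2 ≤ n := by omega
    have hl : 1/2 ≤ Real.log n := by
      have : Real.log 2 ≤ Real.log n := Real.log_le_log (by norm_num) (by exact_mod_cast hn2)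
      linarith [Real.log_two_gt_d9]
    have hn0 : (n:ℂ) ≠ 0 := by exact_mod_cast hn.ne'
    set k : ℂ := -(I * (Real.log n : ℝ)) with hk
    have hk0 : k ≠ 0 := by
      rw [hk, neg_ne_zero]
      exact mul_ne_zero I_ne_zero (by exact_mod_cast (by linarith : Real.log n ≠ 0))
    have e : ∀ t : ℝ, (bco n : ℂ) * (n:ℂ) ^ (-((a:ℂ) + t * I)) = ((bco n : ℂ) * (n:ℂ) ^ (-(a:ℂ))) * cexp (k * t) := by
      intro t
      rw [neg_add, Complex.cpow_add _ _ hn0, Complex.cpow_def_of_ne_zero hn0 (-(t * I)), ← Complex.natCast_log, hk]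
      rw [show ((Real.log n : ℝ):ℂ) * (-(t * I)) = -(I * (Real.log n : ℝ)) * t by ring]
      ring
    simp only [e]
    rw [intervalIntegral.integral_const_mul, integral_exp_mul_complex hk0]
    rw [norm_mul, norm_mul, Complex.norm_real, Real.norm_of_nonneg (bco_nonneg n), Complex.norm_natCast_cpow_of_pos hn, norm_div]
    have hkn : ‖k‖ = Real.log n := by
      rw [hk, norm_neg, norm_mul, Complex.norm_I, one_mul, Complex.norm_real, Real.norm_of_nonneg (by linarith)]
    have hnum : ‖cexp (k * d) - cexp (k * c)‖ ≤ 2 := by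
      refine (norm_sub_le _ _).trans ?_
      have h1 : ∀ t : ℝ, ‖cexp (k * t)‖ = 1 := by
        intro t
        rw [hk, show -(I * ((Real.log n : ℝ):ℂ)) * t = ((-(Real.log n * t) : ℝ) : ℂ) * I by push_cast; ring]
        exact Complex.norm_exp_ofReal_mul_I _
      rw [h1, h1]; norm_num
    rw [hkn]
    have h4 : ‖cexp (k * d) - cexp (k * c)‖ / Real.log n ≤ 4 := by
      rw [div_le_iff₀ (by linarith)]; linarith
    have h5 : 0 ≤ bco n * (n:ℝ) ^ (-(a:ℂ)).re := mul_nonneg (bco_nonneg n) (by positivity)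
    have h6 : (-(a:ℂ)).re = -a := by simp
    rw [h6] at h5 ⊢
    calc _ ≤ bco n * (n:ℝ) ^ (-a) * 4 := mul_le_mul_of_nonneg_left h4 h5
      _ = _ := by ring
  rw [← hsumI.tsum_eq]
  refine (tsum_of_norm_bounded (((bco_real_summable ha1).mul_left 4).hasSum) hbd).trans ?_
  rw [tsum_mul_left, mul_div_assoc]
  gcongr
  exact hb a ha1 ha2

lemma Hf_eq_logDeriv (s : ℂ) : Hf s = deriv (deriv ζ) s - deriv ζ s * logDeriv ζ s := by
  rw [Hf, logDeriv_apply]; ring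

lemma horiz_cont {f : ℂ → ℂ} {p q T : ℝ} (h : ∀ x : ℝ, p ≤ x → x ≤ q → AnalyticAt ℂ f (x + T * I)) :
    ContinuousOn (fun x : ℝ => f (x + T * I)) (Set.Icc p q) := by
  intro x hx
  refine ContinuousAt.continuousWithinAt ?_
  exact ContinuousAt.comp (f := fun t : ℝ => (t:ℂ) + T * I) (h x hx.1 hx.2).continuousAt (by fun_prop)

lemma top_edge (δ : ℝ) (hδ : 0 < δ) : ∃ K > (0:ℝ), ∀ T : ℝ, 10000 ≤ T → AdmissibleHeight δ T →
    ‖∫ x in (1 - (1 + 1 / Real.log T))..(1 + 1 / Real.log T), Hf (x + T * I)‖ ≤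
      K * T ^ ((1:ℝ)/2) * Real.log T ^ ((7:ℝ)/2) := by
  obtain ⟨C1, hC1, hs⟩ := zeta_deriv_strip
  obtain ⟨C2, hC2, hi⟩ := logDeriv_int
  refine ⟨2 * C1 + C1 * C2 * (1 + Real.sqrt δ⁻¹), by positivity, fun T hT hadm => ?_⟩
  have hT0 : 0 < T := by linarith
  have hlog2 : 2 ≤ Real.log T := by
    rw [Real.le_log_iff_exp_le hT0]
    have : Real.exp 2 = Real.exp 1 * Real.exp 1 := by rw [← Real.exp_add]; norm_num
    have h1 := Real.exp_one_lt_d9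
    nlinarith [Real.exp_pos 1]
  set ℓ := Real.log T with hℓ
  set a := 1 + 1 / ℓ with ha
  have hinv : 1 / ℓ ≤ 1/2 := by rw [div_le_div_iff₀ (by linarith) (by norm_num)]; linarith
  have hinv0 : 0 < 1 / ℓ := by positivity
  have hpq : 1 - a ≤ a := by linarith
  have hd0 : 0 < δ / ℓ := by positivity
  have hzero : ∀ ρ, ζ ρ = 0 → 0 < ρ.im → δ / ℓ ≤ |T - ρ.im| := fun ρ h0 h1 =>
    hadm ρ ⟨h0, zero_in_strip h0 h1.ne'⟩
  have hne : ∀ x : ℝ, ζ (x + T * I) ≠ 0 := by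
    intro x h0
    have := hzero _ h0 (by simpa using hT0)
    simp at this
    linarith
  have hone : ∀ x : ℝ, (x:ℂ) + T * I ≠ 1 := by
    intro x h
    have := congrArg Complex.im h
    simp at this; linarith
  have hA : ∀ x : ℝ, AnalyticAt ℂ ζ (x + T * I) := fun x => zeta_analyticAt (hone x)
  have hbd : ∀ x : ℝ, 1 - a ≤ x → ‖deriv ζ (x + T * I)‖ ≤ C1 * T ^ ((1:ℝ)/2) * ℓ ^ 2 := by
    intro x hx
    have := hs (x + T * I) (by simp; rw [abs_of_pos hT0]; linarith) (by simp; rw [← hℓ]; rw [ha] at hx; simp at hx; linarith)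
    simp only [add_im, ofReal_im, mul_im, ofReal_re, I_im, mul_one, I_re, mul_zero, add_zero, zero_add, abs_of_pos hT0] at this
    exact this
  have hldc : ContinuousOn (fun x : ℝ => logDeriv ζ (x + T * I)) (Set.Icc (1-a) a) :=
    horiz_cont (f := logDeriv ζ) fun x _ _ => (hA x).deriv.div (hA x) (hne x)
  have hd1c : ContinuousOn (fun x : ℝ => deriv ζ (x + T * I)) (Set.Icc (1-a) a) :=
    horiz_cont fun x _ _ => (hA x).deriv
  have hd2c : ContinuousOn (fun x : ℝ => deriv (deriv ζ) (x + T * I)) (Set.Icc (1-a) a) :=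
    horiz_cont fun x _ _ => (hA x).deriv.deriv
  have hi1 : IntervalIntegrable (fun x : ℝ => deriv (deriv ζ) (x + T * I)) MeasureTheory.volume (1-a) a :=
    ContinuousOn.intervalIntegrable (by rwa [Set.uIcc_of_le hpq])
  have hi2 : IntervalIntegrable (fun x : ℝ => deriv ζ (x + T * I) * logDeriv ζ (x + T * I)) MeasureTheory.volume (1-a) a :=
    ContinuousOn.intervalIntegrable (by rw [Set.uIcc_of_le hpq]; exact hd1c.mul hldc)
  have hi3 : IntervalIntegrable (fun x : ℝ => ‖logDeriv ζ (x + T * I)‖) MeasureTheory.volume (1-a) a :=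
    ContinuousOn.intervalIntegrable (by rw [Set.uIcc_of_le hpq]; exact hldc.norm)
  simp only [Hf_eq_logDeriv]
  rw [intervalIntegral.integral_sub hi1 hi2]
  have hE : ∫ x in (1-a)..a, deriv (deriv ζ) (x + T * I) = deriv ζ (a + T * I) - deriv ζ ((1 - a : ℝ) + T * I) := by
    refine intervalIntegral.integral_eq_sub_of_hasDerivAt (f := fun x : ℝ => deriv ζ (x + T * I)) (fun x _ => ?_) hi1
    have h1 : HasDerivAt (fun z : ℂ => deriv ζ (z + T * I)) (deriv (deriv ζ) (x + T * I)) x := by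
      exact HasDerivAt.comp_add_const (x:ℂ) (T * I) ((hA x).deriv.differentiableAt.hasDerivAt)
    exact h1.comp_ofReal
  have h2 : ‖∫ x in (1-a)..a, deriv ζ (x + T * I) * logDeriv ζ (x + T * I)‖ ≤
      C1 * T ^ ((1:ℝ)/2) * ℓ ^ 2 * (C2 * ℓ * (1 + Real.sqrt (δ/ℓ)⁻¹)) := by
    have h3 : ‖∫ x in (1-a)..a, deriv ζ (x + T * I) * logDeriv ζ (x + T * I)‖ ≤
      ∫ x in (1-a)..a, C1 * T ^ ((1:ℝ)/2) * ℓ ^ 2 * ‖logDeriv ζ (x + T * I)‖ := by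
      refine intervalIntegral.norm_integral_le_of_norm_le hpq ?_ (hi3.const_mul _)
      refine Eventually.of_forall fun x hx => ?_
      rw [norm_mul]
      gcongr
      exact hbd x hx.1.le
    refine h3.trans ?_
    rw [intervalIntegral.integral_const_mul]
    gcongr
    exact hi T (δ/ℓ) (1-a) a (by linarith) hd0 hpq (by linarith) (by linarith) hzero
  have h4 : ‖deriv ζ (a + T * I) - deriv ζ ((1 - a : ℝ) + T * I)‖ ≤ 2 * C1 * T ^ ((1:ℝ)/2) * ℓ ^ 2 := by
    refine (norm_sub_le _ _).trans ?_
    linarith [hbd a (by linarith), hbd (1-a) le_rfl]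
  rw [hE]
  refine (norm_sub_le _ _).trans ?_
  have hℓ0 : 0 < ℓ := by linarith
  have hr : Real.sqrt (δ/ℓ)⁻¹ = Real.sqrt δ⁻¹ * ℓ ^ ((1:ℝ)/2) := by
    rw [inv_div, div_eq_inv_mul, Real.sqrt_mul (by positivity), Real.sqrt_eq_rpow ℓ]
  have h7 : ℓ ^ ((7:ℝ)/2) = ℓ ^ 2 * ℓ * ℓ ^ ((1:ℝ)/2) := by
    rw [show (7:ℝ)/2 = 3 + 1/2 by norm_num, Real.rpow_add hℓ0]
    norm_cast
  have hge1 : 1 ≤ ℓ ^ ((1:ℝ)/2) := Real.one_le_rpow (by linarith) (by norm_num)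
  rw [hr] at h2
  rw [h7]
  set u := ℓ ^ ((1:ℝ)/2)
  set v := T ^ ((1:ℝ)/2)
  have hv : 0 ≤ v := by positivity
  have hb1 : ‖deriv ζ (a + T * I) - deriv ζ ((1 - a : ℝ) + T * I)‖ ≤ 2 * C1 * v * (ℓ ^ 2 * ℓ * u) := by
    refine h4.trans ?_
    gcongr
    rw [mul_assoc]
    apply le_mul_of_one_le_right (by positivity)
    nlinarith
  have hb2 : C1 * v * ℓ ^ 2 * (C2 * ℓ * (1 + Real.sqrt δ⁻¹ * u)) ≤ C1 * C2 * (1 + Real.sqrt δ⁻¹) * v * (ℓ ^ 2 * ℓ * u) := by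
    have : 1 + Real.sqrt δ⁻¹ * u ≤ (1 + Real.sqrt δ⁻¹) * u := by linarith
    calc _ ≤ C1 * v * ℓ ^ 2 * (C2 * ℓ * ((1 + Real.sqrt δ⁻¹) * u)) := by gcongr
      _ = _ := by ring
  calc _ ≤ _ := add_le_add hb1 (h2.trans hb2)
    _ = _ := by ring

lemma left_small : ∃ K > (0:ℝ), ∀ t₀ T : ℝ, 30 ≤ t₀ → t₀ ≤ 31 → 10000 ≤ T →
    ‖∫ t in t₀..T, YF (((1 + 1 / Real.log T : ℝ):ℂ) + t * I) * ζ (((1 + 1 / Real.log T : ℝ):ℂ) + t * I) *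
      deriv LY (((1 + 1 / Real.log T : ℝ):ℂ) + t * I)‖ ≤ K * T ^ ((1:ℝ)/2) * Real.log T ^ 2 := by
  obtain ⟨C1, hC1, hY⟩ := YF_bound
  obtain ⟨C2, hC2, hz⟩ := zeta_bound
  refine ⟨C1 * C2 * 200 * Real.exp 1, by positivity, fun t₀ T ht0 ht1 hT => ?_⟩
  have hT0 : 0 < T := by linarith
  have hlog : 1 ≤ Real.log T := log_ge_one (by linarith)
  set a := 1 + 1 / Real.log T with ha
  have ha1 : 1 < a := by rw [ha]; have : 0 < 1 / Real.log T := by positivity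
                         linarith
  have ha2 : a ≤ 2 := by rw [ha]; have : 1 / Real.log T ≤ 1 := by rw [div_le_one (by linarith)]; exact hlog
                         linarith
  have hTa : T ^ (a - 1/2) = Real.exp 1 * T ^ ((1:ℝ)/2) := by
    have : a - 1/2 = 1 / Real.log T + 1/2 := by rw [ha]; ring
    rw [this, Real.rpow_add hT0]
    congr 1
    rw [Real.rpow_def_of_pos hT0]; congr 1; field_simp
  have h1 : ‖∫ t in t₀..T, YF ((a:ℂ) + t * I) * ζ ((a:ℂ) + t * I) * deriv LY ((a:ℂ) + t * I)‖ ≤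
      ∫ t in t₀..T, C1 * T ^ (a - 1/2) * (C2 * Real.log T) * 200 * t⁻¹ := by
    refine intervalIntegral.norm_integral_le_of_norm_le (by linarith) ?_ ?_
    · refine Eventually.of_forall fun t ht => ?_
      have ht30 : 30 < t := by linarith [ht.1]
      have htp : 0 < t := by linarith
      have y1 := hY (a + t * I) (by simp; linarith) (by simp; linarith) (by simp; rw [abs_of_pos htp]; linarith)
      have z1 := hz (a + t * I) (by simp; linarith) (by simp; rw [abs_of_pos htp]; linarith)
      have l1 := LY_deriv_le (s := a + t * I) (by simp; linarith) (by simp; linarith)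
      simp only [add_re, ofReal_re, mul_re, I_re, mul_zero, ofReal_im, I_im, mul_one, sub_self, add_zero, add_im, mul_im, zero_add, abs_of_pos htp] at y1 z1 l1
      rw [max_eq_right (by linarith), Real.rpow_zero, mul_one] at z1
      have hlt : Real.log t ≤ Real.log T := Real.log_le_log htp ht.2
      have htt : t ^ (a - 1/2) ≤ T ^ (a - 1/2) := Real.rpow_le_rpow htp.le ht.2 (by linarith)
      rw [norm_mul, norm_mul]
      calc _ ≤ (C1 * T ^ (a - 1/2)) * (C2 * Real.log T) * (200 / t) := by
            gcongr
            · exact y1.trans (by gcongr)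
            · exact z1.trans (by gcongr)
        _ = _ := by ring
    · refine ContinuousOn.intervalIntegrable ?_
      rw [Set.uIcc_of_le (by linarith)]
      refine continuousOn_const.mul (continuousOn_id.inv₀ ?_)
      intro x hx
      have := hx.1
      simp only [id]; linarith
  refine h1.trans ?_
  rw [intervalIntegral.integral_const_mul, integral_inv_of_pos (by linarith) hT0, hTa]
  have h2 : Real.log (T / t₀) ≤ Real.log T := by
    apply Real.log_le_log (by positivity)
    exact div_le_self hT0.le (by linarith)
  calc _ ≤ C1 * (Real.exp 1 * T ^ ((1:ℝ)/2)) * (C2 * Real.log T) * 200 * Real.log T := by gcongr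
    _ = _ := by ring

lemma intervalIntegral_conj' (f : ℝ → ℂ) (a b : ℝ) :
    ∫ x in a..b, (starRingEnd ℂ) (f x) = (starRingEnd ℂ) (∫ x in a..b, f x) := by
  simp only [intervalIntegral, map_sub, integral_conj]

/-- Reduction of the zero sum to the summatory function of the coefficients. -/
theorem part_one (δ : ℝ) (hδ : 0 < δ) : ∃ K > (0:ℝ), ∀ T : ℝ, 10000 ≤ T → AdmissibleHeight δ T →
    ‖zetaZeroSum 1 T - BF (T / (2 * π))‖ ≤ K * T ^ ((1:ℝ)/2) * Real.log T ^ ((7:ℝ)/2) := by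
  obtain ⟨_, -, hgh⟩ := good_height
  obtain ⟨t₀, ht0', ht1', hgood⟩ := hgh 30 le_rfl
  have ht0 : 30 ≤ t₀ := by simpa using ht0'
  have ht1 : t₀ ≤ 31 := by push_cast at ht1'; linarith
  obtain ⟨K1, hK1, hright⟩ := right_edge
  obtain ⟨K2, hK2, htop⟩ := top_edge δ hδ
  obtain ⟨K3, hK3, hsmall⟩ := left_small
  obtain ⟨K4, hK4, hmain⟩ := left_main
  have hcz : ∀ ρ, ζ ρ = 0 → ρ.im ≠ t₀ := by
    intro ρ h0 h
    have hs := zero_in_strip h0 (by rw [h]; linarith)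
    apply (hgood ρ.re (by linarith [hs.1]) (by linarith [hs.2])).1
    rw [← h, Complex.re_add_im]; exact h0
  have hbc : ContinuousOn (fun x : ℝ => Hf (x + t₀ * I)) (Set.Icc (-(1/2)) 2) := by
    refine horiz_cont fun x hx1 hx2 => Hf_analyticAt ?_ (hgood x hx1 hx2).1
    intro h
    have := congrArg Complex.im h
    simp at this; linarith
  obtain ⟨K0, hK0⟩ := (isCompact_Icc.image_of_continuousOn hbc.norm).bddAbove
  have hK0' : ∀ x : ℝ, -(1/2) ≤ x → x ≤ 2 → ‖Hf (x + t₀ * I)‖ ≤ K0 := fun x h1 h2 =>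
    hK0 ⟨x, ⟨h1, h2⟩, rfl⟩
  have hK0nn : 0 ≤ K0 := (norm_nonneg _).trans (hK0' 0 (by norm_num) (by norm_num))
  set S0 := ∑ ρ ∈ zfin t₀, deriv ζ ρ with hS0
  refine ⟨‖S0‖ + (3 * K0 + K1 + K2 + K3 + K4), by positivity, fun T hT hadm => ?_⟩
  have hT0 : 0 < T := by linarith
  have hlog2 : 2 ≤ Real.log T := by
    rw [Real.le_log_iff_exp_le hT0]
    have : Real.exp 2 = Real.exp 1 * Real.exp 1 := by rw [← Real.exp_add]; norm_num
    have h1 := Real.exp_one_lt_d9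
    nlinarith [Real.exp_pos 1]
  have htop' := htop T hT hadm
  have hsmall' := hsmall t₀ T ht0 ht1 hT
  have hmain' := hmain t₀ T ht0 ht1 hT
  set ℓ := Real.log T with hℓ
  set a := 1 + 1 / ℓ with ha
  have hinv : 1 / ℓ ≤ 1/2 := by rw [div_le_div_iff₀ (by linarith) (by norm_num)]; linarith
  have hinv0 : 0 < 1 / ℓ := by positivity
  have hdz : ∀ ρ, ζ ρ = 0 → ρ.im ≠ T := by
    intro ρ h0 h
    have := hadm ρ ⟨h0, zero_in_strip h0 (by rw [h]; linarith)⟩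
    rw [h, sub_self, abs_zero] at this
    have : 0 < δ / ℓ := by positivity
    linarith
  have hright' := hright a t₀ T (by linarith) (by linarith) (by linarith)
  have hrect := Hf_rect (p := 1 - a) (q := a) (c := t₀) (d := T) (by linarith) (by linarith) (by linarith) (by linarith) hcz hdz
  -- split of the sum
  have hsplit : zetaZeroSum 1 T = S0 + ∑ ρ ∈ (zfin T).filter (fun ρ => t₀ < ρ.im), deriv ζ ρ := by
    rw [zetaZeroSum_eq, ← Finset.sum_filter_not_add_sum_filter (zfin T) (fun ρ => t₀ < ρ.im), hS0]
    congr 1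
    refine Finset.sum_congr ?_ fun _ _ => rfl
    ext ρ
    simp only [Finset.mem_filter, mem_zfin, not_lt]
    constructor
    · rintro ⟨⟨h1, h2, -⟩, h3⟩; exact ⟨h1, h2, h3⟩
    · rintro ⟨h1, h2, h3⟩; exact ⟨⟨h1, h2, by linarith⟩, h3⟩
  set S1 := ∑ ρ ∈ (zfin T).filter (fun ρ => t₀ < ρ.im), deriv ζ ρ with hS1
  rw [rectInt] at hrect
  have hbot : ‖∫ x in (1-a)..a, Hf (x + t₀ * I)‖ ≤ 3 * K0 := by
    have := intervalIntegral.norm_integral_le_of_norm_le_const (a := 1-a) (b := a) (C := K0) (f := fun x : ℝ => Hf (x + t₀ * I)) (fun x hx => by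
      rw [Set.uIoc_of_le (by linarith)] at hx
      exact hK0' x (by linarith [hx.1]) (by linarith [hx.2]))
    refine this.trans ?_
    rw [abs_of_nonneg (by linarith), mul_comm]
    gcongr
    linarith
  -- left edge
  have hleft : (∫ y in t₀..T, Hf ((1 - a : ℝ) + y * I)) =
      (starRingEnd ℂ) ((∫ t in t₀..T, YF ((a:ℂ) + t * I) * Hf ((a:ℂ) + t * I)) +
        ∫ t in t₀..T, YF ((a:ℂ) + t * I) * ζ ((a:ℂ) + t * I) * deriv LY ((a:ℂ) + t * I)) := by
    have hYc : Continuous (fun t : ℝ => YF (a + t * I)) := by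
      simp only [YF]
      exact (XF_line_cont (σ := a) (by linarith)).mul (by fun_prop)
    have hlc : ∀ t : ℝ, (a:ℂ) + t * I ≠ 1 := fun t => ne_one_of_re (by simp; linarith)
    have hi1 : IntervalIntegrable (fun t : ℝ => YF ((a:ℂ) + t * I) * Hf ((a:ℂ) + t * I)) MeasureTheory.volume t₀ T :=
      (hYc.mul (Hf_line_cont (by linarith))).intervalIntegrable _ _
    have hHl : ContinuousOn (fun t : ℝ => Hf (1 - ((a:ℂ) + t * I))) (Set.uIcc t₀ T) := by
      intro t ht
      rw [Set.uIcc_of_le (by linarith)] at ht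
      have htp : 0 < t := by linarith [ht.1]
      refine ContinuousAt.continuousWithinAt ?_
      have hA : AnalyticAt ℂ Hf (1 - ((a:ℂ) + t * I)) := by
        refine Hf_analyticAt ?_ ?_
        · intro h
          have := congrArg Complex.im h
          simp at this; linarith
        · intro h0
          have := zero_in_strip h0 (by simp; linarith)
          simp at this
          linarith [this.1]
      exact ContinuousAt.comp (f := fun t : ℝ => 1 - ((a:ℂ) + t * I)) hA.continuousAt (by fun_prop)
    have hrefl : ∀ t ∈ Set.uIcc t₀ T, Hf (1 - ((a:ℂ) + t * I)) = YF ((a:ℂ) + t * I) * Hf ((a:ℂ) + t * I) + YF ((a:ℂ) + t * I) * ζ ((a:ℂ) + t * I) * deriv LY ((a:ℂ) + t * I) := by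
      intro t ht
      rw [Set.uIcc_of_le (by linarith)] at ht
      exact Hf_reflect (by simp; linarith) (by simp; linarith [ht.1])
    have hi2 : IntervalIntegrable (fun t : ℝ => YF ((a:ℂ) + t * I) * ζ ((a:ℂ) + t * I) * deriv LY ((a:ℂ) + t * I)) MeasureTheory.volume t₀ T := by
      refine (hHl.intervalIntegrable.sub hi1).congr ?_
      intro t ht
      simp only [Pi.sub_apply]
      rw [hrefl t (Set.uIoc_subset_uIcc ht)]; ring
    rw [← intervalIntegral.integral_add hi1 hi2, ← intervalIntegral.integral_congr (fun t ht => hrefl t ht), ← intervalIntegral_conj']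
    refine intervalIntegral.integral_congr fun t _ => ?_
    rw [← Hf_conj]
    congr 1
    apply Complex.ext <;> simp
  set IB := ∫ x in (1-a)..a, Hf (x + t₀ * I)
  set IT := ∫ x in (1-a)..a, Hf (x + T * I)
  set IR := ∫ y in t₀..T, Hf (a + y * I)
  set IM := ∫ t in t₀..T, YF ((a:ℂ) + t * I) * Hf ((a:ℂ) + t * I)
  set IS := ∫ t in t₀..T, YF ((a:ℂ) + t * I) * ζ ((a:ℂ) + t * I) * deriv LY ((a:ℂ) + t * I)
  rw [hleft] at hrect
  set B := BF (T / (2 * π))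
  have hconj : (starRingEnd ℂ) (IM + IS) = (starRingEnd ℂ) (IM - 2 * π * B) + (starRingEnd ℂ) IS + 2 * π * B := by
    have h2 : (starRingEnd ℂ) 2 = 2 := Complex.conj_ofNat 2
    simp [h2]
    ring
  have hfin : 2 * π * (S1 - B) = (starRingEnd ℂ) (IM - 2 * π * B) + (starRingEnd ℂ) IS + I * (IB - IT) - IR := by
    rw [hconj] at hrect
    have hI := Complex.I_mul_I
    linear_combination (-I) * hrect - ((starRingEnd ℂ) (IM - 2 * π * B) + (starRingEnd ℂ) IS + 2 * π * B - 2 * π * S1 - IR) * hI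
  have hn : 2 * π * ‖S1 - B‖ ≤ ‖IM - 2 * π * B‖ + ‖IS‖ + (‖IB‖ + ‖IT‖) + ‖IR‖ := by
    have : ‖(2 * π * (S1 - B) : ℂ)‖ = 2 * π * ‖S1 - B‖ := by
      rw [norm_mul, norm_mul, Complex.norm_real, Real.norm_of_nonneg Real.pi_pos.le]; simp
    rw [← this, hfin]
    refine (norm_sub_le _ _).trans (add_le_add ?_ le_rfl)
    refine (norm_add_le _ _).trans (add_le_add ?_ ?_)
    · refine (norm_add_le _ _).trans ?_
      rw [Complex.norm_conj, Complex.norm_conj]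
    · rw [norm_mul, Complex.norm_I, one_mul]; exact norm_sub_le _ _
  have hℓ0 : 0 < ℓ := by linarith
  set v := T ^ ((1:ℝ)/2) with hv
  set w := ℓ ^ ((7:ℝ)/2) with hw
  have hv1 : 1 ≤ v := Real.one_le_rpow (by linarith) (by norm_num)
  have hw1 : 1 ≤ w := Real.one_le_rpow (by linarith) (by norm_num)
  have hw3 : ℓ ^ 3 ≤ w := by
    rw [hw, ← Real.rpow_natCast]
    exact Real.rpow_le_rpow_of_exponent_le (by linarith) (by norm_num)
  have hw2 : ℓ ^ 2 ≤ w := by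
    rw [hw, ← Real.rpow_natCast]
    exact Real.rpow_le_rpow_of_exponent_le (by linarith) (by norm_num)
  have hvw : 1 ≤ v * w := by nlinarith
  have hR2 : K1 / (a - 1) ^ 3 = K1 * ℓ ^ 3 := by rw [ha]; field_simp; ring
  rw [hR2] at hright'
  have e1 : K1 * ℓ ^ 3 ≤ K1 * (v * w) := by
    gcongr; nlinarith
  have e3 : K3 * v * ℓ ^ 2 ≤ K3 * (v * w) := by rw [mul_assoc]; gcongr
  have e4 : K4 * v * ℓ ^ 3 ≤ K4 * (v * w) := by rw [mul_assoc]; gcongr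
  have e0 : 3 * K0 ≤ 3 * K0 * (v * w) := le_mul_of_one_le_right (by positivity) hvw
  have eS : ‖S0‖ ≤ ‖S0‖ * (v * w) := le_mul_of_one_le_right (by positivity) hvw
  have hpi : ‖S1 - B‖ ≤ 2 * π * ‖S1 - B‖ := by nlinarith [Real.pi_gt_three, norm_nonneg (S1 - (B:ℂ))]
  rw [hsplit, add_sub_assoc]
  refine (norm_add_le _ _).trans ?_
  linarith

/-- Second order Taylor data. -/
def Jet (f : ℂ → ℂ) (p c0 c1 c2 : ℂ) : Prop :=
  ∃ R : ℂ → ℂ, AnalyticAt ℂ R p ∧ ∀ᶠ z in 𝓝 p, f z = c0 + c1 * (z - p) + c2 * (z - p) ^ 2 + R z * (z - p) ^ 3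

lemma dslope_analyticAt {f : ℂ → ℂ} {p : ℂ} (hf : AnalyticAt ℂ f p) : AnalyticAt ℂ (dslope f p) p := by
  obtain ⟨q, hq⟩ := hf
  exact ⟨_, hq.has_fpower_series_dslope_fslope⟩

lemma dslope_eq (f : ℂ → ℂ) (p z : ℂ) : f z = f p + (z - p) * dslope f p z := by
  have := sub_smul_dslope f p z
  rw [smul_eq_mul] at this
  rw [this]; ring

lemma jet_taylor {f : ℂ → ℂ} {p : ℂ} (hf : AnalyticAt ℂ f p) :
    Jet f p (f p) (deriv f p) (deriv (deriv f) p / 2) := by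
  have h1 := dslope_analyticAt hf
  have h2 := dslope_analyticAt h1
  refine ⟨_, dslope_analyticAt h2, Eventually.of_forall fun z => ?_⟩
  have hd2 : deriv (deriv f) p = 2 * deriv (dslope f p) p := by
    have he : deriv f =ᶠ[𝓝 p] fun z => dslope f p z + (z - p) * deriv (dslope f p) z := by
      filter_upwards [h1.eventually_analyticAt] with z hz
      have h3 : HasDerivAt (fun z => f p + (z - p) * dslope f p z) (1 * dslope f p z + (z - p) * deriv (dslope f p) z) z :=
        (((hasDerivAt_id z).sub_const p).mul hz.differentiableAt.hasDerivAt).const_add (f p)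
      have h4 : f = fun z => f p + (z - p) * dslope f p z := funext fun z => dslope_eq f p z
      rw [h4, h3.deriv, ← h4]; ring
    rw [he.deriv_eq]
    have h5 : HasDerivAt (fun z => dslope f p z + (z - p) * deriv (dslope f p) z)
        (deriv (dslope f p) p + (1 * deriv (dslope f p) p + (p - p) * deriv (deriv (dslope f p)) p)) p :=
      h1.differentiableAt.hasDerivAt.add (((hasDerivAt_id p).sub_const p).mul h1.deriv.differentiableAt.hasDerivAt)
    rw [h5.deriv]; ring
  rw [hd2, dslope_eq f p z, dslope_eq (dslope f p) p z, dslope_eq (dslope (dslope f p) p) p z, dslope_same, dslope_same]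
  ring

lemma Jet.mul {f g : ℂ → ℂ} {p c0 c1 c2 d0 d1 d2 : ℂ} (hf : Jet f p c0 c1 c2) (hg : Jet g p d0 d1 d2) :
    Jet (fun z => f z * g z) p (c0 * d0) (c0 * d1 + c1 * d0) (c0 * d2 + c1 * d1 + c2 * d0) := by
  obtain ⟨R, hR, h1⟩ := hf
  obtain ⟨S, hS, h2⟩ := hg
  refine ⟨fun z => R z * (d0 + d1 * (z - p) + d2 * (z - p) ^ 2 + S z * (z - p) ^ 3) +
    (c0 + c1 * (z - p) + c2 * (z - p) ^ 2) * S z + (c1 * d2 + c2 * d1) + c2 * d2 * (z - p), ?_, ?_⟩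
  · have : AnalyticAt ℂ (fun z : ℂ => z - p) p := analyticAt_id.sub analyticAt_const
    fun_prop
  · filter_upwards [h1, h2] with z e1 e2
    rw [e1, e2]; ring

lemma Z_at_one : riemannZeta₁ 1 = 1 := by simp [riemannZeta₁]

/-- The cubic Laurent data of `Hf` at `1`. -/
lemma Hf_jet : Jet (fun z => riemannZeta₁ z + (z - 1) ^ 2 * (deriv (deriv riemannZeta₁) z - deriv riemannZeta₁ z ^ 2 / riemannZeta₁ z)) 1
    1 (deriv riemannZeta₁ 1) (3 * (deriv (deriv riemannZeta₁) 1 / 2) - deriv riemannZeta₁ 1 ^ 2) := by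
  have hZ := riemannZeta₁_analyticAt 1
  obtain ⟨R, hR, h1⟩ := jet_taylor hZ
  have hW : AnalyticAt ℂ (fun z => deriv (deriv riemannZeta₁) z - deriv riemannZeta₁ z ^ 2 / riemannZeta₁ z) 1 := by
    refine hZ.deriv.deriv.sub ((hZ.deriv.pow 2).div hZ ?_)
    rw [Z_at_one]; exact one_ne_zero
  set W := fun z => deriv (deriv riemannZeta₁) z - deriv riemannZeta₁ z ^ 2 / riemannZeta₁ z with hWd
  have hW1 : W 1 = deriv (deriv riemannZeta₁) 1 - deriv riemannZeta₁ 1 ^ 2 := by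
    rw [hWd]; simp only [Z_at_one, div_one]
  refine ⟨fun z => R z + dslope W 1 z, hR.add (dslope_analyticAt hW), ?_⟩
  filter_upwards [h1] with z e1
  have : deriv (deriv riemannZeta₁) z - deriv riemannZeta₁ z ^ 2 / riemannZeta₁ z = W z := rfl
  rw [this, dslope_eq W 1 z, hW1, e1, Z_at_one]; ring

/-- Perron weight. -/
noncomputable def GF (L : ℝ) (z : ℂ) : ℂ := cexp ((z + 1) * L) / (z * (z + 1))

lemma GF_analyticAt {L : ℝ} {z : ℂ} (h0 : z ≠ 0) (h1 : z ≠ -1) : AnalyticAt ℂ (GF L) z := by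
  have : z + 1 ≠ 0 := fun h => h1 (eq_neg_of_add_eq_zero_left h)
  unfold GF
  refine AnalyticAt.div ?_ ?_ (mul_ne_zero h0 this)
  · fun_prop
  · fun_prop

lemma GF_jet (L : ℝ) : Jet (GF L) 1 (cexp (2 * L) * (1/2)) (cexp (2 * L) * (-3/4) + L * cexp (2 * L) * (1/2))
    (cexp (2 * L) * (7/8) + L * cexp (2 * L) * (-3/4) + L ^ 2 * cexp (2 * L) / 2 * (1/2)) := by
  have hE : AnalyticAt ℂ (fun z : ℂ => cexp ((z + 1) * L)) 1 := by fun_prop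
  have hd : ∀ (c : ℂ), deriv (fun z : ℂ => c * cexp ((z + 1) * L)) = fun z => c * L * cexp ((z + 1) * L) := by
    intro c
    funext z
    have h1 : HasDerivAt (fun z : ℂ => (z + 1) * (L:ℂ)) (1 * (L:ℂ)) z := ((hasDerivAt_id z).add_const 1).mul_const _
    have h2 : HasDerivAt (fun z : ℂ => c * cexp ((z + 1) * L)) (c * (cexp ((z + 1) * L) * (1 * L))) z := (h1.cexp).const_mul c
    rw [h2.deriv]; ring
  have hd1 : deriv (fun z : ℂ => cexp ((z + 1) * L)) = fun z => (L:ℂ) * cexp ((z + 1) * L) := by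
    have := hd 1
    simpa using this
  have hj := jet_taylor hE
  rw [hd1, hd] at hj
  have hr : Jet (fun z : ℂ => 1 / (z * (z + 1))) 1 (1/2) (-3/4) (7/8) := by
    refine ⟨fun z => -(15/8 + 7/8 * (z - 1)) / (z * (z + 1)), ?_, ?_⟩
    · refine AnalyticAt.div (by fun_prop) (by fun_prop) (by norm_num)
    · have h0 : ∀ᶠ z : ℂ in 𝓝 1, z ≠ 0 := continuousAt_id.eventually_ne one_ne_zero
      have h1 : ∀ᶠ z : ℂ in 𝓝 1, z + 1 ≠ 0 := (continuousAt_id.add continuousAt_const).eventually_ne (by norm_num)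
      filter_upwards [h0, h1] with z e0 e1
      field_simp
      ring
  have hm := hj.mul hr
  have e : (1:ℂ) + 1 = 2 := by norm_num
  simp only [e] at hm
  convert hm using 1
  · funext z; rw [GF]; ring
  · ring

lemma cube_pole {f : ℂ → ℂ} {p c0 c1 c2 : ℂ} (h : Jet f p c0 c1 c2) : ∃ k2 k3 : ℂ, ∃ h : ℂ → ℂ, AnalyticAt ℂ h p ∧ ∀ᶠ z in 𝓝[≠] p,
      f z / (z - p) ^ 3 = h z + c2 * (1 / (z - p)) + k2 * (1 / (z - p) ^ 2) + k3 * (1 / (z - p) ^ 3) := by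
  obtain ⟨R, hR, h1⟩ := h
  refine ⟨c1, c0, R, hR, ?_⟩
  filter_upwards [nhdsWithin_le_nhds h1, self_mem_nhdsWithin] with z e1 e2
  have : z - p ≠ 0 := sub_ne_zero.mpr e2
  rw [e1]; field_simp; ring

lemma simple_pole_mul {f g h : ℂ → ℂ} {p k : ℂ} (hg : AnalyticAt ℂ g p) (hh : AnalyticAt ℂ h p)
    (hf : ∀ᶠ z in 𝓝[≠] p, f z = h z + k * (1 / (z - p))) :
    ∃ k2 k3 : ℂ, ∃ h : ℂ → ℂ, AnalyticAt ℂ h p ∧ ∀ᶠ z in 𝓝[≠] p,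
      f z * g z = h z + k * g p * (1 / (z - p)) + k2 * (1 / (z - p) ^ 2) + k3 * (1 / (z - p) ^ 3) := by
  refine ⟨0, 0, fun z => h z * g z + k * dslope g p z, (hh.mul hg).add (analyticAt_const.mul (dslope_analyticAt hg)), ?_⟩
  filter_upwards [hf, self_mem_nhdsWithin] with z e1 e2
  have h0 : z - p ≠ 0 := sub_ne_zero.mpr e2
  rw [e1]
  have := dslope_eq g p z
  have h3 : k * (1 / (z - p)) * g z = k * g p * (1 / (z - p)) + k * dslope g p z := by
    rw [this]; field_simp
  linear_combination h3

lemma perron_one {x : ℝ} (hx : 0 < x) :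
    ∫ t : ℝ, cexp (((2:ℝ) + t * I) * Real.log x) / (((2:ℝ) + t * I) * ((2:ℝ) + t * I + 1)) = 2 * π * (max (1 - 1 / x) 0 : ℝ) := by
  set f : ℝ → ℂ := fun u => Set.indicator (Set.Ioc 0 1) (fun _ => 1 : ℝ → ℂ) u - Set.indicator (Set.Ioc 0 1) (fun t => (t:ℂ) ^ (1:ℂ) : ℝ → ℂ) u with hf
  have hmel : ∀ s : ℂ, 0 < s.re → HasMellin f s (1 / (s * (s + 1))) := by
    intro s hs
    have h1 := hasMellin_one_Ioc hs
    have h2 := hasMellin_cpow_Ioc 1 (s := s) (by simp; linarith)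
    have h3 := hasMellin_sub h1.1 h2.1
    rw [h1.2, h2.2] at h3
    have hs0 : s ≠ 0 := by rintro rfl; simp at hs
    have hs1 : s + 1 ≠ 0 := by intro h; have := congrArg Complex.re h; simp at this; linarith
    have e : 1 / s - 1 / (s + 1) = 1 / (s * (s + 1)) := by field_simp; ring
    rwa [e] at h3
  have hfv : ∀ u : ℝ, 0 < u → f u = (max (1 - u) 0 : ℝ) := by
    intro u hu
    simp only [hf, Set.indicator]
    by_cases h : u ≤ 1
    · rw [if_pos ⟨hu, h⟩, if_pos ⟨hu, h⟩, max_eq_left (by linarith)]; push_cast; simp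
    · rw [if_neg (fun h' => h h'.2), if_neg (fun h' => h h'.2), max_eq_right (by linarith)]; simp
  have hpt : ∀ t : ℝ, mellin f (((2:ℝ):ℂ) + t * I) = 1 / (((2:ℝ) + t * I) * ((2:ℝ) + t * I + 1)) := fun t =>
    (hmel _ (by simp)).2
  have hne : ∀ t : ℝ, (((2:ℝ):ℂ) + t * I) * ((2:ℝ) + t * I + 1) ≠ 0 := by
    intro t
    refine mul_ne_zero ?_ ?_ <;> (intro h; have := congrArg Complex.re h; norm_num at this)
  have hnorm : ∀ t : ℝ, ‖1 / ((((2:ℝ):ℂ) + t * I) * ((2:ℝ) + t * I + 1))‖ ≤ (1 + t ^ 2)⁻¹ := by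
    intro t
    rw [norm_div, norm_one, one_div, norm_mul]
    apply inv_anti₀ (by positivity)
    have h1 : Real.sqrt (1 + t ^ 2) ≤ ‖((2:ℝ):ℂ) + t * I‖ := by
      rw [Complex.norm_def]; apply Real.sqrt_le_sqrt; simp [Complex.normSq_apply]; nlinarith
    have h2 : Real.sqrt (1 + t ^ 2) ≤ ‖((2:ℝ):ℂ) + t * I + 1‖ := by
      rw [Complex.norm_def]; apply Real.sqrt_le_sqrt; simp [Complex.normSq_apply]; nlinarith
    calc 1 + t ^ 2 = Real.sqrt (1 + t ^ 2) * Real.sqrt (1 + t ^ 2) := (Real.mul_self_sqrt (by positivity)).symm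
      _ ≤ _ := by gcongr
  have hvi : VerticalIntegrable (mellin f) 2 := by
    rw [VerticalIntegrable]
    simp only [hpt]
    refine integrable_inv_one_add_sq.mono' ?_ (Eventually.of_forall hnorm)
    refine Continuous.aestronglyMeasurable ?_
    exact continuous_const.div (by fun_prop) hne
  have hcont : ContinuousAt f (1/x) := by
    have : f =ᶠ[𝓝 (1/x)] fun u => ((max (1 - u) 0 : ℝ) : ℂ) := by
      filter_upwards [lt_mem_nhds (show 0 < 1/x by positivity)] with u hu
      exact hfv u hu
    refine ContinuousAt.congr ?_ this.symm
    fun_prop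
  have key := mellinInv_mellin_eq 2 f (x := 1/x) (by positivity) (by simpa using (hmel ((2:ℝ):ℂ) (by simp)).1) hvi hcont
  rw [hfv _ (by positivity), mellinInv] at key
  simp only [hpt] at key
  have e : ∀ t : ℝ, ((1/x : ℝ):ℂ) ^ (-(((2:ℝ):ℂ) + t * I)) • (1 / ((((2:ℝ):ℂ) + t * I) * ((2:ℝ) + t * I + 1))) =
      cexp (((2:ℝ) + t * I) * Real.log x) / (((2:ℝ) + t * I) * ((2:ℝ) + t * I + 1)) := by
    intro t
    rw [smul_eq_mul, Complex.cpow_def_of_ne_zero (by exact_mod_cast (by positivity : (1/x:ℝ) ≠ 0)), ← Complex.ofReal_log (by positivity),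
      one_div x, Real.log_inv, mul_one_div]
    congr 2
    push_cast; ring
  simp only [e] at key
  generalize (∫ t : ℝ, cexp (((2:ℝ) + t * I) * Real.log x) / (((2:ℝ) + t * I) * ((2:ℝ) + t * I + 1))) = J at key ⊢
  rw [← key]
  rw [Complex.real_smul]
  have hpi : (π : ℂ) ≠ 0 := by exact_mod_cast Real.pi_ne_zero
  push_cast
  field_simp

/-- First Riesz mean of `bco`. -/
noncomputable def BR (y : ℝ) : ℝ := ∑ n ∈ range (⌊y⌋₊ + 1), bco n * (y - n)

lemma inv_quad_norm {a t : ℝ} (ha : 1 ≤ a) : ‖1 / (((a:ℂ) + t * I) * ((a:ℂ) + t * I + 1))‖ ≤ (1 + t ^ 2)⁻¹ := by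
  rw [norm_div, norm_one, one_div, norm_mul]
  apply inv_anti₀ (by positivity)
  have h1 : Real.sqrt (1 + t ^ 2) ≤ ‖(a:ℂ) + t * I‖ := by
    rw [Complex.norm_def]; apply Real.sqrt_le_sqrt; simp [Complex.normSq_apply]; nlinarith
  have h2 : Real.sqrt (1 + t ^ 2) ≤ ‖(a:ℂ) + t * I + 1‖ := by
    rw [Complex.norm_def]; apply Real.sqrt_le_sqrt; simp [Complex.normSq_apply]; nlinarith
  calc 1 + t ^ 2 = Real.sqrt (1 + t ^ 2) * Real.sqrt (1 + t ^ 2) := (Real.mul_self_sqrt (by positivity)).symm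
    _ ≤ _ := by gcongr

lemma two_line_ne (t : ℝ) : (((2:ℝ):ℂ) + t * I) * ((2:ℝ) + t * I + 1) ≠ 0 := by
  refine mul_ne_zero ?_ ?_ <;> (intro h; have := congrArg Complex.re h; norm_num at this)

lemma two_line_int {x : ℝ} (hx : 0 < x) : MeasureTheory.Integrable (fun t : ℝ =>
    cexp (((2:ℝ) + t * I) * Real.log x) / (((2:ℝ) + t * I) * ((2:ℝ) + t * I + 1))) ∧
    ∀ t : ℝ, ‖cexp (((2:ℝ) + t * I) * Real.log x) / (((2:ℝ) + t * I) * ((2:ℝ) + t * I + 1))‖ ≤ x ^ 2 * (1 + t ^ 2)⁻¹ := by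
  have hb : ∀ t : ℝ, ‖cexp (((2:ℝ) + t * I) * Real.log x) / (((2:ℝ) + t * I) * ((2:ℝ) + t * I + 1))‖ ≤ x ^ 2 * (1 + t ^ 2)⁻¹ := by
    intro t
    rw [← mul_one_div, norm_mul]
    have h1 := inv_quad_norm (a := 2) (t := t) (by norm_num)
    have h2 : ‖cexp (((2:ℝ) + t * I) * Real.log x)‖ = x ^ 2 := by
      rw [Complex.norm_exp]
      have : ((((2:ℝ):ℂ) + t * I) * (Real.log x : ℂ)).re = Real.log x * 2 := by
        simp only [mul_re, add_re, add_im, ofReal_re, ofReal_im, I_re, I_im, mul_im]; ring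
      rw [this, Real.exp_mul, Real.exp_log hx]; norm_num
    rw [h2]; gcongr
  refine ⟨(integrable_inv_one_add_sq.const_mul (x ^ 2)).mono' ?_ (Eventually.of_forall hb), hb⟩
  exact Continuous.aestronglyMeasurable (Continuous.div (by fun_prop) (by fun_prop) two_line_ne)

lemma BR_perron {y : ℝ} (hy : 0 < y) :
    MeasureTheory.Integrable (fun t : ℝ => Hf ((2:ℝ) + t * I) * GF (Real.log y) ((2:ℝ) + t * I)) ∧
    ∫ t : ℝ, Hf ((2:ℝ) + t * I) * GF (Real.log y) ((2:ℝ) + t * I) = 2 * π * BR y := by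
  set P : ℝ → ℝ → ℂ := fun x t => cexp (((2:ℝ) + t * I) * Real.log x) / (((2:ℝ) + t * I) * ((2:ℝ) + t * I + 1)) with hP
  set F : ℕ → ℝ → ℂ := fun n t => ((bco n * y : ℝ) : ℂ) * P (y / n) t with hF
  have hterm : ∀ (n : ℕ) (t : ℝ), (bco n : ℂ) * (n:ℂ) ^ (-(((2:ℝ):ℂ) + t * I)) * GF (Real.log y) ((2:ℝ) + t * I) = F n t := by
    intro n t
    rcases Nat.eq_zero_or_pos n with rfl | hn
    · simp [hF, bco_zero]
    have hn' : (0:ℝ) < n := by exact_mod_cast hn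
    simp only [hF, hP, GF]
    rw [Complex.cpow_def_of_ne_zero (by exact_mod_cast hn.ne'), ← Complex.natCast_log, Real.log_div hy.ne' hn'.ne']
    have : cexp (((2:ℝ) + t * I + 1) * Real.log y) = y * cexp (((2:ℝ) + t * I) * Real.log y) := by
      rw [add_mul, Complex.exp_add, one_mul, ← Complex.ofReal_exp, Real.exp_log hy]; ring
    rw [this]
    have h3 : cexp (((2:ℝ) + t * I) * ((Real.log y - Real.log n : ℝ):ℂ)) = cexp (((Real.log n : ℝ):ℂ) * -(((2:ℝ):ℂ) + t * I)) * cexp (((2:ℝ) + t * I) * Real.log y) := by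
      rw [← Complex.exp_add]; congr 1; push_cast; ring
    rw [h3]
    push_cast; ring
  have hsumt : ∀ t : ℝ, HasSum (fun n => F n t) (Hf ((2:ℝ) + t * I) * GF (Real.log y) ((2:ℝ) + t * I)) := by
    intro t
    have := (Hf_hasSum (s := ((2:ℝ):ℂ) + t * I) (by simp)).mul_right (GF (Real.log y) ((2:ℝ) + t * I))
    exact this.congr_fun (fun n => (hterm n t).symm) |> fun h => h
  have hpos : ∀ n : ℕ, F n = 0 ∨ 0 < (n:ℝ) := by
    intro n
    rcases Nat.eq_zero_or_pos n with rfl | hn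
    · left; funext t; simp [hF, bco_zero]
    · right; exact_mod_cast hn
  have hint : ∀ n, MeasureTheory.Integrable (F n) := by
    intro n
    rcases hpos n with h | h
    · rw [h]; exact MeasureTheory.integrable_zero _ _ _
    · exact (two_line_int (div_pos hy h)).1.const_mul _
  have hFb : ∀ n t, ‖F n t‖ ≤ bco n * (n:ℝ) ^ (-(2:ℝ)) * y ^ 3 * (1 + t ^ 2)⁻¹ := by
    intro n t
    rcases Nat.eq_zero_or_pos n with rfl | hn
    · simp [hF, bco_zero]
    have hn' : (0:ℝ) < n := by exact_mod_cast hn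
    simp only [hF]
    rw [norm_mul, Complex.norm_real, Real.norm_of_nonneg (mul_nonneg (bco_nonneg n) hy.le)]
    have := (two_line_int (div_pos hy hn')).2 t
    calc bco n * y * ‖P (y / n) t‖ ≤ bco n * y * ((y / n) ^ 2 * (1 + t ^ 2)⁻¹) := by
          have := bco_nonneg n
          gcongr
      _ = _ := by
          rw [Real.rpow_neg hn'.le, show ((n:ℝ) ^ (2:ℝ)) = (n:ℝ) ^ 2 by norm_num]
          field_simp
  have hs2 : Summable fun n : ℕ => bco n * (n:ℝ) ^ (-(2:ℝ)) * y ^ 3 := (bco_real_summable (by norm_num)).mul_right _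
  have hsum : Summable fun n => ∫ t, ‖F n t‖ := by
    refine Summable.of_nonneg_of_le (fun n => MeasureTheory.integral_nonneg fun t => norm_nonneg _) (fun n => ?_)
      (hs2.mul_right (∫ t : ℝ, (1 + t ^ 2)⁻¹))
    rw [← MeasureTheory.integral_const_mul]
    exact MeasureTheory.integral_mono (hint n).norm (integrable_inv_one_add_sq.const_mul _) (hFb n)
  have key := MeasureTheory.hasSum_integral_of_summable_integral_norm hint hsum
  have e1 : ∀ t, ∑' n, F n t = Hf ((2:ℝ) + t * I) * GF (Real.log y) ((2:ℝ) + t * I) := fun t => (hsumt t).tsum_eq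
  simp only [e1] at key
  constructor
  · have hb : ∀ t : ℝ, ‖Hf ((2:ℝ) + t * I) * GF (Real.log y) ((2:ℝ) + t * I)‖ ≤ (∑' n : ℕ, bco n * (n:ℝ) ^ (-(2:ℝ)) * y ^ 3) * (1 + t ^ 2)⁻¹ := by
      intro t
      rw [← e1]
      exact tsum_of_norm_bounded (hs2.hasSum.mul_right _) (fun n => hFb n t)
    refine (integrable_inv_one_add_sq.const_mul _).mono' ?_ (Eventually.of_forall hb)
    refine Continuous.aestronglyMeasurable ((Hf_line_cont (by norm_num)).mul ?_)
    exact Continuous.div (by fun_prop) (by fun_prop) two_line_ne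
  · have e2 : ∀ n, ∫ t, F n t = ((2 * π * (bco n * max (y - n) 0) : ℝ) : ℂ) := by
      intro n
      rcases Nat.eq_zero_or_pos n with rfl | hn
      · simp [hF, bco_zero]
      have hn' : (0:ℝ) < n := by exact_mod_cast hn
      simp only [hF]
      rw [MeasureTheory.integral_const_mul, perron_one (div_pos hy hn')]
      have : max (y - n) 0 = y * max (1 - 1 / (y / n)) 0 := by
        rw [mul_max_of_nonneg _ _ hy.le]; congr 1
        · field_simp
        · simp
      rw [this]; push_cast; ring
    simp only [e2] at key
    have h4 := hasSum_sum_of_ne_finset_zero (L := SummationFilter.unconditional ℕ) (f := fun n : ℕ => ((2 * π * (bco n * max (y - n) 0) : ℝ) : ℂ)) (s := range (⌊y⌋₊ + 1)) (by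
      intro n hn
      rw [mem_range, not_lt] at hn
      have : y < n := (Nat.floor_lt hy.le).mp (by omega)
      rw [max_eq_right (by linarith)]; simp)
    rw [key.unique h4, BR]
    push_cast
    rw [mul_sum]
    refine sum_congr rfl fun n hn => ?_
    rw [mem_range] at hn
    have : (n:ℝ) ≤ y := (Nat.le_floor_iff hy.le).mp (by omega)
    rw [max_eq_left (by linarith)]; push_cast; ring

lemma zeta_ne_zero_left {z : ℂ} (h1 : -(1/4) ≤ z.re) (h2 : z.re ≤ 0) : ζ z ≠ 0 := by
  intro h0
  by_cases him : z.im = 0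
  · by_cases hz : z = 0
    · rw [hz, riemannZeta_zero] at h0; norm_num at h0
    have hzr : z = (z.re : ℂ) := by apply Complex.ext <;> simp [him]
    have hlt : z.re < 0 := lt_of_le_of_ne h2 fun h => hz (by rw [hzr, h]; simp)
    have hs : ∀ n : ℕ, (1 - z) ≠ -n := by
      intro n h
      have := congrArg Complex.re h
      simp at this
      have hn : (0:ℝ) ≤ n := n.cast_nonneg
      linarith
    have := riemannZeta_one_sub hs (by intro h; apply hz; linear_combination -h)
    rw [sub_sub_cancel, h0] at this
    have hcos : Complex.cos (π * (1 - z) / 2) ≠ 0 := by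
      rw [hzr, show (π * (1 - (z.re:ℂ)) / 2) = ((π * (1 - z.re) / 2 : ℝ) : ℂ) by push_cast; ring, ← Complex.ofReal_cos]
      have hp := Real.pi_pos
      have : Real.cos (π * (1 - z.re) / 2) < 0 := Real.cos_neg_of_pi_div_two_lt_of_lt (by nlinarith) (by nlinarith)
      exact_mod_cast this.ne
    have hG : Complex.Gamma (1 - z) ≠ 0 := Complex.Gamma_ne_zero_of_re_pos (by simp; linarith)
    have hZ : ζ (1 - z) ≠ 0 := riemannZeta_ne_zero_of_one_le_re (by simp; linarith)
    have hc : ((2:ℂ) * π) ^ (-(1 - z)) ≠ 0 := by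
      rw [Complex.cpow_def_of_ne_zero (by exact_mod_cast (by positivity : (2 * π:ℝ) ≠ 0))]
      exact Complex.exp_ne_zero _
    exact (mul_ne_zero (mul_ne_zero (mul_ne_zero (mul_ne_zero two_ne_zero hc) hG) hcos) hZ) this.symm
  · linarith [(zero_in_strip h0 him).1]

lemma zaset_finite (T : ℝ) : {ρ : ℂ | ζ ρ = 0 ∧ 0 < ρ.re ∧ ρ.re < 1 ∧ |ρ.im| ≤ T}.Finite := by
  have hf := ((isCompact_Icc (a := (0:ℝ)) (b := 1)).reProdIm (isCompact_Icc (a := -T) (b := T))).inter_riemannZetaZeros_finite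
  refine hf.subset ?_
  rintro ρ ⟨h0, h1, h2, h3⟩
  refine ⟨?_, h0⟩
  rw [mem_reProdIm]
  exact ⟨⟨h1.le, h2.le⟩, abs_le.mp h3⟩

/-- All zeros in the critical strip up to height `T`. -/
noncomputable def zall (T : ℝ) : Finset ℂ := (zaset_finite T).toFinset

lemma mem_zall {T : ℝ} {ρ : ℂ} : ρ ∈ zall T ↔ ζ ρ = 0 ∧ 0 < ρ.re ∧ ρ.re < 1 ∧ |ρ.im| ≤ T := by
  simp only [zall, Set.Finite.mem_toFinset, Set.mem_setOf_eq]

lemma zero_mem_zall {T : ℝ} {z : ℂ} (h0 : ζ z = 0) (h1 : -(1/4) ≤ z.re) (hT : |z.im| ≤ T) : z ∈ zall T := by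
  rw [mem_zall]
  refine ⟨h0, ?_, ?_, hT⟩
  · by_contra h; exact zeta_ne_zero_left h1 (not_lt.mp h) h0
  · by_contra h; exact riemannZeta_ne_zero_of_one_le_re (not_lt.mp h) h0

/-- Residue at `s = 1`. -/
noncomputable def M1res (L : ℝ) : ℂ :=
  cexp (2 * L) * (7/8) + L * cexp (2 * L) * (-3/4) + L ^ 2 * cexp (2 * L) / 2 * (1/2)
   + deriv riemannZeta₁ 1 * (cexp (2 * L) * (-3/4) + L * cexp (2 * L) * (1/2))
   + (3 * (deriv (deriv riemannZeta₁) 1 / 2) - deriv riemannZeta₁ 1 ^ 2) * (cexp (2 * L) * (1/2))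

lemma F_rect (L : ℝ) {T : ℝ} (hT : 1 < T) (hTz : ∀ ρ, ζ ρ = 0 → ρ.im ≠ T) (hTz' : ∀ ρ, ζ ρ = 0 → ρ.im ≠ -T) :
    rectInt (fun z => Hf z * GF L z) (-(1/4)) 2 (-T) T = 2 * π * I *
      (M1res L + Hf 0 * cexp L - ∑ ρ ∈ zall T, deriv ζ ρ * GF L ρ) := by
  classical
  have h1z : (1:ℂ) ∉ zall T := fun h => by have := (mem_zall.mp h).2.2.1; simp at this
  have h0z : (0:ℂ) ∉ zall T := fun h => by have := (mem_zall.mp h).2.1; simp at this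
  have h10 : (1:ℂ) ∉ insert 0 (zall T) := by
    rw [Finset.mem_insert]; rintro (h | h)
    · exact one_ne_zero h
    · exact h1z h
  set res : ℂ → ℂ := fun p => if p = 1 then M1res L else if p = 0 then Hf 0 * cexp L else -(deriv ζ p) * GF L p with hres
  have hsum : ∑ p ∈ insert 1 (insert 0 (zall T)), res p = M1res L + Hf 0 * cexp L - ∑ ρ ∈ zall T, deriv ζ ρ * GF L ρ := by
    rw [Finset.sum_insert h10, Finset.sum_insert h0z]
    have : ∑ ρ ∈ zall T, res ρ = ∑ ρ ∈ zall T, -(deriv ζ ρ * GF L ρ) := by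
      refine sum_congr rfl fun ρ hρ => ?_
      simp only [hres]
      rw [if_neg (by rintro rfl; exact h1z hρ), if_neg (by rintro rfl; exact h0z hρ)]; ring
    rw [this, Finset.sum_neg_distrib]
    simp only [hres]
    rw [if_pos trivial, if_neg zero_ne_one, if_pos trivial]; ring
  have key := rect_residue (a := -(1/4)) (b := 2) (c := -T) (d := T) (by norm_num) (by linarith)
    (insert 1 (insert 0 (zall T))) res (fun z => Hf z * GF L z) ?_ ?_ ?_
  · rw [← hsum, ← key]
  · intro p hp
    rw [Finset.mem_insert, Finset.mem_insert] at hp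
    rcases hp with rfl | rfl | hp
    · simp; constructor <;> [norm_num; linarith]
    · simp; linarith
    · obtain ⟨h0, h1, h2, h3⟩ := mem_zall.mp hp
      refine ⟨⟨by linarith, by linarith⟩, lt_of_le_of_ne (abs_le.mp h3).1 (Ne.symm (hTz' p h0)), lt_of_le_of_ne (abs_le.mp h3).2 (hTz p h0)⟩
  · intro z hz1 hz2 hzS
    rw [Finset.mem_insert, Finset.mem_insert] at hzS
    push Not at hzS
    refine (Hf_analyticAt hzS.1 ?_).mul (GF_analyticAt hzS.2.1 ?_)
    · intro h0; exact hzS.2.2 (zero_mem_zall h0 hz1.1 (abs_le.mpr hz2))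
    · rintro rfl; have := hz1.1; norm_num at this
  · intro p hp
    rw [Finset.mem_insert, Finset.mem_insert] at hp
    rcases hp with rfl | rfl | hp
    · have hj := Hf_jet.mul (GF_jet L)
      obtain ⟨k2, k3, h, hh, he⟩ := cube_pole hj
      refine ⟨k2, k3, h, hh, ?_⟩
      have hz : ∀ᶠ z in 𝓝[≠] (1:ℂ), ζ z ≠ 0 := by
        have h1 : ∀ᶠ z in 𝓝 (1:ℂ), riemannZeta₁ z ≠ 0 :=
          (riemannZeta₁_analyticAt 1).continuousAt.eventually_ne (by rw [Z_at_one]; exact one_ne_zero)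
        filter_upwards [nhdsWithin_le_nhds h1, self_mem_nhdsWithin] with z h1 h2 h3
        rw [riemannZeta₁_eq_mul h2, h3, mul_zero] at h1
        exact h1 rfl
      filter_upwards [he, hz, self_mem_nhdsWithin] with z e1 e2 e3
      have hz0 : z - 1 ≠ 0 := sub_ne_zero.mpr e3
      have hr : res 1 = M1res L := by simp only [hres]; rw [if_pos trivial]
      have e4 : Hf z * GF L z = (riemannZeta₁ z + (z - 1) ^ 2 * (deriv (deriv riemannZeta₁) z - deriv riemannZeta₁ z ^ 2 / riemannZeta₁ z)) * GF L z / (z - 1) ^ 3 := by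
        rw [Hf_eq_Z e3 e2]; field_simp
      rw [e4, hr, e1, M1res]
      ring
    · have hA : AnalyticAt ℂ (fun z : ℂ => cexp ((z + 1) * L) / (z + 1)) 0 := by
        refine AnalyticAt.div (by fun_prop) (by fun_prop) (by norm_num)
      have hg : AnalyticAt ℂ Hf 0 := Hf_analyticAt zero_ne_one (by rw [riemannZeta_zero]; norm_num)
      obtain ⟨k2, k3, h, hh, he⟩ := simple_pole_mul (f := GF L) (g := Hf) (h := dslope (fun z : ℂ => cexp ((z + 1) * L) / (z + 1)) 0) (p := 0) (k := cexp L) hg (dslope_analyticAt hA) (by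
        filter_upwards [self_mem_nhdsWithin] with z hz
        have hz0 : z ≠ 0 := hz
        have := dslope_eq (fun z : ℂ => cexp ((z + 1) * L) / (z + 1)) 0 z
        simp only [zero_add, one_mul, div_one, sub_zero] at this
        rw [GF, mul_comm z, ← div_div, this]
        generalize dslope (fun z : ℂ => cexp ((z + 1) * L) / (z + 1)) 0 z = D
        rw [sub_zero]; field_simp; ring)
      refine ⟨k2, k3, h, hh, ?_⟩
      filter_upwards [he] with z e1
      have hr : res 0 = Hf 0 * cexp L := by simp only [hres]; rw [if_neg zero_ne_one, if_pos trivial]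
      rw [hr, mul_comm (Hf z), e1]; ring
    · have hp1 : p ≠ 1 := by rintro rfl; exact h1z hp
      have hp0 : p ≠ 0 := by rintro rfl; exact h0z hp
      obtain ⟨h0, h1, h2, h3⟩ := mem_zall.mp hp
      obtain ⟨h, ha, he⟩ := Hf_pole hp1 h0
      have := simple_pole_mul (GF_analyticAt (L := L) hp0 (by rintro rfl; norm_num at h1)) ha he
      simp only [hres]
      rw [if_neg hp1, if_neg hp0]
      exact this

lemma GF_norm (L : ℝ) (z : ℂ) : ‖GF L z‖ = Real.exp ((z.re + 1) * L) / (‖z‖ * ‖z + 1‖) := by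
  rw [GF, norm_div, norm_mul, Complex.norm_exp]
  congr 2
  simp

lemma Hf_left : ∃ K > (0:ℝ), ∀ t : ℝ, ‖Hf ((-(1/4) : ℝ) + t * I)‖ ≤ K * (1 + t ^ 2) ^ (3/8:ℝ) := by
  obtain ⟨CY, hCY, hY⟩ := YF_bound
  obtain ⟨Cz, hCz, hz⟩ := zeta_bound
  set A : ℝ := ∑' n : ℕ, bco n * (n : ℝ) ^ (-(5/4:ℝ)) with hA
  have hA0 : 0 ≤ A := tsum_nonneg fun n => mul_nonneg (bco_nonneg n) (by positivity)
  have hcont : Continuous (fun t : ℝ => Hf ((-(1/4) : ℝ) + t * I)) := by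
    rw [continuous_iff_continuousAt]
    intro t
    have h := Hf_analyticAt (s := ((-(1/4) : ℝ):ℂ) + t * I) (ne_of_apply_ne Complex.re (by norm_num))
      (zeta_ne_zero_left (by simp) (by simp))
    exact ContinuousAt.comp (f := fun t : ℝ => ((-(1/4):ℝ):ℂ) + t * I) h.continuousAt (by fun_prop)
  obtain ⟨B, hB⟩ := (isCompact_Icc (a := (-2:ℝ)) (b := 2)).exists_bound_of_continuousOn hcont.continuousOn
  refine ⟨|B| + CY * A + CY * Cz * 200 + 1, by positivity, fun t => ?_⟩
  have h1 : (1:ℝ) ≤ (1 + t ^ 2) ^ (3/8:ℝ) := Real.one_le_rpow (by nlinarith) (by norm_num)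
  by_cases ht : |t| ≤ 2
  · have := hB t (abs_le.mp ht)
    have h2 : |B| ≤ |B| + CY * A + CY * Cz * 200 + 1 := by
      have : 0 ≤ CY * A + CY * Cz * 200 + 1 := by positivity
      linarith
    calc _ ≤ |B| * 1 := by linarith [le_abs_self B]
      _ ≤ _ := by gcongr
  · push Not at ht
    set τ := |t| with hτ
    have hw : ‖Hf ((-(1/4) : ℝ) + t * I)‖ = ‖Hf (1 - ((5/4:ℝ) + τ * I))‖ := by
      rcases abs_cases t with ⟨h, _⟩ | ⟨h, _⟩
      · have : (1:ℂ) - (((5/4:ℝ):ℂ) + τ * I) = starRingEnd ℂ (((-(1/4) : ℝ):ℂ) + t * I) := by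
          rw [hτ, h]; apply Complex.ext <;> simp; norm_num
        rw [this, Hf_conj, RCLike.norm_conj]
      · congr 2
        rw [hτ, h]; apply Complex.ext <;> simp; norm_num
    rw [hw]
    set w : ℂ := (5/4:ℝ) + τ * I with hwd
    have hre : w.re = 5/4 := by simp [hwd]
    have him : w.im = τ := by simp [hwd]
    have hτ0 : 0 < τ := by linarith
    rw [Hf_reflect (by rw [hre]; norm_num) (by rw [him]; exact hτ0)]
    have a1 := hY w (by rw [hre]; norm_num) (by rw [hre]; norm_num) (by rw [him, abs_of_pos hτ0]; linarith)
    have a2 := Hf_norm_le (s := w) (by rw [hre]; norm_num)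
    have a3 := hz w (by rw [hre]; norm_num) (by rw [him, abs_of_pos hτ0]; linarith)
    have a4 := LY_deriv_le (s := w) (by rw [hre]; norm_num) (by rw [him]; linarith)
    rw [hre, him, abs_of_pos hτ0] at a1 a3
    rw [him] at a4
    rw [hre] at a2
    rw [show (max (1 - 5/4 : ℝ) 0) = 0 by norm_num, Real.rpow_zero, mul_one] at a3
    have hl : Real.log τ ≤ τ := (Real.log_le_sub_one_of_pos hτ0).trans (by linarith)
    have a5 : τ ^ (5/4 - 1/2 : ℝ) ≤ (1 + t ^ 2) ^ (3/8:ℝ) := by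
      have : τ ^ (5/4 - 1/2 : ℝ) = (t ^ 2) ^ (3/8:ℝ) := by
        rw [← sq_abs t, ← hτ, ← Real.rpow_natCast, ← Real.rpow_mul hτ0.le]; norm_num
      rw [this]
      exact Real.rpow_le_rpow (by positivity) (by linarith) (by norm_num)
    have a6 : ‖ζ w‖ * ‖deriv LY w‖ ≤ Cz * 200 := by
      calc _ ≤ (Cz * τ) * (200 / τ) := by
            gcongr
            exact a3.trans (by gcongr)
        _ = _ := by field_simp
    calc ‖YF w * Hf w + YF w * ζ w * deriv LY w‖ ≤ ‖YF w‖ * (‖Hf w‖ + ‖ζ w‖ * ‖deriv LY w‖) := by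
          refine (norm_add_le _ _).trans ?_
          rw [norm_mul, norm_mul, norm_mul]; linarith
      _ ≤ (CY * (1 + t ^ 2) ^ (3/8:ℝ)) * (A + Cz * 200) := by
          gcongr
          exact a1.trans (by gcongr)
      _ ≤ _ := by
          have h0 : (0:ℝ) ≤ (|B| + 1) * (1 + t ^ 2) ^ (3/8:ℝ) := by positivity
          nlinarith

lemma left_line : ∃ K > (0:ℝ), ∀ L T : ℝ, 0 ≤ T →
    ‖∫ t in (-T)..T, Hf ((-(1/4) : ℝ) + t * I) * GF L ((-(1/4) : ℝ) + t * I)‖ ≤ K * Real.exp (3/4 * L) := by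
  obtain ⟨K, hK, hb⟩ := Hf_left
  have hint : MeasureTheory.Integrable (fun t : ℝ => (1 + ‖t‖ ^ 2) ^ (-(5/4:ℝ)/2)) :=
    integrable_rpow_neg_one_add_norm_sq (by simp; norm_num)
  set J := ∫ t : ℝ, (1 + ‖t‖ ^ 2) ^ (-(5/4:ℝ)/2) with hJ
  have hJ0 : 0 ≤ J := MeasureTheory.integral_nonneg fun t => by positivity
  refine ⟨K * 16 * J + 1, by positivity, fun L T hT => ?_⟩
  have hpt : ∀ t : ℝ, ‖Hf ((-(1/4) : ℝ) + t * I) * GF L ((-(1/4) : ℝ) + t * I)‖ ≤ K * 16 * Real.exp (3/4 * L) * (1 + ‖t‖ ^ 2) ^ (-(5/4:ℝ)/2) := by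
    intro t
    rw [norm_mul, GF_norm]
    have hp : (0:ℝ) < 1 + t ^ 2 := by positivity
    have e1 : (((-(1/4) : ℝ):ℂ) + t * I).re + 1 = 3/4 := by simp; norm_num
    have h1 : (1/4) * Real.sqrt (1 + t ^ 2) ≤ ‖((-(1/4) : ℝ):ℂ) + t * I‖ := by
      rw [Complex.norm_def, show (1/4:ℝ) = Real.sqrt ((1/4)^2) by rw [Real.sqrt_sq (by norm_num)], ← Real.sqrt_mul (by positivity)]
      apply Real.sqrt_le_sqrt; simp [Complex.normSq_apply]; nlinarith
    have h2 : (1/4) * Real.sqrt (1 + t ^ 2) ≤ ‖((-(1/4) : ℝ):ℂ) + t * I + 1‖ := by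
      rw [Complex.norm_def, show (1/4:ℝ) = Real.sqrt ((1/4)^2) by rw [Real.sqrt_sq (by norm_num)], ← Real.sqrt_mul (by positivity)]
      apply Real.sqrt_le_sqrt; simp [Complex.normSq_apply]; nlinarith
    have h3 : (1/16) * (1 + t ^ 2) ≤ ‖((-(1/4) : ℝ):ℂ) + t * I‖ * ‖((-(1/4) : ℝ):ℂ) + t * I + 1‖ := by
      calc (1/16) * (1 + t ^ 2) = (1/4) * Real.sqrt (1 + t ^ 2) * ((1/4) * Real.sqrt (1 + t ^ 2)) := by
            nlinarith [Real.mul_self_sqrt hp.le]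
        _ ≤ _ := by gcongr
    rw [e1, Real.norm_eq_abs, sq_abs]
    calc _ ≤ (K * (1 + t ^ 2) ^ (3/8:ℝ)) * (Real.exp (3/4 * L) / ((1/16) * (1 + t ^ 2))) := by
          gcongr
          exact hb t
      _ = K * 16 * Real.exp (3/4 * L) * ((1 + t ^ 2) ^ (3/8:ℝ) / (1 + t ^ 2)) := by field_simp
      _ = _ := by
          congr 1
          rw [show (-(5/4:ℝ)/2) = 3/8 - 1 by norm_num, Real.rpow_sub_one hp.ne']
  rw [intervalIntegral.integral_of_le (by linarith)]
  calc _ ≤ ∫ t in Set.Ioc (-T) T, K * 16 * Real.exp (3/4 * L) * (1 + ‖t‖ ^ 2) ^ (-(5/4:ℝ)/2) :=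
        MeasureTheory.norm_integral_le_of_norm_le (hint.const_mul _).integrableOn (Eventually.of_forall hpt)
    _ ≤ ∫ t, K * 16 * Real.exp (3/4 * L) * (1 + ‖t‖ ^ 2) ^ (-(5/4:ℝ)/2) :=
        MeasureTheory.setIntegral_le_integral (hint.const_mul _) (Eventually.of_forall fun t => by positivity)
    _ = K * 16 * J * Real.exp (3/4 * L) := by rw [MeasureTheory.integral_const_mul]; ring
    _ ≤ _ := by gcongr; linarith

lemma good_height2 : ∃ K > (0:ℝ), ∀ j : ℕ, 30 ≤ j → ∃ T : ℝ, (j:ℝ) ≤ T ∧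
    (∀ ρ, ζ ρ = 0 → ρ.im ≠ T) ∧ (∀ ρ, ζ ρ = 0 → ρ.im ≠ -T) ∧
    ∀ L : ℝ, 0 ≤ L →
    ‖∫ x in (-(1/4) : ℝ)..2, Hf (x + T * I) * GF L (x + T * I)‖ ≤ K * Real.exp (3 * L) * T ^ (-(1/4:ℝ)) ∧
    ‖∫ x in (-(1/4) : ℝ)..2, Hf (x + (-T : ℝ) * I) * GF L (x + (-T : ℝ) * I)‖ ≤ K * Real.exp (3 * L) * T ^ (-(1/4:ℝ)) := by
  obtain ⟨C, hC, hg⟩ := good_height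
  obtain ⟨C1, hC1, h1⟩ := zeta_d1
  obtain ⟨C2, hC2, h2⟩ := zeta_d2
  refine ⟨(C2 + C1 * C) * 64 * (9/4), by positivity, fun j hj => ?_⟩
  obtain ⟨T, hT1, hT2, hT⟩ := hg j hj
  have hj' : (30:ℝ) ≤ j := by exact_mod_cast hj
  have hT0 : 0 < T := by linarith
  have hnz : ∀ ρ, ζ ρ = 0 → ρ.im ≠ T := by
    intro ρ h0 him
    have hs := zero_in_strip h0 (by rw [him]; exact hT0.ne')
    have := (hT ρ.re (by linarith) (by linarith)).1
    apply this
    rw [← him, Complex.re_add_im]; exact h0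
  have hpt : ∀ L : ℝ, 0 ≤ L → ∀ x : ℝ, -(1/4) ≤ x → x ≤ 2 → ∀ z : ℂ, z.re = x → |z.im| = T → ‖Hf z‖ = ‖Hf (x + T * I)‖ →
      ‖Hf z * GF L z‖ ≤ (C2 + C1 * C) * 64 * Real.exp (3 * L) * T ^ (-(1/4:ℝ)) := by
    intro L hL x hx1 hx2 z hzr hzi hzH
    have hlog : Real.log T ^ 2 ≤ 64 * T ^ (1/4:ℝ) := by
      have h0 : Real.log T ≤ T ^ (1/8:ℝ) / (1/8) := Real.log_le_rpow_div hT0.le (by norm_num)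
      have h00 : 0 ≤ Real.log T := Real.log_nonneg (by linarith)
      calc Real.log T ^ 2 ≤ (T ^ (1/8:ℝ) / (1/8)) ^ 2 := by gcongr
        _ = 64 * (T ^ (1/8:ℝ)) ^ 2 := by ring
        _ = _ := by rw [← Real.rpow_natCast, ← Real.rpow_mul hT0.le]; norm_num
    have hr1 : (1:ℝ) ≤ T ^ (1/4:ℝ) := Real.one_le_rpow (by linarith) (by norm_num)
    have hre : ((x:ℂ) + T * I).re = x := by simp
    have him : |((x:ℂ) + T * I).im| = T := by simp [abs_of_pos hT0]
    have b1 := h1 (x + T * I) (by rw [hre]; linarith) (by rw [him]; linarith)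
    have b2 := h2 (x + T * I) (by rw [hre]; linarith) (by rw [him]; linarith)
    have b3 := (hT x (by linarith) hx2).2
    rw [him] at b1 b2
    have hH : ‖Hf z‖ ≤ (C2 + C1 * C) * 64 * T ^ (1/4:ℝ) * T ^ (3/2:ℝ) := by
      rw [hzH, Hf_eq_logDeriv]
      calc _ ≤ C2 * T ^ (3/2:ℝ) + C1 * T ^ (3/2:ℝ) * (C * Real.log T ^ 2) := by
            refine (norm_sub_le _ _).trans ?_
            rw [norm_mul]; gcongr
        _ ≤ C2 * T ^ (3/2:ℝ) * (64 * T ^ (1/4:ℝ)) + C1 * T ^ (3/2:ℝ) * (C * (64 * T ^ (1/4:ℝ))) := by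
            refine add_le_add (le_mul_of_one_le_right (by positivity) (by linarith)) ?_
            gcongr
        _ = _ := by ring
    have hG : ‖GF L z‖ ≤ Real.exp (3 * L) / (T * T) := by
      rw [GF_norm]
      have c1 : T ≤ ‖z‖ := by rw [← hzi]; exact Complex.abs_im_le_norm z
      have c2 : T ≤ ‖z + 1‖ := by
        have := Complex.abs_im_le_norm (z + 1)
        simp only [add_im, one_im, add_zero] at this
        rwa [hzi] at this
      gcongr
      rw [hzr]; linarith
    rw [norm_mul]
    calc _ ≤ ((C2 + C1 * C) * 64 * T ^ (1/4:ℝ) * T ^ (3/2:ℝ)) * (Real.exp (3 * L) / (T * T)) := by gcongr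
      _ = (C2 + C1 * C) * 64 * Real.exp (3 * L) * (T ^ (1/4:ℝ) * T ^ (3/2:ℝ) / (T * T)) := by ring
      _ = _ := by
          congr 1
          rw [← Real.rpow_add hT0, show T * T = T ^ (2:ℝ) by norm_num; ring, ← Real.rpow_sub hT0]; norm_num
  have habs : |(2:ℝ) - (-(1/4))| = 9/4 := by norm_num [abs_of_pos]
  refine ⟨T, hT1, hnz, ?_, fun L hL => ⟨?_, ?_⟩⟩
  · intro ρ h0 him
    apply hnz (starRingEnd ℂ ρ)
    · rw [riemannZeta_conj, h0, map_zero]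
    · simp [him]
  · have := intervalIntegral.norm_integral_le_of_norm_le_const (a := (-(1/4):ℝ)) (b := 2) (f := fun x : ℝ => Hf (x + T * I) * GF L (x + T * I))
      (C := (C2 + C1 * C) * 64 * Real.exp (3 * L) * T ^ (-(1/4:ℝ))) (by
        intro x hx
        rw [Set.uIoc_of_le (by norm_num)] at hx
        exact hpt L hL x hx.1.le hx.2 _ (by simp) (by simp [abs_of_pos hT0]) rfl)
    rw [habs] at this
    linarith
  · have := intervalIntegral.norm_integral_le_of_norm_le_const (a := (-(1/4):ℝ)) (b := 2) (f := fun x : ℝ => Hf (x + (-T : ℝ) * I) * GF L (x + (-T : ℝ) * I))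
      (C := (C2 + C1 * C) * 64 * Real.exp (3 * L) * T ^ (-(1/4:ℝ))) (by
        intro x hx
        rw [Set.uIoc_of_le (by norm_num)] at hx
        refine hpt L hL x hx.1.le hx.2 _ (by simp) (by simp [abs_of_pos hT0]) ?_
        have : (x:ℂ) + ((-T:ℝ):ℂ) * I = starRingEnd ℂ ((x:ℂ) + T * I) := by apply Complex.ext <;> simp
        rw [this, Hf_conj, RCLike.norm_conj])
    rw [habs] at this
    linarith

lemma explicit_formula : ∃ K > (0:ℝ), ∃ Tq : ℕ → ℝ, ∀ y : ℝ, 1 ≤ y → ∀ᶠ j in atTop,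
    ‖(BR y : ℂ) - (M1res (Real.log y) + Hf 0 * y - ∑ ρ ∈ zall (Tq j), deriv ζ ρ * GF (Real.log y) ρ)‖ ≤ K * y ^ (3/4:ℝ) := by
  obtain ⟨K1, hK1, hl⟩ := left_line
  obtain ⟨K2, hK2, hg⟩ := good_height2
  have hch : ∀ j : ℕ, _ := fun j => hg (j + 30) (by omega)
  choose Tq hTj hz1 hz2 hTb using hch
  refine ⟨K1 + 3, by positivity, Tq, fun y hy => ?_⟩
  have hy0 : 0 < y := by linarith
  set L := Real.log y with hL
  have hL0 : 0 ≤ L := Real.log_nonneg hy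
  have hTt : Tendsto Tq atTop atTop := by
    refine tendsto_atTop_mono (fun j => ?_) tendsto_natCast_atTop_atTop
    have := hTj j
    push_cast at this; linarith
  obtain ⟨hint, hval⟩ := BR_perron hy0
  have htail := MeasureTheory.intervalIntegral_tendsto_integral hint (tendsto_neg_atTop_atBot.comp hTt) hTt
  have ev1 : ∀ᶠ j in atTop, ‖(∫ t in (-(Tq j))..(Tq j), Hf ((2:ℝ) + t * I) * GF L ((2:ℝ) + t * I)) - 2 * π * BR y‖ ≤ 1 := by
    rw [hval] at htail
    have := (tendsto_iff_norm_sub_tendsto_zero.mp htail).eventually (eventually_le_nhds (show (0:ℝ) < 1 by norm_num))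
    exact this
  have ev2 : ∀ᶠ j in atTop, K2 * Real.exp (3 * L) * (Tq j) ^ (-(1/4:ℝ)) ≤ 1 := by
    have := ((tendsto_rpow_neg_atTop (show (0:ℝ) < 1/4 by norm_num)).comp hTt).const_mul (K2 * Real.exp (3 * L))
    rw [mul_zero] at this
    exact this.eventually (eventually_le_nhds (show (0:ℝ) < 1 by norm_num))
  filter_upwards [ev1, ev2] with j e1 e2
  have hT1 : 1 < Tq j := by have := hTj j; push_cast at this; have : (0:ℝ) ≤ j := j.cast_nonneg; linarith
  have hr := F_rect L hT1 (hz1 j) (hz2 j)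
  rw [rectInt] at hr
  obtain ⟨ht, hb⟩ := hTb j L hL0
  have hle := hl L (Tq j) (by linarith)
  rw [show cexp L = y by rw [hL, ← Complex.ofReal_exp, Real.exp_log hy0] ] at hr
  have hexp : Real.exp (3/4 * L) = y ^ (3/4:ℝ) := by rw [hL, Real.rpow_def_of_pos hy0]; ring_nf
  rw [hexp] at hle
  generalize M1res L + Hf 0 * y - ∑ ρ ∈ zall (Tq j), deriv ζ ρ * GF L ρ = R at hr ⊢
  have c1 : (2:ℂ) = ((2:ℝ):ℂ) := by norm_num
  generalize (∫ t in (-(Tq j))..(Tq j), Hf ((2:ℝ) + t * I) * GF L ((2:ℝ) + t * I)) = A1 at hr e1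
  generalize (∫ t in (-(Tq j))..(Tq j), Hf ((-(1/4) : ℝ) + t * I) * GF L ((-(1/4) : ℝ) + t * I)) = A2 at hr hle
  generalize (∫ x in (-(1/4) : ℝ)..2, Hf (x + (Tq j) * I) * GF L (x + (Tq j) * I)) = A3 at hr ht
  generalize (∫ x in (-(1/4) : ℝ)..2, Hf (x + (-(Tq j) : ℝ) * I) * GF L (x + (-(Tq j) : ℝ) * I)) = A4 at hr hb
  have hY1 : 1 ≤ y ^ (3/4:ℝ) := Real.one_le_rpow hy (by norm_num)
  have hI : I * I = -1 := I_mul_I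
  have heq : 2 * π * ((BR y : ℂ) - R) = -(A1 - 2 * π * BR y) + A2 + I * (A4 - A3) := by
    linear_combination (-I) * hr - (A2 - A1 + 2 * π * R) * hI
  have h1 : ‖2 * π * ((BR y : ℂ) - R)‖ ≤ 1 + K1 * y ^ (3/4:ℝ) + (1 + 1) := by
    rw [heq]
    refine (norm_add_le _ _).trans (add_le_add ((norm_add_le _ _).trans (add_le_add ?_ hle)) ?_)
    · rw [norm_neg]; exact e1
    · rw [norm_mul, norm_I, one_mul]
      exact (norm_sub_le _ _).trans (add_le_add (hb.trans e2) (ht.trans e2))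
  rw [norm_mul] at h1
  have h2 : 1 ≤ ‖(2 * π : ℂ)‖ := by
    rw [show (2 * π : ℂ) = ((2 * π : ℝ) : ℂ) by push_cast; ring, Complex.norm_real, Real.norm_of_nonneg (by positivity)]
    linarith [Real.pi_gt_three]
  have h3 := norm_nonneg ((BR y : ℂ) - R)
  nlinarith

/-- The residue main term for `BF`. -/
noncomputable def MM (y : ℝ) : ℂ :=
  y * ((Real.log y : ℂ) ^ 2 / 2 - Real.log y + 1 + deriv riemannZeta₁ 1 * (Real.log y - 1) +
    (3 * (deriv (deriv riemannZeta₁) 1 / 2) - deriv riemannZeta₁ 1 ^ 2))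

lemma log_ofReal_hasDerivAt {y : ℝ} (hy : 0 < y) : HasDerivAt (fun y : ℝ => ((Real.log y : ℝ) : ℂ)) ((y⁻¹ : ℝ) : ℂ) y :=
  (Real.hasDerivAt_log hy.ne').ofReal_comp

lemma id_ofReal_hasDerivAt (y : ℝ) : HasDerivAt (fun y : ℝ => ((y : ℝ) : ℂ)) 1 y := by
  simpa using (hasDerivAt_id y).ofReal_comp

lemma MM_hasDerivAt {y : ℝ} (hy : 0 < y) : HasDerivAt MM ((Real.log y : ℂ) ^ 2 / 2 + deriv riemannZeta₁ 1 * Real.log y +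
    (3 * (deriv (deriv riemannZeta₁) 1 / 2) - deriv riemannZeta₁ 1 ^ 2)) y := by
  have hl := log_ofReal_hasDerivAt hy
  generalize hk : (3 * (deriv (deriv riemannZeta₁) 1 / 2) - deriv riemannZeta₁ 1 ^ 2) = k
  generalize ha : deriv riemannZeta₁ 1 = a at hk
  have h := (id_ofReal_hasDerivAt y).mul (((((hl.pow 2).div_const 2).sub hl).add_const 1).add ((hl.sub_const 1).const_mul a) |>.add_const k)
  have e : MM = fun y : ℝ => (y:ℂ) * ((Real.log y : ℂ) ^ 2 / 2 - Real.log y + 1 + a * (Real.log y - 1) + k) := by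
    funext u; rw [MM, ← hk, ← ha]
  rw [e]
  refine h.congr_deriv ?_
  have hy' : (y:ℂ) ≠ 0 := by exact_mod_cast hy.ne'
  simp only [Pi.add_apply, Pi.sub_apply, Pi.pow_apply, Nat.cast_ofNat]
  push_cast
  field_simp
  ring

lemma M1_hasDerivAt {y : ℝ} (hy : 0 < y) : HasDerivAt (fun y : ℝ => M1res (Real.log y)) (MM y) y := by
  have hl := log_ofReal_hasDerivAt hy
  generalize hk : (3 * (deriv (deriv riemannZeta₁) 1 / 2) - deriv riemannZeta₁ 1 ^ 2) = k
  generalize ha : deriv riemannZeta₁ 1 = a at hk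
  have h := ((id_ofReal_hasDerivAt y).pow 2).mul ((((hl.mul_const (-3/4)).const_add (7/8)).add ((hl.pow 2).div_const 4)).add (((hl.div_const 2).sub_const (3/4)).const_mul a) |>.add_const (k/2))
  have e : (fun y : ℝ => M1res (Real.log y)) =ᶠ[𝓝 y] fun y : ℝ => (y:ℂ)^2 * ((7/8 + (Real.log y : ℂ) * (-3/4)) + (Real.log y : ℂ) ^ 2 / 4 + a * (Real.log y / 2 - 3/4) + k / 2) := by
    filter_upwards [lt_mem_nhds hy] with u hu
    have : cexp (2 * (Real.log u : ℂ)) = (u:ℂ)^2 := by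
      rw [two_mul, Complex.exp_add, ← Complex.ofReal_exp, Real.exp_log hu]; ring
    rw [M1res, this, ← hk, ← ha]; ring
  refine HasDerivAt.congr_of_eventuallyEq ?_ e
  refine h.congr_deriv ?_
  have hy' : (y:ℂ) ≠ 0 := by exact_mod_cast hy.ne'
  rw [MM, ha, hk]
  simp only [Pi.add_apply, Pi.sub_apply, Pi.pow_apply, Nat.cast_ofNat]
  push_cast
  field_simp
  ring

lemma M1_diff : ∃ K > (0:ℝ), ∀ x h : ℝ, 3 ≤ x → 0 ≤ h → h ≤ x →
    ‖M1res (Real.log (x + h)) - M1res (Real.log x) - h * MM x‖ ≤ K * h ^ 2 * Real.log x ^ 2 := by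
  set a := deriv riemannZeta₁ 1 with ha
  set k := (3 * (deriv (deriv riemannZeta₁) 1 / 2) - deriv riemannZeta₁ 1 ^ 2) with hk
  refine ⟨4 * (1 + ‖a‖ + ‖k‖), by positivity, fun x h hx h0 hh => ?_⟩
  set C := 4 * (1 + ‖a‖ + ‖k‖) * Real.log x ^ 2 with hC
  have hlx : 1 ≤ Real.log x := log_ge_one hx
  have hd : ∀ y ∈ Set.Icc x (x + h), ‖(Real.log y : ℂ) ^ 2 / 2 + a * Real.log y + k‖ ≤ C := by
    intro y hy
    have hy0 : 0 < y := by linarith [hy.1]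
    have hl0 : 0 ≤ Real.log y := Real.log_nonneg (by linarith [hy.1])
    have hl1 : Real.log y ≤ 2 * Real.log x := by
      rw [show 2 * Real.log x = Real.log (x * x) by rw [Real.log_mul (by linarith) (by linarith)]; ring]
      exact Real.log_le_log hy0 (by nlinarith [hy.2])
    have h4 : Real.log y ^ 2 ≤ 4 * Real.log x ^ 2 := by nlinarith
    have h5 : Real.log y ≤ 4 * Real.log x ^ 2 := by nlinarith
    calc _ ≤ Real.log y ^ 2 / 2 + ‖a‖ * Real.log y + ‖k‖ := by
          refine (norm_add₃_le).trans (le_of_eq ?_)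
          rw [norm_mul, norm_div, norm_pow, Complex.norm_real, Real.norm_of_nonneg hl0]; norm_num
      _ ≤ 4 * Real.log x ^ 2 * 1 + ‖a‖ * (4 * Real.log x ^ 2) + ‖k‖ * (4 * Real.log x ^ 2) := by
          have : ‖k‖ ≤ ‖k‖ * (4 * Real.log x ^ 2) := le_mul_of_one_le_right (norm_nonneg _) (by nlinarith)
          have : ‖a‖ * Real.log y ≤ ‖a‖ * (4 * Real.log x ^ 2) := by gcongr
          nlinarith
      _ = C := by rw [hC]; ring
  have hMM : ∀ y ∈ Set.Icc x (x + h), ‖MM y - MM x‖ ≤ C * h := by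
    intro y hy
    have := norm_image_sub_le_of_norm_deriv_le_segment' (f := MM) (a := x) (b := x + h) (C := C)
      (f' := fun y => (Real.log y : ℂ) ^ 2 / 2 + a * Real.log y + k)
      (fun y hy => (MM_hasDerivAt (by linarith [hy.1])).hasDerivWithinAt) (fun y hy => hd y ⟨hy.1, hy.2.le⟩) y hy
    refine this.trans ?_
    gcongr
    linarith [hy.2]
  have := norm_image_sub_le_of_norm_deriv_le_segment' (f := fun y : ℝ => M1res (Real.log y) - y * MM x) (a := x) (b := x + h) (C := C * h)
      (f' := fun y => MM y - 1 * MM x)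
      (fun y hy => ((M1_hasDerivAt (by linarith [hy.1])).sub ((id_ofReal_hasDerivAt y).mul_const _)).hasDerivWithinAt)
      (fun y hy => by rw [one_mul]; exact hMM y ⟨hy.1, hy.2.le⟩) (x + h) ⟨by linarith, le_rfl⟩
  have e : M1res (Real.log (x + h)) - M1res (Real.log x) - h * MM x = M1res (Real.log (x + h)) - ((x + h : ℝ):ℂ) * MM x - (M1res (Real.log x) - x * MM x) := by
    push_cast; ring
  rw [e]
  refine this.trans (le_of_eq ?_)
  rw [hC]; ring

lemma BR_diff {x h : ℝ} (hx : 3 ≤ x) (h1 : 1 ≤ h) (hh : h ≤ x) :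
    |BR (x + h) - BR x - h * BF x| ≤ 8 * h ^ 2 * Real.log x ^ 2 := by
  have hsub : range (⌊x⌋₊ + 1) ⊆ range (⌊x + h⌋₊ + 1) := by
    apply range_subset_range.mpr
    have : ⌊x⌋₊ ≤ ⌊x + h⌋₊ := Nat.floor_le_floor (by linarith)
    omega
  have e : BR (x + h) - BR x - h * BF x = ∑ n ∈ range (⌊x + h⌋₊ + 1) \ range (⌊x⌋₊ + 1), bco n * (x + h - n) := by
    rw [BR, ← sum_sdiff hsub, BR, BF, mul_sum]
    have : ∑ n ∈ range (⌊x⌋₊ + 1), bco n * (x + h - n) = ∑ n ∈ range (⌊x⌋₊ + 1), bco n * (x - n) + ∑ n ∈ range (⌊x⌋₊ + 1), h * bco n := by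
      rw [← sum_add_distrib]; exact sum_congr rfl fun n _ => by ring
    rw [this]; ring
  have hlx : 1 ≤ Real.log x := log_ge_one hx
  have hterm : ∀ n ∈ range (⌊x + h⌋₊ + 1) \ range (⌊x⌋₊ + 1), |bco n * (x + h - n)| ≤ 4 * Real.log x ^ 2 * h := by
    intro n hn
    rw [Finset.mem_sdiff, mem_range, mem_range, not_lt] at hn
    have hn1 : (n:ℝ) ≤ x + h := (Nat.le_floor_iff (by linarith)).mp (by omega)
    have hn2 : x < n := (Nat.floor_lt (by linarith)).mp (by omega)
    have hb := bco_le n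
    have hn0 : (0:ℝ) < n := by linarith
    have hl1 : Real.log n ≤ 2 * Real.log x := by
      rw [show 2 * Real.log x = Real.log (x * x) by rw [Real.log_mul (by linarith) (by linarith)]; ring]
      exact Real.log_le_log hn0 (by nlinarith)
    have hl0 : 0 ≤ Real.log n := Real.log_nonneg (by linarith)
    rw [abs_of_nonneg (mul_nonneg (bco_nonneg n) (by linarith))]
    have : bco n ≤ 4 * Real.log x ^ 2 := by nlinarith
    have h0 : 0 ≤ x + h - n := by linarith
    have := bco_nonneg n
    gcongr
    linarith
  rw [e]
  refine (abs_sum_le_sum_abs _ _).trans ((sum_le_sum hterm).trans ?_)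
  rw [sum_const, nsmul_eq_mul, card_sdiff_of_subset hsub, card_range, card_range]
  have hcard : ((⌊x + h⌋₊ + 1 - (⌊x⌋₊ + 1) : ℕ) : ℝ) ≤ 2 * h := by
    have : ⌊x⌋₊ ≤ ⌊x + h⌋₊ := Nat.floor_le_floor (by linarith)
    rw [Nat.cast_sub (by omega)]
    push_cast
    have h3 := Nat.floor_le (show 0 ≤ x + h by linarith)
    have h4 := Nat.lt_floor_add_one x
    linarith
  calc _ ≤ 2 * h * (4 * Real.log x ^ 2 * h) := by gcongr
    _ = _ := by ring

lemma diff_lemma : ∃ K > (0:ℝ), ∀ x h V : ℝ, 3 ≤ x → 1 ≤ h → h ≤ x →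
    (∀ T : ℝ, ∑ ρ ∈ zall T, ‖deriv ζ ρ‖ * ‖GF (Real.log (x + h)) ρ - GF (Real.log x) ρ‖ ≤ h * V) →
    ‖(BF x : ℂ) - MM x‖ ≤ V + K * (x ^ (3/4:ℝ) / h + h * Real.log x ^ 2) := by
  obtain ⟨K1, hK1, Tq, hex⟩ := explicit_formula
  obtain ⟨K2, hK2, hM⟩ := M1_diff
  refine ⟨3 * K1 + K2 + 8 + ‖Hf 0‖, by positivity, fun x h V hx h1 hh hV => ?_⟩
  obtain ⟨j, e1, e2⟩ := ((hex (x + h) (by linarith)).and (hex x (by linarith))).exists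
  have b1 := hM x h hx (by linarith) hh
  have b2 := BR_diff hx h1 hh
  have b3 := hV (Tq j)
  have b4 : ‖∑ ρ ∈ zall (Tq j), deriv ζ ρ * GF (Real.log (x + h)) ρ - ∑ ρ ∈ zall (Tq j), deriv ζ ρ * GF (Real.log x) ρ‖ ≤ h * V := by
    rw [← sum_sub_distrib]
    refine (norm_sum_le _ _).trans (le_trans (le_of_eq (sum_congr rfl fun ρ _ => ?_)) b3)
    rw [← mul_sub, norm_mul]
  have hx0 : 0 < x := by linarith
  have b5 : (x + h) ^ (3/4:ℝ) ≤ 2 * x ^ (3/4:ℝ) := by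
    calc (x + h) ^ (3/4:ℝ) ≤ (2 * x) ^ (3/4:ℝ) := Real.rpow_le_rpow (by linarith) (by linarith) (by norm_num)
      _ = 2 ^ (3/4:ℝ) * x ^ (3/4:ℝ) := Real.mul_rpow (by norm_num) hx0.le
      _ ≤ 2 * x ^ (3/4:ℝ) := by
          gcongr
          calc (2:ℝ) ^ (3/4:ℝ) ≤ 2 ^ (1:ℝ) := Real.rpow_le_rpow_of_exponent_le (by norm_num) (by norm_num)
            _ = 2 := by norm_num
  generalize (∑ ρ ∈ zall (Tq j), deriv ζ ρ * GF (Real.log (x + h)) ρ) = S1 at e1 b4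
  generalize (∑ ρ ∈ zall (Tq j), deriv ζ ρ * GF (Real.log x) ρ) = S2 at e2 b4
  have b6 : ‖((BR (x + h) - BR x - h * BF x : ℝ) : ℂ)‖ ≤ 8 * h ^ 2 * Real.log x ^ 2 := by
    rw [Complex.norm_real]; exact b2
  have heq : (h:ℂ) * ((BF x : ℂ) - MM x) = ((BR (x + h) : ℂ) - (M1res (Real.log (x + h)) + Hf 0 * ((x + h : ℝ):ℂ) - S1)) -
      ((BR x : ℂ) - (M1res (Real.log x) + Hf 0 * x - S2)) - ((BR (x + h) - BR x - h * BF x : ℝ) : ℂ) +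
      (M1res (Real.log (x + h)) - M1res (Real.log x) - h * MM x) + Hf 0 * h - (S1 - S2) := by
    push_cast; ring
  have hlx : 1 ≤ Real.log x := log_ge_one hx
  have hmain : ‖(h:ℂ) * ((BF x : ℂ) - MM x)‖ ≤ K1 * (2 * x ^ (3/4:ℝ)) + K1 * x ^ (3/4:ℝ) + 8 * h ^ 2 * Real.log x ^ 2 + K2 * h ^ 2 * Real.log x ^ 2 + ‖Hf 0‖ * h + h * V := by
    rw [heq]
    refine (norm_sub_le _ _).trans (add_le_add ((norm_add_le _ _).trans (add_le_add ((norm_add_le _ _).trans (add_le_add ((norm_sub_le _ _).trans (add_le_add ((norm_sub_le _ _).trans (add_le_add (e1.trans ?_) e2)) b6)) b1)) ?_)) b4)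
    · gcongr
    · rw [norm_mul, Complex.norm_real, Real.norm_of_nonneg (by linarith)]
  rw [norm_mul, Complex.norm_real, Real.norm_of_nonneg (by linarith)] at hmain
  have h0 : 0 < h := by linarith
  refine le_of_mul_le_mul_left (hmain.trans ?_) h0
  have e : h * (V + (3 * K1 + K2 + 8 + ‖Hf 0‖) * (x ^ (3/4:ℝ) / h + h * Real.log x ^ 2)) = h * V + (3 * K1 + K2 + 8 + ‖Hf 0‖) * (x ^ (3/4:ℝ) + h ^ 2 * Real.log x ^ 2) := by
    field_simp
  rw [e]
  have hX : 0 ≤ x ^ (3/4:ℝ) := by positivity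
  have hq : h ≤ h ^ 2 * Real.log x ^ 2 := by nlinarith [mul_le_mul h1 hlx (by norm_num) (by linarith), sq_nonneg (h * Real.log x)]
  have c1 : ‖Hf 0‖ * h ≤ ‖Hf 0‖ * (h ^ 2 * Real.log x ^ 2) := by gcongr
  have c2 : 0 ≤ (K2 + 8 + ‖Hf 0‖) * x ^ (3/4:ℝ) := by positivity
  have c3 : 0 ≤ 3 * K1 * (h ^ 2 * Real.log x ^ 2) := by positivity
  linarith

lemma GF_diff1 {x h : ℝ} {z : ℂ} (hx : 1 ≤ x) (h1 : 0 ≤ h) (hh : h ≤ x) (hz : 0 ≤ z.re) :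
    ‖GF (Real.log (x + h)) z - GF (Real.log x) z‖ ≤ 2 * (2 * x) ^ (z.re + 1) / (‖z‖ * ‖z + 1‖) := by
  have hb : ∀ y : ℝ, 1 ≤ y → y ≤ 2 * x → ‖GF (Real.log y) z‖ ≤ (2 * x) ^ (z.re + 1) / (‖z‖ * ‖z + 1‖) := by
    intro y h1 h2
    rw [GF_norm, mul_comm, ← Real.rpow_def_of_pos (by linarith)]
    gcongr
  refine (norm_sub_le _ _).trans ?_
  have a := hb (x + h) (by linarith) (by linarith)
  have b := hb x hx (by linarith)
  rw [mul_div_assoc]; linarith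

lemma GF_diff2 {x h : ℝ} {z : ℂ} (hx : 1 ≤ x) (h1 : 0 ≤ h) (hh : h ≤ x) (hz : 0 < z.re) :
    ‖GF (Real.log (x + h)) z - GF (Real.log x) z‖ ≤ h * ((2 * x) ^ z.re / ‖z‖) := by
  have hz0 : z ≠ 0 := by rintro rfl; simp at hz
  have hz1 : z + 1 ≠ 0 := by intro h; have := congrArg Complex.re h; simp at this; linarith
  have hder : ∀ y ∈ Set.Icc x (x + h), HasDerivWithinAt (fun y : ℝ => GF (Real.log y) z) (cexp (z * Real.log y) / z) (Set.Icc x (x + h)) y := by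
    intro y hy
    have hy0 : 0 < y := by linarith [hy.1]
    have := (((log_ofReal_hasDerivAt hy0).const_mul (z + 1)).cexp).div_const (z * (z + 1))
    refine HasDerivAt.hasDerivWithinAt (this.congr_deriv ?_)
    have e : cexp ((z + 1) * (Real.log y : ℂ)) = cexp (z * Real.log y) * y := by
      rw [add_mul, Complex.exp_add, one_mul, ← Complex.ofReal_exp, Real.exp_log hy0]
    have hy' : (y:ℂ) ≠ 0 := by exact_mod_cast hy0.ne'
    rw [e]; push_cast; field_simp
  have := norm_image_sub_le_of_norm_deriv_le_segment' hder (C := (2 * x) ^ z.re / ‖z‖) (fun y hy => by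
    have hy0 : 0 < y := by linarith [hy.1]
    rw [norm_div, Complex.norm_exp]
    have : (z * (Real.log y : ℂ)).re = Real.log y * z.re := by simp; ring
    rw [this, ← Real.rpow_def_of_pos hy0]
    gcongr
    linarith [hy.2]) (x + h) ⟨by linarith, le_rfl⟩
  rw [add_sub_cancel_left, mul_comm] at this
  exact this

lemma zero_count_abs : ∃ C > (0:ℝ), ∀ T : ℝ, 20 ≤ T → ∀ S : Finset ℂ,
    (∀ ρ ∈ S, ζ ρ = 0 ∧ |(|ρ.im| - T)| ≤ 3/2) → (S.card : ℝ) ≤ C * Real.log T := by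
  obtain ⟨C, hC, h⟩ := zero_count
  refine ⟨2 * C, by linarith, fun T hT S hS => ?_⟩
  classical
  have h1 := h T hT (S.filter (fun ρ => 0 ≤ ρ.im)) (by
    intro ρ hρ
    rw [Finset.mem_filter] at hρ
    have := hS ρ hρ.1
    rwa [abs_of_nonneg hρ.2] at this)
  have h2 := h T hT ((S.filter (fun ρ => ¬ 0 ≤ ρ.im)).image (starRingEnd ℂ)) (by
    intro ρ hρ
    rw [Finset.mem_image] at hρ
    obtain ⟨w, hw, rfl⟩ := hρ
    rw [Finset.mem_filter] at hw
    have := hS w hw.1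
    rw [abs_of_neg (not_le.mp hw.2)] at this
    refine ⟨by rw [riemannZeta_conj, this.1, map_zero], ?_⟩
    rw [conj_im]; exact this.2)
  rw [Finset.card_image_of_injective _ (starRingEnd ℂ).injective] at h2
  have := Finset.card_filter_add_card_filter_not (s := S) (fun ρ : ℂ => 0 ≤ ρ.im)
  have h3 : (S.card : ℝ) = ((S.filter (fun ρ => 0 ≤ ρ.im)).card : ℝ) + ((S.filter (fun ρ => ¬ 0 ≤ ρ.im)).card : ℝ) := by
    exact_mod_cast this.symm
  linarith

lemma zsum : ∃ C > (0:ℝ), ∀ (T A : ℝ) (f : ℂ → ℝ), 0 ≤ A →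
    (∀ ρ ∈ zall T, 20 ≤ |ρ.im| → f ρ ≤ A * |ρ.im| ^ (-(21/16):ℝ)) →
    ∑ ρ ∈ (zall T).filter (fun ρ => 20 ≤ |ρ.im|), f ρ ≤ C * A := by
  obtain ⟨C, hC, hc⟩ := zero_count_abs
  have hs : Summable fun k : ℕ => (k:ℝ) ^ (-(5/4):ℝ) := Real.summable_nat_rpow.mpr (by norm_num)
  refine ⟨C * 16 * (∑' k : ℕ, (k:ℝ) ^ (-(5/4):ℝ)) + 1, by positivity, fun T A f hA hf => ?_⟩
  set S := (zall T).filter (fun ρ => 20 ≤ |ρ.im|) with hS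
  have hmap : ∀ ρ ∈ S, ⌊|ρ.im|⌋₊ ∈ Finset.Icc 20 ⌊T⌋₊ := by
    intro ρ hρ
    rw [hS, Finset.mem_filter, mem_zall] at hρ
    rw [Finset.mem_Icc]
    exact ⟨Nat.le_floor (by exact_mod_cast hρ.2), Nat.floor_le_floor hρ.1.2.2.2⟩
  rw [← Finset.sum_fiberwise_of_maps_to hmap]
  have hk : ∀ k ∈ Finset.Icc 20 ⌊T⌋₊, ∑ ρ ∈ S with ⌊|ρ.im|⌋₊ = k, f ρ ≤ C * 16 * A * (k:ℝ) ^ (-(5/4):ℝ) := by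
    intro k hk
    have hk20 : (20:ℝ) ≤ k := by exact_mod_cast (Finset.mem_Icc.mp hk).1
    have hk0 : (0:ℝ) < k := by linarith
    have hcard := hc k hk20 (S.filter (fun ρ => ⌊|ρ.im|⌋₊ = k)) (by
      intro ρ hρ
      rw [Finset.mem_filter, hS, Finset.mem_filter, mem_zall] at hρ
      refine ⟨hρ.1.1.1, ?_⟩
      have h1 := Nat.floor_le (abs_nonneg ρ.im)
      have h2 := Nat.lt_floor_add_one |ρ.im|
      rw [hρ.2] at h1 h2
      rw [abs_le]; constructor <;> linarith)
    have hb : ∀ ρ ∈ S.filter (fun ρ => ⌊|ρ.im|⌋₊ = k), f ρ ≤ A * (k:ℝ) ^ (-(21/16):ℝ) := by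
      intro ρ hρ
      rw [Finset.mem_filter, hS, Finset.mem_filter] at hρ
      refine (hf ρ hρ.1.1 hρ.1.2).trans ?_
      have h1 := Nat.floor_le (abs_nonneg ρ.im)
      rw [hρ.2] at h1
      have : |ρ.im| ^ (-(21/16):ℝ) ≤ (k:ℝ) ^ (-(21/16):ℝ) := Real.rpow_le_rpow_of_nonpos hk0 h1 (by norm_num)
      gcongr
    have hl : Real.log k ≤ 16 * (k:ℝ) ^ (1/16:ℝ) := by
      have := Real.log_le_rpow_div hk0.le (show (0:ℝ) < 1/16 by norm_num)
      linarith
    calc _ ≤ ∑ ρ ∈ S with ⌊|ρ.im|⌋₊ = k, A * (k:ℝ) ^ (-(21/16):ℝ) := sum_le_sum hb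
      _ = ((S.filter (fun ρ => ⌊|ρ.im|⌋₊ = k)).card : ℝ) * (A * (k:ℝ) ^ (-(21/16):ℝ)) := by rw [sum_const, nsmul_eq_mul]
      _ ≤ (C * (16 * (k:ℝ) ^ (1/16:ℝ))) * (A * (k:ℝ) ^ (-(21/16):ℝ)) := by
          gcongr
          exact hcard.trans (by gcongr)
      _ = C * 16 * A * ((k:ℝ) ^ (1/16:ℝ) * (k:ℝ) ^ (-(21/16):ℝ)) := by ring
      _ = _ := by rw [← Real.rpow_add hk0]; norm_num
  calc _ ≤ ∑ k ∈ Finset.Icc 20 ⌊T⌋₊, C * 16 * A * (k:ℝ) ^ (-(5/4):ℝ) := sum_le_sum hk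
    _ = C * 16 * A * ∑ k ∈ Finset.Icc 20 ⌊T⌋₊, (k:ℝ) ^ (-(5/4):ℝ) := by rw [mul_sum]
    _ ≤ C * 16 * A * ∑' k : ℕ, (k:ℝ) ^ (-(5/4):ℝ) := by
        gcongr
        exact hs.sum_le_tsum _ (fun _ _ => by positivity)
    _ ≤ _ := by linarith

lemma low_zeros : ∃ η > (0:ℝ), ∀ ρ ∈ zall 20, ρ.re ≤ 1 - η := by
  rcases (zall 20).eq_empty_or_nonempty with h | h
  · exact ⟨1, one_pos, by simp [h]⟩
  · obtain ⟨m, hm, hmax⟩ := Finset.exists_max_image (zall 20) Complex.re h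
    exact ⟨1 - m.re, by linarith [(mem_zall.mp hm).2.2.1], fun ρ hρ => by linarith [hmax ρ hρ]⟩

lemma zall_sum_uncond : ∃ c > (0:ℝ), c ≤ 1 ∧ ∃ K > (0:ℝ), ∀ x h T : ℝ, 3 ≤ x → 0 ≤ h → h ≤ x →
    ∑ ρ ∈ zall T, ‖deriv ζ ρ‖ * ‖GF (Real.log (x + h)) ρ - GF (Real.log x) ρ‖ ≤
      K * x ^ 2 * Real.exp (-(c * Real.sqrt (Real.log x))) := by
  obtain ⟨c0, hc0, hzf⟩ := zero_free
  obtain ⟨η, hη, hlow⟩ := low_zeros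
  obtain ⟨C1, hC1, hd⟩ := zeta_deriv_strip
  obtain ⟨C2, hC2, hsum⟩ := zsum
  set c := min 1 (min η (Real.sqrt c0 / 2)) with hc
  have hcpos : 0 < c := by rw [hc]; positivity
  have hc1 : c ≤ 1 := min_le_left _ _
  have hcη : c ≤ η := (min_le_right _ _).trans (min_le_left _ _)
  have hcc : c ≤ Real.sqrt c0 / 2 := (min_le_right _ _).trans (min_le_right _ _)
  set D := ∑ ρ ∈ zall 20, ‖deriv ζ ρ‖ * (1 / (‖ρ‖ * ‖ρ + 1‖)) with hD
  have hD0 : 0 ≤ D := sum_nonneg fun ρ _ => by positivity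
  refine ⟨c, hcpos, hc1, 8 * D + C2 * (C1 * 1024 * 8), by positivity, fun x h T hx h0 hh => ?_⟩
  have hx0 : 0 < x := by linarith
  set L := Real.log x with hL
  have hL1 : 1 ≤ L := log_ge_one hx
  set E := Real.exp (-(c * Real.sqrt L)) with hE
  have hpow : ∀ ρ : ℂ, ρ.re < 1 → ∀ d : ℝ, d ≤ 1 - ρ.re → c * Real.sqrt L ≤ d * L → (2 * x) ^ (ρ.re + 1) ≤ 4 * x ^ 2 * Real.exp (-(d * L)) := by
    intro ρ h1 d hd1 hd2
    have hd0 : 0 ≤ d * L := le_trans (by positivity) hd2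
    rw [Real.mul_rpow (by norm_num) hx0.le]
    have a1 : (2:ℝ) ^ (ρ.re + 1) ≤ 4 := by
      calc (2:ℝ) ^ (ρ.re + 1) ≤ 2 ^ (2:ℝ) := Real.rpow_le_rpow_of_exponent_le (by norm_num) (by linarith)
        _ = 4 := by norm_num
    have a2 : x ^ (ρ.re + 1) ≤ x ^ 2 * Real.exp (-(d * L)) := by
      calc x ^ (ρ.re + 1) ≤ x ^ (2 - d) := Real.rpow_le_rpow_of_exponent_le (by linarith) (by linarith)
        _ = x ^ (2:ℝ) * Real.exp (-(d * L)) := by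
            rw [Real.rpow_def_of_pos hx0, Real.rpow_def_of_pos hx0, ← Real.exp_add]; congr 1; rw [← hL]; ring
        _ = _ := by norm_num
    calc _ ≤ 4 * (x ^ 2 * Real.exp (-(d * L))) := by gcongr
      _ = _ := by ring
  have hsL : Real.sqrt L ≤ L := by
    rw [Real.sqrt_le_left (by linarith)]; nlinarith
  -- high zeros
  have high := hsum T (C1 * 1024 * 8 * x ^ 2 * E) (fun ρ => ‖deriv ζ ρ‖ * ‖GF (Real.log (x + h)) ρ - GF (Real.log x) ρ‖) (by positivity) (by
    intro ρ hρ h20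
    obtain ⟨hz, hr0, hr1, -⟩ := mem_zall.mp hρ
    set g := |ρ.im| with hg
    have hg0 : 0 < g := by linarith
    have hlg : 0 < Real.log g := Real.log_pos (by linarith)
    have hre : ρ.re ≤ 1 - c0 / Real.log g := by
      rcases abs_cases ρ.im with ⟨h, _⟩ | ⟨h, _⟩
      · have := hzf ρ hz (by rw [← h]; exact h20)
        rwa [hg, h]
      · have := hzf (starRingEnd ℂ ρ) (by rw [riemannZeta_conj, hz, map_zero]) (by rw [conj_im, ← h]; exact h20)
        rw [conj_re, conj_im] at this
        rwa [hg, h]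
    have b1 := hd ρ (by linarith) (by have : 0 < 1 / Real.log g := by positivity
                                      linarith)
    rw [← hg] at b1
    have b2 := GF_diff1 (x := x) (h := h) (z := ρ) (by linarith) h0 hh hr0.le
    have hg1 : g ≤ ‖ρ‖ := Complex.abs_im_le_norm ρ
    have hg2 : g ≤ ‖ρ + 1‖ := by
      have := Complex.abs_im_le_norm (ρ + 1)
      simpa using this
    have hlog : Real.log g ^ 2 ≤ 1024 * g ^ (1/8:ℝ) := by
      have h0 : Real.log g ≤ g ^ (1/16:ℝ) / (1/16) := Real.log_le_rpow_div hg0.le (by norm_num)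
      calc Real.log g ^ 2 ≤ (g ^ (1/16:ℝ) / (1/16)) ^ 2 := by gcongr
        _ = 256 * (g ^ (1/16:ℝ)) ^ 2 := by ring
        _ = 256 * g ^ (1/8:ℝ) := by rw [← Real.rpow_natCast, ← Real.rpow_mul hg0.le]; norm_num
        _ ≤ _ := by gcongr; norm_num
    have hp2 : (2 * x) ^ (ρ.re + 1) ≤ 4 * x ^ 2 * (E * g ^ (1/16:ℝ)) := by
      have a1 : x ^ (ρ.re + 1) ≤ x ^ 2 * (E * g ^ (1/16:ℝ)) := by
        rw [Real.rpow_def_of_pos hx0, ← hL]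
        have : x ^ 2 = Real.exp (2 * L) := by rw [two_mul, Real.exp_add, hL, Real.exp_log hx0]; ring
        rw [this, hE, Real.rpow_def_of_pos hg0, ← Real.exp_add, ← Real.exp_add]
        apply Real.exp_le_exp.mpr
        have k1 : L * (ρ.re + 1) ≤ 2 * L - c0 * L / Real.log g := by
          calc L * (ρ.re + 1) ≤ L * (1 - c0 / Real.log g + 1) := by gcongr
            _ = _ := by ring
        have k2 : c * Real.sqrt L ≤ c0 * L / Real.log g + Real.log g * (1/16) := by
          calc c * Real.sqrt L ≤ Real.sqrt c0 / 2 * Real.sqrt L := by gcongr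
            _ ≤ _ := by
              have e1 : c0 * L = (Real.sqrt c0 * Real.sqrt L) ^ 2 := by
                rw [mul_pow, Real.sq_sqrt hc0.le, Real.sq_sqrt (by linarith)]
              rw [e1]
              set u := Real.sqrt c0 * Real.sqrt L
              have : u ^ 2 / Real.log g + Real.log g * (1/16) - u / 2 = (u - Real.log g / 4) ^ 2 / Real.log g := by
                field_simp; ring
              have h4 : 0 ≤ (u - Real.log g / 4) ^ 2 / Real.log g := by positivity
              have h5 : Real.sqrt c0 / 2 * Real.sqrt L = u / 2 := by simp only [u]; ring
              linarith
        linarith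
      rw [Real.mul_rpow (by norm_num) hx0.le]
      have a2 : (2:ℝ) ^ (ρ.re + 1) ≤ 4 := by
        calc (2:ℝ) ^ (ρ.re + 1) ≤ 2 ^ (2:ℝ) := Real.rpow_le_rpow_of_exponent_le (by norm_num) (by linarith)
          _ = 4 := by norm_num
      calc _ ≤ 4 * (x ^ 2 * (E * g ^ (1/16:ℝ))) := by gcongr
        _ = _ := by ring
    have hE0 : 0 < E := Real.exp_pos _
    calc _ ≤ (C1 * g ^ (1/2:ℝ) * (1024 * g ^ (1/8:ℝ))) * (2 * (4 * x ^ 2 * (E * g ^ (1/16:ℝ))) / (g * g)) := by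
          gcongr
          · exact b1.trans (by gcongr)
          · exact b2.trans (by gcongr)
      _ = C1 * 1024 * 8 * x ^ 2 * E * (g ^ (1/2:ℝ) * g ^ (1/8:ℝ) * g ^ (1/16:ℝ) / (g * g)) := by ring
      _ = _ := by
          congr 1
          rw [← Real.rpow_add hg0, ← Real.rpow_add hg0, show g * g = g ^ (2:ℝ) by norm_num; ring, ← Real.rpow_sub hg0]; norm_num)
  have low : ∑ ρ ∈ (zall T).filter (fun ρ => ¬ 20 ≤ |ρ.im|), ‖deriv ζ ρ‖ * ‖GF (Real.log (x + h)) ρ - GF (Real.log x) ρ‖ ≤ 8 * D * x ^ 2 * E := by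
    have hsub : (zall T).filter (fun ρ => ¬ 20 ≤ |ρ.im|) ⊆ zall 20 := by
      intro ρ hρ
      rw [Finset.mem_filter, mem_zall] at hρ
      rw [mem_zall]
      exact ⟨hρ.1.1, hρ.1.2.1, hρ.1.2.2.1, by linarith [hρ.2]⟩
    refine (sum_le_sum_of_subset_of_nonneg hsub fun _ _ _ => by positivity).trans ?_
    rw [hD, mul_sum, sum_mul, sum_mul]
    refine sum_le_sum fun ρ hρ => ?_
    obtain ⟨hz, hr0, hr1, -⟩ := mem_zall.mp hρ
    have b2 := GF_diff1 (x := x) (h := h) (z := ρ) (by linarith) h0 hh hr0.le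
    have b3 := hpow ρ hr1 η (by linarith [hlow ρ hρ]) (by gcongr)
    have b4 : Real.exp (-(η * L)) ≤ E := by
      rw [hE]; apply Real.exp_le_exp.mpr
      have : c * Real.sqrt L ≤ η * L := by gcongr
      linarith
    calc _ ≤ ‖deriv ζ ρ‖ * (2 * (4 * x ^ 2 * E) / (‖ρ‖ * ‖ρ + 1‖)) := by
          gcongr
          exact b2.trans (by gcongr; exact b3.trans (by gcongr))
      _ = _ := by ring
  rw [← Finset.sum_filter_add_sum_filter_not (zall T) (fun ρ => 20 ≤ |ρ.im|)]
  calc _ ≤ C2 * (C1 * 1024 * 8 * x ^ 2 * E) + 8 * D * x ^ 2 * E := add_le_add high low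
    _ = _ := by ring

lemma BF_uncond : ∃ c > (0:ℝ), ∃ K > (0:ℝ), ∀ x : ℝ, 3 ≤ x →
    ‖(BF x : ℂ) - MM x‖ ≤ K * x * Real.exp (-(c * Real.sqrt (Real.log x))) := by
  obtain ⟨c, hc, hc1, K1, hK1, hs⟩ := zall_sum_uncond
  obtain ⟨K2, hK2, hd⟩ := diff_lemma
  set M := Real.exp 0 * (24 * (4 / c) ^ 4) with hM
  refine ⟨c / 4, by positivity, K1 + K2 * (1 + M), by positivity, fun x hx => ?_⟩
  have hx0 : 0 < x := by linarith
  have hL1 : 1 ≤ Real.log x := log_ge_one hx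
  set L := Real.log x with hL
  set q := Real.sqrt L with hq
  have hqL : q ^ 2 = L := Real.sq_sqrt (by linarith)
  have hq0 : 0 ≤ q := Real.sqrt_nonneg _
  have hq1 : 1 ≤ q := by rw [hq, Real.one_le_sqrt]; exact hL1
  have hxe : x = Real.exp L := (Real.exp_log hx0).symm
  set h := x * Real.exp (-(c / 2 * q)) with hh
  have hh1 : 1 ≤ h := by
    rw [hh, hxe, ← Real.exp_add]; apply Real.one_le_exp; nlinarith
  have hhx : h ≤ x := by
    rw [hh]; apply mul_le_of_le_one_right hx0.le
    rw [Real.exp_le_one_iff]; have : 0 ≤ c / 2 * q := by positivity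
    linarith
  set E := Real.exp (-(c / 4 * q)) with hE
  have hE0 : 0 < E := Real.exp_pos _
  have key := hd x h (K1 * x * E) hx hh1 hhx (fun T => (hs x h T hx (by linarith) hhx).trans (by
    have : Real.exp (-(c * q)) ≤ Real.exp (-(c / 2 * q)) * E := by
      rw [hE, ← Real.exp_add]; apply Real.exp_le_exp.mpr
      have : 0 ≤ c * q := by positivity
      linarith
    calc _ ≤ K1 * x ^ 2 * (Real.exp (-(c / 2 * q)) * E) := by gcongr
      _ = _ := by rw [hh]; ring))
  have t1 : x ^ (3/4:ℝ) / h ≤ x * E := by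
    calc x ^ (3/4:ℝ) / h ≤ x ^ (3/4:ℝ) := div_le_self (by positivity) hh1
      _ ≤ x * E := by
          rw [Real.rpow_def_of_pos hx0, ← hL, hE]
          nth_rewrite 1 [hxe]
          rw [← Real.exp_add]; apply Real.exp_le_exp.mpr
          nlinarith
  have t2 : h * L ^ 2 ≤ M * x * E := by
    have h4 : L ^ 2 ≤ M * Real.exp (c / 4 * q) := by
      have := Real.pow_div_factorial_le_exp (c / 4 * q) (by positivity) 4
      have e : L ^ 2 = (24 * (4 / c) ^ 4) * ((c / 4 * q) ^ 4 / (Nat.factorial 4 : ℕ)) := by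
        rw [← hqL]; norm_num [Nat.factorial]; field_simp
      rw [e, hM, Real.exp_zero, one_mul]; gcongr
    calc h * L ^ 2 ≤ h * (M * Real.exp (c / 4 * q)) := by gcongr
      _ = M * x * (Real.exp (-(c / 2 * q)) * Real.exp (c / 4 * q)) := by rw [hh]; ring
      _ = M * x * E := by rw [← Real.exp_add, hE]; congr 2; ring
  calc _ ≤ _ := key
    _ ≤ K1 * x * E + K2 * (x * E + M * x * E) := by gcongr
    _ = _ := by ring

lemma planch (b : ℝ) (hb : 0 < b) (ψ : ℝ → ℝ) (h1 : MeasureTheory.Integrable ψ)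
    (h2 : MeasureTheory.Integrable fun v => ψ v ^ 2) :
    MeasureTheory.Integrable (fun t : ℝ =>
      Real.exp (-b * t ^ 2) * ‖∫ v : ℝ, (ψ v : ℂ) * cexp (-I * t * v)‖ ^ 2) ∧
    ∫ t : ℝ, Real.exp (-b * t ^ 2) * ‖∫ v : ℝ, (ψ v : ℂ) * cexp (-I * t * v)‖ ^ 2
      ≤ 2 * π * ∫ v, ψ v ^ 2 := by
  have hpi := Real.pi_pos
  set Φ : ℝ → ℂ := fun t => ∫ v : ℝ, (ψ v : ℂ) * cexp (-I * t * v) with hΦ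
  set A : ℝ := √(π / b) with hA
  have hA0 : 0 ≤ A := Real.sqrt_nonneg _
  set k : ℝ → ℝ := fun y => A * Real.exp (-(1 / (4 * b)) * y ^ 2) with hk
  have hk0 : ∀ y, 0 ≤ k y := fun y => by positivity
  have hki : MeasureTheory.Integrable k :=
    (integrable_exp_neg_mul_sq (by positivity : (0:ℝ) < 1 / (4 * b))).const_mul A
  have hkI : ∫ y, k y = 2 * π := by
    simp only [hk]
    rw [MeasureTheory.integral_const_mul, integral_gaussian, hA, ← Real.sqrt_mul (by positivity)]
    have : π / b * (π / (1 / (4 * b))) = (2 * π) ^ 2 := by field_simp; norm_num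
    rw [this, Real.sqrt_sq (by positivity)]
  have hw : ∀ y : ℝ, ∫ t : ℝ, ((Real.exp (-b * t ^ 2) : ℝ) : ℂ) * cexp (I * t * y) = (k y : ℂ) := by
    intro y
    have h := fourierIntegral_gaussian (b := (b : ℂ)) (by simpa using hb) (y : ℂ)
    have e1 : ∀ t : ℝ, ((Real.exp (-b * t ^ 2) : ℝ) : ℂ) * cexp (I * t * y)
        = cexp (I * y * t) * cexp (-b * t ^ 2) := by
      intro t; push_cast; rw [mul_comm]; ring_nf
    simp only [e1]
    rw [h]
    simp only [hk, hA]
    rw [Real.sqrt_eq_rpow]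
    push_cast
    rw [Complex.ofReal_cpow (by positivity)]
    push_cast
    congr 2
    field_simp
  -- triple integrability
  set F : ℝ → ℝ × ℝ → ℂ := fun t p => ((Real.exp (-b * t ^ 2) : ℝ) : ℂ) *
    (((ψ p.1 : ℂ) * cexp (-I * t * p.1)) * ((ψ p.2 : ℂ) * cexp (I * t * p.2))) with hF
  have hFi : MeasureTheory.Integrable (Function.uncurry F)
      (MeasureTheory.volume.prod MeasureTheory.volume) := by
    have a1 := ((integrable_exp_neg_mul_sq hb).ofReal (𝕜 := ℂ)).mul_prod
      ((h1.ofReal (𝕜 := ℂ)).mul_prod (h1.ofReal (𝕜 := ℂ)))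
    have a2 : MeasureTheory.AEStronglyMeasurable (fun z : ℝ × (ℝ × ℝ) =>
        cexp (-I * z.1 * z.2.1) * cexp (I * z.1 * z.2.2))
        (MeasureTheory.volume.prod (MeasureTheory.volume.prod MeasureTheory.volume)) := by
      apply Continuous.aestronglyMeasurable
      fun_prop
    refine (a1.bdd_mul (c := 1) a2 (Eventually.of_forall fun z => ?_)).congr
      (Eventually.of_forall fun z => ?_)
    · rw [norm_mul, Complex.norm_exp, Complex.norm_exp]; simp
    · simp only [Function.uncurry, hF]
      simp only [RCLike.ofReal_eq_complex_ofReal]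
      ring
  have b1 : ∀ t : ℝ, ((Real.exp (-b * t ^ 2) * ‖Φ t‖ ^ 2 : ℝ) : ℂ) = ∫ p, F t p := by
    intro t
    simp only [hF]
    rw [MeasureTheory.integral_const_mul,
      MeasureTheory.Measure.volume_eq_prod,
      MeasureTheory.integral_prod_mul (fun v : ℝ => (ψ v : ℂ) * cexp (-I * t * v))
        (fun v : ℝ => (ψ v : ℂ) * cexp (I * t * v))]
    have c1 : ∫ v : ℝ, (ψ v : ℂ) * cexp (I * t * v) = (starRingEnd ℂ) (Φ t) := by
      rw [hΦ, ← integral_conj]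
      congr 1; funext v
      rw [map_mul, ← Complex.exp_conj]
      simp
    rw [c1, Complex.mul_conj, Complex.normSq_eq_norm_sq]
    push_cast; ring
  have key : ((∫ t : ℝ, Real.exp (-b * t ^ 2) * ‖Φ t‖ ^ 2 : ℝ) : ℂ)
      = ∫ p : ℝ × ℝ, (ψ p.1 : ℂ) * ψ p.2 * k (p.2 - p.1) := by
    rw [← integral_complex_ofReal]
    simp only [b1]
    rw [MeasureTheory.integral_integral_swap hFi]
    congr 1; funext p
    rw [← hw, ← MeasureTheory.integral_const_mul]
    congr 1; funext t
    simp only [hF]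
    rw [show I * (t:ℂ) * ((p.2 - p.1 : ℝ) : ℂ) = -I * t * p.1 + I * t * p.2 by push_cast; ring,
      Complex.exp_add]
    ring
  have i1 : MeasureTheory.Integrable (fun p : ℝ × ℝ => ψ p.2 ^ 2 * k (p.1 - p.2))
      (MeasureTheory.volume.prod MeasureTheory.volume) :=
    h2.convolution_integrand (ContinuousLinearMap.mul ℝ ℝ) hki
  have i1v : ∫ p : ℝ × ℝ, ψ p.2 ^ 2 * k (p.1 - p.2) = 2 * π * ∫ v, ψ v ^ 2 := by
    rw [MeasureTheory.Measure.volume_eq_prod, MeasureTheory.integral_prod_symm _ i1]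
    simp only [MeasureTheory.integral_const_mul]
    have : ∀ y : ℝ, ∫ x, k (x - y) = 2 * π := fun y => by
      rw [MeasureTheory.integral_sub_right_eq_self k y, hkI]
    simp only [this]
    rw [MeasureTheory.integral_mul_const, mul_comm]
  have hks : ∀ x y, k (x - y) = k (y - x) := fun x y => by simp only [hk]; ring_nf
  have i2 : MeasureTheory.Integrable (fun p : ℝ × ℝ => ψ p.1 ^ 2 * k (p.2 - p.1))
      (MeasureTheory.volume.prod MeasureTheory.volume) := by
    have := i1.swap
    exact this
  have i2v : ∫ p : ℝ × ℝ, ψ p.1 ^ 2 * k (p.2 - p.1) = 2 * π * ∫ v, ψ v ^ 2 := by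
    rw [← i1v, MeasureTheory.Measure.volume_eq_prod]
    exact MeasureTheory.integral_prod_swap (fun p : ℝ × ℝ => ψ p.2 ^ 2 * k (p.1 - p.2))
  have hnn : 0 ≤ ∫ t : ℝ, Real.exp (-b * t ^ 2) * ‖Φ t‖ ^ 2 :=
    MeasureTheory.integral_nonneg fun t => by positivity
  constructor
  · have := hFi.integral_prod_left
    simp only [Function.uncurry] at this
    refine (this.re).congr (Eventually.of_forall fun t => ?_)
    have e := b1 t
    rw [MeasureTheory.Measure.volume_eq_prod] at e
    exact (congrArg Complex.re e).symm.trans (Complex.ofReal_re _)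
  calc ∫ t : ℝ, Real.exp (-b * t ^ 2) * ‖Φ t‖ ^ 2
      = ‖((∫ t : ℝ, Real.exp (-b * t ^ 2) * ‖Φ t‖ ^ 2 : ℝ) : ℂ)‖ := by
        rw [Complex.norm_real, Real.norm_of_nonneg hnn]
    _ ≤ ∫ p : ℝ × ℝ, (ψ p.1 ^ 2 * k (p.2 - p.1) + ψ p.2 ^ 2 * k (p.1 - p.2)) / 2 := by
        rw [key]
        refine MeasureTheory.norm_integral_le_of_norm_le ((i2.add i1).div_const 2)
          (Eventually.of_forall fun p => ?_)
        rw [norm_mul, norm_mul, Complex.norm_real, Complex.norm_real, Complex.norm_real,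
          Real.norm_of_nonneg (hk0 _), hks p.1 p.2, ← sq_abs (ψ p.1), ← sq_abs (ψ p.2)]
        simp only [Real.norm_eq_abs]
        nlinarith [hk0 (p.2 - p.1), mul_nonneg (hk0 (p.2 - p.1)) (sq_nonneg (|ψ p.1| - |ψ p.2|))]
    _ = 2 * π * ∫ v, ψ v ^ 2 := by
        have e := MeasureTheory.integral_add i2 i1
        rw [← MeasureTheory.Measure.volume_eq_prod] at e
        rw [MeasureTheory.integral_div, e, i1v, i2v]; ring

noncomputable def phiF (v : ℝ) : ℝ := if 0 < v then Int.fract (Real.exp v) else 0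

lemma phiF_nonneg (v : ℝ) : 0 ≤ phiF v := by
  unfold phiF; split_ifs
  · exact Int.fract_nonneg _
  · exact le_rfl

lemma phiF_le (v : ℝ) : phiF v ≤ 1 := by
  unfold phiF; split_ifs
  · exact (Int.fract_lt_one _).le
  · exact zero_le_one

lemma phiF_meas : Measurable phiF :=
  Measurable.ite measurableSet_Ioi (measurable_fract.comp Real.measurable_exp) measurable_const

lemma phiF_mul_integrable (s : ℂ) (hs : 0 < s.re) :
    MeasureTheory.Integrable fun v : ℝ => (phiF v : ℂ) * cexp (-s * v) := by
  have h : MeasureTheory.IntegrableOn (fun v : ℝ => Real.exp (-s.re * v)) (Set.Ioi 0) :=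
    exp_neg_integrableOn_Ioi 0 hs
  rw [← MeasureTheory.integrable_indicator_iff measurableSet_Ioi] at h
  refine h.mono' ?_ (Eventually.of_forall fun v => ?_)
  · exact ((Complex.measurable_ofReal.comp phiF_meas).aestronglyMeasurable).mul
      (Continuous.aestronglyMeasurable (by fun_prop))
  · rw [norm_mul, Complex.norm_exp, Complex.norm_real, Real.norm_of_nonneg (phiF_nonneg v)]
    by_cases hv : 0 < v
    · rw [Set.indicator_of_mem (Set.mem_Ioi.mpr hv)]
      have : (-s * (v:ℂ)).re = -s.re * v := by simp
      rw [this]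
      exact mul_le_of_le_one_left (Real.exp_pos _).le (phiF_le v)
    · rw [Set.indicator_of_notMem (by simpa using hv)]
      simp [phiF, hv]

lemma fracInt_phi (s : ℂ) : fracInt 1 s = ∫ v : ℝ, (phiF v : ℂ) * cexp (-s * v) := by
  have him : Real.exp '' Set.Ioi 0 = Set.Ioi 1 := by
    ext y; constructor
    · rintro ⟨x, hx, rfl⟩; exact Real.one_lt_exp_iff.mpr hx
    · intro hy
      have hy' : (1:ℝ) < y := hy
      exact ⟨Real.log y, Real.log_pos hy', Real.exp_log (by linarith)⟩
  unfold fracInt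
  rw [← him, MeasureTheory.integral_image_eq_integral_abs_deriv_smul measurableSet_Ioi
    (fun x _ => (Real.hasDerivAt_exp x).hasDerivWithinAt) Real.exp_injective.injOn,
    ← MeasureTheory.integral_indicator measurableSet_Ioi]
  congr 1; funext v
  by_cases hv : 0 < v
  · rw [Set.indicator_of_mem (Set.mem_Ioi.mpr hv), abs_of_pos (Real.exp_pos v)]
    simp only [phiF, hv, if_true]
    rw [Complex.cpow_def_of_ne_zero (by exact_mod_cast (Real.exp_pos v).ne'),
      ← Complex.ofReal_log (Real.exp_pos v).le, Real.log_exp, Complex.real_smul,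
      show -s * (v:ℂ) = v + v * -(s + 1) by ring, Complex.exp_add]
    push_cast; ring
  · rw [Set.indicator_of_notMem (by simpa using hv)]
    simp [phiF, hv]

noncomputable def psiF (h σ v : ℝ) : ℝ := (phiF v - phiF (v - h)) * Real.exp (-σ * v)

lemma fracInt_psi (h σ t : ℝ) (hσ : 0 < σ) :
    (1 - cexp (-(σ + t * I) * h)) * fracInt 1 (σ + t * I)
      = ∫ v : ℝ, (psiF h σ v : ℂ) * cexp (-I * t * v) := by
  set s : ℂ := σ + t * I with hs
  have hre : 0 < s.re := by simp [hs, hσ]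
  have hi := phiF_mul_integrable s hre
  have e2 : cexp (-s * h) * fracInt 1 s = ∫ v : ℝ, (phiF (v - h) : ℂ) * cexp (-s * v) := by
    rw [fracInt_phi, ← MeasureTheory.integral_const_mul,
      ← MeasureTheory.integral_sub_right_eq_self _ h]
    congr 1; funext v
    rw [show -s * (v:ℂ) = -s * h + -s * ((v - h : ℝ) : ℂ) by push_cast; ring, Complex.exp_add]
    ring
  have hi2 : MeasureTheory.Integrable fun v : ℝ => (phiF (v - h) : ℂ) * cexp (-s * v) := by
    refine ((hi.comp_sub_right h).const_mul (cexp (-s * h))).congr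
      (Eventually.of_forall fun v => ?_)
    simp only
    rw [show -s * (v:ℂ) = -s * h + -s * ((v - h : ℝ) : ℂ) by push_cast; ring, Complex.exp_add]
    ring
  rw [sub_mul, one_mul, e2, fracInt_phi, ← MeasureTheory.integral_sub hi hi2]
  congr 1; funext v
  unfold psiF
  push_cast
  rw [show -s * (v:ℂ) = -σ * v + -I * t * v by rw [hs]; ring, Complex.exp_add]
  ring

lemma psiF_meas (h σ : ℝ) : Measurable (psiF h σ) := by
  unfold psiF
  exact ((phiF_meas.sub (phiF_meas.comp (measurable_id.sub_const h)))).mul (by fun_prop)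

lemma psiF_abs_le (h σ v : ℝ) (hh : 0 < h) :
    |psiF h σ v| ≤ (Set.Ioi (0:ℝ)).indicator (fun v => Real.exp (-σ * v)) v := by
  unfold psiF
  by_cases hv : 0 < v
  · rw [Set.indicator_of_mem (Set.mem_Ioi.mpr hv), abs_mul, abs_of_pos (Real.exp_pos _)]
    refine mul_le_of_le_one_left (Real.exp_pos _).le ?_
    rw [abs_le]
    constructor <;> linarith [phiF_nonneg v, phiF_nonneg (v - h), phiF_le v, phiF_le (v - h)]
  · rw [Set.indicator_of_notMem (by simpa using hv)]
    have h2 : ¬ 0 < v - h := by linarith [not_lt.mp hv]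
    simp only [phiF, hv, if_false, h2]; simp

lemma psiF_integrable (h σ : ℝ) (hh : 0 < h) (hσ : 0 < σ) :
    MeasureTheory.Integrable (psiF h σ) := by
  have h0 : MeasureTheory.IntegrableOn (fun v : ℝ => Real.exp (-σ * v)) (Set.Ioi 0) :=
    exp_neg_integrableOn_Ioi 0 hσ
  rw [← MeasureTheory.integrable_indicator_iff measurableSet_Ioi] at h0
  exact h0.mono' (psiF_meas h σ).aestronglyMeasurable
    (Eventually.of_forall fun v => psiF_abs_le h σ v hh)

lemma psiF_sq_le (h σ v : ℝ) (hh : 0 < h) (hσ : 1 / 2 ≤ σ) (hv : 0 < v) :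
    psiF h σ v ^ 2 ≤ |phiF v - phiF (v - h)| * Real.exp (-v) := by
  unfold psiF
  rw [mul_pow, ← sq_abs, ← Real.exp_nat_mul]
  have h1 : |phiF v - phiF (v - h)| ≤ 1 := by
    rw [abs_le]
    constructor <;> linarith [phiF_nonneg v, phiF_nonneg (v - h), phiF_le v, phiF_le (v - h)]
  have h0 := abs_nonneg (phiF v - phiF (v - h))
  apply mul_le_mul (by nlinarith) _ (Real.exp_pos _).le h0
  apply Real.exp_le_exp.mpr
  push_cast; nlinarith

lemma psiF_sq_integrable (h σ : ℝ) (hh : 0 < h) (hσ : 1 / 2 ≤ σ) :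
    MeasureTheory.Integrable fun v => psiF h σ v ^ 2 := by
  have h0 : MeasureTheory.IntegrableOn (fun v : ℝ => Real.exp (-1 * v)) (Set.Ioi 0) :=
    exp_neg_integrableOn_Ioi 0 one_pos
  rw [← MeasureTheory.integrable_indicator_iff measurableSet_Ioi] at h0
  refine h0.mono' ((psiF_meas h σ).pow_const 2).aestronglyMeasurable
    (Eventually.of_forall fun v => ?_)
  rw [Real.norm_of_nonneg (sq_nonneg _)]
  by_cases hv : 0 < v
  · rw [Set.indicator_of_mem (Set.mem_Ioi.mpr hv)]
    refine (psiF_sq_le h σ v hh hσ hv).trans ?_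
    rw [neg_one_mul]
    refine mul_le_of_le_one_left (Real.exp_pos _).le ?_
    rw [abs_le]
    constructor <;> linarith [phiF_nonneg v, phiF_nonneg (v - h), phiF_le v, phiF_le (v - h)]
  · have := psiF_abs_le h σ v hh
    rw [Set.indicator_of_notMem (by simpa using hv)] at this ⊢
    rw [abs_nonpos_iff.mp this]; simp

lemma psiF_sq_integral (h σ : ℝ) (hh : 0 < h) (hh1 : h ≤ Real.exp (-1)) (hσ : 1 / 2 ≤ σ) :
    ∫ v, psiF h σ v ^ 2 ≤ 5 * h * Real.log (1 / h) := by
  set A := Real.log (1 / h) with hA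
  have hA1 : 1 ≤ A := by
    rw [hA, one_div, Real.log_inv]
    have := Real.log_le_log hh hh1
    rw [Real.log_exp] at this; linarith
  have hhA : h ≤ A := hh1.trans (by have := Real.exp_le_one_iff.mpr (show (-1:ℝ) ≤ 0 by norm_num); linarith)
  have hexA : Real.exp (-A) = h := by
    rw [hA, one_div, Real.log_inv, neg_neg, Real.exp_log hh]
  have hI := psiF_sq_integrable h σ hh hσ
  set q : ℝ → ℝ := fun v => psiF h σ v ^ 2 with hq
  have hII : ∀ a b : ℝ, IntervalIntegrable q MeasureTheory.volume a b :=
    fun a b => hI.intervalIntegrable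
  have e0 : ∫ v, q v = ∫ v in Set.Ioi 0, q v := by
    symm
    apply MeasureTheory.setIntegral_eq_integral_of_forall_compl_eq_zero
    intro v hv
    have := psiF_abs_le h σ v hh
    rw [Set.indicator_of_notMem hv] at this
    simp only [hq]
    rw [abs_nonpos_iff.mp this]; simp
  have e1 := intervalIntegral.integral_interval_add_Ioi (a := 0) (b := A)
    hI.integrableOn hI.integrableOn
  have e2 := intervalIntegral.integral_add_adjacent_intervals (hII 0 h) (hII h A)
  -- three pieces
  have hd1 : ∀ v, |phiF v - phiF (v - h)| ≤ 1 := fun v => by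
    rw [abs_le]
    constructor <;> linarith [phiF_nonneg v, phiF_nonneg (v - h), phiF_le v, phiF_le (v - h)]
  have hqe : ∀ v, 0 < v → q v ≤ Real.exp (-v) := fun v hv =>
    (psiF_sq_le h σ v hh hσ hv).trans (mul_le_of_le_one_left (Real.exp_pos _).le (hd1 v))
  have p1 : ∫ v in (0:ℝ)..h, q v ≤ h := by
    have : ∫ v in (0:ℝ)..h, q v ≤ ∫ v in (0:ℝ)..h, (1:ℝ) := by
      apply intervalIntegral.integral_mono_on_of_le_Ioo hh.le (hII 0 h) (by simp)
      intro v hv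
      exact (hqe v hv.1).trans (Real.exp_le_one_iff.mpr (by linarith [hv.1]))
    simpa using this
  have p3 : ∫ v in Set.Ioi A, q v ≤ h := by
    have h0 : MeasureTheory.IntegrableOn (fun v : ℝ => Real.exp (-v)) (Set.Ioi A) :=
      integrableOn_exp_neg_Ioi A
    have := MeasureTheory.setIntegral_mono_on hI.integrableOn h0 measurableSet_Ioi
      (fun v hv => hqe v (by linarith [Set.mem_Ioi.mp hv]))
    rwa [integral_exp_neg_Ioi, hexA] at this
  set F : ℝ → ℝ := fun v => (⌊Real.exp v⌋ : ℝ) * Real.exp (-v) with hF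
  have hmono : Monotone fun v : ℝ => ((⌊Real.exp v⌋ : ℤ) : ℝ) := fun a b hab => by
    simp only
    exact_mod_cast Int.floor_le_floor (Real.exp_le_exp.mpr hab)
  have hFI : ∀ a b : ℝ, IntervalIntegrable F MeasureTheory.volume a b := fun a b =>
    (hmono.intervalIntegrable).mul_continuousOn (by fun_prop)
  have hF0 : ∀ v, 0 ≤ F v := fun v => by
    have : (0:ℤ) ≤ ⌊Real.exp v⌋ := Int.floor_nonneg.mpr (Real.exp_pos v).le
    have : (0:ℝ) ≤ (⌊Real.exp v⌋ : ℝ) := by exact_mod_cast this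
    simp only [hF]; positivity
  have hF1 : ∀ v, F v ≤ 1 := fun v => by
    simp only [hF]
    calc (⌊Real.exp v⌋ : ℝ) * Real.exp (-v) ≤ Real.exp v * Real.exp (-v) := by
          gcongr; exact Int.floor_le _
      _ = 1 := by rw [← Real.exp_add]; simp
  have hFle : ∀ a b : ℝ, a ≤ b → ∫ v in a..b, F v ≤ b - a := fun a b hab => by
    have := intervalIntegral.integral_mono_on hab (hFI a b)
      (intervalIntegrable_const (c := (1:ℝ))) (fun v _ => hF1 v)
    simpa using this
  have hF0' : ∀ a b : ℝ, a ≤ b → 0 ≤ ∫ v in a..b, F v := fun a b hab =>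
    intervalIntegral.integral_nonneg hab fun v _ => hF0 v
  have hFs : IntervalIntegrable (fun v => Real.exp (-h) * F (v - h)) MeasureTheory.volume h A := by
    have := (hFI (h - h) (A - h)).comp_sub_right h
    simp only [sub_add_cancel] at this
    exact this.const_mul _
  have hexh : 1 - h ≤ Real.exp (-h) := by linarith [Real.add_one_le_exp (-h)]
  have hexh1 : Real.exp (-h) ≤ 1 := Real.exp_le_one_iff.mpr (by linarith)
  have p2 : ∫ v in h..A, q v ≤ 2 * h * A + h := by
    have c1 : ∫ v in h..A, q v ≤ ∫ v in h..A, (h + (F v - Real.exp (-h) * F (v - h))) := by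
      apply intervalIntegral.integral_mono_on_of_le_Ioo hhA (hII h A)
        (intervalIntegrable_const.add ((hFI h A).sub hFs))
      intro v hv
      have hv0 : 0 < v := hh.trans hv.1
      refine (psiF_sq_le h σ v hh hσ hv0).trans ?_
      have hvh : 0 < v - h := by linarith [hv.1]
      simp only [phiF, hv0, hvh, if_true, hF]
      have hfl : (⌊Real.exp (v - h)⌋ : ℝ) ≤ ⌊Real.exp v⌋ := hmono (by linarith)
      have hev : Real.exp (v - h) = Real.exp (-h) * Real.exp v := by
        rw [← Real.exp_add]; ring_nf
      have hev2 : Real.exp (-(v - h)) * Real.exp (-h) = Real.exp (-v) := by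
        rw [← Real.exp_add]; ring_nf
      have hev3 : Real.exp v * Real.exp (-v) = 1 := by rw [← Real.exp_add]; simp
      have hab : |Int.fract (Real.exp v) - Int.fract (Real.exp (v - h))| ≤
          h * Real.exp v + (⌊Real.exp v⌋ - ⌊Real.exp (v - h)⌋ : ℝ) := by
        unfold Int.fract
        have hpos := Real.exp_pos v
        have h3 : Real.exp v - Real.exp (v - h) ≤ h * Real.exp v := by rw [hev]; nlinarith
        have h4 : Real.exp (v - h) ≤ Real.exp v := Real.exp_le_exp.mpr (by linarith)
        rw [abs_le]; constructor <;> linarith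
      calc _ ≤ (h * Real.exp v + (⌊Real.exp v⌋ - ⌊Real.exp (v - h)⌋ : ℝ)) * Real.exp (-v) := by
            gcongr
        _ = h * (Real.exp v * Real.exp (-v)) + (⌊Real.exp v⌋ * Real.exp (-v)
              - ⌊Real.exp (v - h)⌋ * Real.exp (-v)) := by ring
        _ = _ := by rw [hev3, ← hev2]; ring
    have c2 : ∫ v in h..A, (h + (F v - Real.exp (-h) * F (v - h)))
        = h * (A - h) + (∫ v in h..A, F v) - Real.exp (-h) * ∫ v in (0:ℝ)..(A - h), F v := by
      rw [intervalIntegral.integral_add intervalIntegrable_const ((hFI h A).sub hFs),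
        intervalIntegral.integral_sub (hFI h A) hFs, intervalIntegral.integral_const_mul,
        intervalIntegral.integral_comp_sub_right F h, intervalIntegral.integral_const]
      simp only [sub_self, smul_eq_mul]; ring
    have c3 := intervalIntegral.integral_add_adjacent_intervals (hFI 0 h) (hFI h A)
    have c4 := intervalIntegral.integral_add_adjacent_intervals (hFI 0 (A - h)) (hFI (A - h) A)
    have c5 := hFle 0 (A - h) (by linarith)
    have c6 := hFle (A - h) A (by linarith)
    have c7 := hF0' 0 h hh.le
    have c8 := hF0' 0 (A - h) (by linarith)
    have c9 : (1 - Real.exp (-h)) * ∫ v in (0:ℝ)..(A - h), F v ≤ h * A :=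
      mul_le_mul (by linarith) (by linarith) c8 hh.le
    rw [c2] at c1
    nlinarith
  rw [e0, ← e1, ← e2]
  nlinarith

lemma zeta_line_cont (σ a b : ℝ) (ha : 0 < a) (hab : a ≤ b) :
    ContinuousOn (fun t : ℝ => ‖ζ (σ + t * I)‖ ^ 2) (Set.uIcc a b) := by
  rw [Set.uIcc_of_le hab]
  intro t ht
  have hne : (σ + t * I : ℂ) ≠ 1 := ne_one_of_im (by simpa using (ha.trans_le ht.1).ne')
  have h1 : ContinuousAt ζ (σ + t * I : ℂ) := (zeta_analyticAt hne).continuousAt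
  have h2 : ContinuousAt (fun t : ℝ => (σ + t * I : ℂ)) t := by fun_prop
  have h3 : ContinuousAt (fun t : ℝ => ζ (σ + t * I)) t :=
    ContinuousAt.comp (g := ζ) (f := fun t : ℝ => (σ + t * I : ℂ)) h1 h2
  exact (h3.norm.pow 2).continuousWithinAt

lemma mean_sq : ∃ C > 0, ∀ U : ℝ, 10 ≤ U → ∀ σ : ℝ, 1 / 2 ≤ σ → σ ≤ 3 / 4 →
    ∫ t in (U / 2)..(4 * U), ‖ζ (σ + t * I)‖ ^ 2 ≤ C * (U * Real.log U) := by
  refine ⟨28 + 51200 * Real.exp 16 * π * 5, by positivity, fun U hU σ h1 h2 => ?_⟩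
  have hU0 : 0 < U := by linarith
  set h : ℝ := 1 / (4 * U) with hh
  have hhp : 0 < h := by positivity
  have hh40 : h ≤ 1 / 40 := by rw [hh]; apply one_div_le_one_div_of_le <;> linarith
  have hhe : h ≤ Real.exp (-1) := hh40.trans (by linarith [Real.exp_neg_one_gt_d9])
  have hb : 0 < 1 / U ^ 2 := by positivity
  obtain ⟨hi, hp⟩ := planch (1 / U ^ 2) hb (psiF h σ) (psiF_integrable h σ hhp (by linarith))
    (psiF_sq_integrable h σ hhp h1)
  set Ψ : ℝ → ℂ := fun t => ∫ v : ℝ, (psiF h σ v : ℂ) * cexp (-I * t * v) with hΨ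
  have hlog1 : 1 ≤ Real.log U := log_ge_one (by linarith)
  have hpt : ∀ t ∈ Set.Icc (U / 2) (4 * U), ‖ζ (σ + t * I)‖ ^ 2 ≤
      8 + 51200 * U ^ 2 * Real.exp 16 * (Real.exp (-(1 / U ^ 2) * t ^ 2) * ‖Ψ t‖ ^ 2) := by
    intro t ht
    have ht5 : 5 ≤ t := by linarith [ht.1]
    set s : ℂ := σ + t * I with hs
    have hre : s.re = σ := by simp [hs]
    have him : s.im = t := by simp [hs]
    have hs1 : s ≠ 1 := ne_one_of_im (by rw [him]; exact abs_pos.mpr (by linarith : (0:ℝ) < t).ne')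
    have hz := zeta_fracInt (s := s) (by rw [hre]; linarith) hs1
    have hG := fracInt_psi h σ t (by linarith)
    rw [← hs] at hG
    have hc : 1 / 32 ≤ ‖1 - cexp (-s * h)‖ := by
      have e1 : (1 - cexp (-s * h)).im = Real.exp (-(σ * h)) * Real.sin (t * h) := by
        rw [Complex.sub_im, Complex.exp_im]
        simp [hre, him, Real.sin_neg]
      have hth1 : 1 / 8 ≤ t * h := by
        rw [hh, mul_one_div, le_div_iff₀ (by positivity)]; linarith [ht.1]
      have hth2 : t * h ≤ 1 := by
        rw [hh, mul_one_div, div_le_iff₀ (by positivity)]; linarith [ht.2]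
      have hsin := Real.mul_le_sin (x := t * h) (by linarith) (by linarith [Real.pi_gt_three])
      have hpi : 1 / 2 ≤ 2 / π := by
        rw [le_div_iff₀ Real.pi_pos]; linarith [Real.pi_le_four]
      have hs16 : 1 / 16 ≤ Real.sin (t * h) := by nlinarith
      have hexp : 1 / 2 ≤ Real.exp (-(σ * h)) := by
        have := Real.add_one_le_exp (-(σ * h)); nlinarith
      have := Complex.abs_im_le_norm (1 - cexp (-s * h))
      rw [e1] at this
      have h3 := le_abs_self (Real.exp (-(σ * h)) * Real.sin (t * h))
      nlinarith
    have hGn : ‖fracInt 1 s‖ ≤ 32 * ‖Ψ t‖ := by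
      have e : ‖1 - cexp (-s * h)‖ * ‖fracInt 1 s‖ = ‖Ψ t‖ := by
        rw [← norm_mul, hG]
      nlinarith [norm_nonneg (fracInt 1 s)]
    have hsn : ‖s‖ ≤ 5 * U := by
      have := Complex.norm_le_abs_re_add_abs_im s
      rw [hre, him, abs_of_nonneg (by linarith), abs_of_nonneg (by linarith)] at this
      linarith [ht.2]
    have hq : ‖s / (s - 1)‖ ≤ 2 := by
      have h0 : s - 1 ≠ 0 := sub_ne_zero.mpr hs1
      have e : s / (s - 1) = 1 + 1 / (s - 1) := by field_simp; ring
      have h1' : 1 ≤ ‖s - 1‖ := by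
        have := Complex.abs_im_le_norm (s - 1)
        simp only [Complex.sub_im, Complex.one_im, sub_zero, him] at this
        rw [abs_of_nonneg (by linarith)] at this; linarith
      rw [e]
      refine (norm_add_le _ _).trans ?_
      rw [norm_one, norm_div, norm_one]
      have := (div_le_one (by linarith)).mpr h1'
      linarith
    have hzn : ‖ζ s‖ ≤ 2 + 160 * U * ‖Ψ t‖ := by
      rw [hz]
      refine (norm_sub_le _ _).trans ?_
      rw [norm_mul]
      have := mul_le_mul hsn hGn (norm_nonneg _) (by positivity)
      linarith
    have hw : 1 ≤ Real.exp 16 * Real.exp (-(1 / U ^ 2) * t ^ 2) := by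
      rw [← Real.exp_add]
      apply Real.one_le_exp
      have : 1 / U ^ 2 * t ^ 2 ≤ 16 := by
        rw [one_div, inv_mul_le_iff₀ (by positivity)]
        nlinarith [ht.2]
      linarith
    have hsq : ‖ζ s‖ ^ 2 ≤ (2 + 160 * U * ‖Ψ t‖) ^ 2 :=
      pow_le_pow_left₀ (norm_nonneg _) hzn 2
    have hfin : 51200 * U ^ 2 * ‖Ψ t‖ ^ 2 * 1 ≤
        51200 * U ^ 2 * ‖Ψ t‖ ^ 2 * (Real.exp 16 * Real.exp (-(1 / U ^ 2) * t ^ 2)) := by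
      gcongr
    nlinarith [sq_nonneg (2 - 160 * U * ‖Ψ t‖)]
  have hle : U / 2 ≤ 4 * U := by linarith
  have m1 := intervalIntegral.integral_mono_on hle
    (zeta_line_cont σ (U / 2) (4 * U) (by linarith) hle).intervalIntegrable
    (intervalIntegrable_const.add (hi.intervalIntegrable.const_mul _)) hpt
  refine m1.trans ?_
  rw [intervalIntegral.integral_add intervalIntegrable_const (hi.intervalIntegrable.const_mul _),
    intervalIntegral.integral_const_mul, intervalIntegral.integral_const, smul_eq_mul]
  have m2 : ∫ t in (U / 2)..(4 * U), Real.exp (-(1 / U ^ 2) * t ^ 2) * ‖Ψ t‖ ^ 2 ≤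
      2 * π * (5 * h * Real.log (1 / h)) := by
    rw [intervalIntegral.integral_of_le hle]
    refine (MeasureTheory.setIntegral_le_integral hi
      (Eventually.of_forall fun t => by positivity)).trans (hp.trans ?_)
    gcongr
    exact psiF_sq_integral h σ hhp hhe h1
  have m3 : Real.log (1 / h) ≤ 2 * Real.log U := by
    rw [hh, one_div_one_div, ← Real.log_rpow hU0]
    apply Real.log_le_log (by positivity)
    rw [Real.rpow_two]; nlinarith
  have m4 : U ^ 2 * h = U / 4 := by rw [hh]; field_simp
  have m5 : 51200 * U ^ 2 * Real.exp 16 *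
      (∫ t in (U / 2)..(4 * U), Real.exp (-(1 / U ^ 2) * t ^ 2) * ‖Ψ t‖ ^ 2) ≤
      51200 * Real.exp 16 * π * 5 * (U * Real.log U) := by
    calc _ ≤ 51200 * U ^ 2 * Real.exp 16 * (2 * π * (5 * h * (2 * Real.log U))) := by
          gcongr
          exact m2.trans (by gcongr)
      _ = 51200 * Real.exp 16 * π * 5 * 4 * (U ^ 2 * h) * Real.log U := by ring
      _ = _ := by rw [m4]; ring
  nlinarith

lemma mean_sq_near : ∃ C > 0, ∀ U : ℝ, Real.exp 20 ≤ U → ∀ σ : ℝ, |σ - 1 / 2| ≤ 5 / Real.log U →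
    ∫ t in (U / 2)..(4 * U), ‖ζ (σ + t * I)‖ ^ 2 ≤ C * (U * Real.log U) := by
  obtain ⟨C, hC, h⟩ := mean_sq
  obtain ⟨K, hK, hY⟩ := YF_bound
  refine ⟨C + (K * Real.exp 10) ^ 2 * C, by positivity, fun U hU σ hσ => ?_⟩
  have hL : 20 ≤ Real.log U := by
    have := Real.log_le_log (Real.exp_pos _) hU; rwa [Real.log_exp] at this
  have hU10 : 10 ≤ U := by linarith [Real.add_one_le_exp 20]
  have hU0 : 0 < U := by linarith
  have hr : 5 / Real.log U ≤ 1 / 4 := by rw [div_le_iff₀ (by linarith)]; linarith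
  have hσ' := abs_le.mp hσ
  have hUL : 0 ≤ U * Real.log U := by positivity
  by_cases hc : 1 / 2 ≤ σ
  · refine (h U hU10 σ hc (by linarith)).trans ?_
    apply mul_le_mul_of_nonneg_right _ hUL
    have : 0 ≤ (K * Real.exp 10) ^ 2 * C := by positivity
    linarith
  · push Not at hc
    have hle : U / 2 ≤ 4 * U := by linarith
    have hpt : ∀ t ∈ Set.Icc (U / 2) (4 * U), ‖ζ (σ + t * I)‖ ^ 2 ≤
        (K * Real.exp 10) ^ 2 * ‖ζ ((1 - σ : ℝ) + t * I)‖ ^ 2 := by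
      intro t ht
      have ht5 : 5 ≤ t := by linarith [ht.1]
      set s : ℂ := (1 - σ : ℝ) + t * I with hs
      have hre : s.re = 1 - σ := by simp [hs]
      have him : s.im = t := by simp [hs]
      have hs1 : s ≠ 1 := ne_one_of_im (by rw [him]; exact abs_pos.mpr (by linarith : (0:ℝ) < t).ne')
      have hfe := zeta_fe (s := s) (by rw [hre]; linarith) hs1
      have e1 : 1 - s = (starRingEnd ℂ) (σ + t * I) := by
        rw [hs]; push_cast; simp; ring
      have e2 : ‖ζ (1 - s)‖ = ‖ζ (σ + t * I)‖ := by
        rw [e1, riemannZeta_conj, RCLike.norm_conj]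
      have hYs := hY s (by rw [hre]; linarith) (by rw [hre]; linarith)
        (by rw [him, abs_of_nonneg (by linarith)]; linarith)
      rw [hre, him, abs_of_nonneg (by linarith)] at hYs
      have hp : t ^ (1 - σ - 1 / 2) ≤ Real.exp 10 := by
        rw [Real.rpow_def_of_pos (by linarith)]
        apply Real.exp_le_exp.mpr
        have hlt : Real.log t ≤ 2 * Real.log U := by
          rw [← Real.log_rpow hU0]
          apply Real.log_le_log (by linarith)
          rw [Real.rpow_two]; nlinarith [ht.2]
        have hlt0 : 0 ≤ Real.log t := Real.log_nonneg (by linarith)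
        calc Real.log t * (1 - σ - 1 / 2) ≤ 2 * Real.log U * (5 / Real.log U) := by
              apply mul_le_mul hlt (by linarith) (by linarith) (by positivity)
          _ = 10 := by field_simp; norm_num
      rw [← e2, hfe, norm_mul, mul_pow]
      gcongr
      exact hYs.trans (by gcongr)
    have i2 : IntervalIntegrable (fun t : ℝ => ‖ζ ((1 - σ : ℝ) + t * I)‖ ^ 2)
        MeasureTheory.volume (U / 2) (4 * U) :=
      (zeta_line_cont (1 - σ) (U / 2) (4 * U) (by linarith) hle).intervalIntegrable
    have m1 := intervalIntegral.integral_mono_on hle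
      (zeta_line_cont σ (U / 2) (4 * U) (by linarith) hle).intervalIntegrable
      (i2.const_mul _) hpt
    refine m1.trans ?_
    rw [intervalIntegral.integral_const_mul]
    have m2 := h U hU10 (1 - σ) (by linarith) (by linarith)
    calc _ ≤ (K * Real.exp 10) ^ 2 * (C * (U * Real.log U)) := by gcongr
      _ ≤ _ := by nlinarith [mul_nonneg hC.le hUL]

lemma window_dslope {c : ℂ} {r : ℝ} (hr : 0 < r) {G : ℂ → ℂ} {M : ℝ}
    (hG : DifferentiableOn ℂ G (Metric.ball c (4 * r))) (hM : ∀ w, ‖w - c‖ = 3 * r → ‖G w‖ ≤ M)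
    {z : ℂ} (hz : ‖z - c‖ ≤ r) (hz0 : G z = 0) :
    DifferentiableOn ℂ (dslope G z) (Metric.ball c (4 * r)) ∧
    ∀ w, ‖w - c‖ = 3 * r → ‖dslope G z w‖ ≤ M / (2 * r) := by
  constructor
  · refine (Complex.differentiableOn_dslope (Metric.isOpen_ball.mem_nhds ?_)).mpr hG
    rw [mem_ball_iff_norm]; linarith
  · intro w hw
    have e := dslope_eq G z w
    rw [hz0, zero_add] at e
    have h1 := hM w hw
    rw [e, norm_mul] at h1
    have h2 : 2 * r ≤ ‖w - z‖ := by
      have := norm_sub_norm_le (w - c) (z - c)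
      rw [sub_sub_sub_cancel_right] at this; linarith
    rw [le_div_iff₀ (by positivity)]
    nlinarith [norm_nonneg (dslope G z w)]

lemma window_aux (c : ℂ) (r : ℝ) (hr : 0 < r) (S : Finset ℂ) : ∀ (G : ℂ → ℂ) (M : ℝ),
    DifferentiableOn ℂ G (Metric.ball c (4 * r)) → (∀ w, ‖w - c‖ = 3 * r → ‖G w‖ ≤ M) →
    (∀ z ∈ S, ‖z - c‖ ≤ r ∧ G z = 0) → ∀ w, ‖w - c‖ ≤ r →
    ‖G w‖ ≤ M * ∏ z ∈ S, (‖w - z‖ / (2 * r)) := by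
  classical
  induction S using Finset.induction_on with
  | empty =>
    intro G M hG hM _ w hw
    rw [Finset.prod_empty, mul_one]
    have hsub : closure (Metric.ball c (3 * r)) ⊆ Metric.ball c (4 * r) :=
      Metric.closure_ball_subset_closedBall.trans (Metric.closedBall_subset_ball (by linarith))
    refine Complex.norm_le_of_forall_mem_frontier_norm_le (Metric.isBounded_ball (x := c) (r := 3 * r))
      (DifferentiableOn.diffContOnCl (hG.mono hsub)) ?_ (subset_closure ?_)
    · intro z hz
      have := Metric.frontier_ball_subset_sphere hz
      exact hM z (by simpa using mem_sphere_iff_norm.mp this)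
    · rw [mem_ball_iff_norm]; linarith
  | insert z S hzS ih =>
    intro G M hG hM hS w hw
    obtain ⟨hz, hz0⟩ := hS z (Finset.mem_insert_self _ _)
    obtain ⟨d1, d2⟩ := window_dslope hr hG hM hz hz0
    have h := ih (dslope G z) (M / (2 * r)) d1 d2 (fun y hy => by
      obtain ⟨hy1, hy0⟩ := hS y (Finset.mem_insert_of_mem hy)
      refine ⟨hy1, ?_⟩
      have hne : y ≠ z := fun h => hzS (h ▸ hy)
      have e := dslope_eq G z y
      rw [hz0, hy0, zero_add] at e
      exact (mul_eq_zero.mp e.symm).resolve_left (sub_ne_zero.mpr hne)) w hw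
    rw [Finset.prod_insert hzS, dslope_eq G z w, hz0, zero_add, norm_mul]
    calc ‖w - z‖ * ‖dslope G z w‖ ≤ ‖w - z‖ * (M / (2 * r) * ∏ z ∈ S, (‖w - z‖ / (2 * r))) := by
          gcongr
      _ = _ := by ring

lemma window_sum (c : ℂ) (r : ℝ) (hr : 0 < r) (S : Finset ℂ) (f : ℂ → ℂ) (M : ℝ) (hM0 : 0 ≤ M)
    (hG : DifferentiableOn ℂ f (Metric.ball c (4 * r))) (hM : ∀ w, ‖w - c‖ = 3 * r → ‖f w‖ ≤ M)
    (hS : ∀ z ∈ S, ‖z - c‖ ≤ r ∧ f z = 0) (hd : ∀ z ∈ S, ∀ y ∈ S, ‖z - y‖ ≤ r) :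
    ∑ z ∈ S, ‖deriv f z‖ ≤ M / (2 * r) := by
  classical
  rcases Nat.eq_zero_or_pos S.card with h0 | hpos
  · rw [Finset.card_eq_zero.mp h0, Finset.sum_empty]; positivity
  have key : ∀ z ∈ S, ‖deriv f z‖ ≤ M / (2 * r) * (1 / 2) ^ (S.card - 1) := by
    intro z hz
    obtain ⟨hz1, hz0⟩ := hS z hz
    obtain ⟨d1, d2⟩ := window_dslope hr hG hM hz1 hz0
    have h := window_aux c r hr (S.erase z) (dslope f z) (M / (2 * r)) d1 d2 (fun y hy => by
      obtain ⟨hne, hy'⟩ := Finset.mem_erase.mp hy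
      obtain ⟨hy1, hy0⟩ := hS y hy'
      refine ⟨hy1, ?_⟩
      have e := dslope_eq f z y
      rw [hz0, hy0, zero_add] at e
      exact (mul_eq_zero.mp e.symm).resolve_left (sub_ne_zero.mpr hne)) z hz1
    rw [dslope_same] at h
    refine h.trans ?_
    gcongr
    rw [← Finset.card_erase_of_mem hz]
    rw [← Finset.prod_const]
    refine Finset.prod_le_prod (fun y _ => by positivity) fun y hy => ?_
    have := hd z hz y (Finset.mem_of_mem_erase hy)
    rw [div_le_iff₀ (by positivity)]; linarith
  have := Finset.sum_le_card_nsmul S _ _ key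
  refine this.trans ?_
  rw [nsmul_eq_mul]
  obtain ⟨m, hm⟩ : ∃ m, S.card = m + 1 := ⟨S.card - 1, by omega⟩
  rw [hm, Nat.add_sub_cancel]
  have h2 : ((m + 1 : ℕ) : ℝ) * (1 / 2) ^ m ≤ 1 := by
    rw [one_div, inv_pow, ← div_eq_mul_inv, div_le_one (by positivity)]
    exact_mod_cast Nat.lt_two_pow_self (n := m)
  calc _ = M / (2 * r) * (((m + 1 : ℕ) : ℝ) * (1 / 2) ^ m) := by ring
    _ ≤ M / (2 * r) * 1 := by gcongr
    _ = _ := mul_one _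

/-- A globally continuous function equal to the squared modulus of zeta away from one. -/
noncomputable def qz (s : ℂ) : ℝ := (‖riemannZeta₁ s‖ / max ‖s - 1‖ 1) ^ 2

lemma qz_cont : Continuous qz := by
  have h : Continuous riemannZeta₁ :=
    continuous_iff_continuousAt.mpr fun s => (riemannZeta₁_analyticAt s).continuousAt
  unfold qz
  refine ((h.norm).div (by fun_prop) fun s => ?_).pow 2
  have := le_max_right ‖s - 1‖ 1
  linarith

lemma qz_eq {s : ℂ} (hs : 1 ≤ |s.im|) : qz s = ‖ζ s‖ ^ 2 := by
  have h1 : 1 ≤ ‖s - 1‖ := by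
    have := Complex.abs_im_le_norm (s - 1)
    simp only [Complex.sub_im, Complex.one_im, sub_zero] at this
    linarith
  have hs1 : s ≠ 1 := ne_one_of_im (by linarith)
  unfold qz
  rw [max_eq_left h1, riemannZeta₁_eq_mul hs1, norm_mul,
    mul_div_cancel_left₀ _ (by linarith : ‖s - 1‖ ≠ 0)]

noncomputable def Aq (ρ c : ℝ) : ℝ :=
  ∫ θ in (0:ℝ)..(2 * π), qz (circleMap (1 / 2 + c * I) ρ θ)

lemma Aq_cont2 (ρ : ℝ) : Continuous fun p : ℝ × ℝ => qz (circleMap (1 / 2 + p.1 * I) ρ p.2) := by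
  apply qz_cont.comp
  unfold circleMap
  fun_prop

lemma Aq_cont (ρ : ℝ) : Continuous (Aq ρ) :=
  intervalIntegral.continuous_parametric_intervalIntegral_of_continuous' (Aq_cont2 ρ) 0 (2 * π)

lemma Aq_sup (r c : ℝ) (hr : 0 < r) (hr1 : r ≤ 1 / 20) (hc : 3 ≤ c) (w : ℂ)
    (hw : ‖w - (1 / 2 + c * I)‖ ≤ 4 * r) : ‖ζ w‖ ^ 2 ≤ Aq (5 * r) c := by
  set a : ℂ := 1 / 2 + c * I with ha
  have haim : a.im = c := by simp [ha]
  have him : ∀ z : ℂ, ‖z - a‖ ≤ 5 * r → 1 ≤ |z.im| := fun z hz => by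
    have := (Complex.abs_im_le_norm (z - a)).trans hz
    rw [Complex.sub_im, haim, abs_le] at this
    rw [le_abs]; left; linarith
  have hd : ∀ z : ℂ, ‖z - a‖ ≤ 5 * r → DifferentiableAt ℂ (fun z => ζ z ^ 2) z :=
    fun z hz => ((zeta_analyticAt (ne_one_of_im (by linarith [him z hz]))).differentiableAt).pow 2
  have h5 : |5 * r| = 5 * r := abs_of_pos (by positivity)
  have h := circleAverage_sub_sub_inv_smul_of_differentiable_on_off_countable
    (f := fun z => ζ z ^ 2) (c := a) (R := 5 * r) (w := w) Set.countable_empty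
    (fun z hz => (hd z (by rw [h5] at hz; exact mem_closedBall_iff_norm.mp hz)).continuousAt.continuousWithinAt)
    (fun z hz => hd z (by have := hz.1; rw [h5] at this; exact (mem_ball_iff_norm.mp this).le))
    (by rw [h5, mem_ball_iff_norm]; linarith)
  unfold Real.circleAverage at h
  have hn : ‖ζ w‖ ^ 2 = ‖ζ w ^ 2‖ := (norm_pow _ _).symm
  rw [hn, ← h, norm_smul]
  have h2pi : (0:ℝ) ≤ 2 * π := by positivity
  have hci : Continuous fun θ : ℝ => qz (circleMap a (5 * r) θ) :=
    qz_cont.comp (continuous_circleMap a (5 * r))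
  have hb := intervalIntegral.norm_integral_le_of_norm_le (μ := MeasureTheory.volume)
    (f := fun θ : ℝ => ((circleMap a (5 * r) θ - a) / (circleMap a (5 * r) θ - w)) •
      ζ (circleMap a (5 * r) θ) ^ 2) (g := fun θ => 5 * qz (circleMap a (5 * r) θ))
    h2pi (Eventually.of_forall fun θ _ => by
      have e1 : ‖circleMap a (5 * r) θ - a‖ = 5 * r := by simp [circleMap, hr.le]
      rw [norm_smul, norm_div, e1, norm_pow, ← qz_eq (him _ e1.le)]
      apply mul_le_mul_of_nonneg_right _ (by unfold qz; positivity)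
      have h3 : r ≤ ‖circleMap a (5 * r) θ - w‖ := by
        have := norm_sub_norm_le (circleMap a (5 * r) θ - a) (w - a)
        rw [sub_sub_sub_cancel_right, e1] at this; linarith
      rw [div_le_iff₀ (by linarith)]; linarith)
    ((hci.const_mul 5).intervalIntegrable _ _)
  rw [intervalIntegral.integral_const_mul] at hb
  have hA0 : 0 ≤ Aq (5 * r) c := by
    unfold Aq
    exact intervalIntegral.integral_nonneg h2pi fun θ _ => by unfold qz; positivity
  rw [norm_inv, Real.norm_of_nonneg h2pi]
  refine (mul_le_mul_of_nonneg_left hb (by positivity)).trans ?_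
  change (2 * π)⁻¹ * (5 * Aq (5 * r) c) ≤ _
  rw [inv_mul_le_iff₀ (by positivity)]
  nlinarith [Real.pi_gt_three]

lemma Aq_in (C U ρ : ℝ) (hU : Real.exp 20 ≤ U) (hρ0 : 0 < ρ) (hρe : ρ = 5 / Real.log U)
    (hρ1 : ρ ≤ 1 / 4) (h : ∀ σ : ℝ, |σ - 1 / 2| ≤ 5 / Real.log U →
    ∫ t in (U / 2)..(4 * U), ‖ζ (σ + t * I)‖ ^ 2 ≤ C * (U * Real.log U)) (θ : ℝ) :
    ∫ c in U..(2 * U + 1), qz (circleMap (1 / 2 + c * I) ρ θ) ≤ C * (U * Real.log U) := by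
  have hU10 : 10 ≤ U := by linarith [Real.add_one_le_exp 20]
  set σ : ℝ := 1 / 2 + ρ * Real.cos θ with hσ
  set y : ℝ := ρ * Real.sin θ with hy
  have hcm : ∀ c : ℝ, circleMap (1 / 2 + c * I) ρ θ = σ + (c + y : ℝ) * I := by
    intro c
    unfold circleMap
    rw [Complex.exp_mul_I, hσ, hy]; push_cast; ring
  have hyb : |y| ≤ ρ := by
    rw [hy, abs_mul, abs_of_pos hρ0]
    exact mul_le_of_le_one_right hρ0.le (Real.abs_sin_le_one θ)
  have hσb : |σ - 1 / 2| ≤ 5 / Real.log U := by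
    rw [← hρe, hσ, add_sub_cancel_left, abs_mul, abs_of_pos hρ0]
    exact mul_le_of_le_one_right hρ0.le (Real.abs_cos_le_one θ)
  have hyb' := abs_le.mp hyb
  simp only [hcm]
  rw [intervalIntegral.integral_comp_add_right (fun t : ℝ => qz (σ + (t : ℝ) * I)) y]
  refine le_trans ?_ (h σ hσb)
  have hcont : Continuous fun t : ℝ => qz (σ + (t : ℝ) * I) := qz_cont.comp (by fun_prop)
  calc ∫ t in (U + y)..(2 * U + 1 + y), qz (σ + (t : ℝ) * I)
      ≤ ∫ t in (U / 2)..(4 * U), qz (σ + (t : ℝ) * I) := by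
        apply intervalIntegral.integral_mono_interval (by linarith) (by linarith) (by linarith)
          (Eventually.of_forall fun t => by simp only [Pi.zero_apply]; unfold qz; positivity)
          (hcont.intervalIntegrable _ _)
    _ = _ := by
        apply intervalIntegral.integral_congr
        intro t ht
        rw [Set.uIcc_of_le (by linarith)] at ht
        simp only
        rw [qz_eq]
        simp only [Complex.add_im, Complex.ofReal_im, Complex.mul_im, Complex.ofReal_re,
          Complex.I_im, Complex.I_re, mul_one, mul_zero, zero_add, add_zero]
        rw [le_abs]; left; linarith [ht.1]

lemma Aq_int : ∃ C > 0, ∀ U : ℝ, Real.exp 20 ≤ U →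
    ∫ c in U..(2 * U + 1), Aq (5 * (1 / Real.log U)) c ≤ C * (U * Real.log U) := by
  obtain ⟨C, hC, h⟩ := mean_sq_near
  refine ⟨2 * π * C, by positivity, fun U hU => ?_⟩
  have hL : 20 ≤ Real.log U := by
    have := Real.log_le_log (Real.exp_pos _) hU; rwa [Real.log_exp] at this
  have hU10 : 10 ≤ U := by linarith [Real.add_one_le_exp 20]
  set ρ : ℝ := 5 * (1 / Real.log U) with hρ
  have hρ0 : 0 < ρ := by positivity
  have hρe : ρ = 5 / Real.log U := by rw [hρ]; ring
  have hρ1 : ρ ≤ 1 / 4 := by rw [hρe, div_le_iff₀ (by linarith)]; linarith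
  have h2pi : (0:ℝ) ≤ 2 * π := by positivity
  have hK : IsCompact (Set.uIcc U (2 * U + 1) ×ˢ Set.uIcc (0:ℝ) (2 * π)) :=
    isCompact_uIcc.prod isCompact_uIcc
  have hint : MeasureTheory.IntegrableOn
      (Function.uncurry fun c θ : ℝ => qz (circleMap (1 / 2 + c * I) ρ θ))
      (Set.uIoc U (2 * U + 1) ×ˢ Set.uIoc (0:ℝ) (2 * π)) :=
    ((Aq_cont2 ρ).continuousOn.integrableOn_compact hK).mono_set
      (Set.prod_mono Set.uIoc_subset_uIcc Set.uIoc_subset_uIcc)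
  have sw := MeasureTheory.intervalIntegral_intervalIntegral_swap hint
  change ∫ c in U..(2 * U + 1), ∫ θ in (0:ℝ)..(2 * π), qz (circleMap (1 / 2 + c * I) ρ θ) ≤ _
  refine sw.trans_le ?_
  have hin := Aq_in C U ρ hU hρ0 hρe hρ1 (h U hU)
  have hc2 : Continuous fun p : ℝ × ℝ => qz (circleMap (1 / 2 + p.2 * I) ρ p.1) := by
    apply qz_cont.comp
    unfold circleMap
    fun_prop
  have hcI : Continuous fun θ : ℝ => ∫ c in U..(2 * U + 1), qz (circleMap (1 / 2 + c * I) ρ θ) :=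
    intervalIntegral.continuous_parametric_intervalIntegral_of_continuous' hc2 _ _
  have := intervalIntegral.integral_mono_on (μ := MeasureTheory.volume) h2pi (hcI.intervalIntegrable _ _)
    (intervalIntegrable_const (c := C * (U * Real.log U))) (fun θ _ => hin θ)
  refine this.trans ?_
  rw [intervalIntegral.integral_const, smul_eq_mul]
  apply le_of_eq; ring

lemma deriv_sum_pos : ∃ C > 0, ∀ U : ℝ, Real.exp 20 ≤ U → ∀ S : Finset ℂ,
    (∀ ρ ∈ S, ζ ρ = 0 ∧ ρ.re = 1 / 2 ∧ U ≤ ρ.im ∧ ρ.im < 2 * U) →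
    ∑ ρ ∈ S, ‖deriv ζ ρ‖ ≤ C * (U * Real.log U ^ (5 / 2 : ℝ)) := by
  obtain ⟨C, hC, h⟩ := Aq_int
  refine ⟨√(2 * C), by positivity, fun U hU S hS => ?_⟩
  have hL : 20 ≤ Real.log U := by
    have := Real.log_le_log (Real.exp_pos _) hU; rwa [Real.log_exp] at this
  have hU10 : 10 ≤ U := by linarith [Real.add_one_le_exp 20]
  have hint := h U hU
  set L := Real.log U with hLdef
  have hL0 : 0 < L := by linarith
  set r : ℝ := 1 / L with hr
  have hr0 : 0 < r := by positivity
  have hrL : r * L = 1 := by rw [hr]; field_simp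
  have hr1 : r ≤ 1 / 20 := by rw [hr]; exact one_div_le_one_div_of_le (by norm_num) hL
  set A := Aq (5 * r) with hA
  have hAc : Continuous A := Aq_cont _
  have hAi : ∀ a b : ℝ, IntervalIntegrable A MeasureTheory.volume a b :=
    fun a b => hAc.intervalIntegrable a b
  have hA0 : ∀ c, 0 ≤ A c := fun c => by
    simp only [hA]; unfold Aq
    exact intervalIntegral.integral_nonneg (by positivity) fun θ _ => by unfold qz; positivity
  set N : ℕ := ⌊U * L⌋₊ + 1 with hN
  set t : ℕ → ℝ := fun j => U + j * r with ht
  set J : ℂ → ℕ := fun ρ => ⌊(ρ.im - U) * L⌋₊ with hJ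
  set W : ℕ → ℝ := fun j => L * ∫ c in (t j)..(t (j + 1)), A c with hW
  have htt : ∀ j, t (j + 1) = t j + r := fun j => by simp only [ht]; push_cast; ring
  have htU : ∀ j, U ≤ t j := fun j => by
    simp only [ht]; have : 0 ≤ (j:ℝ) * r := by positivity
    linarith
  have hW0 : ∀ j, 0 ≤ W j := fun j => by
    simp only [hW]
    exact mul_nonneg hL0.le (intervalIntegral.integral_nonneg (by rw [htt]; linarith) fun c _ => hA0 c)
  have hwin : ∀ j, ∑ ρ ∈ S with J ρ = j, ‖deriv ζ ρ‖ ≤ √(W j) / (2 * r) := by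
    intro j
    have hloc : ∀ ρ ∈ S.filter (fun ρ => J ρ = j), ζ ρ = 0 ∧ ρ.re = 1 / 2 ∧
        t j ≤ ρ.im ∧ ρ.im ≤ t j + r := by
      intro ρ hρ
      obtain ⟨hρS, hρj⟩ := Finset.mem_filter.mp hρ
      obtain ⟨h1, h2, h3, h4⟩ := hS ρ hρS
      have hnn : 0 ≤ (ρ.im - U) * L := mul_nonneg (by linarith) hL0.le
      have f1 := Nat.floor_le hnn
      have f2 := Nat.lt_floor_add_one ((ρ.im - U) * L)
      simp only [hJ] at hρj
      rw [hρj] at f1 f2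
      have e : ρ.im - U = (ρ.im - U) * L * r := by rw [mul_assoc, mul_comm L r, hrL, mul_one]
      refine ⟨h1, h2, ?_, ?_⟩
      · simp only [ht]; nlinarith
      · simp only [ht]; nlinarith
    have hd1 : ∀ (x y : ℂ), x.re = y.re → ‖x - y‖ = |x.im - y.im| := by
      intro x y hxy
      have : x - y = ((x.im - y.im : ℝ) : ℂ) * I := by
        apply Complex.ext <;> simp [hxy]
      rw [this, norm_mul, Complex.norm_I, mul_one, Complex.norm_real, Real.norm_eq_abs]
    have hcre : (1 / 2 + (t j : ℂ) * I).re = 1 / 2 := by simp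
    have hcim : (1 / 2 + (t j : ℂ) * I).im = t j := by simp
    apply window_sum (1 / 2 + (t j : ℂ) * I) r hr0 _ ζ _ (Real.sqrt_nonneg _)
    · intro w hw
      rw [mem_ball_iff_norm] at hw
      have := (Complex.abs_im_le_norm _).trans hw.le
      rw [Complex.sub_im, hcim, abs_le] at this
      have h5 := htU j
      exact (zeta_analyticAt (ne_one_of_im (abs_pos.mpr (by linarith : 0 < w.im).ne'))).differentiableAt.differentiableWithinAt
    · intro w hw
      apply Real.le_sqrt_of_sq_le
      have hc : ∀ c ∈ Set.Icc (t j) (t (j + 1)), ‖ζ w‖ ^ 2 ≤ A c := by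
        intro c hc
        rw [htt] at hc
        apply Aq_sup r c hr0 hr1 (by linarith [htU j, hc.1])
        have e := norm_sub_le_norm_sub_add_norm_sub w (1 / 2 + (t j : ℂ) * I) (1 / 2 + c * I)
        rw [hw, hd1 (1 / 2 + (t j : ℂ) * I) (1 / 2 + c * I) (by simp)] at e
        have : |(1 / 2 + (t j : ℂ) * I).im - (1 / 2 + (c : ℂ) * I).im| ≤ r := by
          rw [hcim]; simp
          rw [abs_le]; constructor <;> linarith [hc.1, hc.2]
        linarith
      have m := intervalIntegral.integral_mono_on (μ := MeasureTheory.volume)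
        (show t j ≤ t (j + 1) by rw [htt]; linarith)
        (intervalIntegrable_const (c := ‖ζ w‖ ^ 2)) (hAi _ _) hc
      rw [intervalIntegral.integral_const, smul_eq_mul, htt, add_sub_cancel_left, ← htt] at m
      simp only [hW]
      calc ‖ζ w‖ ^ 2 = L * (r * ‖ζ w‖ ^ 2) := by
            rw [← mul_assoc, mul_comm L r, hrL, one_mul]
        _ ≤ _ := by gcongr
    · intro z hz
      obtain ⟨h1, h2, h3, h4⟩ := hloc z hz
      refine ⟨?_, h1⟩
      rw [hd1 _ _ (by rw [h2, hcre]), hcim, abs_le]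
      constructor <;> linarith
    · intro z hz y hy
      obtain ⟨h1, h2, h3, h4⟩ := hloc z hz
      obtain ⟨g1, g2, g3, g4⟩ := hloc y hy
      rw [hd1 _ _ (by rw [h2, g2]), abs_le]
      constructor <;> linarith
  have hmap : ∀ ρ ∈ S, J ρ ∈ Finset.range N := by
    intro ρ hρ
    obtain ⟨h1, h2, h3, h4⟩ := hS ρ hρ
    rw [Finset.mem_range, hN, Nat.lt_succ_iff]
    simp only [hJ]
    apply Nat.floor_le_floor
    apply mul_le_mul_of_nonneg_right _ hL0.le
    linarith
  rw [← Finset.sum_fiberwise_of_maps_to hmap]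
  have s1 : ∑ j ∈ Finset.range N, ∑ ρ ∈ S with J ρ = j, ‖deriv ζ ρ‖ ≤
      (∑ j ∈ Finset.range N, √(W j)) / (2 * r) := by
    rw [Finset.sum_div]
    exact Finset.sum_le_sum fun j _ => hwin j
  have hUL : 1 ≤ U * L := by nlinarith
  have hNle : (N : ℝ) ≤ U * L + 1 := by
    rw [hN]; push_cast
    linarith [Nat.floor_le (show 0 ≤ U * L by linarith)]
  have hsumW : ∑ j ∈ Finset.range N, W j ≤ L * (C * (U * L)) := by
    simp only [hW]
    rw [← Finset.mul_sum, intervalIntegral.sum_integral_adjacent_intervals fun k _ => hAi _ _]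
    gcongr
    refine le_trans ?_ hint
    rw [show t 0 = U from by simp only [ht]; simp]
    apply intervalIntegral.integral_mono_interval le_rfl (htU N) _
      (Eventually.of_forall fun c => hA0 c) (hAi _ _)
    simp only [ht]
    have : (N:ℝ) * r ≤ (U * L + 1) * r := by gcongr
    have e : (U * L + 1) * r = U + r := by
      rw [add_mul, mul_assoc, mul_comm L r, hrL]; ring
    linarith
  have cs := sq_sum_le_card_mul_sum_sq (s := Finset.range N) (f := fun j => √(W j))
  simp only [Finset.card_range] at cs
  have hsq : ∀ j, √(W j) ^ 2 = W j := fun j => Real.sq_sqrt (hW0 j)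
  simp only [hsq] at cs
  have hfin : (∑ j ∈ Finset.range N, √(W j)) ≤ √(2 * C) * (U * L ^ (3 / 2 : ℝ)) := by
    apply le_of_sq_le_sq _ (by positivity)
    rw [mul_pow, mul_pow, Real.sq_sqrt (by positivity), ← Real.rpow_natCast (L ^ (3 / 2 : ℝ)) 2,
      ← Real.rpow_mul hL0.le]
    norm_num
    calc _ ≤ (N:ℝ) * ∑ j ∈ Finset.range N, W j := cs
      _ ≤ (2 * (U * L)) * (L * (C * (U * L))) := by
          apply mul_le_mul (by linarith) hsumW (Finset.sum_nonneg fun j _ => hW0 j) (by positivity)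
      _ = _ := by ring
  refine s1.trans ?_
  have e52 : L ^ (5 / 2 : ℝ) = L ^ (3 / 2 : ℝ) * L := by
    rw [← Real.rpow_add_one hL0.ne']; norm_num
  rw [div_le_iff₀ (by positivity), e52]
  calc _ ≤ √(2 * C) * (U * L ^ (3 / 2 : ℝ)) := hfin
    _ ≤ √(2 * C) * (U * L ^ (3 / 2 : ℝ)) * 2 := by
        have : 0 ≤ √(2 * C) * (U * L ^ (3 / 2 : ℝ)) := by positivity
        linarith
    _ = √(2 * C) * (U * L ^ (3 / 2 : ℝ)) * 2 * (r * L) := by rw [hrL, mul_one]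
    _ = _ := by ring

lemma deriv_sum_abs : ∃ C > 0, ∀ U : ℝ, Real.exp 20 ≤ U → ∀ S : Finset ℂ,
    (∀ ρ ∈ S, ζ ρ = 0 ∧ ρ.re = 1 / 2 ∧ U ≤ |ρ.im| ∧ |ρ.im| < 2 * U) →
    ∑ ρ ∈ S, ‖deriv ζ ρ‖ ≤ C * (U * Real.log U ^ (5 / 2 : ℝ)) := by
  classical
  obtain ⟨C, hC, h⟩ := deriv_sum_pos
  refine ⟨2 * C, by positivity, fun U hU S hS => ?_⟩
  have hU0 : 0 < U := (Real.exp_pos _).trans_le hU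
  rw [← Finset.sum_filter_add_sum_filter_not S (fun ρ => 0 ≤ ρ.im)]
  have h1 := h U hU (S.filter (fun ρ => 0 ≤ ρ.im)) (fun ρ hρ => by
    obtain ⟨a, b⟩ := Finset.mem_filter.mp hρ
    have := hS ρ a
    rwa [abs_of_nonneg b] at this)
  have h2 := h U hU ((S.filter (fun ρ => ¬ 0 ≤ ρ.im)).image (starRingEnd ℂ)) (fun ρ hρ => by
    obtain ⟨y, hy, rfl⟩ := Finset.mem_image.mp hρ
    obtain ⟨a, b⟩ := Finset.mem_filter.mp hy
    have := hS y a
    rw [abs_of_neg (not_le.mp b)] at this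
    rw [riemannZeta_conj, this.1, map_zero, conj_re, conj_im]
    exact ⟨rfl, this.2⟩)
  rw [Finset.sum_image fun x _ y _ hxy => (starRingEnd ℂ).injective hxy] at h2
  have e : ∀ ρ ∈ S.filter (fun ρ => ¬ 0 ≤ ρ.im),
      ‖deriv ζ (starRingEnd ℂ ρ)‖ = ‖deriv ζ ρ‖ := by
    intro ρ _
    rw [deriv_zeta_conj, RCLike.norm_conj]
  rw [Finset.sum_congr rfl e] at h2
  linarith

lemma zall_sum_RH (RH : RiemannHypothesis) : ∃ K > (0:ℝ), ∀ x T : ℝ, 3 ≤ x →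
    ∑ ρ ∈ zall T, ‖deriv ζ ρ‖ * ‖GF (Real.log (x + √x)) ρ - GF (Real.log x) ρ‖ ≤
      √x * (K * √x * Real.log x ^ (7 / 2 : ℝ)) := by
  obtain ⟨C, hC, hsum⟩ := deriv_sum_abs
  set q : ℝ := √(1 / 2) with hq
  have hq2 : q ^ 2 = 1 / 2 := Real.sq_sqrt (by norm_num)
  have hq0 : 0 < q := Real.sqrt_pos.mpr (by norm_num)
  have hsm : Summable fun k : ℕ => (k:ℝ) ^ 3 * q ^ k :=
    summable_pow_mul_geometric_of_norm_lt_one 3 (by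
      rw [Real.norm_of_nonneg hq0.le]; nlinarith)
  set Q := ∑' k : ℕ, (k:ℝ) ^ 3 * q ^ k with hQ
  have hQ0 : 0 ≤ Q := tsum_nonneg fun k => by positivity
  set D := ∑ ρ ∈ zall (2 ^ 30), ‖deriv ζ ρ‖ * (1 / ‖ρ‖) with hD
  have hD0 : 0 ≤ D := sum_nonneg fun ρ _ => by positivity
  refine ⟨2 * D + (6 * C + 8 * C * Q), by positivity, fun x T hx => ?_⟩
  have hx0 : 0 < x := by linarith
  have hL1 : 1 ≤ Real.log x := log_ge_one hx
  set L := Real.log x with hL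
  set s := √x with hs
  have hsx : s ^ 2 = x := Real.sq_sqrt hx0.le
  have hs0 : 0 < s := Real.sqrt_pos.mpr hx0
  have hs1 : 1 ≤ s := by rw [hs, Real.one_le_sqrt]; linarith
  have hhx : s ≤ x := by nlinarith
  have hre : ∀ ρ ∈ zall T, ρ.re = 1 / 2 := fun ρ hρ => by
    obtain ⟨hz, h0, h1, -⟩ := mem_zall.mp hρ
    refine RH ρ hz ?_ ?_
    · rintro ⟨n, rfl⟩
      have : (-2 * ((n:ℂ) + 1)).re = -2 * ((n:ℝ) + 1) := by simp
      rw [this] at h0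
      linarith [(Nat.cast_nonneg n : (0:ℝ) ≤ n)]
    · rintro rfl; simp at h1
  have e1 : (2 * x) ^ (1 / 2 : ℝ) ≤ 2 * s := by
    rw [← Real.sqrt_eq_rpow, Real.sqrt_le_left (by positivity)]; nlinarith
  have e2 : (2 * x) ^ (1 / 2 + 1 : ℝ) ≤ 4 * s ^ 3 := by
    rw [Real.rpow_add_one (by positivity)]
    calc _ ≤ 2 * s * (2 * x) := by gcongr
      _ = _ := by rw [← hsx]; ring
  have d2 : ∀ ρ ∈ zall T, ‖GF (Real.log (x + s)) ρ - GF L ρ‖ ≤ 2 * s ^ 2 * (1 / ‖ρ‖) := fun ρ hρ => by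
    have := GF_diff2 (x := x) (h := s) (z := ρ) (by linarith) hs0.le hhx (by rw [hre ρ hρ]; norm_num)
    rw [hre ρ hρ] at this
    calc _ ≤ s * (2 * s / ‖ρ‖) := this.trans (by gcongr)
      _ = _ := by ring
  have d1 : ∀ ρ ∈ zall T, ‖GF (Real.log (x + s)) ρ - GF L ρ‖ ≤ 8 * s ^ 3 / (‖ρ‖ * ‖ρ + 1‖) := fun ρ hρ => by
    have := GF_diff1 (x := x) (h := s) (z := ρ) (by linarith) hs0.le hhx (by rw [hre ρ hρ]; norm_num)
    rw [hre ρ hρ] at this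
    calc _ ≤ 2 * (4 * s ^ 3) / (‖ρ‖ * ‖ρ + 1‖) := this.trans (by gcongr)
      _ = _ := by ring
  have low : ∑ ρ ∈ (zall T).filter (fun ρ => ¬ 2 ^ 30 ≤ |ρ.im|), ‖deriv ζ ρ‖ *
      ‖GF (Real.log (x + s)) ρ - GF L ρ‖ ≤ 2 * s ^ 2 * D := by
    have hsub : (zall T).filter (fun ρ => ¬ 2 ^ 30 ≤ |ρ.im|) ⊆ zall (2 ^ 30) := by
      intro ρ hρ
      rw [Finset.mem_filter, mem_zall] at hρ
      rw [mem_zall]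
      exact ⟨hρ.1.1, hρ.1.2.1, hρ.1.2.2.1, by linarith [hρ.2]⟩
    have : ∑ ρ ∈ (zall T).filter (fun ρ => ¬ 2 ^ 30 ≤ |ρ.im|), ‖deriv ζ ρ‖ * (1 / ‖ρ‖) ≤ D :=
      sum_le_sum_of_subset_of_nonneg hsub fun _ _ _ => by positivity
    refine le_trans ?_ (mul_le_mul_of_nonneg_left this (by positivity : 0 ≤ 2 * s ^ 2))
    rw [mul_sum]
    refine sum_le_sum fun ρ hρ => ?_
    calc _ ≤ ‖deriv ζ ρ‖ * (2 * s ^ 2 * (1 / ‖ρ‖)) := by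
          gcongr; exact d2 ρ (Finset.mem_filter.mp hρ).1
      _ = _ := by ring
  set J : ℂ → ℕ := fun ρ => Nat.log 2 ⌊|ρ.im|⌋₊ with hJ
  set S := (zall T).filter (fun ρ => 2 ^ 30 ≤ |ρ.im|) with hS
  have hJ2 : ∀ ρ ∈ S, (2:ℝ) ^ J ρ ≤ |ρ.im| ∧ |ρ.im| < 2 * 2 ^ J ρ := by
    intro ρ hρ
    have h30 := (Finset.mem_filter.mp hρ).2
    have hf : ⌊|ρ.im|⌋₊ ≠ 0 := (Nat.floor_pos.mpr (by linarith)).ne'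
    constructor
    · have := Nat.pow_log_le_self 2 hf
      exact (by exact_mod_cast this : (2:ℝ) ^ J ρ ≤ ⌊|ρ.im|⌋₊).trans (Nat.floor_le (abs_nonneg _))
    · have := Nat.lt_pow_succ_log_self (b := 2) (by norm_num) ⌊|ρ.im|⌋₊
      have := (Nat.floor_lt (abs_nonneg ρ.im)).mp this
      push_cast at this
      rwa [pow_succ'] at this
  set N := Nat.log 2 ⌊T⌋₊ + 1 with hN
  have hmap : ∀ ρ ∈ S, J ρ ∈ Finset.Ico 30 N := by
    intro ρ hρ
    have h := Finset.mem_filter.mp hρ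
    rw [Finset.mem_Ico, hN, Nat.lt_succ_iff]
    exact ⟨Nat.le_log_of_pow_le (by norm_num) (Nat.le_floor (by exact_mod_cast h.2)),
      Nat.log_mono_right (Nat.floor_le_floor (mem_zall.mp h.1).2.2.2)⟩
  have hblock : ∀ k ∈ Finset.Ico 30 N, ∑ ρ ∈ S with J ρ = k, ‖deriv ζ ρ‖ *
      ‖GF (Real.log (x + s)) ρ - GF L ρ‖ ≤
      (if (2:ℝ) ^ k ≤ x then 2 * C * s ^ 2 * L ^ (5 / 2 : ℝ) else 0) + 8 * C * s ^ 2 * ((k:ℝ) ^ 3 * q ^ k) := by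
    intro k hk
    have hk30 := (Finset.mem_Ico.mp hk).1
    have hk1 : (1:ℝ) ≤ k := by exact_mod_cast (by omega : 1 ≤ k)
    set U : ℝ := 2 ^ k with hU
    have hU0 : 0 < U := by positivity
    have hUe : Real.exp 20 ≤ U := by
      calc Real.exp 20 = Real.exp 1 ^ 20 := by rw [← Real.exp_nat_mul]; norm_num
        _ ≤ 2.7182818286 ^ 20 := by gcongr; exact Real.exp_one_lt_d9.le
        _ ≤ 2 ^ 30 := by norm_num
        _ ≤ U := pow_le_pow_right₀ (by norm_num) hk30
    have hlU : Real.log U = k * Real.log 2 := by rw [hU, Real.log_pow]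
    have hlU0 : 0 ≤ Real.log U := by rw [hlU]; exact mul_nonneg (by linarith) (Real.log_nonneg (by norm_num))
    have hloc : ∀ ρ ∈ S.filter (fun ρ => J ρ = k), ρ ∈ zall T ∧ U ≤ |ρ.im| ∧ |ρ.im| < 2 * U := fun ρ hρ => by
      obtain ⟨a, b⟩ := Finset.mem_filter.mp hρ
      have := hJ2 ρ a
      rw [b] at this
      exact ⟨(Finset.mem_filter.mp a).1, this⟩
    have hds := hsum U hUe (S.filter (fun ρ => J ρ = k)) fun ρ hρ =>
      ⟨(mem_zall.mp (hloc ρ hρ).1).1, hre ρ (hloc ρ hρ).1, (hloc ρ hρ).2⟩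
    have gen : ∀ A : ℝ, 0 ≤ A → (∀ ρ ∈ S.filter (fun ρ => J ρ = k), ‖GF (Real.log (x + s)) ρ - GF L ρ‖ ≤ A) →
        ∑ ρ ∈ S with J ρ = k, ‖deriv ζ ρ‖ * ‖GF (Real.log (x + s)) ρ - GF L ρ‖ ≤
        C * (U * Real.log U ^ (5 / 2 : ℝ)) * A := fun A hA hAb => by
      refine le_trans ?_ (mul_le_mul_of_nonneg_right hds hA)
      rw [sum_mul]
      exact sum_le_sum fun ρ hρ => mul_le_mul_of_nonneg_left (hAb ρ hρ) (norm_nonneg _)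
    have hn : ∀ ρ ∈ S.filter (fun ρ => J ρ = k), U ≤ ‖ρ‖ ∧ U ≤ ‖ρ + 1‖ := fun ρ hρ => by
      have h1 := (hloc ρ hρ).2.1
      have h2 := Complex.abs_im_le_norm (ρ + 1)
      simp only [add_im, one_im, add_zero] at h2
      exact ⟨h1.trans (Complex.abs_im_le_norm ρ), h1.trans h2⟩
    split_ifs with hUx
    · have hlog : Real.log U ≤ L := Real.log_le_log hU0 hUx
      have := gen (2 * s ^ 2 * (1 / U)) (by positivity) fun ρ hρ =>
        (d2 ρ (hloc ρ hρ).1).trans (by gcongr; exact (hn ρ hρ).1)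
      calc _ ≤ _ := this
        _ = 2 * C * s ^ 2 * Real.log U ^ (5 / 2 : ℝ) := by field_simp
        _ ≤ 2 * C * s ^ 2 * L ^ (5 / 2 : ℝ) := by gcongr
        _ ≤ _ := le_add_of_nonneg_right (by positivity)
    · have := gen (8 * s ^ 3 / (U * U)) (by positivity) fun ρ hρ =>
        (d1 ρ (hloc ρ hρ).1).trans (by gcongr; exacts [(hn ρ hρ).1, (hn ρ hρ).2])
      have hlk : Real.log U ^ (5 / 2 : ℝ) ≤ (k:ℝ) ^ 3 := by
        calc _ ≤ (k:ℝ) ^ (5 / 2 : ℝ) := by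
              gcongr; rw [hlU]; nlinarith [Real.log_two_lt_d9]
          _ ≤ (k:ℝ) ^ ((3:ℕ) : ℝ) := Real.rpow_le_rpow_of_exponent_le hk1 (by norm_num)
          _ = _ := Real.rpow_natCast _ _
      have hqU : q ^ k * q ^ k * U = 1 := by
        rw [← mul_pow, ← pow_two, hq2, hU, ← mul_pow]; norm_num
      have hqs : s * q ^ k ≤ 1 := by
        have : (s * q ^ k) ^ 2 ≤ 1 ^ 2 := by
          calc (s * q ^ k) ^ 2 = x * (q ^ k * q ^ k) := by rw [← hsx]; ring
            _ ≤ U * (q ^ k * q ^ k) := by gcongr; exact (not_le.mp hUx).le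
            _ = 1 ^ 2 := by linarith
        exact le_of_sq_le_sq this zero_le_one
      have hUi : 1 / U = q ^ k * q ^ k := by field_simp; linarith
      calc _ ≤ _ := this
        _ = 8 * C * s ^ 3 * Real.log U ^ (5 / 2 : ℝ) * (1 / U) := by field_simp
        _ ≤ 8 * C * s ^ 3 * (k:ℝ) ^ 3 * (1 / U) := by gcongr
        _ = 8 * C * s ^ 2 * ((k:ℝ) ^ 3 * q ^ k) * (s * q ^ k) := by rw [hUi]; ring
        _ ≤ 8 * C * s ^ 2 * ((k:ℝ) ^ 3 * q ^ k) * 1 := by gcongr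
        _ = _ := by ring
  have hcount : ((Finset.Ico 30 N).filter (fun k => (2:ℝ) ^ k ≤ x)).card ≤ 3 * L := by
    have hsub : (Finset.Ico 30 N).filter (fun k => (2:ℝ) ^ k ≤ x) ⊆ Finset.range (⌊2 * L⌋₊ + 1) := by
      intro k hk
      have h2 := (Finset.mem_filter.mp hk).2
      rw [Finset.mem_range, Nat.lt_succ_iff]
      apply Nat.le_floor
      have := Real.log_le_log (by positivity) h2
      rw [Real.log_pow] at this
      nlinarith [Real.log_two_gt_d9, (Nat.cast_nonneg k : (0:ℝ) ≤ k)]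
    have := Finset.card_le_card hsub
    rw [Finset.card_range] at this
    have h3 : (((Finset.Ico 30 N).filter (fun k => (2:ℝ) ^ k ≤ x)).card : ℝ) ≤ (⌊2 * L⌋₊ : ℝ) + 1 := by
      exact_mod_cast this
    linarith [Nat.floor_le (show 0 ≤ 2 * L by linarith)]
  have e72 : L ^ (7 / 2 : ℝ) = L ^ (5 / 2 : ℝ) * L := by
    rw [← Real.rpow_add_one (by linarith)]; norm_num
  have h72 : 1 ≤ L ^ (7 / 2 : ℝ) := Real.one_le_rpow hL1 (by norm_num)
  have high : ∑ ρ ∈ S, ‖deriv ζ ρ‖ * ‖GF (Real.log (x + s)) ρ - GF L ρ‖ ≤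
      6 * C * s ^ 2 * L ^ (7 / 2 : ℝ) + 8 * C * s ^ 2 * Q := by
    rw [← Finset.sum_fiberwise_of_maps_to hmap]
    refine (sum_le_sum hblock).trans ?_
    rw [sum_add_distrib, ← mul_sum, ← sum_filter, sum_const, nsmul_eq_mul]
    refine add_le_add ?_ (mul_le_mul_of_nonneg_left
      (hsm.sum_le_tsum _ (fun _ _ => by positivity)) (by positivity))
    · calc _ ≤ 3 * L * (2 * C * s ^ 2 * L ^ (5 / 2 : ℝ)) := by gcongr
        _ = _ := by rw [e72]; ring
  rw [← Finset.sum_filter_add_sum_filter_not (zall T) (fun ρ => 2 ^ 30 ≤ |ρ.im|)]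
  calc _ ≤ (6 * C * s ^ 2 * L ^ (7 / 2 : ℝ) + 8 * C * s ^ 2 * Q * 1) + 2 * s ^ 2 * D * 1 := by
        rw [mul_one, mul_one]; exact add_le_add high low
    _ ≤ (6 * C * s ^ 2 * L ^ (7 / 2 : ℝ) + 8 * C * s ^ 2 * Q * L ^ (7 / 2 : ℝ)) + 2 * s ^ 2 * D * L ^ (7 / 2 : ℝ) := by gcongr
    _ = _ := by ring

lemma BF_RH (RH : RiemannHypothesis) : ∃ K > (0:ℝ), ∀ x : ℝ, 3 ≤ x →
    ‖(BF x : ℂ) - MM x‖ ≤ K * √x * Real.log x ^ (7 / 2 : ℝ) := by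
  obtain ⟨K1, hK1, hs⟩ := zall_sum_RH RH
  obtain ⟨K2, hK2, hd⟩ := diff_lemma
  refine ⟨K1 + K2 * 2, by positivity, fun x hx => ?_⟩
  have hx0 : 0 < x := by linarith
  have hL1 : 1 ≤ Real.log x := log_ge_one hx
  have hs1 : 1 ≤ √x := by rw [Real.one_le_sqrt]; linarith
  have hsx : √x * √x = x := Real.mul_self_sqrt hx0.le
  have h72 : 1 ≤ Real.log x ^ (7 / 2 : ℝ) := Real.one_le_rpow hL1 (by norm_num)
  have key := hd x √x _ hx hs1 (by nlinarith) (fun T => hs x T hx)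
  have t1 : x ^ (3/4:ℝ) / √x ≤ √x * Real.log x ^ (7 / 2 : ℝ) := by
    rw [div_le_iff₀ (by positivity)]
    have : x ^ (3/4:ℝ) ≤ x ^ (1:ℝ) := Real.rpow_le_rpow_of_exponent_le (by linarith) (by norm_num)
    rw [Real.rpow_one] at this
    nlinarith
  have t2 : Real.log x ^ 2 ≤ Real.log x ^ (7 / 2 : ℝ) := by
    rw [← Real.rpow_natCast]; exact Real.rpow_le_rpow_of_exponent_le hL1 (by norm_num)
  calc _ ≤ _ := key
    _ ≤ K1 * √x * Real.log x ^ (7 / 2 : ℝ) + K2 * (√x * Real.log x ^ (7 / 2 : ℝ) + √x * Real.log x ^ (7 / 2 : ℝ)) := by gcongr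
    _ = _ := by ring

lemma laurent_coeffs (C : ℕ → ℂ)
    (hC : ∀ᶠ s in nhdsWithin (1 : ℂ) {(1 : ℂ)}ᶜ,
      HasSum (fun j : ℕ => C j * (s - 1) ^ j) (ζ s - 1 / (s - 1))) :
    deriv riemannZeta₁ 1 = C 0 ∧ deriv (deriv riemannZeta₁) 1 / 2 = C 1 := by
  set g : ℂ → ℂ := fun s => if s = 1 then C 0 else ζ s - 1 / (s - 1) with hg
  have hz : riemannZeta₁ = fun s => 1 + (s - 1) * g s := by
    funext s
    by_cases h : s = 1
    · simp [h, riemannZeta₁_one]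
    · have : s - 1 ≠ 0 := sub_ne_zero.mpr h
      rw [riemannZeta₁_eq_mul h]
      simp only [hg, h, if_false]
      field_simp; ring
  have hp : HasFPowerSeriesAt g (FormalMultilinearSeries.ofScalars ℂ C) 1 := by
    rw [hasFPowerSeriesAt_iff']
    rw [eventually_nhdsWithin_iff] at hC
    filter_upwards [hC] with s hs
    simp only [FormalMultilinearSeries.coeff_ofScalars, smul_eq_mul]
    by_cases h : s = 1
    · subst h
      have := hasSum_single (f := fun n : ℕ => ((1:ℂ) - 1) ^ n * C n) 0 (fun n hn => by simp [hn])
      simpa [hg] using this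
    · simpa [hg, h, mul_comm] using hs h
  have hg1 : deriv g 1 = C 1 := by
    rw [hp.deriv]
    exact FormalMultilinearSeries.coeff_ofScalars (p := C) (n := 1)
  have hga : AnalyticAt ℂ g 1 := hp.analyticAt
  have hd : deriv riemannZeta₁ =ᶠ[𝓝 1] fun s => g s + (s - 1) * deriv g s := by
    filter_upwards [hga.eventually_analyticAt] with s hs
    rw [hz]
    exact ((((hasDerivAt_id s).sub_const 1).mul hs.differentiableAt.hasDerivAt).const_add 1).deriv.trans
      (by simp)
  refine ⟨by rw [hd.eq_of_nhds]; simp [hg], ?_⟩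
  have := (hga.differentiableAt.hasDerivAt.add (((hasDerivAt_id (1:ℂ)).sub_const 1).mul
    hga.deriv.differentiableAt.hasDerivAt)).deriv
  rw [hd.deriv_eq]
  refine (congrArg (· / 2) this).trans ?_
  simp only [id, hg1, sub_self, zero_mul, one_mul, add_zero]
  ring

lemma MM_eq (C : ℕ → ℂ) (h0 : deriv riemannZeta₁ 1 = C 0)
    (h1 : deriv (deriv riemannZeta₁) 1 / 2 = C 1) (T : ℝ) :
    MM (T / (2 * π)) = fujiiMainTerm C T := by
  have : T / (4 * π) = T / (2 * π) / 2 := by field_simp; norm_num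
  rw [MM, fujiiMainTerm, h0, h1, this]
  push_cast
  ring

lemma x_bounds {T : ℝ} (hT : 10000 ≤ T) : 3 ≤ T / (2 * π) ∧ T / (2 * π) ≤ T ∧
    Real.log T / 4 ≤ Real.log (T / (2 * π)) := by
  have hp := Real.pi_gt_three
  have hp4 := Real.pi_lt_four
  refine ⟨by rw [le_div_iff₀ (by positivity)]; linarith,
    div_le_self (by linarith) (by linarith), ?_⟩
  rw [Real.log_div (by linarith) (by positivity)]
  have a : Real.log (2 * π) ≤ Real.log 10000 / 2 := by
    rw [show (10000:ℝ) = 100 ^ 2 by norm_num, Real.log_pow]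
    push_cast
    linarith [Real.log_le_log (by positivity) (show 2 * π ≤ 100 by linarith)]
  have b : Real.log 10000 ≤ Real.log T := Real.log_le_log (by norm_num) hT
  linarith [log_ge_one (show 3 ≤ T by linarith)]

/-- Fujii's theorem: asymptotic expansion of `∑_{0<γ≤T} ζ'(ρ)`,
with error `O(T e^{-C√(log T)})` unconditionally, and `O(T^{1/2} log^{7/2} T)`
under the Riemann Hypothesis. -/
theorem fujii_shanks (C : ℕ → ℂ)
    (hC : ∀ᶠ s in nhdsWithin (1 : ℂ) {(1 : ℂ)}ᶜ,
      HasSum (fun j : ℕ => C j * (s - 1) ^ j) (riemannZeta s - 1 / (s - 1)))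
    (δ : ℝ) (hδ : 0 < δ) :
    (∃ c > (0 : ℝ), ∃ K > (0 : ℝ), ∃ T₀ : ℝ, ∀ T ≥ T₀, AdmissibleHeight δ T →
      ‖zetaZeroSum 1 T - fujiiMainTerm C T‖ ≤
        K * T * Real.exp (-c * Real.sqrt (Real.log T))) ∧
    (RiemannHypothesis →
      ∃ K > (0 : ℝ), ∃ T₀ : ℝ, ∀ T ≥ T₀, AdmissibleHeight δ T →
        ‖zetaZeroSum 1 T - fujiiMainTerm C T‖ ≤
          K * T ^ ((1 : ℝ) / 2) * Real.log T ^ ((7 : ℝ) / 2)) := by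
  obtain ⟨h0, h1⟩ := laurent_coeffs C hC
  have hMM := MM_eq C h0 h1
  obtain ⟨K0, hK0, hP⟩ := part_one δ hδ
  constructor
  · obtain ⟨c, hc, K1, hK1, hB⟩ := BF_uncond
    refine ⟨min (c / 2) (1 / 4), by positivity, K0 * 6144 + K1, by positivity, 10000, fun T hT hA => ?_⟩
    obtain ⟨x3, xT, xl⟩ := x_bounds hT
    have hT0 : 0 < T := by linarith
    have p := hP T hT hA
    have b := hB _ x3
    rw [hMM] at b
    have hL1 : 1 ≤ Real.log T := log_ge_one (by linarith)
    set L := Real.log T with hL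
    set c' := min (c / 2) (1 / 4) with hc'
    have c1 : c' ≤ c / 2 := min_le_left _ _
    have c2 : c' ≤ 1 / 4 := min_le_right _ _
    have hq : √L ≤ L := by rw [Real.sqrt_le_left (by linarith)]; nlinarith
    have b2 : Real.exp (-(c * √(Real.log (T / (2 * Real.pi))))) ≤ Real.exp (-c' * √L) := by
      apply Real.exp_le_exp.mpr
      have : √L / 2 ≤ √(Real.log (T / (2 * Real.pi))) := by
        apply Real.le_sqrt_of_sq_le
        rw [div_pow, Real.sq_sqrt (by linarith)]; linarith
      have := mul_le_mul_of_nonneg_left this hc.le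
      nlinarith [Real.sqrt_nonneg L]
    have p2 : T ^ ((1:ℝ) / 2) * L ^ ((7:ℝ) / 2) ≤ 6144 * (T * Real.exp (-c' * √L)) := by
      have l4 : L ^ ((7:ℝ) / 2) ≤ L ^ 4 := by
        rw [← Real.rpow_natCast L 4]; exact Real.rpow_le_rpow_of_exponent_le hL1 (by norm_num)
      have e4 : L ^ 4 ≤ 6144 * Real.exp (L / 4) := by
        have := Real.pow_div_factorial_le_exp (L / 4) (by linarith) 4
        norm_num [Nat.factorial] at this
        linarith
      have eT : T = Real.exp L := (Real.exp_log hT0).symm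
      have e1 : T ^ ((1:ℝ) / 2) = Real.exp (L / 2) := by
        rw [Real.rpow_def_of_pos hT0, ← hL]; congr 1; ring
      calc _ ≤ Real.exp (L / 2) * (6144 * Real.exp (L / 4)) := by rw [e1]; gcongr; exact l4.trans e4
        _ = 6144 * Real.exp (L / 2 + L / 4) := by rw [Real.exp_add]; ring
        _ ≤ 6144 * Real.exp (L + -c' * √L) := by
            refine mul_le_mul_of_nonneg_left (Real.exp_le_exp.mpr ?_) (by norm_num)
            nlinarith [Real.sqrt_nonneg L]
        _ = _ := by rw [Real.exp_add, ← eT]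
    calc _ ≤ _ := norm_sub_le_norm_sub_add_norm_sub _ _ _
      _ ≤ K0 * (6144 * (T * Real.exp (-c' * √L))) + K1 * T * Real.exp (-c' * √L) :=
          add_le_add (p.trans (by rw [mul_assoc]; gcongr)) (b.trans (by gcongr))
      _ = _ := by ring
  · intro RH
    obtain ⟨K1, hK1, hB⟩ := BF_RH RH
    refine ⟨K0 + K1, by positivity, 10000, fun T hT hA => ?_⟩
    obtain ⟨x3, xT, -⟩ := x_bounds hT
    have b := hB _ x3
    rw [hMM] at b
    have hl := log_ge_one x3
    have hl2 := Real.log_le_log (by linarith) xT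
    calc _ ≤ _ := norm_sub_le_norm_sub_add_norm_sub _ _ _
      _ ≤ K0 * T ^ ((1:ℝ) / 2) * Real.log T ^ ((7:ℝ) / 2) +
          K1 * T ^ ((1:ℝ) / 2) * Real.log T ^ ((7:ℝ) / 2) :=
          add_le_add (hP T hT hA) (b.trans (by rw [← Real.sqrt_eq_rpow]; gcongr))
      _ = _ := by ring
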